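/- For every ε > 0 there exists a constant C = C(ε) such that for all real X ≥ 2, the sum of h_3(-d)^4 over squarefree integers d with 0 < d < X is at most C · X^{11/6 + ε}. -/

import Mathlib

/-- The imaginary quadratic field `ℚ(√-d)`, realized as the subfield of `ℂ`
generated over `ℚ` by `√d · i`. -/
noncomputable def Kneg (d : ℕ) : IntermediateField ℚ ℂ :=
  IntermediateField.adjoin ℚ {(Real.sqrt d : ℂ) * Complex.I}

/-- `hneg g d` is the `g`-part of the class number of `ℚ(√-d)`: the number of
ideal classes `c` of the ring of integers of `ℚ(√-d)` with `c ^ g = 1`. -/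
noncomputable def hneg (g d : ℕ) : ℕ :=
  Nat.card {c : ClassGroup (NumberField.RingOfIntegers (Kneg d)) // c ^ g = 1}

namespace FourthMoment

/-- The divisor bound `τ(n) ≪ n^ε`. -/
theorem exists_card_divisors_le (ε : ℝ) (hε : 0 < ε) :
    ∃ C : ℝ, 1 ≤ C ∧ ∀ n : ℕ, 0 < n → (n.divisors.card : ℝ) ≤ C * (n : ℝ) ^ ε := by
  set P : ℕ := ⌈(2 : ℝ) ^ (1 / ε)⌉₊ with hP
  set B : ℝ := max 1 (1 / (ε * Real.log 2)) with hB
  have hB1 : 1 ≤ B := le_max_left _ _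
  have hl2 : 0 < Real.log 2 := Real.log_pos (by norm_num)
  have key : ∀ n : ℕ, 0 < n → (n.divisors.card : ℝ) ≤
      B ^ (n.primeFactors.filter (· < P)).card * (n : ℝ) ^ ε := by
    intro n
    induction n using Nat.recOnPosPrimePosCoprime with
    | zero => intro h; exact absurd h (lt_irrefl _)
    | one => intro _; simp
    | prime_pow p k hp hk =>
      intro _
      rw [Nat.divisors_prime_pow hp, Finset.card_map, Finset.card_range,
        Nat.primeFactors_prime_pow hk.ne' hp]
      have hp2 : (2 : ℝ) ≤ p := by exact_mod_cast hp.two_le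
      push_cast
      have hpk : ((p : ℝ) ^ k) ^ ε = ((p : ℝ) ^ ε) ^ k := by
        rw [← Real.rpow_natCast, ← Real.rpow_natCast, ← Real.rpow_mul (by positivity),
          ← Real.rpow_mul (by positivity), mul_comm]
      by_cases hlt : p < P
      · rw [Finset.filter_singleton, if_pos hlt, Finset.card_singleton, pow_one]
        have h1 : (k : ℝ) * (ε * Real.log 2) + 1 ≤ ((p : ℝ) ^ k) ^ ε := by
          calc (k : ℝ) * (ε * Real.log 2) + 1 ≤ Real.exp (k * (ε * Real.log 2)) :=
                Real.add_one_le_exp _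
            _ = ((2 : ℝ) ^ k) ^ ε := by
                rw [← Real.rpow_natCast, ← Real.rpow_mul (by norm_num),
                  Real.rpow_def_of_pos (by norm_num)]
                congr 1; ring
            _ ≤ _ := by gcongr
        have h2 : 1 ≤ B * (ε * Real.log 2) := by
          calc (1 : ℝ) = 1 / (ε * Real.log 2) * (ε * Real.log 2) := by field_simp
            _ ≤ _ := by gcongr; exact le_max_right _ _
        calc (k : ℝ) + 1 ≤ k * (B * (ε * Real.log 2)) + B := by
              have : (k : ℝ) * 1 ≤ k * (B * (ε * Real.log 2)) := by gcongr
              linarith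
          _ = B * (k * (ε * Real.log 2) + 1) := by ring
          _ ≤ _ := by gcongr
      · rw [Finset.filter_singleton, if_neg hlt, Finset.card_empty, pow_zero, one_mul, hpk]
        have h2 : (2 : ℝ) ≤ (p : ℝ) ^ ε := by
          have h3 : (2 : ℝ) ^ (1 / ε) ≤ p :=
            (Nat.le_ceil _).trans (by exact_mod_cast not_lt.mp hlt)
          calc (2 : ℝ) = ((2 : ℝ) ^ (1 / ε)) ^ ε := by
                rw [← Real.rpow_mul (by norm_num)]; field_simp; simp
            _ ≤ _ := by gcongr
        calc (k : ℝ) + 1 ≤ 2 ^ k := by exact_mod_cast Nat.lt_two_pow_self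
          _ ≤ _ := by gcongr
    | coprime a b ha hb hab iha ihb =>
      intro _
      have ha' := iha (by omega)
      have hb' := ihb (by omega)
      rw [hab.card_divisors_mul, hab.primeFactors_mul, Finset.filter_union,
        Finset.card_union_of_disjoint
          (Finset.disjoint_filter_filter hab.disjoint_primeFactors), pow_add]
      push_cast
      rw [Real.mul_rpow (by positivity) (by positivity)]
      calc ((a.divisors.card : ℝ)) * b.divisors.card ≤ _ :=
            mul_le_mul ha' hb' (by positivity) (by positivity)
        _ = _ := by ring
  refine ⟨B ^ P, one_le_pow₀ hB1, fun n hn => (key n hn).trans ?_⟩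
  gcongr
  calc (n.primeFactors.filter (· < P)).card ≤ (Finset.range P).card :=
        Finset.card_le_card (fun x hx => by simpa using (Finset.mem_filter.mp hx).2)
      _ = P := Finset.card_range _

/-- The number of square roots of `a` modulo `n`, when common factors are controlled. -/
theorem card_sqrt_mod_le (n : ℕ) (hn : 0 < n) (a : ℤ) (F : ℕ)
    (hF : ∀ x : ℤ, (n : ℤ) ∣ x ^ 2 - a → ∀ f : ℕ, (f : ℤ) ∣ 2 * x → f ^ 2 ∣ n → f ≤ F) :
    ((Finset.Ico 0 (n : ℤ)).filter (fun x => (n : ℤ) ∣ x ^ 2 - a)).card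
      ≤ n.divisors.card * F := by
  set T := (Finset.Ico 0 (n : ℤ)).filter (fun x => (n : ℤ) ∣ x ^ 2 - a) with hT
  rcases T.eq_empty_or_nonempty with h0 | ⟨x₀, hx₀⟩
  · rw [h0]; simp
  have hx₀' := (Finset.mem_filter.mp hx₀).2
  rw [mul_comm]
  refine Finset.card_le_mul_card_image_of_maps_to (f := fun x : ℤ => Int.gcd (x - x₀) n)
    (fun x _ => ?_) _ (fun g hg => ?_)
  · rw [Nat.mem_divisors]
    exact ⟨by exact_mod_cast Int.gcd_dvd_right (x - x₀) (n : ℤ), hn.ne'⟩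
  · obtain ⟨hgn, -⟩ := Nat.mem_divisors.mp hg
    obtain ⟨q, hq⟩ := hgn
    have hg0 : 0 < g := Nat.pos_of_ne_zero (by rintro rfl; omega)
    have hq0 : 0 < q := Nat.pos_of_ne_zero (by rintro rfl; omega)
    set f := Nat.gcd g q with hf
    have hf0 : 0 < f := Nat.gcd_pos_of_pos_left _ hg0
    obtain ⟨m, hm⟩ : f ∣ n := hq ▸ (Nat.gcd_dvd_left g q).mul_right q
    have hlcm : Nat.lcm g q = m := by
      have := Nat.gcd_mul_lcm g q
      rw [← hq, hm] at this
      exact Nat.eq_of_mul_eq_mul_left hf0 this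
    have hm0 : 0 < m := Nat.pos_of_ne_zero (by rintro rfl; omega)
    have hmem : ∀ x ∈ T.filter (fun x => Int.gcd (x - x₀) n = g),
        (g : ℤ) ∣ x - x₀ ∧ (q : ℤ) ∣ x + x₀ := by
      intro x hx
      obtain ⟨hxT, hxg⟩ := Finset.mem_filter.mp hx
      have hx2 := (Finset.mem_filter.mp hxT).2
      have h1 : (n : ℤ) ∣ (x - x₀) * (x + x₀) := by
        have := dvd_sub hx2 hx₀'
        ring_nf at this ⊢; exact this
      have hd : (g : ℤ) ∣ x - x₀ := hxg ▸ Int.gcd_dvd_left _ _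
      refine ⟨hd, ?_⟩
      obtain ⟨y, hy⟩ := hd
      have hcop : Int.gcd y q = 1 := by
        have h2 : Int.gcd (g * y) (g * q) = g := by
          rw [← hy, show (g : ℤ) * q = (n : ℤ) by rw [hq]; push_cast; ring, hxg]
        rw [Int.gcd_mul_left, Int.natAbs_natCast] at h2
        exact Nat.eq_of_mul_eq_mul_left hg0 (by omega)
      rw [hy, hq] at h1
      push_cast at h1
      rw [mul_assoc] at h1
      have h3 := Int.dvd_of_mul_dvd_mul_left (by exact_mod_cast hg0.ne') h1
      exact Int.dvd_of_dvd_mul_right_of_gcd_one h3 (by rwa [Int.gcd_comm])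
    rcases (T.filter (fun x => Int.gcd (x - x₀) n = g)).eq_empty_or_nonempty with h1 | ⟨x₁, hx₁⟩
    · rw [h1]; simp
    have hfF : f ≤ F := by
      refine hF x₀ hx₀' f ?_ ?_
      · have h2 := dvd_sub (((Int.natCast_dvd_natCast.mpr (Nat.gcd_dvd_right g q))).trans
          (hmem x₁ hx₁).2) (((Int.natCast_dvd_natCast.mpr (Nat.gcd_dvd_left g q))).trans
          (hmem x₁ hx₁).1)
        ring_nf at h2 ⊢; exact h2
      · rw [hq, pow_two]; exact mul_dvd_mul (Nat.gcd_dvd_left g q) (Nat.gcd_dvd_right g q)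
    refine le_trans ?_ hfF
    calc (T.filter (fun x => Int.gcd (x - x₀) n = g)).card ≤ (Finset.Ico (0 : ℤ) f).card := by
          refine Finset.card_le_card_of_injOn (fun x => x / m) (fun x hx => ?_) ?_
          · have hx2 := Finset.mem_Ico.mp (Finset.mem_filter.mp (Finset.mem_filter.mp hx).1).1
            rw [Finset.coe_Ico, Set.mem_Ico]
            refine ⟨Int.ediv_nonneg hx2.1 (by positivity), ?_⟩
            rw [Int.ediv_lt_iff_lt_mul (by exact_mod_cast hm0)]
            rw [hm] at hx2; push_cast at hx2; exact hx2.2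
          · intro x hx y hy hxy
            have hd : (m : ℤ) ∣ x - y := by
              rw [← hlcm]
              have e1 : (g : ℤ) ∣ x - y := by
                have := dvd_sub (hmem x hx).1 (hmem y hy).1
                ring_nf at this ⊢; exact this
              have e2 : (q : ℤ) ∣ x - y := by
                have := dvd_sub (hmem x hx).2 (hmem y hy).2
                ring_nf at this ⊢; exact this
              exact Int.natCast_dvd.mpr (Nat.lcm_dvd (Int.natCast_dvd.mp e1) (Int.natCast_dvd.mp e2))
            have h5 : x % m = y % m := ((Int.modEq_iff_dvd.mpr hd).symm : _)
            have h3 := Int.emod_add_mul_ediv x m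
            have h4 := Int.emod_add_mul_ediv y m
            simp only at hxy
            rw [← h3, ← h4, hxy, h5]
      _ = f := by simp

end FourthMoment

namespace FourthMoment

open Finset

/-- Solutions `(v, z, u)` of `u² + κ d v² = f z³` in a box. -/
noncomputable def solSet (κ f : ℤ) (V Y W d : ℕ) : Finset (ℕ × ℕ × ℤ) :=
  ((Icc 1 V) ×ˢ (Icc 1 Y) ×ˢ (Icc (-(W : ℤ)) W)).filter
    (fun p => p.2.2 ^ 2 + κ * d * (p.1 : ℤ) ^ 2 = f * (p.2.1 : ℤ) ^ 3 ∧ Nat.Coprime p.2.1 p.1)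

theorem eq_of_squarefree_mul_sq {d e v w : ℕ} (hd : Squarefree d) (he : Squarefree e)
    (hv : 0 < v) (hw : 0 < w) (h : d * v ^ 2 = e * w ^ 2) : d = e ∧ v = w := by
  have key : ∀ {d e v w : ℕ}, Squarefree d → 0 < v → 0 < w → d * v ^ 2 = e * w ^ 2 → w ∣ v := by
    intro d e v w hd hv hw h
    set g := Nat.gcd v w with hg
    have hg0 : 0 < g := Nat.gcd_pos_of_pos_left _ hv
    obtain ⟨v', w', hcop, hv', hw'⟩ := Nat.exists_coprime v w
    rw [← hg] at hv' hw'
    have h1 : d * v' ^ 2 = e * w' ^ 2 := by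
      rw [hv', hw', mul_pow, mul_pow, ← mul_assoc, ← mul_assoc] at h
      exact Nat.eq_of_mul_eq_mul_right (by positivity) h
    have h2 : w' ^ 2 ∣ d :=
      (Nat.Coprime.pow 2 2 hcop.symm).dvd_of_dvd_mul_right ⟨e, by rw [h1, mul_comm]⟩
    have h3 : w' = 1 := by
      have := hd w' (by rwa [← pow_two])
      exact Nat.isUnit_iff.mp this
    rw [hw', h3, one_mul]; exact Nat.gcd_dvd_left v w
  have hvw : v = w := Nat.dvd_antisymm (key he hw hv h.symm) (key hd hv hw h)
  subst hvw
  exact ⟨Nat.eq_of_mul_eq_mul_right (by positivity) h, rfl⟩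

/-- Points of a residue class with squares in a short interval. -/
theorem card_residue_class_le (m : ℕ) (hm : 0 < m) (A L : ℝ) (S : Finset ℤ)
    (hpos : ∀ u ∈ S, 0 ≤ u) (hcl : ∀ u ∈ S, ∀ w ∈ S, (m : ℤ) ∣ u - w)
    (hint : ∀ u ∈ S, A ≤ (u : ℝ) ^ 2 ∧ (u : ℝ) ^ 2 ≤ A + L) :
    (S.card : ℝ) ≤ Real.sqrt L / m + 1 := by
  rcases S.eq_empty_or_nonempty with h0 | hne
  · rw [h0]; simp; positivity
  set u₀ := S.min' hne
  have hu₀ : u₀ ∈ S := S.min'_mem hne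
  have hm' : (0 : ℝ) < m := by exact_mod_cast hm
  have hle : S.card ≤ (Icc (0 : ℤ) ⌊Real.sqrt L / m⌋).card := by
    refine Finset.card_le_card_of_injOn (fun u => (u - u₀) / m) (fun u hu => ?_) ?_
    · have h1 : u₀ ≤ u := S.min'_le u hu
      have h2 : (0 : ℝ) ≤ u₀ := by exact_mod_cast hpos u₀ hu₀
      have h3 : (u₀ : ℝ) ≤ u := by exact_mod_cast h1
      have h4 : ((u : ℝ) - u₀) ≤ Real.sqrt L := by
        apply Real.le_sqrt_of_sq_le
        have := (hint u hu).2; have := (hint u₀ hu₀).1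
        nlinarith
      rw [coe_Icc, Set.mem_Icc]
      refine ⟨Int.ediv_nonneg (by omega) (by positivity), ?_⟩
      rw [Int.le_floor, le_div_iff₀ hm']
      refine le_trans ?_ h4
      have := Int.ediv_mul_le (u - u₀) (by exact_mod_cast hm.ne' : (m : ℤ) ≠ 0)
      exact_mod_cast this
    · intro u hu w hw huw
      obtain ⟨a, ha⟩ := hcl u hu u₀ hu₀
      obtain ⟨b, hb⟩ := hcl w hw u₀ hu₀
      have hm0 : (m : ℤ) ≠ 0 := by exact_mod_cast hm.ne'
      simp only [ha, hb, Int.mul_ediv_cancel_left _ hm0] at huw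
      rw [huw] at ha
      omega
  have h5 : (0 : ℤ) ≤ ⌊Real.sqrt L / m⌋ := Int.floor_nonneg.mpr (by positivity)
  have h6 : ((Icc (0 : ℤ) ⌊Real.sqrt L / m⌋).card : ℝ) = ⌊Real.sqrt L / m⌋ + 1 := by
    rw [Int.card_Icc, sub_zero]
    have : ((⌊Real.sqrt L / m⌋ + 1).toNat : ℤ) = ⌊Real.sqrt L / m⌋ + 1 := Int.toNat_of_nonneg (by omega)
    exact_mod_cast this
  calc (S.card : ℝ) ≤ _ := by exact_mod_cast hle
    _ = _ := h6
    _ ≤ _ := by gcongr; exact Int.floor_le _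

/-- For fixed `v, z`, the number of `u ≥ 0` occurring for some `d ∈ [X, 2X)`. -/
theorem card_row_nonneg_le (κ f : ℤ) (hf : 0 < f) (X v z : ℕ) (hv : 0 < v)
    (hzv : Nat.Coprime z v) (S : Finset ℤ) (hpos : ∀ u ∈ S, 0 ≤ u)
    (hS : ∀ u ∈ S, ∃ d : ℕ, X ≤ d ∧ d < 2 * X ∧ u ^ 2 + κ * d * (v : ℤ) ^ 2 = f * (z : ℤ) ^ 3) :
    (S.card : ℝ) ≤ (v ^ 2).divisors.card * (4 * f) * (Real.sqrt (|κ| * X) / v + 1) := by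
  set T := (Finset.Ico 0 ((v ^ 2 : ℕ) : ℤ)).filter
    (fun x => ((v ^ 2 : ℕ) : ℤ) ∣ x ^ 2 - f * (z : ℤ) ^ 3) with hT
  have hsq : ∀ u ∈ S, ((v ^ 2 : ℕ) : ℤ) ∣ u ^ 2 - f * (z : ℤ) ^ 3 := by
    intro u hu
    obtain ⟨d, -, -, h⟩ := hS u hu
    exact ⟨-(κ * d), by push_cast; linarith⟩
  have hTcard : T.card ≤ (v ^ 2).divisors.card * (4 * f).toNat := by
    refine card_sqrt_mod_le (v ^ 2) (by positivity) _ _ (fun x hx g hg hgv => ?_)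
    have hgv' : g ∣ v := (Nat.pow_dvd_pow_iff two_ne_zero).mp hgv
    have h1 : ((g : ℤ)) ^ 2 ∣ 4 * f * (z : ℤ) ^ 3 := by
      have h2 : (g : ℤ) ^ 2 ∣ (2 * x) ^ 2 := pow_dvd_pow_of_dvd hg 2
      have h3 : (g : ℤ) ^ 2 ∣ x ^ 2 - f * (z : ℤ) ^ 3 :=
        (by exact_mod_cast hgv : (g : ℤ) ^ 2 ∣ ((v ^ 2 : ℕ) : ℤ)).trans hx
      have h4 := dvd_sub h2 (h3.mul_left 4)
      ring_nf at h4 ⊢; exact h4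
    have hcop : IsCoprime ((g : ℤ) ^ 2) ((z : ℤ) ^ 3) :=
      ((Nat.isCoprime_iff_coprime.mpr (hzv.symm.coprime_dvd_left hgv')).pow)
    have h5 := hcop.dvd_of_dvd_mul_right h1
    have h6 := Int.le_of_dvd (by positivity) h5
    have h7 : (g : ℤ) ≤ 4 * f := by nlinarith
    omega
  have hmaps : ∀ u ∈ S, u % ((v ^ 2 : ℕ) : ℤ) ∈ T := by
    intro u hu
    have hv2 : (0 : ℤ) < ((v ^ 2 : ℕ) : ℤ) := by positivity
    refine mem_filter.mpr ⟨mem_Ico.mpr ⟨Int.emod_nonneg _ hv2.ne', Int.emod_lt_of_pos _ hv2⟩, ?_⟩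
    have h1 := hsq u hu
    have h2 : ((v ^ 2 : ℕ) : ℤ) ∣ u ^ 2 - (u % ((v ^ 2 : ℕ) : ℤ)) ^ 2 := by
      rw [sq_sub_sq]
      exact (Int.dvd_self_sub_emod).mul_left _
    have h3 := dvd_sub h1 h2
    ring_nf at h3 ⊢; exact h3
  have hfib : ∀ c ∈ T, ((S.filter (fun u => u % ((v ^ 2 : ℕ) : ℤ) = c)).card : ℝ)
      ≤ Real.sqrt (|κ| * X) / v + 1 := by
    intro c _
    have hv' : (0 : ℝ) < v := by exact_mod_cast hv
    rcases le_total 0 κ with hκ | hκ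
    · have := card_residue_class_le (v ^ 2) (by positivity)
        (f * z ^ 3 - κ * (2 * X) * v ^ 2) (|κ| * X * v ^ 2)
        (S.filter (fun u => u % ((v ^ 2 : ℕ) : ℤ) = c))
        (fun u hu => hpos u (mem_filter.mp hu).1)
        (fun u hu w hw => Int.ModEq.dvd ((mem_filter.mp hw).2.trans (mem_filter.mp hu).2.symm))
        (fun u hu => by
          obtain ⟨d, h1, h2, h3⟩ := hS u (mem_filter.mp hu).1
          have h1' : (X : ℝ) ≤ d := by exact_mod_cast h1
          have h2' : (d : ℝ) ≤ 2 * X := by exact_mod_cast h2.le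
          have h3' : (u : ℝ) ^ 2 + κ * d * v ^ 2 = f * z ^ 3 := by exact_mod_cast h3
          have hκ' : (0 : ℝ) ≤ κ := by exact_mod_cast hκ
          rw [abs_of_nonneg hκ]
          have e1 : (κ : ℝ) * X * v ^ 2 ≤ κ * d * v ^ 2 := by gcongr
          have e2 : (κ : ℝ) * d * v ^ 2 ≤ κ * (2 * X) * v ^ 2 := by gcongr
          constructor <;> linarith)
      refine this.trans (le_of_eq ?_)
      rw [Real.sqrt_mul' _ (by positivity), Real.sqrt_sq hv'.le]
      push_cast; field_simp
    · have := card_residue_class_le (v ^ 2) (by positivity)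
        (f * z ^ 3 - κ * X * v ^ 2) (|κ| * X * v ^ 2)
        (S.filter (fun u => u % ((v ^ 2 : ℕ) : ℤ) = c))
        (fun u hu => hpos u (mem_filter.mp hu).1)
        (fun u hu w hw => Int.ModEq.dvd ((mem_filter.mp hw).2.trans (mem_filter.mp hu).2.symm))
        (fun u hu => by
          obtain ⟨d, h1, h2, h3⟩ := hS u (mem_filter.mp hu).1
          have h1' : (X : ℝ) ≤ d := by exact_mod_cast h1
          have h2' : (d : ℝ) ≤ 2 * X := by exact_mod_cast h2.le
          have h3' : (u : ℝ) ^ 2 + κ * d * v ^ 2 = f * z ^ 3 := by exact_mod_cast h3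
          have hκ' : (0 : ℝ) ≤ -κ := by exact_mod_cast neg_nonneg.mpr hκ
          rw [abs_of_nonpos hκ]
          push_cast
          have e1 : (-κ : ℝ) * X * v ^ 2 ≤ -κ * d * v ^ 2 := by gcongr
          have e2 : (-κ : ℝ) * d * v ^ 2 ≤ -κ * (2 * X) * v ^ 2 := by gcongr
          constructor <;> linarith)
      refine this.trans (le_of_eq ?_)
      rw [Real.sqrt_mul' _ (by positivity), Real.sqrt_sq hv'.le]
      push_cast; field_simp
  calc (S.card : ℝ) = ∑ c ∈ T, ((S.filter (fun u => u % ((v ^ 2 : ℕ) : ℤ) = c)).card : ℝ) := by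
        exact_mod_cast card_eq_sum_card_fiberwise hmaps
    _ ≤ ∑ c ∈ T, (Real.sqrt (|κ| * X) / v + 1) := sum_le_sum hfib
    _ = T.card * (Real.sqrt (|κ| * X) / v + 1) := by rw [sum_const, nsmul_eq_mul]
    _ ≤ _ := by
        gcongr
        have h1 : ((4 * f).toNat : ℝ) = 4 * f := by
          have : ((4 * f).toNat : ℤ) = 4 * f := Int.toNat_of_nonneg (by omega)
          exact_mod_cast this
        rw [← h1]; exact_mod_cast hTcard

end FourthMoment

namespace FourthMoment

open Finset

/-- Squarefree integers in `[X, 2X)`. -/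
def sqfreeDyadic (X : ℕ) : Finset ℕ := (Ico X (2 * X)).filter Squarefree

open Classical in
theorem card_row_le (κ f : ℤ) (hf : 0 < f) (X W v z : ℕ) (hv : 0 < v) (hzv : Nat.Coprime z v) :
    (((Icc (-(W : ℤ)) W).filter (fun u => ∃ d : ℕ, X ≤ d ∧ d < 2 * X ∧
        u ^ 2 + κ * d * (v : ℤ) ^ 2 = f * (z : ℤ) ^ 3)).card : ℝ) ≤
      2 * ((v ^ 2).divisors.card * (4 * f) * (Real.sqrt (|κ| * X) / v + 1)) := by
  set S := (Icc (-(W : ℤ)) W).filter (fun u => ∃ d : ℕ, X ≤ d ∧ d < 2 * X ∧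
        u ^ 2 + κ * d * (v : ℤ) ^ 2 = f * (z : ℤ) ^ 3) with hS
  have h1 := card_row_nonneg_le κ f hf X v z hv hzv (S.filter (0 ≤ ·))
    (fun u hu => (mem_filter.mp hu).2)
    (fun u hu => (mem_filter.mp (mem_filter.mp hu).1).2)
  have h2 := card_row_nonneg_le κ f hf X v z hv hzv ((S.filter (¬ 0 ≤ ·)).image (- ·))
    (fun u hu => by
      obtain ⟨w, hw, rfl⟩ := mem_image.mp hu
      have := (mem_filter.mp hw).2
      omega)
    (fun u hu => by
      obtain ⟨w, hw, rfl⟩ := mem_image.mp hu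
      obtain ⟨d, h1, h2, h3⟩ := (mem_filter.mp (mem_filter.mp hw).1).2
      exact ⟨d, h1, h2, by rw [neg_sq]; exact h3⟩)
  rw [card_image_of_injective _ neg_injective] at h2
  have h3 := card_filter_add_card_filter_not (s := S) (0 ≤ ·)
  have h3' : (((S.filter (0 ≤ ·)).card : ℕ) : ℝ) + ((S.filter (¬ 0 ≤ ·)).card : ℕ) = S.card := by
    exact_mod_cast h3
  linarith

theorem solSet_inj {κ f : ℤ} (hκ : κ ≠ 0) {V Y W d e : ℕ} (hd : Squarefree d)
    (he : Squarefree e) {p q : ℕ × ℕ × ℤ} (hp : p ∈ solSet κ f V Y W d)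
    (hq : q ∈ solSet κ f V Y W e) (hz : p.2.1 = q.2.1) (hu : p.2.2 ^ 2 = q.2.2 ^ 2) :
    d = e ∧ p.1 = q.1 := by
  obtain ⟨hp1, hp2, -⟩ := mem_filter.mp hp
  obtain ⟨hq1, hq2, -⟩ := mem_filter.mp hq
  have hpv := (mem_Icc.mp (mem_product.mp hp1).1).1
  have hqv := (mem_Icc.mp (mem_product.mp hq1).1).1
  refine eq_of_squarefree_mul_sq hd he hpv hqv ?_
  have : κ * ((d : ℤ) * (p.1 : ℤ) ^ 2) = κ * ((e : ℤ) * (q.1 : ℤ) ^ 2) := by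
    rw [hz, hu] at hp2; linarith
  exact_mod_cast mul_left_cancel₀ hκ this

theorem sum_card_solSet_le_rows (κ f : ℤ) (hκ : κ ≠ 0) (hf : 0 < f) (X V Y W : ℕ) :
    (∑ d ∈ sqfreeDyadic X, ((solSet κ f V Y W d).card : ℝ)) ≤
      ∑ v ∈ Icc 1 V, ∑ _z ∈ Icc 1 Y,
        2 * ((v ^ 2).divisors.card * (4 * f) * (Real.sqrt (|κ| * X) / v + 1)) := by
  classical
  let R : ℕ → ℕ → Finset ℤ := fun v z =>
    if Nat.Coprime z v then (Icc (-(W : ℤ)) W).filter (fun u => ∃ d : ℕ, X ≤ d ∧ d < 2 * X ∧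
        u ^ 2 + κ * d * (v : ℤ) ^ 2 = f * (z : ℤ) ^ 3) else ∅
  have hcard : ((sqfreeDyadic X).sigma (fun d => solSet κ f V Y W d)).card ≤
      ((Icc 1 V).sigma (fun v => (Icc 1 Y).sigma (fun z => R v z))).card := by
    refine card_le_card_of_injOn
      (fun p => (⟨p.2.1, ⟨p.2.2.1, p.2.2.2⟩⟩ : Σ _ : ℕ, Σ _ : ℕ, ℤ)) ?_ ?_
    · rintro ⟨d, v, z, u⟩ h
      have h' := mem_sigma.mp (mem_coe.mp h)
      simp only [sqfreeDyadic, solSet, mem_filter, mem_product] at h'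
      simp only [mem_coe, mem_sigma]
      refine ⟨h'.2.1.1, h'.2.1.2.1, ?_⟩
      simp only [R, if_pos h'.2.2.2, mem_filter]
      exact ⟨h'.2.1.2.2, d, (mem_Ico.mp h'.1.1).1, (mem_Ico.mp h'.1.1).2, h'.2.2.1⟩
    · rintro ⟨d, v, z, u⟩ h ⟨d', v', z', u'⟩ h' heq
      have h1 := mem_sigma.mp (mem_coe.mp h)
      have h2 := mem_sigma.mp (mem_coe.mp h')
      have e1 : v = v' ∧ z = z' ∧ u = u' := by
        simp only [Sigma.mk.injEq, heq_eq_eq] at heq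
        exact ⟨heq.1, by simpa using heq.2⟩
      obtain ⟨rfl, rfl, rfl⟩ := e1
      obtain ⟨rfl, -⟩ := solSet_inj hκ (mem_filter.mp h1.1).2 (mem_filter.mp h2.1).2 h1.2 h2.2 rfl rfl
      rfl
  have hc1 : ((∑ d ∈ sqfreeDyadic X, (solSet κ f V Y W d).card : ℕ) : ℝ) ≤
      ((∑ v ∈ Icc 1 V, ∑ z ∈ Icc 1 Y, (R v z).card : ℕ) : ℝ) := by
    simp only [card_sigma] at hcard
    exact_mod_cast hcard
  push_cast at hc1
  refine hc1.trans (sum_le_sum fun v hv => sum_le_sum fun z _ => ?_)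
  simp only [R]
  split_ifs with hc
  · exact card_row_le κ f hf X W v z (mem_Icc.mp hv).1 hc
  · have : (0 : ℝ) < f := by exact_mod_cast hf
    simp only [card_empty, Nat.cast_zero]; positivity

/-- Diagonal solutions. -/
theorem exists_sum_card_solSet_le (κ f : ℤ) (hκ : κ ≠ 0) (hf : 0 < f) (η : ℝ) (hη : 0 < η) :
    ∃ C : ℝ, 0 < C ∧ ∀ X V Y W : ℕ, 0 < X → V ≤ X ^ 3 →
      (∑ d ∈ sqfreeDyadic X, ((solSet κ f V Y W d).card : ℝ)) ≤
        C * (X : ℝ) ^ η * (Y * (V + Real.sqrt X)) := by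
  obtain ⟨C₁, hC₁, hτ⟩ := exists_card_divisors_le (η / 12) (by positivity)
  have hf' : (0 : ℝ) < f := by exact_mod_cast hf
  have hκ' : (0 : ℝ) < |κ| := by exact_mod_cast abs_pos.mpr hκ
  set B := 1 + 6 / η
  set A := Real.sqrt |κ| + 1
  refine ⟨2 * (C₁ * (4 * f) * (A * B)), by positivity, fun X V Y W hX hV => ?_⟩
  have hX' : (1 : ℝ) ≤ X := by exact_mod_cast hX
  refine (sum_card_solSet_le_rows κ f hκ hf X V Y W).trans ?_
  have hV' : (V : ℝ) ≤ (X : ℝ) ^ (3 : ℝ) := by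
    rw [show (3 : ℝ) = ((3 : ℕ) : ℝ) by norm_num, Real.rpow_natCast]; exact_mod_cast hV
  have hv : ∀ v ∈ Icc 1 V, (((v ^ 2).divisors.card : ℕ) : ℝ) ≤ C₁ * (X : ℝ) ^ (η / 2) := by
    intro v hv
    obtain ⟨h1, h2⟩ := mem_Icc.mp hv
    refine (hτ (v ^ 2) (by positivity)).trans ?_
    gcongr
    have h3 : ((v ^ 2 : ℕ) : ℝ) ≤ (X : ℝ) ^ (6 : ℝ) := by
      calc ((v ^ 2 : ℕ) : ℝ) = (v : ℝ) ^ 2 := by push_cast; rfl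
        _ ≤ ((X : ℝ) ^ (3 : ℝ)) ^ 2 := by
            gcongr; exact le_trans (by exact_mod_cast h2) hV'
        _ = _ := by rw [← Real.rpow_natCast, ← Real.rpow_mul (by positivity)]; norm_num
    calc ((v ^ 2 : ℕ) : ℝ) ^ (η / 12) ≤ ((X : ℝ) ^ (6 : ℝ)) ^ (η / 12) := by gcongr
      _ = _ := by rw [← Real.rpow_mul (by positivity)]; congr 1; ring
  have hharm : (∑ v ∈ Icc 1 V, (1 : ℝ) / v) ≤ B * (X : ℝ) ^ (η / 2) := by
    rcases Nat.eq_zero_or_pos V with rfl | hVpos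
    · simp; positivity
    have h1 : (∑ v ∈ Icc 1 V, (1 : ℝ) / v) ≤ 1 + Real.log V := by
      have := harmonic_le_one_add_log V
      rw [harmonic_eq_sum_Icc] at this
      push_cast at this
      simpa using this
    have h2 : Real.log V ≤ 6 / η * (X : ℝ) ^ (η / 2) := by
      calc Real.log V ≤ (V : ℝ) ^ (η / 6) / (η / 6) := Real.log_le_rpow_div (by positivity) (by positivity)
        _ ≤ ((X : ℝ) ^ (3 : ℝ)) ^ (η / 6) / (η / 6) := by gcongr
        _ = (X : ℝ) ^ (η / 2) / (η / 6) := by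
            rw [← Real.rpow_mul (by positivity)]; congr 2; ring
        _ = _ := by field_simp
    have h3 : 1 ≤ (X : ℝ) ^ (η / 2) := Real.one_le_rpow hX' (by positivity)
    simp only [B]; linarith
  have hXη : (X : ℝ) ^ (η / 2) * (X : ℝ) ^ (η / 2) = (X : ℝ) ^ η := by
    rw [← Real.rpow_add (by positivity)]; congr 1; ring
  have hXη1 : 1 ≤ (X : ℝ) ^ (η / 2) := Real.one_le_rpow hX' (by positivity)
  have hsum2 : ∑ v ∈ Icc 1 V, (Real.sqrt (|κ| * X) / v + 1) ≤
      A * B * (X : ℝ) ^ (η / 2) * (V + Real.sqrt X) := by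
    rw [sum_add_distrib, sum_const, Nat.card_Icc, Real.sqrt_mul' _ (by positivity)]
    have e0 : ∑ v ∈ Icc 1 V, Real.sqrt |(κ : ℝ)| * Real.sqrt X / (v : ℝ) =
        Real.sqrt |(κ : ℝ)| * Real.sqrt X * ∑ v ∈ Icc 1 V, (1 : ℝ) / v := by
      rw [mul_sum]; exact sum_congr rfl fun v _ => by ring
    rw [show ((|κ| : ℤ) : ℝ) = |(κ : ℝ)| by push_cast; rfl, e0]
    have hA1 : 1 ≤ A := by simp only [A]; linarith [Real.sqrt_nonneg |(κ : ℝ)|]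
    have hA2 : Real.sqrt |(κ : ℝ)| ≤ A := by simp only [A]; linarith
    have hB1 : 1 ≤ B := by simp only [B]; linarith [show 0 < 6 / η by positivity]
    have t1 : Real.sqrt |(κ : ℝ)| * Real.sqrt X * ∑ v ∈ Icc 1 V, (1 : ℝ) / v ≤
        A * Real.sqrt X * (B * (X : ℝ) ^ (η / 2)) := by gcongr
    have t2 : (V : ℝ) ≤ A * B * (X : ℝ) ^ (η / 2) * V := by
      refine le_mul_of_one_le_left (by positivity) ?_
      exact one_le_mul_of_one_le_of_one_le (one_le_mul_of_one_le_of_one_le hA1 hB1) hXη1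
    have : ((V + 1 - 1) • (1 : ℝ)) = V := by simp
    rw [this]
    linarith
  calc ∑ v ∈ Icc 1 V, ∑ z ∈ Icc 1 Y,
        2 * (((v ^ 2).divisors.card : ℝ) * (4 * f) * (Real.sqrt (|κ| * X) / v + 1))
      ≤ ∑ v ∈ Icc 1 V, ∑ z ∈ Icc 1 Y,
        2 * (C₁ * (X : ℝ) ^ (η / 2) * (4 * f) * (Real.sqrt (|κ| * X) / v + 1)) := by
        refine sum_le_sum fun v hv' => sum_le_sum fun z _ => ?_
        have := hv v hv'
        gcongr
    _ = 2 * (C₁ * (X : ℝ) ^ (η / 2) * (4 * f)) * Y *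
        ∑ v ∈ Icc 1 V, (Real.sqrt (|κ| * X) / v + 1) := by
        simp only [sum_const, Nat.card_Icc, mul_sum, nsmul_eq_mul]
        refine sum_congr rfl fun v _ => ?_
        push_cast [Nat.add_sub_cancel]; ring
    _ ≤ 2 * (C₁ * (X : ℝ) ^ (η / 2) * (4 * f)) * Y *
        (A * B * (X : ℝ) ^ (η / 2) * (V + Real.sqrt X)) := by gcongr
    _ = 2 * (C₁ * (4 * f) * (A * B)) * ((X : ℝ) ^ (η / 2) * (X : ℝ) ^ (η / 2)) *
        (Y * (V + Real.sqrt X)) := by ring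
    _ = _ := by rw [hXη]

end FourthMoment

namespace FourthMoment

open Finset

/-- Pairs of solutions with the same `v`. -/
noncomputable def solPairs (κ f : ℤ) (V Y W d : ℕ) : Finset ((ℕ × ℕ × ℤ) × (ℕ × ℕ × ℤ)) :=
  (solSet κ f V Y W d ×ˢ solSet κ f V Y W d).filter (fun p => p.1.1 = p.2.1)

theorem sq_card_solSet_le (κ f : ℤ) (V Y W d : ℕ) :
    (solSet κ f V Y W d).card ^ 2 ≤ V * (solPairs κ f V Y W d).card := by
  set S := solSet κ f V Y W d with hS
  have hmaps : ∀ p ∈ S, p.1 ∈ Icc 1 V := fun p hp =>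
    (mem_product.mp (mem_filter.mp hp).1).1
  have hmaps2 : ∀ p ∈ solPairs κ f V Y W d, p.1.1 ∈ Icc 1 V := fun p hp =>
    hmaps p.1 (mem_product.mp (mem_filter.mp hp).1).1
  rw [card_eq_sum_card_fiberwise hmaps, card_eq_sum_card_fiberwise hmaps2]
  have h := sq_sum_le_card_mul_sum_sq (s := Icc 1 V) (f := fun v => (S.filter (fun p => p.1 = v)).card)
  rw [Nat.card_Icc, Nat.add_sub_cancel] at h
  refine h.trans (Nat.mul_le_mul_left _ (sum_le_sum fun v _ => ?_))
  rw [pow_two, ← card_product]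
  refine card_le_card fun p hp => ?_
  obtain ⟨h1, h2⟩ := mem_product.mp hp
  obtain ⟨h3, h4⟩ := mem_filter.mp h1
  obtain ⟨h5, h6⟩ := mem_filter.mp h2
  exact mem_filter.mpr ⟨mem_filter.mpr ⟨mem_product.mpr ⟨h3, h5⟩, h4.trans h6.symm⟩, h4⟩

theorem sq_eq_of_solSet {κ f : ℤ} {V Y W d : ℕ} {p q : ℕ × ℕ × ℤ} (hp : p ∈ solSet κ f V Y W d)
    (hq : q ∈ solSet κ f V Y W d) (hv : p.1 = q.1) :
    p.2.2 ^ 2 - q.2.2 ^ 2 = f * ((p.2.1 : ℤ) ^ 3 - (q.2.1 : ℤ) ^ 3) := by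
  have h1 := (mem_filter.mp hp).2.1
  have h2 := (mem_filter.mp hq).2.1
  rw [hv] at h1
  linarith

theorem card_diag_le (κ f : ℤ) (V Y W d : ℕ) :
    ((solPairs κ f V Y W d).filter (fun p => p.1.2.1 = p.2.2.1)).card
      ≤ 2 * (solSet κ f V Y W d).card := by
  rw [mul_comm, ← Fintype.card_bool, ← card_univ, ← card_product]
  refine card_le_card_of_injOn (fun p => (p.1, decide (p.1.2.2 = p.2.2.2))) ?_ ?_
  · intro p hp
    exact mem_coe.mpr (mem_product.mpr
      ⟨(mem_product.mp (mem_filter.mp (mem_filter.mp hp).1).1).1, mem_univ _⟩)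
  · intro p hp q hq hpq
    obtain ⟨hp1, hp2⟩ := mem_filter.mp hp
    obtain ⟨hq1, hq2⟩ := mem_filter.mp hq
    obtain ⟨hp3, hp4⟩ := mem_filter.mp hp1
    obtain ⟨hq3, hq4⟩ := mem_filter.mp hq1
    obtain ⟨hp5, hp6⟩ := mem_product.mp hp3
    obtain ⟨hq5, hq6⟩ := mem_product.mp hq3
    have e1 := sq_eq_of_solSet hp5 hp6 hp4
    have e2 := sq_eq_of_solSet hq5 hq6 hq4
    rw [hp2, sub_self, mul_zero, sub_eq_zero, sq_eq_sq_iff_eq_or_eq_neg] at e1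
    rw [hq2, sub_self, mul_zero, sub_eq_zero, sq_eq_sq_iff_eq_or_eq_neg] at e2
    obtain ⟨⟨v1, z1, u1⟩, ⟨v2, z2, u2⟩⟩ := p
    obtain ⟨⟨v3, z3, u3⟩, ⟨v4, z4, u4⟩⟩ := q
    simp only [Prod.mk.injEq, decide_eq_decide] at *
    omega

theorem card_offdiag_le (κ f : ℤ) (hκ : κ ≠ 0) (hf : 0 < f) (X V Y W : ℕ) :
    ∑ d ∈ sqfreeDyadic X, ((solPairs κ f V Y W d).filter (fun p => ¬ p.1.2.1 = p.2.2.1)).card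
      ≤ ∑ z ∈ (Icc 1 Y ×ˢ Icc 1 Y).filter (fun z => ¬ z.1 = z.2),
        2 * (f * ((z.1 : ℤ) ^ 3 - (z.2 : ℤ) ^ 3)).natAbs.divisors.card := by
  have hR : ∀ z : ℕ × ℕ, 2 * (f * ((z.1 : ℤ) ^ 3 - (z.2 : ℤ) ^ 3)).natAbs.divisors.card =
      ((f * ((z.1 : ℤ) ^ 3 - (z.2 : ℤ) ^ 3)).natAbs.divisors ×ˢ (univ : Finset Bool)).card := by
    intro z; rw [card_product, card_univ, Fintype.card_bool, mul_comm]
  simp only [hR]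
  rw [← card_sigma, ← card_sigma]
  refine card_le_card_of_injOn (fun p => (⟨(p.2.1.2.1, p.2.2.2.1),
    ((p.2.1.2.2 - p.2.2.2.2).natAbs, decide (0 ≤ p.2.1.2.2 - p.2.2.2.2))⟩ :
      Σ _ : ℕ × ℕ, ℕ × Bool)) ?_ ?_
  · rintro ⟨d, p, q⟩ h
    obtain ⟨-, h2⟩ := mem_sigma.mp (mem_coe.mp h)
    obtain ⟨h3, hz⟩ := mem_filter.mp h2
    obtain ⟨h4, hv⟩ := mem_filter.mp h3
    obtain ⟨hp, hq⟩ := mem_product.mp h4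
    have e := sq_eq_of_solSet hp hq hv
    have hp2 := (mem_product.mp (mem_product.mp (mem_filter.mp hp).1).2).1
    have hq2 := (mem_product.mp (mem_product.mp (mem_filter.mp hq).1).2).1
    refine mem_coe.mpr (mem_sigma.mpr ⟨mem_filter.mpr ⟨mem_product.mpr ⟨hp2, hq2⟩, hz⟩,
      mem_product.mpr ⟨Nat.mem_divisors.mpr ⟨?_, ?_⟩, mem_univ _⟩⟩)
    · exact Int.natAbs_dvd_natAbs.mpr ⟨p.2.2 + q.2.2, by rw [← e]; ring⟩
    · rw [Ne, Int.natAbs_eq_zero, mul_eq_zero, not_or]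
      refine ⟨hf.ne', fun h0 => hz ?_⟩
      have : p.2.1 ^ 3 = q.2.1 ^ 3 := by exact_mod_cast sub_eq_zero.mp h0
      exact Nat.pow_left_injective (by norm_num : 3 ≠ 0) this
  · rintro ⟨d, p, q⟩ h ⟨d', p', q'⟩ h' heq
    obtain ⟨hd, h2⟩ := mem_sigma.mp (mem_coe.mp h)
    obtain ⟨h3, hz⟩ := mem_filter.mp h2
    obtain ⟨h4, hv⟩ := mem_filter.mp h3
    obtain ⟨hp, hq⟩ := mem_product.mp h4
    obtain ⟨hd', h2'⟩ := mem_sigma.mp (mem_coe.mp h')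
    obtain ⟨h3', hz'⟩ := mem_filter.mp h2'
    obtain ⟨h4', hv'⟩ := mem_filter.mp h3'
    obtain ⟨hp', hq'⟩ := mem_product.mp h4'
    have e := sq_eq_of_solSet hp hq hv
    have e' := sq_eq_of_solSet hp' hq' hv'
    simp only [Sigma.mk.injEq, heq_eq_eq, Prod.mk.injEq, decide_eq_decide] at heq
    obtain ⟨⟨z1, z2⟩, hab, hsg⟩ := heq
    have hdiff : p.2.2 - q.2.2 = p'.2.2 - q'.2.2 := by omega
    have hne : p.2.2 - q.2.2 ≠ 0 := by
      intro h0
      have : f * ((p.2.1 : ℤ) ^ 3 - (q.2.1 : ℤ) ^ 3) = 0 := by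
        rw [← e, sq_sub_sq, h0, mul_zero]
      rcases mul_eq_zero.mp this with h5 | h5
      · exact hf.ne' h5
      · have : p.2.1 ^ 3 = q.2.1 ^ 3 := by exact_mod_cast sub_eq_zero.mp h5
        exact hz (Nat.pow_left_injective (by norm_num : 3 ≠ 0) this)
    have hsum : p.2.2 + q.2.2 = p'.2.2 + q'.2.2 := by
      refine mul_right_cancel₀ hne ?_
      rw [← sq_sub_sq, e, hdiff, ← sq_sub_sq, e', z1, z2]
    have hu : p.2.2 = p'.2.2 := by omega
    have hw : q.2.2 = q'.2.2 := by omega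
    obtain ⟨hdd, hvv⟩ := solSet_inj hκ (mem_filter.mp hd).2 (mem_filter.mp hd').2 hp hp' z1 (by rw [hu])
    subst hdd
    have hpp : p = p' := Prod.ext hvv (Prod.ext z1 hu)
    have hqq : q = q' := Prod.ext (by rw [← hv, ← hv']; exact hvv) (Prod.ext z2 hw)
    rw [hpp, hqq]

/-- Second moment of the number of solutions over squarefree `d ∈ [X, 2X)`. -/
theorem exists_second_moment_le (κ f : ℤ) (hκ : κ ≠ 0) (hf : 0 < f) (η : ℝ) (hη : 0 < η) :
    ∃ C : ℝ, 0 < C ∧ ∀ X V Y W : ℕ, 0 < X → V ≤ X ^ 3 → Y ≤ X ^ 2 →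
      (∑ d ∈ sqfreeDyadic X, ((solSet κ f V Y W d).card : ℝ) ^ 2) ≤
        C * (X : ℝ) ^ η * (V * ((Y : ℝ) ^ 2 + Y * (V + Real.sqrt X))) := by
  obtain ⟨C₁, hC₁, hτ⟩ := exists_card_divisors_le (η / 6) (by positivity)
  obtain ⟨C₂, hC₂, hdiag⟩ := exists_sum_card_solSet_le κ f hκ hf η hη
  have hf' : (0 : ℝ) < f := by exact_mod_cast hf
  refine ⟨2 * C₂ + 2 * C₁ * (f : ℝ) ^ (η / 6), by positivity, fun X V Y W hX hV hY => ?_⟩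
  have hX' : (1 : ℝ) ≤ X := by exact_mod_cast hX
  have hY' : (Y : ℝ) ≤ (X : ℝ) ^ (2 : ℝ) := by
    rw [show (2 : ℝ) = ((2 : ℕ) : ℝ) by norm_num, Real.rpow_natCast]; exact_mod_cast hY
  have h1 : (∑ d ∈ sqfreeDyadic X, ((solSet κ f V Y W d).card : ℝ) ^ 2) ≤
      V * ∑ d ∈ sqfreeDyadic X, ((solPairs κ f V Y W d).card : ℝ) := by
    rw [mul_sum]
    exact sum_le_sum fun d _ => by exact_mod_cast sq_card_solSet_le κ f V Y W d
  have h2 : ∑ d ∈ sqfreeDyadic X, ((solPairs κ f V Y W d).card : ℝ) =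
      (∑ d ∈ sqfreeDyadic X,
        (((solPairs κ f V Y W d).filter (fun p => p.1.2.1 = p.2.2.1)).card : ℝ)) +
      ∑ d ∈ sqfreeDyadic X,
        (((solPairs κ f V Y W d).filter (fun p => ¬ p.1.2.1 = p.2.2.1)).card : ℝ) := by
    rw [← sum_add_distrib]
    refine sum_congr rfl fun d _ => ?_
    exact_mod_cast (card_filter_add_card_filter_not (s := solPairs κ f V Y W d)
      (fun p => p.1.2.1 = p.2.2.1)).symm
  have h3 : (∑ d ∈ sqfreeDyadic X,
      (((solPairs κ f V Y W d).filter (fun p => p.1.2.1 = p.2.2.1)).card : ℝ)) ≤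
      2 * (C₂ * (X : ℝ) ^ η * (Y * (V + Real.sqrt X))) := by
    calc _ ≤ ∑ d ∈ sqfreeDyadic X, 2 * ((solSet κ f V Y W d).card : ℝ) :=
          sum_le_sum fun d _ => by exact_mod_cast card_diag_le κ f V Y W d
      _ = 2 * ∑ d ∈ sqfreeDyadic X, ((solSet κ f V Y W d).card : ℝ) := by rw [mul_sum]
      _ ≤ _ := by gcongr; exact hdiag X V Y W hX hV
  have h4 : (∑ d ∈ sqfreeDyadic X,
        (((solPairs κ f V Y W d).filter (fun p => ¬ p.1.2.1 = p.2.2.1)).card : ℝ)) ≤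
      2 * C₁ * (f : ℝ) ^ (η / 6) * (X : ℝ) ^ η * (Y : ℝ) ^ 2 := by
    have hoff : (∑ d ∈ sqfreeDyadic X,
        (((solPairs κ f V Y W d).filter (fun p => ¬ p.1.2.1 = p.2.2.1)).card : ℝ)) ≤
        ∑ z ∈ (Icc 1 Y ×ˢ Icc 1 Y).filter (fun z => ¬ z.1 = z.2),
        (2 * ((f * ((z.1 : ℤ) ^ 3 - (z.2 : ℤ) ^ 3)).natAbs.divisors.card : ℝ)) := by
      exact_mod_cast card_offdiag_le κ f hκ hf X V Y W
    refine hoff.trans ?_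
    have hterm : ∀ z ∈ (Icc 1 Y ×ˢ Icc 1 Y).filter (fun z => ¬ z.1 = z.2),
        (2 * ((f * ((z.1 : ℤ) ^ 3 - (z.2 : ℤ) ^ 3)).natAbs.divisors.card : ℝ)) ≤
        2 * (C₁ * ((f : ℝ) ^ (η / 6) * (X : ℝ) ^ η)) := by
      intro z hz
      obtain ⟨hz1, hz2⟩ := mem_filter.mp hz
      obtain ⟨ha, hb⟩ := mem_product.mp hz1
      rw [mem_Icc] at ha hb
      have hne : z.1 ^ 3 ≠ z.2 ^ 3 := fun h => hz2 (Nat.pow_left_injective (by norm_num : 3 ≠ 0) h)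
      have hpos : 0 < (f * ((z.1 : ℤ) ^ 3 - (z.2 : ℤ) ^ 3)).natAbs := by
        rw [Int.natAbs_pos]
        refine mul_ne_zero hf.ne' (sub_ne_zero.mpr ?_)
        exact_mod_cast hne
      have hbd : (((f * ((z.1 : ℤ) ^ 3 - (z.2 : ℤ) ^ 3)).natAbs : ℕ) : ℝ) ≤ f * (X : ℝ) ^ (6 : ℝ) := by
        rw [Nat.cast_natAbs]
        push_cast
        rw [abs_mul, abs_of_pos hf']
        gcongr
        have hz1' : (z.1 : ℝ) ^ 3 ≤ (X : ℝ) ^ (6 : ℝ) := by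
          calc (z.1 : ℝ) ^ 3 ≤ ((X : ℝ) ^ (2 : ℝ)) ^ 3 := by
                gcongr; exact le_trans (by exact_mod_cast ha.2) hY'
            _ = _ := by rw [← Real.rpow_natCast, ← Real.rpow_mul (by positivity)]; norm_num
        have hz2' : (z.2 : ℝ) ^ 3 ≤ (X : ℝ) ^ (6 : ℝ) := by
          calc (z.2 : ℝ) ^ 3 ≤ ((X : ℝ) ^ (2 : ℝ)) ^ 3 := by
                gcongr; exact le_trans (by exact_mod_cast hb.2) hY'
            _ = _ := by rw [← Real.rpow_natCast, ← Real.rpow_mul (by positivity)]; norm_num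
        rw [abs_le]
        constructor
        · have : (0 : ℝ) ≤ (z.1 : ℝ) ^ 3 := by positivity
          linarith
        · have : (0 : ℝ) ≤ (z.2 : ℝ) ^ 3 := by positivity
          linarith
      gcongr
      refine (hτ _ hpos).trans ?_
      gcongr
      calc _ ≤ (f * (X : ℝ) ^ (6 : ℝ)) ^ (η / 6) := by gcongr
        _ = _ := by
          rw [Real.mul_rpow hf'.le (by positivity), ← Real.rpow_mul (by positivity)]
          congr 2; ring
    refine (sum_le_sum hterm).trans ?_
    rw [sum_const, nsmul_eq_mul]
    have hc : ((((Icc 1 Y ×ˢ Icc 1 Y).filter (fun z => ¬ z.1 = z.2)).card : ℕ) : ℝ) ≤ (Y : ℝ) ^ 2 := by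
      have := card_filter_le (Icc 1 Y ×ˢ Icc 1 Y) (fun z => ¬ z.1 = z.2)
      rw [card_product, Nat.card_Icc, Nat.add_sub_cancel, ← pow_two] at this
      exact_mod_cast this
    calc _ ≤ (Y : ℝ) ^ 2 * (2 * (C₁ * ((f : ℝ) ^ (η / 6) * (X : ℝ) ^ η))) := by gcongr
      _ = _ := by ring
  refine h1.trans ?_
  rw [h2]
  calc _ ≤ (V : ℝ) * (2 * (C₂ * (X : ℝ) ^ η * (Y * (V + Real.sqrt X))) +
        2 * C₁ * (f : ℝ) ^ (η / 6) * (X : ℝ) ^ η * (Y : ℝ) ^ 2) := by gcongr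
    _ = (X : ℝ) ^ η * (V : ℝ) * (2 * C₂ * (Y * (V + Real.sqrt X)) +
        2 * C₁ * (f : ℝ) ^ (η / 6) * (Y : ℝ) ^ 2) := by ring
    _ ≤ (X : ℝ) ^ η * (V : ℝ) * (2 * C₂ * (Y * (V + Real.sqrt X)) +
        2 * C₁ * (f : ℝ) ^ (η / 6) * (Y : ℝ) ^ 2 + (2 * C₂ * (Y : ℝ) ^ 2 +
        2 * C₁ * (f : ℝ) ^ (η / 6) * (Y * (V + Real.sqrt X)))) := by
        refine mul_le_mul_of_nonneg_left (le_add_of_nonneg_right ?_) (by positivity)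
        positivity
    _ = _ := by ring

end FourthMoment

namespace FourthMoment

/-- The ring of Eisenstein integers. -/
abbrev Eis := QuadraticAlgebra ℤ (-1) (-1)

namespace Eis

theorem norm_eq (x : Eis) : x.norm = x.re ^ 2 - x.re * x.im + x.im ^ 2 := by
  rw [QuadraticAlgebra.norm_def]; ring

theorem norm_nonneg (x : Eis) : 0 ≤ x.norm := by
  rw [norm_eq]; nlinarith [sq_nonneg (x.re - x.im), sq_nonneg x.re, sq_nonneg x.im]

theorem norm_eq_zero {x : Eis} (h : x.norm = 0) : x = 0 := by
  rw [norm_eq] at h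
  have h1 : x.re = 0 := by
    nlinarith [sq_nonneg (2 * x.im - x.re), sq_nonneg x.re, sq_nonneg x.im]
  have h2 : x.im = 0 := by
    rw [h1] at h; nlinarith [sq_nonneg x.im]
  ext <;> simp [h1, h2]

instance : IsDomain Eis :=
  have : NoZeroDivisors Eis := ⟨fun {x y} h => by
    have h1 : x.norm * y.norm = 0 := by rw [← map_mul, h]; exact QuadraticAlgebra.norm_zero
    rcases mul_eq_zero.mp h1 with h1 | h1
    · exact Or.inl (norm_eq_zero h1)
    · exact Or.inr (norm_eq_zero h1)⟩
  NoZeroDivisors.to_isDomain _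

/-- A primitive cube root of unity. -/
def om : Eis := ⟨0, 1⟩

theorem om_sq : om ^ 2 = -1 - om := by
  rw [pow_two]; ext <;> rfl

theorem om_pow_three : om ^ 3 = 1 := by
  have h := om_sq
  linear_combination (om - 1) * h

theorem isPrimitiveRoot_om : IsPrimitiveRoot om 3 := by
  refine IsPrimitiveRoot.of_map_of_injective (f := RingHom.id Eis) ?_ Function.injective_id
  have : Fact (Nat.Prime 3) := ⟨by norm_num⟩
  refine IsPrimitiveRoot.iff_orderOf.mpr (orderOf_eq_prime om_pow_three ?_)
  intro h
  exact one_ne_zero (congrArg QuadraticAlgebra.im h : (1 : ℤ) = 0)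

theorem eq_add_mul_om (x : Eis) : x = (x.re : Eis) + (x.im : Eis) * om := by
  ext <;> simp [om]

theorem mul_star_eq (x : Eis) : x * star x = (x.norm : Eis) := by
  have := QuadraticAlgebra.algebraMap_norm_eq_mul_star x
  rw [← this]; simp

/-- The embedding of the Eisenstein integers in the complex numbers. -/
noncomputable def toComplex : Eis →+* ℂ :=
  (QuadraticAlgebra.lift (R := ℤ) (a := -1) (b := -1) (A := ℂ)
    ⟨-1 / 2 + (Real.sqrt 3 / 2 : ℝ) * Complex.I, by
      have h3 : ((Real.sqrt 3 : ℝ) : ℂ) ^ 2 = 3 := by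
        rw [← Complex.ofReal_pow, Real.sq_sqrt (by norm_num)]; norm_num
      have hI := Complex.I_sq
      simp only [neg_smul, one_smul]
      push_cast
      linear_combination (Complex.I ^ 2 / 4) * h3 + (3 / 4) * hI⟩).toRingHom

theorem toComplex_injective : Function.Injective toComplex := by
  rw [injective_iff_map_eq_zero]
  intro x hx
  have h1 : toComplex x = x.re + x.im * (-1 / 2 + (Real.sqrt 3 / 2 : ℝ) * Complex.I) := by
    conv_lhs => rw [eq_add_mul_om x]
    rw [map_add, map_mul, map_intCast, map_intCast]
    congr 2
    simp [toComplex, QuadraticAlgebra.lift, om]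
  rw [h1] at hx
  have him := congrArg Complex.im hx
  have hre := congrArg Complex.re hx
  simp at him hre
  have h2 : x.im = 0 := by
    simpa using him
  rw [h2] at hre
  have h3 : x.re = 0 := by simpa using hre
  ext <;> simp [h2, h3]

end Eis
end FourthMoment

namespace FourthMoment
namespace Eis

open Finset in
/-- A Gauss sum computation: the Jacobi sum of a cubic character detects the character. -/
theorem jacobiSum_pow_eq {q p : ℕ} [Fact q.Prime] [Fact p.Prime] (hpq : p ≠ q) (hp3 : p ≠ 3)
    {k : Type*} [Field k] [CharP k p] (χ : MulChar (ZMod q) k) (hχ : orderOf χ = 3) :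
    (q * jacobiSum χ χ) ^ ((p ^ 2 - 1) / 3) = χ p := by
  have hp : p.Prime := Fact.out
  have hq : q.Prime := Fact.out
  have hqk : (q : k) ≠ 0 := by
    intro h
    rw [CharP.cast_eq_zero_iff k p] at h
    exact hpq ((Nat.prime_dvd_prime_iff_eq hp hq).mp h)
  let ψ₀ := AddChar.primitiveZModChar ⟨q, hq.pos⟩ k hqk
  let L := CyclotomicField ψ₀.n k
  let ψ : AddChar (ZMod q) L := ψ₀.char
  have hψ : ψ.IsPrimitive := ψ₀.prim
  let f := algebraMap k L
  have hf : Function.Injective f := FaithfulSMul.algebraMap_injective k L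
  have : CharP L p := charP_of_injective_algebraMap hf p
  let χ' := χ.ringHomComp f
  have hχ' : orderOf χ' = 3 := by
    have : Fact (Nat.Prime 3) := ⟨by norm_num⟩
    refine orderOf_eq_prime ?_ ?_
    · rw [MulChar.ringHomComp_pow, ← hχ, pow_orderOf_eq_one]
      ext; simp
    · rw [Ne, MulChar.ringHomComp_eq_one_iff hf]
      intro h
      rw [h, orderOf_one] at hχ
      omega
  have h3 := gaussSum_pow_eq_prod_jacobiSum (χ := χ') (ψ := ψ) (by omega) hψ
  rw [hχ', show (3 : ℕ) - 1 = 2 by norm_num, show Ico 1 2 = {1} by rfl, prod_singleton, pow_one] at h3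
  have hχ1 : χ' ^ 3 = 1 := by rw [← hχ', pow_orderOf_eq_one]
  have hm1 : χ' (-1) = 1 := by
    have h1 : χ' (-1) ^ 3 = 1 := by
      rw [← MulChar.pow_apply' _ (by norm_num), hχ1]
      exact MulChar.one_apply (by simp)
    have h2 : χ' (-1) ^ 2 = 1 := by rw [← map_pow]; simp
    calc χ' (-1) = χ' (-1) ^ 3 := by rw [pow_succ, h2, one_mul]
      _ = 1 := h1
  rw [hm1, one_mul, ZMod.card, jacobiSum_ringHomComp] at h3
  have hg0 : gaussSum χ' ψ ≠ 0 := by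
    refine gaussSum_ne_zero_of_nontrivial ?_ ?_ hψ
    · rw [ZMod.card]; intro h
      exact hqk (hf (by simpa using h))
    · intro h
      rw [h, orderOf_one] at hχ'
      omega
  have h3p : ¬ 3 ∣ p := fun h => hp3 ((Nat.prime_dvd_prime_iff_eq (by norm_num) hp).mp h).symm
  have hdvd : p ^ 2 = 3 * ((p ^ 2 - 1) / 3) + 1 := by
    have h1 : p ^ 2 % 3 = 1 := by
      have : p % 3 = 1 ∨ p % 3 = 2 := by omega
      rcases this with h | h <;> simp [Nat.pow_mod, h]
    omega
  have hfrob : gaussSum χ' ψ ^ (p ^ 2) = χ' p * gaussSum χ' ψ := by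
    rw [pow_two, pow_mul, gaussSum_frob, gaussSum_frob, ← pow_mul, ← pow_mul, ← pow_two]
    have e1 : χ' ^ (p ^ 2) = χ' := by
      rw [hdvd, pow_succ, pow_mul, hχ1, one_pow, one_mul]
    have hpu : IsUnit ((p : ZMod q)) := by
      rw [isUnit_iff_ne_zero]
      intro h
      rw [ZMod.natCast_eq_zero_iff] at h
      exact hpq ((Nat.prime_dvd_prime_iff_eq hq hp).mp h).symm
    obtain ⟨u, hu⟩ := hpu
    have e2 : ψ ^ (p ^ 2) = ψ.mulShift ((u * u : (ZMod q)ˣ) : ZMod q) := by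
      rw [AddChar.pow_mulShift]; rw [Units.val_mul, hu]; push_cast; rw [pow_two]
    have e3 := gaussSum_mulShift χ' ψ (u * u)
    rw [e1, e2]
    have e4 : χ' p ^ 3 = 1 := by
      rw [← MulChar.pow_apply' _ (by norm_num), hχ1, ← hu]
      exact MulChar.one_apply (Units.isUnit u)
    have e5 : χ' ((u * u : (ZMod q)ˣ) : ZMod q) = χ' p ^ 2 := by
      rw [Units.val_mul, map_mul, hu, pow_two]
    rw [e5] at e3
    rw [← e3]
    linear_combination (-gaussSum χ' (ψ.mulShift ↑(u * u))) * e4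
  have hfin : (q * f (jacobiSum χ χ)) ^ ((p ^ 2 - 1) / 3) = χ' p := by
    rw [← h3, ← pow_mul]
    refine mul_right_cancel₀ hg0 ?_
    rw [← pow_succ, ← hdvd, hfrob]
  apply hf
  rw [map_pow, map_mul, map_natCast]
  exact hfin

/-- Norm, congruence and residue symbol of a cubic Jacobi sum. -/
theorem exists_jacobi (q : ℕ) (hq : q.Prime) (hq3 : q % 3 = 1) :
    ∃ (J : Eis) (χ : MulChar (ZMod q) Eis), (∀ x, x ≠ 0 → χ x ^ 3 = 1) ∧ J.norm = q ∧
      (3 : ℤ) ∣ J.im ∧ (3 : ℤ) ∣ J.re + 1 ∧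
      ∀ p : ℕ, p.Prime → p ≠ 3 → p ≠ q → ∀ (k : Type) [Field k] [CharP k p] (φ : Eis →+* k),
        φ (J ^ 2 * star J) ^ ((p ^ 2 - 1) / 3) = φ (χ p) := by
  have : Fact q.Prime := ⟨hq⟩
  have f3 : Fact (Nat.Prime 3) := ⟨by norm_num⟩
  have hdq : 3 ∣ Fintype.card (ZMod q) - 1 := by
    rw [ZMod.card]; omega
  obtain ⟨χ, hχ⟩ := MulChar.exists_mulChar_orderOf (ZMod q) hdq isPrimitiveRoot_om
  have hχ3 : χ ^ 3 = 1 := by rw [← hχ, pow_orderOf_eq_one]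
  have hcube : ∀ x, x ≠ 0 → χ x ^ 3 = 1 := by
    intro x hx
    rw [← MulChar.pow_apply' _ (by norm_num), hχ3]
    exact MulChar.one_apply (isUnit_iff_ne_zero.mpr hx)
  have hne : ∀ n, 0 < n → n < 3 → χ ^ n ≠ 1 := by
    intro n h0 h1 h
    have := orderOf_dvd_of_pow_eq_one h
    rw [hχ] at this
    exact absurd (Nat.le_of_dvd h0 this) (by omega)
  set J := jacobiSum χ χ
  have hstar : jacobiSum χ⁻¹ χ⁻¹ = star J := by
    have h1 : χ⁻¹ = χ.ringHomComp (starRingEnd Eis) := by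
      refine inv_eq_of_mul_eq_one_right ?_
      refine MulChar.ext fun u => ?_
      have hu := hcube u (Units.ne_zero u)
      have hn : (χ u).norm = 1 := by
        have h2 : (χ u).norm ^ 3 = 1 := by rw [← map_pow, hu, map_one]
        have h4 := norm_nonneg (χ u)
        nlinarith [sq_nonneg ((χ u).norm + 1)]
      simp only [MulChar.mul_apply, MulChar.ringHomComp_apply, starRingEnd_apply, mul_star_eq, hn,
        MulChar.one_apply_coe, Int.cast_one]
    rw [h1, jacobiSum_ringHomComp]; rfl
  have hnorm : J.norm = q := by
    have hinj := toComplex_injective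
    have h1 := jacobiSum_mul_jacobiSum_inv (F := ZMod q) (F' := ℂ) (χ := χ.ringHomComp toComplex)
      (φ := χ.ringHomComp toComplex) (by
        rw [ringChar.eq_zero, ZMod.ringChar_zmod_n]; exact hq.ne_zero.symm)
      ((MulChar.ringHomComp_ne_one_iff hinj).mpr (by simpa using hne 1 (by omega) (by omega)))
      ((MulChar.ringHomComp_ne_one_iff hinj).mpr (by simpa using hne 1 (by omega) (by omega)))
      (by
        rw [← MulChar.ringHomComp_mul, ← pow_two]
        exact (MulChar.ringHomComp_ne_one_iff hinj).mpr (hne 2 (by omega) (by omega)))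
    rw [MulChar.ringHomComp_inv, jacobiSum_ringHomComp, jacobiSum_ringHomComp, hstar,
      ← map_mul, mul_star_eq, ZMod.card, map_intCast] at h1
    exact_mod_cast h1
  obtain ⟨z, -, hz⟩ := exists_jacobiSum_eq_neg_one_add (by norm_num) hχ3 hχ3 hdq isPrimitiveRoot_om
  have hz' : J = -1 + 3 * (-(z * om)) := by
    have := om_sq
    change J = _ at hz
    rw [hz]; linear_combination z * this
  have re3 : QuadraticAlgebra.re (3 : Eis) = 3 := rfl
  have im3 : QuadraticAlgebra.im (3 : Eis) = 0 := rfl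
  refine ⟨J, χ, hcube, hnorm, ?_, ?_, ?_⟩
  · rw [hz']; simp [QuadraticAlgebra.im_one, im3, re3]
  · rw [hz']; simp [QuadraticAlgebra.re_one, im3, re3]
  · intro p hp hp3 hpq k _ _ φ
    have : Fact p.Prime := ⟨hp⟩
    have hqk : (q : k) ≠ 0 := by
      intro h
      rw [CharP.cast_eq_zero_iff k p] at h
      exact hpq ((Nat.prime_dvd_prime_iff_eq hp hq).mp h)
    have hφo : φ om ≠ 1 := by
      intro h
      have h2 := congrArg φ om_sq
      rw [map_pow, map_sub, map_neg, map_one, h] at h2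
      have h3 : ((3 : ℕ) : k) = 0 := by push_cast; linear_combination h2
      rw [CharP.cast_eq_zero_iff k p] at h3
      exact hp3 ((Nat.prime_dvd_prime_iff_eq hp (by norm_num)).mp h3)
    have hord : orderOf (χ.ringHomComp φ) = 3 := by
      refine orderOf_eq_prime ?_ ?_
      · rw [MulChar.ringHomComp_pow, hχ3]; ext; simp
      · intro h
        apply hne 1 (by omega) (by omega)
        rw [pow_one]
        refine MulChar.ext fun u => ?_
        have hu := hcube u (Units.ne_zero u)
        have h1 : φ (χ u) = 1 := by
          have := DFunLike.congr_fun h (u : ZMod q)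
          simpa using this
        obtain ⟨i, hi, hi'⟩ := isPrimitiveRoot_om.eq_pow_of_pow_eq_one hu
        rw [MulChar.one_apply_coe]
        interval_cases i
        · simpa using hi'.symm
        · rw [← hi', pow_one] at h1; exact absurd h1 hφo
        · rw [← hi', map_pow] at h1
          exfalso; apply hφo
          have h4 : φ om ^ 3 = 1 := by rw [← map_pow, om_pow_three, map_one]
          calc φ om = φ om ^ 2 * φ om := by rw [h1, one_mul]
            _ = 1 := by rw [← h4]; ring
    have hmain := jacobiSum_pow_eq hpq hp3 (χ.ringHomComp φ) hord
    rw [jacobiSum_ringHomComp] at hmain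
    have e : J ^ 2 * star J = (q : Eis) * J := by
      have := mul_star_eq J
      rw [hnorm] at this; push_cast at this
      linear_combination J * this
    rw [e, map_mul, map_natCast]
    exact hmain

end Eis
end FourthMoment

namespace FourthMoment
namespace Eis

/-- `γ` admits a cubic residue character `χ` on the integers, given by Euler's criterion
for `γ²γ̄`. -/
def HasCubicChar (γ : Eis) : Prop :=
  ∃ χ : ℤ →* Eis, (∀ n, IsCoprime n γ.norm → χ n ^ 3 = 1) ∧
    (∀ n n' : ℤ, γ ∣ ((n - n' : ℤ) : Eis) → χ n = χ n') ∧
    ∀ p : ℕ, p.Prime → p ≠ 3 → ¬ (p : ℤ) ∣ γ.norm → ∀ (k : Type) [Field k] [CharP k p]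
      (φ : Eis →+* k), φ (γ ^ 2 * star γ) ^ ((p ^ 2 - 1) / 3) = φ (χ p)

theorem HasCubicChar.mul {γ γ' : Eis} (h : HasCubicChar γ) (h' : HasCubicChar γ') :
    HasCubicChar (γ * γ') := by
  obtain ⟨χ, h1, h2, h3⟩ := h
  obtain ⟨χ', h1', h2', h3'⟩ := h'
  refine ⟨χ * χ', fun n hn => ?_, fun n n' hn => ?_, fun p hp hp3 hpn k _ _ φ => ?_⟩
  · rw [map_mul] at hn
    rw [MonoidHom.mul_apply, mul_pow, h1 n (hn.of_mul_right_left), h1' n (hn.of_mul_right_right),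
      one_mul]
  · rw [MonoidHom.mul_apply, MonoidHom.mul_apply, h2 n n' ((dvd_mul_right _ _).trans hn),
      h2' n n' ((dvd_mul_left _ _).trans hn)]
  · rw [map_mul] at hpn
    have e := h3 p hp hp3 (fun h => hpn (h.mul_right _)) k φ
    have e' := h3' p hp hp3 (fun h => hpn (h.mul_left _)) k φ
    rw [MonoidHom.mul_apply, map_mul φ (χ p), ← e, ← e', ← mul_pow, ← map_mul]
    congr 2
    rw [star_mul]; ring

theorem three_dvd_sq_sub_one {p : ℕ} (hp : p.Prime) (hp3 : p ≠ 3) : 3 ∣ p ^ 2 - 1 := by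
  have h3p : ¬ 3 ∣ p := fun h => hp3 ((Nat.prime_dvd_prime_iff_eq (by norm_num) hp).mp h).symm
  have h1 : p ^ 2 % 3 = 1 := by
    have : p % 3 = 1 ∨ p % 3 = 2 := by omega
    rcases this with h | h <;> simp [Nat.pow_mod, h]
  omega

theorem intCast_pow_eq_one {p : ℕ} (hp : p.Prime) {k : Type*} [Field k] [CharP k p] {m : ℤ}
    (hm : ¬ (p : ℤ) ∣ m) : (m : k) ^ (p ^ 2 - 1) = 1 := by
  have : Fact p.Prime := ⟨hp⟩
  have hm0 : (m : k) ≠ 0 := by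
    rwa [Ne, CharP.intCast_eq_zero_iff k p]
  have h1 : (m : k) ^ p = m := by
    have := map_intCast (frobenius k p) m
    rwa [frobenius_def] at this
  refine mul_right_cancel₀ hm0 ?_
  rw [← pow_succ, Nat.sub_add_cancel (Nat.one_le_pow _ _ hp.pos), one_mul, pow_two, pow_mul, h1, h1]

theorem hasCubicChar_intCast (m : ℤ) : HasCubicChar (m : Eis) := by
  refine ⟨1, fun n _ => by simp, fun n n' _ => by simp, fun p hp hp3 hpn k _ _ φ => ?_⟩
  have hm : ¬ (p : ℤ) ∣ m := by
    intro h
    rw [QuadraticAlgebra.norm_intCast] at hpn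
    exact hpn (dvd_pow h (by norm_num))
  have e : (m : Eis) ^ 2 * star (m : Eis) = ((m : ℤ) : Eis) ^ 3 := by
    rw [star_intCast]; ring
  rw [e, map_pow, map_intCast, ← pow_mul, Nat.mul_div_cancel' (three_dvd_sq_sub_one hp hp3),
    intCast_pow_eq_one hp hm, MonoidHom.one_apply, map_one]

theorem hasCubicChar_of_mulChar {q : ℕ} (hq : q.Prime) {J : Eis} (hJ : J.norm = q)
    {χ : MulChar (ZMod q) Eis} (hχ : ∀ x, x ≠ 0 → χ x ^ 3 = 1)
    (h : ∀ p : ℕ, p.Prime → p ≠ 3 → p ≠ q → ∀ (k : Type) [Field k] [CharP k p] (φ : Eis →+* k),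
        φ (J ^ 2 * star J) ^ ((p ^ 2 - 1) / 3) = φ (χ p)) : HasCubicChar J := by
  have : Fact q.Prime := ⟨hq⟩
  refine ⟨χ.toMonoidHom.comp (Int.castRingHom (ZMod q)).toMonoidHom, fun n hn => ?_,
    fun n n' hn => ?_, fun p hp hp3 hpn k _ _ φ => ?_⟩
  · refine hχ _ fun h0 => ?_
    have h0' : ((n : ℤ) : ZMod q) = 0 := h0
    rw [ZMod.intCast_zmod_eq_zero_iff_dvd] at h0'
    rw [hJ] at hn
    have := hn.isUnit_of_dvd' h0' dvd_rfl
    rw [Int.isUnit_iff] at this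
    have := hq.two_le
    omega
  · have e : ((n : ℤ) : ZMod q) = n' := by
      obtain ⟨c, hc⟩ := hn
      have h1 := congrArg QuadraticAlgebra.norm hc
      rw [map_mul, hJ, QuadraticAlgebra.norm_intCast] at h1
      have h2 : (q : ℤ) ∣ n - n' := Int.Prime.dvd_pow' hq ⟨_, by exact_mod_cast h1⟩
      have := (ZMod.intCast_zmod_eq_zero_iff_dvd (n - n') q).mpr h2
      push_cast at this
      exact sub_eq_zero.mp this
    change χ ((n : ℤ) : ZMod q) = χ ((n' : ℤ) : ZMod q)
    rw [e]
  · have := h p hp hp3 (fun h => hpn (by rw [hJ, h])) k φ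
    rw [this]
    change _ = φ (χ (((p : ℤ) : ℤ) : ZMod q))
    rw [Int.cast_natCast]

theorem prime_dvd_of_dvd_norm {q : ℕ} (hq : q.Prime) (hq3 : q % 3 = 2) {a b : ℤ}
    (h : (q : ℤ) ∣ a ^ 2 - a * b + b ^ 2) : (q : ℤ) ∣ a ∧ (q : ℤ) ∣ b := by
  have : Fact q.Prime := ⟨hq⟩
  have key : ∀ x y : ZMod q, x ^ 2 - x * y + y ^ 2 = 0 → y = 0 := by
    intro x y hxy
    by_contra hy
    have h3 : ((-x / y) ^ 3 : ZMod q) = 1 := by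
      field_simp; linear_combination (-(x + y)) * hxy
    have hu : (-x / y) ≠ 0 := by
      intro h0; rw [h0] at h3; simp at h3
    have h1 : (-x / y : ZMod q) ^ (q - 1) = 1 := ZMod.pow_card_sub_one_eq_one hu
    have h2 : (-x / y : ZMod q) = 1 := by
      have e : q - 1 = 3 * (q / 3) + 1 := by omega
      rw [e, pow_succ, pow_mul, h3, one_pow, one_mul] at h1
      exact h1
    have h4 : x = -y := by
      rw [div_eq_one_iff_eq hy] at h2
      rw [← h2, neg_neg]
    rw [h4] at hxy
    have h5 : (3 : ZMod q) * y ^ 2 = 0 := by linear_combination hxy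
    rcases mul_eq_zero.mp h5 with h6 | h6
    · have h7 : ((3 : ℕ) : ZMod q) = 0 := by exact_mod_cast h6
      rw [ZMod.natCast_eq_zero_iff] at h7
      rw [(Nat.prime_dvd_prime_iff_eq hq (by norm_num)).mp h7] at hq3
      omega
    · exact hy (by simpa using h6)
  have h0 : ((a : ZMod q)) ^ 2 - a * b + (b : ZMod q) ^ 2 = 0 := by
    have := (ZMod.intCast_zmod_eq_zero_iff_dvd _ q).mpr h
    push_cast at this; exact this
  have hb := key _ _ h0
  have ha := key (b : ZMod q) a (by linear_combination h0)
  exact ⟨(ZMod.intCast_zmod_eq_zero_iff_dvd _ q).mp ha, (ZMod.intCast_zmod_eq_zero_iff_dvd _ q).mp hb⟩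

theorem dvd_or_star_dvd {q : ℕ} (hq : q.Prime) {J γ : Eis} (hJ : J.norm = q)
    (h : (q : ℤ) ∣ γ.norm) : J ∣ γ ∨ star J ∣ γ := by
  have hqz : (q : ℤ) ≠ 0 := by exact_mod_cast hq.ne_zero
  have hqp : Prime (q : ℤ) := Nat.prime_iff_prime_int.mp hq
  have key : ∀ α β : Eis, α * β = (q : ℤ) → (q : ℤ) ∣ (γ * β).im → (q : ℤ) ∣ (γ * β).norm →
      α ∣ γ := by
    intro α β hαβ him hn
    have hre : (q : ℤ) ∣ (γ * β).re := by
      rw [norm_eq] at hn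
      have h1 : (q : ℤ) ∣ (γ * β).re ^ 2 := by
        have h2 : (γ * β).re ^ 2 = ((γ * β).re ^ 2 - (γ * β).re * (γ * β).im + (γ * β).im ^ 2) +
            (γ * β).im * ((γ * β).re - (γ * β).im) := by ring
        rw [h2]; exact dvd_add hn (him.mul_right _)
      exact hqp.dvd_of_dvd_pow h1
    obtain ⟨x, hx⟩ := hre
    obtain ⟨y, hy⟩ := him
    have e : γ * β = (q : ℤ) * (⟨x, y⟩ : Eis) := by
      ext <;> simp [hx, hy]
    refine ⟨⟨x, y⟩, ?_⟩
    have hβ : β ≠ 0 := by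
      rintro rfl
      rw [mul_zero] at hαβ
      exact hqz (by exact_mod_cast hαβ.symm)
    refine mul_right_cancel₀ hβ ?_
    rw [e, ← hαβ]; ring
  have hprod : (q : ℤ) ∣ (γ * star J).im * (γ * J).im := by
    have e : (γ * star J).im * (γ * J).im = γ.im ^ 2 * J.norm - J.im ^ 2 * γ.norm := by
      rw [norm_eq, norm_eq]
      simp only [QuadraticAlgebra.im_mul, QuadraticAlgebra.re_star, QuadraticAlgebra.im_star]
      ring
    rw [e, hJ]
    exact dvd_sub (dvd_mul_left _ _) (h.mul_left _)
  rcases hqp.dvd_or_dvd hprod with h1 | h1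
  · left
    exact key J (star J) (by rw [mul_star_eq, hJ]) h1 (by rw [map_mul]; exact h.mul_right _)
  · right
    exact key (star J) J (by rw [mul_comm, mul_star_eq, hJ]) h1 (by rw [map_mul]; exact h.mul_right _)

theorem hasCubicChar_star_intro {J : Eis} (h : HasCubicChar J) : HasCubicChar (star J) := by
  obtain ⟨χ, h1, h2, h3⟩ := h
  refine ⟨(starRingEnd Eis).toMonoidHom.comp χ, fun n hn => ?_, fun n n' hn => ?_,
    fun p hp hp3 hpn k _ _ φ => ?_⟩
  · rw [QuadraticAlgebra.norm_star] at hn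
    change star (χ n) ^ 3 = 1
    rw [← star_pow, h1 n hn, star_one]
  · change star (χ n) = star (χ n')
    rw [h2 n n' ?_]
    obtain ⟨c, hc⟩ := hn
    refine ⟨star c, ?_⟩
    have := congrArg star hc
    rw [star_intCast, star_mul, star_star, mul_comm] at this
    exact this
  · rw [QuadraticAlgebra.norm_star] at hpn
    have := h3 p hp hp3 hpn k (φ.comp (starRingEnd Eis))
    simp only [RingHom.comp_apply, starRingEnd_apply, star_mul, star_pow] at this
    rw [mul_comm]
    exact this

/-- Every `γ ≡ ±1 mod 3` has a cubic residue character. -/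
theorem hasCubicChar (γ : Eis) (him : (3 : ℤ) ∣ γ.im) (hre : ¬ (3 : ℤ) ∣ γ.re) :
    HasCubicChar γ := by
  induction' hN : γ.norm.natAbs using Nat.strong_induction_on with N ih generalizing γ
  have hpos : 0 < γ.norm := by
    refine lt_of_le_of_ne (norm_nonneg γ) fun h => hre ?_
    rw [norm_eq_zero h.symm]; exact dvd_zero _
  by_cases h1 : γ.norm = 1
  · rw [norm_eq] at h1
    have hb : γ.im = 0 := by
      obtain ⟨c, hc⟩ := him
      rw [hc] at h1 ⊢
      by_contra h0
      have : 1 ≤ c ^ 2 := by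
        have : c ≠ 0 := fun h => h0 (by rw [h, mul_zero])
        nlinarith [Int.one_le_abs this, sq_abs c, abs_nonneg c]
      nlinarith [sq_nonneg (2 * γ.re - 3 * c)]
    have : γ = (γ.re : Eis) := by ext <;> simp [hb]
    rw [this]
    exact hasCubicChar_intCast _
  · have hne : γ.norm.natAbs ≠ 1 := by omega
    obtain ⟨q, hq, hqd⟩ := Nat.exists_prime_and_dvd hne
    have hqd' : (q : ℤ) ∣ γ.norm := Int.natCast_dvd.mpr hqd
    have hq3 : q ≠ 3 := by
      rintro rfl
      rw [norm_eq] at hqd'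
      apply hre
      have h2 : ((3 : ℕ) : ℤ) ∣ γ.re ^ 2 := by
        have e : γ.re ^ 2 = (γ.re ^ 2 - γ.re * γ.im + γ.im ^ 2) + γ.im * (γ.re - γ.im) := by ring
        rw [e]; exact dvd_add hqd' (him.mul_right _)
      exact_mod_cast Int.Prime.dvd_pow' hq h2
    have hqm : q % 3 ≠ 0 := fun h =>
      hq3 ((Nat.prime_dvd_prime_iff_eq (by norm_num) hq).mp (Nat.dvd_of_mod_eq_zero h)).symm
    have hred : ∀ α δ : Eis, γ = α * δ → HasCubicChar α → 1 < α.norm → (3 : ℤ) ∣ α.im →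
        HasCubicChar γ := by
      intro α δ h hα hα1 hαi
      rw [h]
      refine hα.mul (ih δ.norm.natAbs ?_ δ ?_ ?_ rfl)
      · rw [← hN, h, map_mul, Int.natAbs_mul]
        have hδ : 0 < δ.norm := by
          have := norm_nonneg δ
          rw [h, map_mul] at hpos
          nlinarith
        have : 1 < α.norm.natAbs := by omega
        have : 0 < δ.norm.natAbs := by omega
        nlinarith
      · have hi : γ.im = α.re * δ.im + α.im * (δ.re - δ.im) := by
          rw [h]; simp only [QuadraticAlgebra.im_mul]; ring
        have hr : γ.re = α.re * δ.re - α.im * δ.im := by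
          rw [h]; simp only [QuadraticAlgebra.re_mul]; ring
        have hαr : ¬ (3 : ℤ) ∣ α.re := fun h3 => hre (by
          rw [hr]; exact dvd_sub (h3.mul_right _) (hαi.mul_right _))
        have h4 : (3 : ℤ) ∣ α.re * δ.im := by
          have : α.re * δ.im = γ.im - α.im * (δ.re - δ.im) := by rw [hi]; ring
          rw [this]; exact dvd_sub him (hαi.mul_right _)
        exact (Int.prime_three.dvd_or_dvd h4).resolve_left hαr
      · intro h3
        apply hre
        have hr : γ.re = α.re * δ.re - α.im * δ.im := by
          rw [h]; simp only [QuadraticAlgebra.re_mul]; ring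
        rw [hr]; exact dvd_sub (h3.mul_left _) (hαi.mul_right _)
    have hqq := hq.two_le
    have hcase : q % 3 = 1 ∨ q % 3 = 2 := by omega
    rcases hcase with hq1 | hq2
    · obtain ⟨J, χ, hχ, hJ, hJi, -, hJφ⟩ := exists_jacobi q hq hq1
      have hgood := hasCubicChar_of_mulChar hq hJ hχ hJφ
      rcases dvd_or_star_dvd hq hJ hqd' with ⟨δ, hδ⟩ | ⟨δ, hδ⟩
      · exact hred J δ hδ hgood (by rw [hJ]; exact_mod_cast hqq) hJi
      · refine hred (star J) δ hδ (hasCubicChar_star_intro hgood)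
          (by rw [QuadraticAlgebra.norm_star, hJ]; exact_mod_cast hqq) ?_
        rw [QuadraticAlgebra.im_star]
        simpa using hJi
    · rw [norm_eq] at hqd'
      obtain ⟨⟨x, hx⟩, ⟨y, hy⟩⟩ := prime_dvd_of_dvd_norm hq hq2 hqd'
      refine hred ((q : ℤ) : Eis) ⟨x, y⟩ ?_ (hasCubicChar_intCast _) ?_ ?_
      · ext <;> simp [hx, hy]
      · rw [QuadraticAlgebra.norm_intCast]
        have : (2 : ℤ) ≤ q := by exact_mod_cast hqq
        rw [Int.cast_id]
        nlinarith
      · simp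

end Eis
end FourthMoment

namespace FourthMoment
namespace Eis

/-- The square root `1 + 2ω` of `-3`. -/
def theta : Eis := ⟨1, 2⟩

theorem theta_sq : theta ^ 2 = -3 := by
  rw [pow_two]; ext <;> rfl

theorem star_theta : star theta = -theta := by
  ext <;> rfl

theorem map_om_pow {p : ℕ} {k : Type*} [Field k] (φ : Eis →+* k) (hp3 : p % 3 = 2) :
    φ om ^ p = φ (star om) := by
  have h : φ om ^ 3 = 1 := by rw [← map_pow, om_pow_three, map_one]
  have e : p = 3 * (p / 3) + 2 := by omega
  have h2 : star om = om ^ 2 := by rw [om_sq]; ext <;> rfl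
  rw [e, pow_add, pow_mul, h, one_pow, one_mul, ← map_pow, h2]

section CharP
variable {p : ℕ} {k : Type*} [Field k] [CharP k p] (φ : Eis →+* k)

theorem map_pow_char (hp : p.Prime) (hp3 : p % 3 = 2) (γ : Eis) : φ γ ^ p = φ (star γ) := by
  have : Fact p.Prime := ⟨hp⟩
  have hint : ∀ m : ℤ, ((m : ℤ) : k) ^ p = m := fun m => by
    have := map_intCast (frobenius k p) m
    rwa [frobenius_def] at this
  conv_lhs => rw [eq_add_mul_om γ, map_add, add_pow_char, map_mul, mul_pow, map_intCast, map_intCast,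
    hint, hint, map_om_pow φ hp3]
  conv_rhs => rw [eq_add_mul_om γ, star_add, star_mul, star_intCast, star_intCast, map_add, map_mul,
    map_intCast, map_intCast]
  rw [mul_comm]

theorem map_pow_char_sq (hp : p.Prime) (hp3 : p ≠ 3) (γ : Eis) : φ γ ^ (p ^ 2) = φ γ := by
  have : Fact p.Prime := ⟨hp⟩
  have hint : ∀ m : ℤ, ((m : ℤ) : k) ^ (p ^ 2) = m := fun m => by
    have := map_intCast (iterateFrobenius k p 2) m
    rwa [iterateFrobenius_def] at this
  have h : φ om ^ 3 = 1 := by rw [← map_pow, om_pow_three, map_one]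
  have e : φ om ^ (p ^ 2) = φ om := by
    have h1 := three_dvd_sq_sub_one hp hp3
    have h2 : p ^ 2 = 3 * ((p ^ 2 - 1) / 3) + 1 := by
      have := Nat.one_le_pow 2 p hp.pos
      omega
    rw [h2, pow_succ, pow_mul, h, one_pow, one_mul]
  rw [eq_add_mul_om γ, map_add, map_mul, map_intCast, map_intCast, add_pow_char_pow, mul_pow, hint,
    hint, e]

theorem map_pow_sq_sub_one (hp : p.Prime) (hp3 : p ≠ 3) {γ : Eis} (hγ : φ γ ≠ 0) :
    φ γ ^ (p ^ 2 - 1) = 1 := by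
  refine mul_right_cancel₀ hγ ?_
  rw [← pow_succ, Nat.sub_add_cancel (Nat.one_le_pow _ _ hp.pos), map_pow_char_sq φ hp hp3, one_mul]

theorem map_ne_zero {γ : Eis} (h : ¬ (p : ℤ) ∣ γ.norm) : φ γ ≠ 0 := by
  intro h0
  apply h
  have h1 := congrArg φ (mul_star_eq γ)
  rw [map_mul, h0, zero_mul, map_intCast] at h1
  exact (CharP.intCast_eq_zero_iff k p _).mp h1.symm

theorem euler_exp_eq (hp : p.Prime) (hp3 : p % 3 = 2) {γ : Eis} (hγ : φ γ ≠ 0) :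
    φ (γ ^ 2 * star γ) ^ ((p ^ 2 - 1) / 3) = φ γ ^ ((p ^ 2 - 1) / 3) := by
  have hp3' : p ≠ 3 := by rintro rfl; omega
  have h3 := three_dvd_sq_sub_one hp hp3'
  rw [map_mul, map_pow, ← map_pow_char φ hp hp3, ← pow_add, ← pow_mul]
  have e : (2 + p) * ((p ^ 2 - 1) / 3) = (p ^ 2 - 1) * ((p + 1) / 3) + (p ^ 2 - 1) / 3 := by
    obtain ⟨c, hc⟩ := h3
    obtain ⟨b, hb⟩ : ∃ b, p = 3 * b + 2 := ⟨p / 3, by omega⟩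
    have e1 : (p + 1) / 3 = b + 1 := by omega
    have e2 : (p ^ 2 - 1) / 3 = c := by omega
    rw [e2, hc, e1, hb]; ring
  rw [e, pow_add, pow_mul, map_pow_sq_sub_one φ hp hp3' hγ, one_pow, one_mul]

theorem intCast_euler (hp : p.Prime) (hp3 : p % 3 = 2) {m : ℤ} (hm : ¬ (p : ℤ) ∣ m) :
    (m : k) ^ ((p ^ 2 - 1) / 3) = 1 := by
  have : Fact p.Prime := ⟨hp⟩
  have hm0 : (m : k) ≠ 0 := by
    rwa [Ne, CharP.intCast_eq_zero_iff k p]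
  have h1 : (m : k) ^ p = m := by
    have := map_intCast (frobenius k p) m
    rwa [frobenius_def] at this
  have h2 : (m : k) ^ (p - 1) = 1 := by
    refine mul_right_cancel₀ hm0 ?_
    rw [← pow_succ, Nat.sub_add_cancel hp.one_le, h1, one_mul]
  have e : (p ^ 2 - 1) / 3 = (p - 1) * ((p + 1) / 3) := by
    obtain ⟨b, hb⟩ : ∃ b, p = 3 * b + 2 := ⟨p / 3, by omega⟩
    have e1 : (p + 1) / 3 = b + 1 := by omega
    have e2 : p - 1 = 3 * b + 1 := by omega
    have e3 : p ^ 2 - 1 = 3 * ((3 * b + 1) * (b + 1)) := by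
      rw [hb]; apply Nat.sub_eq_of_eq_add; ring
    rw [e1, e2, e3, Nat.mul_div_cancel_left _ (by norm_num)]
  rw [e, pow_mul, h2, one_pow]

theorem eq_of_map_eq (hp : p.Prime) (hp3 : p ≠ 3) {x y : Eis} (hx : x ^ 3 = 1) (hy : y ^ 3 = 1)
    (h : φ x = φ y) : x = y := by
  have hprim : IsPrimitiveRoot (φ om) 3 := by
    have : Fact (Nat.Prime 3) := ⟨by norm_num⟩
    refine IsPrimitiveRoot.iff_orderOf.mpr (orderOf_eq_prime ?_ ?_)
    · rw [← map_pow, om_pow_three, map_one]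
    · intro h
      have h2 := congrArg φ om_sq
      rw [map_pow, map_sub, map_neg, map_one, h] at h2
      have h3 : ((3 : ℕ) : k) = 0 := by push_cast; linear_combination h2
      rw [CharP.cast_eq_zero_iff k p] at h3
      exact hp3 ((Nat.prime_dvd_prime_iff_eq hp (by norm_num)).mp h3)
  obtain ⟨i, hi, rfl⟩ := isPrimitiveRoot_om.eq_pow_of_pow_eq_one hx
  obtain ⟨j, hj, rfl⟩ := isPrimitiveRoot_om.eq_pow_of_pow_eq_one hy
  rw [map_pow, map_pow] at h
  rw [hprim.pow_inj hi hj h]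

end CharP

theorem exists_hom (p : ℕ) [Fact p.Prime] : Nonempty (Eis →+* AlgebraicClosure (ZMod p)) := by
  obtain ⟨x, hx⟩ := IsAlgClosed.exists_root (Polynomial.X ^ 2 + Polynomial.X + 1 :
    Polynomial (AlgebraicClosure (ZMod p))) (by
      have : (Polynomial.X ^ 2 + Polynomial.X + 1 :
        Polynomial (AlgebraicClosure (ZMod p))).degree = 2 := by compute_degree!
      rw [this]; norm_num)
  simp only [Polynomial.IsRoot.def, Polynomial.eval_add, Polynomial.eval_pow, Polynomial.eval_X,
    Polynomial.eval_one] at hx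
  exact ⟨(QuadraticAlgebra.lift (R := ℤ) (a := -1) (b := -1) ⟨x, by
    simp only [neg_smul, one_smul]; linear_combination hx⟩).toRingHom⟩

end Eis
end FourthMoment

namespace FourthMoment
namespace Eis

theorem char_eq_one_of_prime {χ : ℤ →* Eis} (hneg : χ (-1) = 1) {m : ℤ} (hm : m ≠ 0)
    (h : ∀ p : ℕ, p.Prime → (p : ℤ) ∣ m → χ p = 1) : χ m = 1 := by
  have key : ∀ n : ℕ, n ≠ 0 → (∀ p : ℕ, p.Prime → p ∣ n → χ p = 1) → χ n = 1 := by
    intro n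
    induction n using Nat.recOnMul with
    | zero => simp
    | one => simp
    | prime p hp => exact fun _ h => h p hp dvd_rfl
    | mul a b iha ihb =>
      intro hab h
      rw [mul_ne_zero_iff] at hab
      rw [Nat.cast_mul, map_mul, iha hab.1 fun p hp hd => h p hp (hd.mul_right _),
        ihb hab.2 fun p hp hd => h p hp (hd.mul_left _), one_mul]
  have h1 := key m.natAbs (Int.natAbs_ne_zero.mpr hm) fun p hp hd => h p hp (Int.natCast_dvd.mpr hd)
  rcases Int.natAbs_eq m with e | e
  · rw [e]; exact h1
  · rw [e, show -(m.natAbs : ℤ) = -1 * m.natAbs by ring, map_mul, hneg, h1, one_mul]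

theorem norm_mk (a b : ℤ) : ((-a : ℤ) + (b : ℤ) * theta : Eis).norm = a ^ 2 + 3 * b ^ 2 := by
  have h : ((-a : ℤ) + (b : ℤ) * theta : Eis) = ⟨-a + b, 2 * b⟩ := by
    ext <;> simp [theta]; ring
  rw [h, norm_eq]; ring

theorem not_dvd_norm {a b : ℤ} (hab : IsCoprime a b) {p : ℕ} (hp : p.Prime)
    (h : (p : ℤ) ∣ a ∧ p ≠ 3 ∨ (p : ℤ) ∣ b) : ¬ (p : ℤ) ∣ a ^ 2 + 3 * b ^ 2 := by
  have hpi : Prime (p : ℤ) := Nat.prime_iff_prime_int.mp hp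
  intro hd
  have hu : ¬ IsUnit (p : ℤ) := hpi.not_isUnit
  rcases h with ⟨h, h3⟩ | h
  · have h1 : (p : ℤ) ∣ 3 * b ^ 2 := (dvd_add_right (dvd_pow h two_ne_zero)).mp hd
    rcases hpi.dvd_or_dvd h1 with h1 | h1
    · exact h3 ((Nat.prime_dvd_prime_iff_eq hp (by norm_num)).mp (by exact_mod_cast h1))
    · exact hu (hab.isUnit_of_dvd' h (hpi.dvd_of_dvd_pow h1))
  · have h1 : (p : ℤ) ∣ a ^ 2 :=
      (dvd_add_left ((dvd_pow h two_ne_zero).mul_left 3)).mp hd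
    exact hu (hab.isUnit_of_dvd' (hpi.dvd_of_dvd_pow h1) h)

theorem exists_char {a b : ℤ} (hab : IsCoprime a b) (hb : b ≠ 0) (ha3 : ¬ 3 ∣ a) (hb3 : 3 ∣ b) :
    ∃ χ : ℤ →* Eis, χ (-1) = 1 ∧ (∀ m, m ∣ a → χ m = 1) ∧ (∀ m, m ∣ b → ¬ 3 ∣ m → χ m = 1) ∧
      (∀ n, IsCoprime n (a ^ 2 + 3 * b ^ 2) → χ n ^ 3 = 1) ∧
      (∀ n n', a ^ 2 + 3 * b ^ 2 ∣ n - n' → χ n = χ n') ∧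
      ∀ p : ℕ, p.Prime → p % 3 = 2 → ¬ (p : ℤ) ∣ a ^ 2 + 3 * b ^ 2 →
        ∀ (k : Type) [Field k] [CharP k p] (φ : Eis →+* k),
          φ ((-a : ℤ) + (b : ℤ) * theta) ^ ((p ^ 2 - 1) / 3) = φ (χ p) := by
  set γ : Eis := (-a : ℤ) + (b : ℤ) * theta with hγ
  have hN : γ.norm = a ^ 2 + 3 * b ^ 2 := norm_mk a b
  have hγ' : γ = ⟨-a + b, 2 * b⟩ := by
    rw [hγ]; ext <;> simp [theta]; ring
  have ha0 : a ≠ 0 := by rintro rfl; simp at ha3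
  obtain ⟨χ, h1, h2, h3⟩ := hasCubicChar γ (by rw [hγ']; exact hb3.mul_left 2) (by
    rw [hγ']; intro h; exact ha3 (by simpa using (dvd_add_left hb3).mp h))
  rw [hN] at h1
  have hneg : χ (-1) = 1 := by
    have e1 := h1 (-1) (isCoprime_one_left.neg_left)
    have e2 : χ (-1) ^ 2 = 1 := by rw [← map_pow]; simp
    rw [pow_succ, e2, one_mul] at e1
    exact e1
  have hstar : star γ = (-a : ℤ) - (b : ℤ) * theta := by
    rw [hγ, star_add, star_mul, star_intCast, star_intCast, star_theta]; ring
  have hprime : ∀ p : ℕ, p.Prime → p ≠ 3 → ((p : ℤ) ∣ a ∨ (p : ℤ) ∣ b) → χ p = 1 := by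
    intro p hp hp3 hd
    have hpN := not_dvd_norm hab hp (hd.imp_left fun h => ⟨h, hp3⟩)
    have hpc : IsCoprime (p : ℤ) (a ^ 2 + 3 * b ^ 2) :=
      (Nat.prime_iff_prime_int.mp hp).coprime_iff_not_dvd.mpr hpN
    have : Fact p.Prime := ⟨hp⟩
    obtain ⟨φ⟩ := exists_hom p
    have hφγ : φ γ ≠ 0 := map_ne_zero φ (by rwa [hN])
    refine eq_of_map_eq φ hp hp3 (h1 _ hpc) (one_pow 3) ?_
    rw [← h3 p hp hp3 (by rwa [hN]) _ φ, map_one]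
    have hz : ∀ m : ℤ, (p : ℤ) ∣ m → φ (m : Eis) = 0 := fun m hm => by
      rw [map_intCast]; exact (CharP.intCast_eq_zero_iff _ p m).mpr hm
    have hcube : ∃ x : Eis, φ x ≠ 0 ∧ φ (γ ^ 2 * star γ) = φ x ^ 3 := by
      rcases hd with hd | hd
      · refine ⟨-γ, by simpa using hφγ, ?_⟩
        have e := hz _ ((dvd_neg).mpr hd)
        rw [hstar, map_mul, map_sub, e, hγ, map_pow, map_neg, map_add, e]; ring
      · refine ⟨γ, hφγ, ?_⟩
        have e := hz _ hd
        rw [hstar, map_mul, map_sub, map_mul, e, map_pow, hγ, map_add, map_mul, e]; ring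
    obtain ⟨x, hx, e⟩ := hcube
    rw [e, ← pow_mul, Nat.mul_div_cancel' (three_dvd_sq_sub_one hp hp3),
      map_pow_sq_sub_one φ hp hp3 hx]
  refine ⟨χ, hneg, fun m hm => ?_, fun m hm hm3 => ?_, h1, fun n n' hn => ?_, ?_⟩
  · have hm0 : m ≠ 0 := by rintro rfl; exact ha0 (zero_dvd_iff.mp hm)
    refine char_eq_one_of_prime hneg hm0 fun p hp hd => hprime p hp ?_ (Or.inl (hd.trans hm))
    rintro rfl; exact ha3 (hd.trans hm)
  · have hm0 : m ≠ 0 := by rintro rfl; exact hb (zero_dvd_iff.mp hm)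
    refine char_eq_one_of_prime hneg hm0 fun p hp hd => hprime p hp ?_ (Or.inr (hd.trans hm))
    rintro rfl; exact hm3 hd
  · refine h2 n n' ?_
    rw [← hN] at hn
    have e : γ ∣ ((γ.norm : ℤ) : Eis) := ⟨star γ, (mul_star_eq γ).symm⟩
    exact e.trans (by exact_mod_cast (Int.cast_dvd_cast (α := Eis) _ _ hn))
  · intro p hp hp3 hpN k _ _ φ
    rw [← euler_exp_eq φ hp hp3 (map_ne_zero φ (by rwa [hN])),
      h3 p hp (by rintro rfl; omega) (by rwa [hN]) k φ]

end Eis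
end FourthMoment

namespace FourthMoment
namespace Eis

/-- The cubic reciprocity law, in the form relating the cubic residue symbols of
`-V s + U t √-3` modulo the primes dividing `s² - 3 d t²`, where `U² + d V²` is a cube
or four times a cube. -/
theorem cubic_reciprocity {U V d n e s t : ℤ} (hnorm : U ^ 2 + d * V ^ 2 = e * n ^ 3)
    (he : e = 1 ∨ e = 4) (hUV : IsCoprime U V) (hU : ¬ 3 ∣ U) (hV : ¬ 27 ∣ V) (ht3 : 27 ∣ t)
    (ht2 : 2 ∣ t) (hst : IsCoprime s t)
    (hM : ∀ l : ℕ, l.Prime → (l : ℤ) ∣ s ^ 2 - 3 * d * t ^ 2 →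
      l % 3 = 2 ∧ ¬ (l : ℤ) ∣ n ∧ ¬ (l : ℤ) ∣ d) :
    ∃ χ : ℤ →* Eis, χ (s ^ 2 - 3 * d * t ^ 2) = 1 ∧
      ∀ l : ℕ, l.Prime → (l : ℤ) ∣ s ^ 2 - 3 * d * t ^ 2 → χ l ^ 3 = 1 ∧
        ∀ (k : Type) [Field k] [CharP k l] (φ : Eis →+* k),
          φ ((-(V * s) : ℤ) + (U * t : ℤ) * theta) ^ ((l ^ 2 - 1) / 3) = φ (χ l) := by
  rcases eq_or_ne t 0 with rfl | ht0
  · refine ⟨1, rfl, fun l hl hd => ?_⟩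
    exfalso
    have hs : IsUnit s := isCoprime_zero_right.mp hst
    have h1 : (l : ℤ) ∣ s ^ 2 := by simpa using hd
    exact (Nat.prime_iff_prime_int.mp hl).not_isUnit (isUnit_of_dvd_unit h1 (hs.pow 2))
  have hU0 : U ≠ 0 := by rintro rfl; simp at hU
  have hV0 : V ≠ 0 := by rintro rfl; simp at hV
  have hp3 : Prime (3 : ℤ) := Int.prime_three
  obtain ⟨g, V', t', hg0, hVt', rfl, rfl⟩ : ∃ g V' t' : ℤ, g ≠ 0 ∧ IsCoprime V' t' ∧
      V = g * V' ∧ t = g * t' := by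
    have h0 : (Int.gcd V t : ℤ) ≠ 0 := by
      exact_mod_cast (Int.gcd_pos_of_ne_zero_left t hV0).ne'
    refine ⟨Int.gcd V t, V / Int.gcd V t, t / Int.gcd V t, h0, ?_, ?_, ?_⟩
    · rw [Int.isCoprime_iff_gcd_eq_one]
      exact Int.gcd_ediv_gcd_ediv_gcd (Int.gcd_pos_of_ne_zero_left t hV0)
    · rw [Int.mul_ediv_cancel' (Int.gcd_dvd_left ..)]
    · rw [Int.mul_ediv_cancel' (Int.gcd_dvd_right ..)]
  obtain ⟨c, U', s', hc0, hUs', rfl, rfl⟩ : ∃ c U' s' : ℤ, c ≠ 0 ∧ IsCoprime U' s' ∧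
      U = c * U' ∧ s = c * s' := by
    have h0 : (Int.gcd U s : ℤ) ≠ 0 := by
      exact_mod_cast (Int.gcd_pos_of_ne_zero_left s hU0).ne'
    refine ⟨Int.gcd U s, U / Int.gcd U s, s / Int.gcd U s, h0, ?_, ?_, ?_⟩
    · rw [Int.isCoprime_iff_gcd_eq_one]
      exact Int.gcd_ediv_gcd_ediv_gcd (Int.gcd_pos_of_ne_zero_left s hU0)
    · rw [Int.mul_ediv_cancel' (Int.gcd_dvd_left ..)]
    · rw [Int.mul_ediv_cancel' (Int.gcd_dvd_right ..)]
  have ht'0 : t' ≠ 0 := right_ne_zero_of_mul ht0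
  have hU'0 : U' ≠ 0 := right_ne_zero_of_mul hU0
  have hV'0 : V' ≠ 0 := right_ne_zero_of_mul hV0
  have hU'3 : ¬ 3 ∣ U' := fun h => hU (h.mul_left _)
  have ht'3 : 3 ∣ t' := by
    by_contra h
    have h1 : IsCoprime ((3 : ℤ) ^ 3) t' := (hp3.coprime_iff_not_dvd.mpr h).pow_left
    exact hV ((by simpa using h1.dvd_of_dvd_mul_right (by simpa using ht3) :
      (27 : ℤ) ∣ g).mul_right _)
  have hV'3 : ¬ 3 ∣ V' := fun h => hp3.not_isUnit (hVt'.isUnit_of_dvd' h ht'3)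
  have hs'3 : ¬ 3 ∣ s' := fun h =>
    hp3.not_isUnit (hst.isUnit_of_dvd' (h.mul_left _) (ht'3.mul_left _))
  set a := V' * s' with ha
  set b := U' * t' with hb
  have hs't' : IsCoprime s' t' := hst.of_mul_left_right.of_mul_right_right
  have hab : IsCoprime a b := IsCoprime.mul_left
    (IsCoprime.mul_right hUV.of_mul_left_right.of_mul_right_right.symm hVt')
    (IsCoprime.mul_right hUs'.symm hs't')
  obtain ⟨χ, hneg, hχa, hχb, hχ3, hχc, hχp⟩ := exists_char hab (mul_ne_zero hU'0 ht'0)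
    (fun h => (hp3.dvd_or_dvd h).elim hV'3 hs'3) (ht'3.mul_left _)
  set M := (c * s') ^ 2 - 3 * d * (g * t') ^ 2 with hMdef
  have key : V' ^ 2 * M = c ^ 2 * (a ^ 2 + 3 * b ^ 2) - 3 * t' ^ 2 * e * n ^ 3 := by
    rw [hMdef, ha, hb]; linear_combination (-3 * t' ^ 2) * hnorm
  have hlN : ∀ l : ℕ, l.Prime → (l : ℤ) ∣ M →
      ¬ (l : ℤ) ∣ a ^ 2 + 3 * b ^ 2 ∧ ¬ (l : ℤ) ∣ c * s' ∧ ¬ (l : ℤ) ∣ g * t' := by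
    intro l hl hlM
    have hli := Nat.prime_iff_prime_int.mp hl
    obtain ⟨hl3, hln, hld⟩ := hM l hl hlM
    have hl3' : ¬ (l : ℤ) ∣ 3 := fun h => by
      have := (Nat.prime_dvd_prime_iff_eq hl Nat.prime_three).mp (by exact_mod_cast h)
      omega
    have hlt : ¬ (l : ℤ) ∣ g * t' := fun h => by
      have h1 : (l : ℤ) ∣ (c * s') ^ 2 :=
        (dvd_sub_left ((dvd_pow h two_ne_zero).mul_left _)).mp hlM
      exact hli.not_isUnit (hst.isUnit_of_dvd' (hli.dvd_of_dvd_pow h1) h)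
    have hls : ¬ (l : ℤ) ∣ c * s' := fun h => by
      have h1 : (l : ℤ) ∣ 3 * d * (g * t') ^ 2 :=
        (dvd_sub_right (dvd_pow h two_ne_zero)).mp hlM
      rcases hli.dvd_or_dvd h1 with h1 | h1
      · exact (hli.dvd_or_dvd h1).elim hl3' hld
      · exact hlt (hli.dvd_of_dvd_pow h1)
    have hle : ¬ (l : ℤ) ∣ e := fun h => by
      rcases he with rfl | rfl
      · exact hli.not_isUnit (isUnit_of_dvd_one h)
      · have h2 : (l : ℤ) ∣ 2 := hli.dvd_of_dvd_pow (n := 2) (by simpa using h)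
        exact hlt (h2.trans ht2)
    refine ⟨fun h => ?_, hls, hlt⟩
    have h1 : (l : ℤ) ∣ 3 * t' ^ 2 * e * n ^ 3 := by
      have h2 : (l : ℤ) ∣ c ^ 2 * (a ^ 2 + 3 * b ^ 2) - 3 * t' ^ 2 * e * n ^ 3 := by
        rw [← key]; exact hlM.mul_left _
      exact (dvd_sub_right (h.mul_left _)).mp h2
    rcases hli.dvd_or_dvd h1 with h1 | h1
    · rcases hli.dvd_or_dvd h1 with h1 | h1
      · rcases hli.dvd_or_dvd h1 with h1 | h1
        · exact hl3' h1
        · exact hlt ((hli.dvd_of_dvd_pow h1).mul_left _)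
      · exact hle h1
    · exact hln (hli.dvd_of_dvd_pow h1)
  have hN0 : a ^ 2 + 3 * b ^ 2 ≠ 0 := by
    have : b ≠ 0 := mul_ne_zero hU'0 ht'0
    positivity
  have hnN : IsCoprime n (a ^ 2 + 3 * b ^ 2) := by
    refine isCoprime_of_prime_dvd (fun h => hN0 h.2) ?_
    intro l hl hln hlN'
    obtain ⟨q, hq, hql⟩ : ∃ q : ℕ, q.Prime ∧ (q : ℤ) ∣ l :=
      ⟨l.natAbs, Int.prime_iff_natAbs_prime.mp hl, Int.natAbs_dvd.mpr dvd_rfl⟩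
    have hqi := Nat.prime_iff_prime_int.mp hq
    have hqN := hql.trans hlN'
    have hqn := hql.trans hln
    have h1 : (q : ℤ) ∣ V' ^ 2 * M := by
      rw [key]; exact dvd_sub (hqN.mul_left _) ((dvd_pow hqn three_ne_zero).mul_left _)
    rcases hqi.dvd_or_dvd h1 with h1 | h1
    · have h2 : (q : ℤ) ∣ a := (hqi.dvd_of_dvd_pow h1).mul_right _
      refine not_dvd_norm hab hq (Or.inl ⟨h2, ?_⟩) hqN
      rintro rfl
      exact hV'3 (hqi.dvd_of_dvd_pow h1)
    · exact (hM q hq h1).2.1 hqn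
  obtain ⟨j, w, hw3, rfl⟩ : ∃ (j : ℕ) (w : ℤ), ¬ 3 ∣ w ∧ t' = 3 ^ j * w := by
    obtain ⟨w, hw1, hw2⟩ := (Int.finiteMultiplicity_iff.mpr
      ⟨by norm_num, ht'0⟩ : FiniteMultiplicity (3 : ℤ) t').exists_eq_pow_mul_and_not_dvd
    exact ⟨_, w, hw2, hw1⟩
  have hw : χ w = 1 := hχb w ⟨U' * 3 ^ j, by rw [hb]; ring⟩ hw3
  have hU'1 : χ U' = 1 := hχb U' ⟨_, hb⟩ hU'3
  have hV'1 : χ V' = 1 := hχa V' ⟨_, ha⟩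
  have he1 : χ e = 1 := by
    rcases he with rfl | rfl
    · exact map_one χ
    · have h2 : (2 : ℤ) ∣ b := by
        have hg2 : ¬ (2 : ℤ) ∣ g := fun h => by
          obtain ⟨x, hx⟩ := h
          have hcU : ¬ (2 : ℤ) ∣ c * U' := fun h =>
            Int.prime_two.not_isUnit (hUV.isUnit_of_dvd' h ((Dvd.intro x hx.symm).mul_right _))
          have : (2 : ℤ) ∣ (c * U') ^ 2 :=
            ⟨2 * n ^ 3 - d * 2 * x ^ 2 * V' ^ 2, by rw [hx] at hnorm; linear_combination hnorm⟩
          exact hcU (Int.prime_two.dvd_of_dvd_pow this)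
        exact ((Int.prime_two.dvd_or_dvd ht2).resolve_left hg2).mul_left _
      rw [show (4 : ℤ) = 2 * 2 by norm_num, map_mul, hχb 2 h2 (by norm_num), one_mul]
  have e1 : χ 3 ^ (1 + 2 * j) = 1 := by
    have h1 : χ (a ^ 2) = χ (-1 * 3 * (U' * (3 ^ j * w)) ^ 2) :=
      hχc _ _ ⟨1, by rw [hb]; ring⟩
    rw [map_pow, hχa a dvd_rfl, one_pow, map_mul, map_mul, hneg, map_pow, map_mul, map_mul, map_pow,
      hw, hU'1] at h1
    rw [h1]; ring
  have hM1 : χ M = 1 := by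
    have h1 : χ (V' ^ 2 * M) = χ (-1 * 3 * (3 ^ j * w) ^ 2 * e * n ^ 3) :=
      hχc _ _ ⟨c ^ 2, by rw [key]; ring⟩
    rw [map_mul, map_pow, hV'1, one_pow, one_mul] at h1
    rw [h1]
    simp only [map_mul, map_pow, hneg, hw, he1, hχ3 n hnN]
    linear_combination e1
  refine ⟨χ, hM1, fun l hl hlM => ?_⟩
  have hli := Nat.prime_iff_prime_int.mp hl
  obtain ⟨hlN1, hls, hlt⟩ := hlN l hl hlM
  refine ⟨hχ3 _ (hli.coprime_iff_not_dvd.mpr hlN1), fun k _ _ φ => ?_⟩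
  have hl3 := (hM l hl hlM).1
  have e2 : ((-(g * V' * (c * s')) : ℤ) + (c * U' * (g * (3 ^ j * w)) : ℤ) * theta : Eis) =
      ((c * g : ℤ) : Eis) * ((-a : ℤ) + (b : ℤ) * theta) := by
    rw [ha, hb]; push_cast; ring
  have hcg : ¬ (l : ℤ) ∣ c * g := fun h => (hli.dvd_or_dvd h).elim
    (fun h => hls (h.mul_right _)) (fun h => hlt (h.mul_right _))
  rw [e2, map_mul, mul_pow, hχp l hl hl3 hlN1 k φ, map_intCast, intCast_euler hl hl3 hcg, one_mul]

end Eis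
end FourthMoment

namespace FourthMoment
namespace Lat

open Zsqrtd

/-- A basis `x, y` of the lattice `{s + t √D : s ≡ r t mod A}`, with `x` short:
`x̄ y = A (b + √D)` and `N(x) = A c`. -/
structure Reduced (D : ℤ) (A r c b : ℤ) (x : ℤ√D) : Prop where
  dvd_x : A ∣ x.re - r * x.im
  norm_x : x.norm = A * c
  c_ne_zero : c ≠ 0
  c_dvd : c ∣ b ^ 2 - D
  abs_c : (c : ℝ) ^ 2 ≤ D
  re_le : (x.re : ℝ) ^ 2 ≤ A * √(D : ℝ)
  im_le : (D : ℝ) * (x.im : ℝ) ^ 2 ≤ A * √(D : ℝ)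
  exists_basis : ∃ (y : ℤ√D) (k k' : ℤ), A ∣ y.re - r * y.im ∧ (A : ℤ√D) = k' * x - k * y ∧
    (c : ℤ√D) * y = x * ⟨b, 1⟩

theorem intCast_mul_left_cancel {D : ℤ} {a : ℤ} (ha : a ≠ 0) {x y : ℤ√D} (h : (a : ℤ√D) * x = a * y) :
    x = y := Zsqrtd.eq_of_smul_eq_smul_left ha h

theorem reduced_aux {D A r j k j' k' : ℤ} (hD : ∀ n : ℤ, D ≠ n * n) (hA : 0 < A)
    (hr : A ∣ r ^ 2 - D) (hjk : k * j' - j * k' = 1)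
    (hre : ((k * r - j * A : ℤ) : ℝ) ^ 2 ≤ A * √(D : ℝ))
    (him : (D : ℝ) * (k : ℝ) ^ 2 ≤ A * √(D : ℝ)) (hD0 : 0 < D) :
    ∃ c b : ℤ, Reduced D A r c b ⟨k * r - j * A, k⟩ := by
  obtain ⟨q, hq⟩ := hr
  have hA' : (0 : ℝ) < A := by exact_mod_cast hA
  have hD' : (0 : ℝ) < D := by exact_mod_cast hD0
  set x : ℤ√D := ⟨k * r - j * A, k⟩ with hx
  set y : ℤ√D := ⟨k' * r - j' * A, k'⟩ with hy
  set c := k ^ 2 * q - 2 * k * j * r + j ^ 2 * A with hc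
  set b := k * k' * q - r * (k * j' + j * k') + j * j' * A with hb
  have hN : x.norm = A * c := by
    rw [norm_def, hc]; simp only [hx]; linear_combination k ^ 2 * hq
  have hxy : star x * y = (A : ℤ√D) * ⟨b, 1⟩ := by
    ext
    · simp [hx, hy, hb]; linear_combination (k * k') * hq
    · simp [hx, hy]; linear_combination A * hjk
  have hcy : (c : ℤ√D) * y = x * ⟨b, 1⟩ := by
    refine intCast_mul_left_cancel hA.ne' ?_
    have h1 := norm_eq_mul_conj x
    rw [hN] at h1; push_cast at h1
    linear_combination y * h1 + x * hxy
  have hN0 : x.norm ≠ 0 := by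
    rw [Ne, Zsqrtd.norm_eq_zero hD]
    intro h
    have h1 : k = 0 := congrArg Zsqrtd.im h
    have h2 : k * r - j * A = 0 := congrArg Zsqrtd.re h
    rw [h1] at h2 hjk
    have h3 : j = 0 := by
      simpa [hA.ne'] using h2
    rw [h3] at hjk; simp at hjk
  have hc0 : c ≠ 0 := by rintro h; rw [hN, h, mul_zero] at hN0; exact hN0 rfl
  refine ⟨c, b, ⟨j * -1, by simp [hx]; ring⟩, hN, hc0, ?_, ?_, hre, him,
    y, k, k', ⟨j' * -1, by simp [hy]; ring⟩, ?_, hcy⟩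
  · have h1 := congrArg Zsqrtd.norm hxy
    rw [norm_mul, norm_conj, norm_mul, hN, norm_intCast] at h1
    have hyn : y.norm = A * (k' ^ 2 * q - 2 * k' * j' * r + j' ^ 2 * A) := by
      rw [norm_def]; simp only [hy]; linear_combination k' ^ 2 * hq
    rw [hyn, norm_def] at h1
    refine ⟨k' ^ 2 * q - 2 * k' * j' * r + j' ^ 2 * A, ?_⟩
    refine mul_left_cancel₀ (mul_ne_zero hA.ne' hA.ne') ?_
    linear_combination -h1
  · have h1 : ((A * c : ℤ) : ℝ) = (x.re : ℝ) ^ 2 - D * (x.im : ℝ) ^ 2 := by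
      rw [← hN, norm_def]; push_cast; ring
    have h2 : |((A * c : ℤ) : ℝ)| ≤ A * √(D : ℝ) := by
      have h3 : 0 ≤ (D : ℝ) * (x.im : ℝ) ^ 2 := by positivity
      have h4 : (D : ℝ) * (x.im : ℝ) ^ 2 ≤ A * √(D : ℝ) := him
      have h5 : (x.re : ℝ) ^ 2 ≤ A * √(D : ℝ) := hre
      rw [h1, abs_le]
      constructor <;> nlinarith [sq_nonneg (x.re : ℝ)]
    push_cast at h2
    rw [abs_mul, abs_of_pos hA'] at h2
    have h3 : |(c : ℝ)| ≤ √(D : ℝ) := le_of_mul_le_mul_left h2 hA'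
    rw [← sq_abs]
    exact (Real.le_sqrt (abs_nonneg _) hD'.le).mp h3
  · ext
    · simp [hx, hy]; linear_combination -A * hjk
    · simp [hx, hy]; ring

theorem exists_reduced {D A r : ℤ} (hD : ∀ n : ℤ, D ≠ n * n) (hD0 : 0 < D) (hA : 0 < A)
    (hr : A ∣ r ^ 2 - D) : ∃ (x : ℤ√D) (c b : ℤ), Reduced D A r c b x := by
  have hA' : (0 : ℝ) < A := by exact_mod_cast hA
  have hD' : (0 : ℝ) < D := by exact_mod_cast hD0
  set S := √(D : ℝ) with hS
  have hS0 : 0 < S := Real.sqrt_pos.mpr hD'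
  have hS2 : S ^ 2 = D := Real.sq_sqrt hD'.le
  set T := √((A : ℝ) / S) with hT
  have hT2 : T ^ 2 = A / S := Real.sq_sqrt (by positivity)
  rcases Nat.eq_zero_or_pos ⌊T⌋₊ with h0 | hpos
  · have h1 : T < 1 := Nat.floor_eq_zero.mp h0
    have h2 : (A : ℝ) ≤ S := by
      have : (A : ℝ) / S ≤ 1 := by rw [← hT2]; exact pow_le_one₀ (Real.sqrt_nonneg _) h1.le
      rwa [div_le_one hS0] at this
    obtain ⟨c, b, h⟩ := reduced_aux (r := r) (j := -1) (k := 0) (j' := 0) (k' := 1) hD hA hr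
      (by norm_num) (by push_cast; nlinarith) (by push_cast; nlinarith) hD0
    exact ⟨_, c, b, h⟩
  · obtain ⟨q, hq1, hq2⟩ := Real.exists_rat_abs_sub_le_and_den_le ((r : ℝ) / A) hpos
    have hden : (0 : ℝ) < q.den := by exact_mod_cast q.pos
    have hco : IsCoprime (q.den : ℤ) q.num := by
      rw [Int.isCoprime_iff_gcd_eq_one, Int.gcd_comm]; exact q.reduced
    obtain ⟨u, v, huv⟩ := hco
    have hk : (q.den : ℝ) ≤ T := le_trans (by exact_mod_cast hq2) (Nat.floor_le (Real.sqrt_nonneg _))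
    have hfl : T < (⌊T⌋₊ : ℝ) + 1 := Nat.lt_floor_add_one T
    have hTpos : 0 < T := hden.trans_le hk
    have hre : |((q.den * r - q.num * A : ℤ) : ℝ)| ≤ A / T := by
      have h1 : ((q.den * r - q.num * A : ℤ) : ℝ) = q.den * A * ((r : ℝ) / A - q) := by
        have : (q : ℝ) = q.num / q.den := by exact_mod_cast (Rat.num_div_den q).symm
        rw [this]; push_cast; field_simp
      rw [h1, abs_mul, abs_of_pos (by positivity)]
      calc _ ≤ (q.den : ℝ) * A * (1 / ((⌊T⌋₊ + 1) * q.den)) := by gcongr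
        _ = (A : ℝ) / (⌊T⌋₊ + 1) := by field_simp
        _ ≤ A / T := by gcongr
    obtain ⟨c, b, h⟩ := reduced_aux (r := r) (j := q.num) (k := q.den) (j' := u) (k' := -v) hD hA hr
      (by linear_combination huv) (by
        rw [← sq_abs]
        calc _ ≤ ((A : ℝ) / T) ^ 2 := by gcongr
          _ = A * S := by rw [div_pow, hT2]; field_simp) (by
        push_cast
        calc (D : ℝ) * (q.den : ℝ) ^ 2 ≤ D * T ^ 2 := by gcongr
          _ = A * S := by rw [hT2, ← hS2]; field_simp) hD0
    exact ⟨_, c, b, h⟩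

theorem Reduced.exists_quotient {D A r c b x A' r' b' x'} (hD : ∀ n : ℤ, D ≠ n * n)
    (hA : 0 < A) (hA' : 0 < A') (h : Reduced D A r c b x) (h' : Reduced D A' r' c b' x') (hb : c ∣ b' - b) :
    ∃ β : ℤ√D, A' ∣ β.re - r' * β.im ∧ A ∣ β.re + r * β.im ∧ (c : ℤ√D) * β = x' * star x ∧
      β.norm = A * A' := by
  obtain ⟨n, hn⟩ := hb
  obtain ⟨y, k, k', hy, hk, hcy⟩ := h.exists_basis
  obtain ⟨y', l, l', hy', hl, hcy'⟩ := h'.exists_basis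
  have hc := h.c_ne_zero
  have key : ∀ {A A' r' k k' n : ℤ} {x x' y y' : ℤ√D}, x.norm = A * c → x ≠ 0 →
      (A : ℤ√D) = k' * x - k * y →
      A' ∣ x'.re - r' * x'.im → A' ∣ y'.re - r' * y'.im → ∀ b b' : ℤ, b' = b + c * n →
      (c : ℤ√D) * y = x * ⟨b, 1⟩ →
      (c : ℤ√D) * y' = x' * ⟨b', 1⟩ →
      A' ∣ ((k' + k * n) * x' - k * y' : ℤ√D).re - r' * ((k' + k * n) * x' - k * y' : ℤ√D).im ∧
        (c : ℤ√D) * ((k' + k * n) * x' - k * y') = x' * star x := by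
    intro A A' r' k k' n x x' y y' hN hx0 hk hx' hy' b b' hbb hcy hcy'
    constructor
    · obtain ⟨e, he⟩ := hx'
      obtain ⟨f, hf⟩ := hy'
      refine ⟨(k' + k * n) * e - k * f, ?_⟩
      simp
      linear_combination (k' + k * n) * he - k * hf
    · have hxs : x * star x = x * ((k' : ℤ√D) * c - k * ⟨b, 1⟩) := by
        have h1 := norm_eq_mul_conj x
        rw [hN] at h1; push_cast at h1
        linear_combination (-1 : ℤ√D) * h1 + (c : ℤ√D) * hk + (-k : ℤ√D) * hcy
      have hs : star x = (k' : ℤ√D) * c - k * ⟨b, 1⟩ := by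
        have hn0 : x.norm ≠ 0 := by rwa [Ne, Zsqrtd.norm_eq_zero hD]
        refine intCast_mul_left_cancel hn0 ?_
        rw [norm_eq_mul_conj]
        linear_combination star x * hxs
      have hb' : (⟨b', 1⟩ : ℤ√D) = ⟨b, 1⟩ + c * n := by
        rw [hbb]; ext <;> simp
      rw [hs]
      rw [hb'] at hcy'
      linear_combination (-k : ℤ√D) * hcy'
  have hx0 : x ≠ 0 := by
    rintro rfl
    have := h.norm_x
    simp [hA.ne', hc] at this
  have hx0' : x' ≠ 0 := by
    rintro rfl
    have := h'.norm_x
    simp [hA'.ne', hc] at this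
  obtain ⟨e1, e2⟩ := key (n := n) h.norm_x hx0 hk h'.dvd_x hy' b b' (by linear_combination hn) hcy hcy'
  obtain ⟨e3, e4⟩ := key (n := -n) h'.norm_x hx0' hl h.dvd_x hy b' b (by linear_combination -hn)
    hcy' hcy
  refine ⟨_, e1, ?_, e2, ?_⟩
  · have h1 := congrArg star e2
    rw [star_mul, star_intCast, mul_comm, star_mul, star_star, ← e4] at h1
    have h2 := intCast_mul_left_cancel hc h1
    rw [← h2, re_star, im_star, mul_neg, sub_neg_eq_add] at e3
    exact e3
  · have h1 := congrArg Zsqrtd.norm e2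
    rw [Zsqrtd.norm_mul, Zsqrtd.norm_mul, norm_conj, h.norm_x, h'.norm_x, norm_intCast] at h1
    refine mul_left_cancel₀ (mul_ne_zero hc hc) ?_
    linear_combination h1

end Lat
end FourthMoment

namespace FourthMoment
namespace Lat

open Zsqrtd Finset

/-- The possible discrete invariants of a reduced basis. -/
noncomputable def dataSet (D : ℤ) (S J : ℕ) : Finset (ℤ × ℤ × ℤ) :=
  ((Icc (-(S : ℤ)) S) ×ˢ (Ico (0 : ℤ) S) ×ˢ (Icc (-(J : ℤ)) J)).filter
    (fun p => p.1 ≠ 0 ∧ p.2.1 < |p.1| ∧ p.1 ∣ p.2.1 ^ 2 - D)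

/-- The lattice `{s + t √D : s ≡ r t mod A}` has a reduced basis with invariants `p`. -/
def HasData (D A r : ℤ) (p : ℤ × ℤ × ℤ) : Prop :=
  ∃ (x : ℤ√D) (b : ℤ), Reduced D A r p.1 b x ∧ p.1 ∣ b - p.2.1 ∧
    Int.log 2 (|(x.re : ℝ) + x.im * √(D : ℝ)| / √(A : ℝ)) = p.2.2

section
variable {D : ℤ}

theorem embed_mul_conj (hD0 : 0 < D) (x : ℤ√D) :
    ((x.re : ℝ) + x.im * √(D : ℝ)) * ((x.re : ℝ) - x.im * √(D : ℝ)) = x.norm := by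
  have h := Real.sq_sqrt (show (0 : ℝ) ≤ D by exact_mod_cast hD0.le)
  rw [norm_def]; push_cast
  linear_combination (-(x.im : ℝ) ^ 2) * h

theorem Reduced.abs_sq_le {A r c b x} (hD0 : 0 < D) (h : Reduced D A r c b x) :
    |(x.re : ℝ) + x.im * √(D : ℝ)| ^ 2 ≤ 4 * (A * √(D : ℝ)) ∧
      |(x.re : ℝ) - x.im * √(D : ℝ)| ^ 2 ≤ 4 * (A * √(D : ℝ)) := by
  have hs := Real.sq_sqrt (show (0 : ℝ) ≤ D by exact_mod_cast hD0.le)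
  have h1 := h.re_le
  have h2 := h.im_le
  rw [← hs] at h2
  rw [Real.sqrt_sq (Real.sqrt_nonneg _)] at h2
  constructor <;> rw [sq_abs]
  · nlinarith [sq_nonneg ((x.re : ℝ) - x.im * √(D : ℝ))]
  · nlinarith [sq_nonneg ((x.re : ℝ) + x.im * √(D : ℝ))]

theorem exists_hasData (hD : ∀ n : ℤ, D ≠ n * n) (hD0 : 0 < D) {S J : ℕ}
    (hS : ∀ c : ℤ, (c : ℝ) ^ 2 ≤ D → |c| ≤ S) (hJ : 4 * √(D : ℝ) ≤ 4 ^ J) {A r : ℤ} (hA : 0 < A)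
    (hr : A ∣ r ^ 2 - D) : ∃ p ∈ dataSet D S J, HasData D A r p := by
  obtain ⟨x, c, b, h⟩ := exists_reduced hD hD0 hA hr
  have hc := h.c_ne_zero
  have hcS := hS c h.abs_c
  have hA' : (0 : ℝ) < A := by exact_mod_cast hA
  have hD' : (0 : ℝ) < D := by exact_mod_cast hD0
  set ρ := |(x.re : ℝ) + x.im * √(D : ℝ)| / √(A : ℝ) with hρ
  set ρ' := |(x.re : ℝ) - x.im * √(D : ℝ)| / √(A : ℝ) with hρ'
  have hsA : √(A : ℝ) ^ 2 = A := Real.sq_sqrt hA'.le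
  have hprod : ρ * ρ' = |(c : ℝ)| := by
    rw [hρ, hρ', div_mul_div_comm, ← pow_two, hsA, ← abs_mul, embed_mul_conj hD0, h.norm_x]
    push_cast
    rw [abs_mul, abs_of_pos hA']; field_simp
  have hc1 : (1 : ℝ) ≤ |(c : ℝ)| := by exact_mod_cast Int.one_le_abs hc
  obtain ⟨h1, h2⟩ := h.abs_sq_le hD0
  have hb1 : ∀ y : ℝ, 0 ≤ y → y ^ 2 ≤ 4 * (A * √(D : ℝ)) → y / √(A : ℝ) ≤ 2 ^ J := by
    intro y hy0 hy
    refine le_of_sq_le_sq ?_ (by positivity)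
    rw [div_pow, hsA, ← pow_mul, mul_comm J, pow_mul, div_le_iff₀ hA']
    norm_num
    nlinarith
  have h3 : ρ ≤ 2 ^ J := hb1 _ (abs_nonneg _) h1
  have h4 : ρ' ≤ 2 ^ J := hb1 _ (abs_nonneg _) h2
  have hρ0 : 0 < ρ := by
    rcases (show 0 ≤ ρ by positivity).eq_or_lt with h0 | h0
    · rw [← h0, zero_mul] at hprod; linarith
    · exact h0
  have h5 : (2 : ℝ) ^ (-(J : ℤ)) ≤ ρ := by
    rw [zpow_neg, zpow_natCast, inv_le_iff_one_le_mul₀ (by positivity)]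
    calc (1 : ℝ) ≤ ρ * ρ' := by rw [hprod]; exact hc1
      _ ≤ ρ * 2 ^ J := by gcongr
  refine ⟨(c, b % c, Int.log 2 ρ), ?_, x, b, h, ?_, rfl⟩
  · have hm1 := Int.emod_nonneg b hc
    have hm2 := Int.emod_lt_abs b hc
    have hm3 : (b % c) < S := hm2.trans_le hcS
    simp only [dataSet, mem_filter, mem_product, mem_Icc, mem_Ico]
    refine ⟨⟨abs_le.mp hcS, ⟨hm1, hm3⟩, ?_, ?_⟩, hc, hm2, ?_⟩
    · exact (Int.zpow_le_iff_le_log (by norm_num) hρ0).mp (by exact_mod_cast h5)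
    · by_contra hlt
      push Not at hlt
      have := (Int.zpow_le_iff_le_log (b := 2) (by norm_num) hρ0).mpr
        (Int.add_one_le_iff.mpr hlt)
      rw [zpow_add_one₀ (by norm_num), zpow_natCast] at this
      push_cast at this
      have h6 : (0 : ℝ) < 2 ^ J := by positivity
      linarith
    · have e : b % c = b - c * (b / c) := by rw [Int.emod_def]
      have h7 : c ∣ (b % c) ^ 2 - b ^ 2 := by
        rw [e]; exact ⟨c * (b / c) ^ 2 - 2 * b * (b / c), by ring⟩
      have := dvd_add h7 h.c_dvd
      simpa using this
  · exact Int.dvd_self_sub_emod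

theorem HasData.exists_quotient (hD : ∀ n : ℤ, D ≠ n * n) (hD0 : 0 < D) {A r A' r' : ℤ}
    {p : ℤ × ℤ × ℤ} (hA : 0 < A) (hA' : 0 < A') (h : HasData D A r p) (h' : HasData D A' r' p) :
    ∃ s t : ℤ, A' ∣ s - r' * t ∧ A ∣ s + r * t ∧ s ^ 2 - D * t ^ 2 = A * A' ∧
      s ^ 2 ≤ 4 * (A * A') ∧ D * t ^ 2 ≤ 4 * (A * A') := by
  obtain ⟨x, b, hx, hb, hl⟩ := h
  obtain ⟨x', b', hx', hb', hl'⟩ := h'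
  obtain ⟨β, h1, h2, h3, h4⟩ := hx.exists_quotient hD hA hA' hx' (by
    have := dvd_sub hb' hb; simpa using this)
  have hAr : (0 : ℝ) < A := by exact_mod_cast hA
  have hAr' : (0 : ℝ) < A' := by exact_mod_cast hA'
  have hc := hx.c_ne_zero
  set S := √(D : ℝ) with hS
  have hS2 : S ^ 2 = D := Real.sq_sqrt (show (0 : ℝ) ≤ D by exact_mod_cast hD0.le)
  set α := |(x.re : ℝ) + x.im * S| with hα
  set α' := |(x'.re : ℝ) + x'.im * S| with hα'
  have hpos : ∀ {A r b x}, 0 < A → Reduced D A r p.1 b x → 0 < |(x.re : ℝ) + x.im * S| := by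
    intro A r b x hA h
    rw [abs_pos]
    intro h0
    have := embed_mul_conj hD0 x
    rw [← hS, h0, zero_mul, h.norm_x] at this
    have h5 : A * p.1 = 0 := by exact_mod_cast this.symm
    exact mul_ne_zero hA.ne' hc h5
  have hα0 : 0 < α := hpos hA hx
  have hα0' : 0 < α' := hpos hA' hx'
  have hquot : ∀ {u v : ℝ}, 0 < u → 0 < v → Int.log 2 u = Int.log 2 v → u ≤ 2 * v := by
    intro u v hu hv huv
    have h5 := Int.lt_zpow_succ_log_self (b := 2) (by norm_num) u
    have h6 := Int.zpow_log_le_self (b := 2) (by norm_num) hv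
    rw [huv, zpow_add_one₀ (by norm_num)] at h5
    push_cast at h5 h6
    linarith
  have hsA : √(A : ℝ) ^ 2 = A := Real.sq_sqrt hAr.le
  have hsA' : √(A' : ℝ) ^ 2 = A' := Real.sq_sqrt hAr'.le
  have hsA0 : 0 < √(A : ℝ) := Real.sqrt_pos.mpr hAr
  have hsA0' : 0 < √(A' : ℝ) := Real.sqrt_pos.mpr hAr'
  have q1 : α' * √(A : ℝ) ≤ 2 * α * √(A' : ℝ) := by
    have := hquot (div_pos hα0' hsA0') (div_pos hα0 hsA0) (hl'.trans hl.symm)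
    rw [div_le_iff₀ hsA0'] at this
    calc α' * √(A : ℝ) ≤ 2 * (α / √(A : ℝ)) * √(A' : ℝ) * √(A : ℝ) := by gcongr
      _ = _ := by field_simp
  have q2 : α * √(A' : ℝ) ≤ 2 * α' * √(A : ℝ) := by
    have := hquot (div_pos hα0 hsA0) (div_pos hα0' hsA0') (hl.trans hl'.symm)
    rw [div_le_iff₀ hsA0] at this
    calc α * √(A' : ℝ) ≤ 2 * (α' / √(A' : ℝ)) * √(A : ℝ) * √(A' : ℝ) := by gcongr
      _ = _ := by field_simp
  set y := (β.re : ℝ) + β.im * S with hy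
  set y' := (β.re : ℝ) - β.im * S with hy'
  have hyy : y * y' = A * A' := by
    rw [hy, hy', hS, embed_mul_conj hD0, h4]; push_cast; ring
  have hyα : |y| * α = A * α' := by
    have e1 := congrArg Zsqrtd.re h3
    have e2 := congrArg Zsqrtd.im h3
    simp only [re_mul, im_mul, re_intCast, im_intCast, re_star, im_star] at e1 e2
    have e3 : (p.1 : ℝ) * y = ((x'.re : ℝ) + x'.im * S) * (x.re - x.im * S) := by
      have e1' : ((p.1 : ℝ) * β.re + D * 0 * β.im) = x'.re * x.re + D * x'.im * -x.im := by
        exact_mod_cast e1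
      have e2' : ((p.1 : ℝ) * β.im + 0 * β.re) = x'.re * -x.im + x'.im * x.re := by
        exact_mod_cast e2
      rw [hy]
      linear_combination e1' + S * e2' + (x'.im * x.im : ℝ) * hS2
    have e4 := embed_mul_conj hD0 x
    rw [hx.norm_x, ← hS] at e4
    push_cast at e4
    have e5 : (p.1 : ℝ) * (y * (x.re + x.im * S)) = p.1 * (A * ((x'.re : ℝ) + x'.im * S)) := by
      linear_combination ((x.re : ℝ) + x.im * S) * e3 + ((x'.re : ℝ) + x'.im * S) * e4
    have e6 := mul_left_cancel₀ (by exact_mod_cast hc) e5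
    rw [hα, ← abs_mul, e6, abs_mul, abs_of_pos hAr]
  have hyb : |y| ≤ 2 * (√(A : ℝ) * √(A' : ℝ)) := by
    refine le_of_mul_le_mul_right ?_ hα0
    calc _ = √(A : ℝ) * (α' * √(A : ℝ)) := by rw [hyα]; linear_combination (-α') * hsA
      _ ≤ √(A : ℝ) * (2 * α * √(A' : ℝ)) := by gcongr
      _ = _ := by ring
  have hyb' : |y'| ≤ 2 * (√(A : ℝ) * √(A' : ℝ)) := by
    have e1 : |y'| * α' = A' * α := by
      have e2 : |y| * |y'| = A * A' := by rw [← abs_mul, hyy, abs_of_pos (by positivity)]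
      have hy0 : |y| ≠ 0 := by
        intro h0; rw [h0, zero_mul] at e2
        exact (mul_pos hAr hAr').ne e2
      refine mul_left_cancel₀ (mul_ne_zero hy0 hAr.ne') ?_
      linear_combination (A * α' : ℝ) * e2 - (A * A' : ℝ) * hyα
    refine le_of_mul_le_mul_right ?_ hα0'
    calc _ = √(A' : ℝ) * (α * √(A' : ℝ)) := by rw [e1]; linear_combination (-α) * hsA'
      _ ≤ √(A' : ℝ) * (2 * α' * √(A : ℝ)) := by gcongr
      _ = _ := by ring
  have hB : (2 * (√(A : ℝ) * √(A' : ℝ))) ^ 2 = 4 * (A * A') := by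
    rw [mul_pow, mul_pow, hsA, hsA']; norm_num
  have hre : |(β.re : ℝ)| ≤ 2 * (√(A : ℝ) * √(A' : ℝ)) := by
    have e : (β.re : ℝ) = (y + y') / 2 := by rw [hy, hy']; ring
    rw [abs_le] at *
    constructor <;> linarith
  have him : |(β.im : ℝ) * S| ≤ 2 * (√(A : ℝ) * √(A' : ℝ)) := by
    have e : (β.im : ℝ) * S = (y - y') / 2 := by rw [hy, hy']; ring
    rw [abs_le] at *
    constructor <;> linarith
  refine ⟨β.re, β.im, h1, h2, ?_, ?_, ?_⟩
  · rw [← h4, norm_def]; ring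
  · have := pow_le_pow_left₀ (abs_nonneg _) hre 2
    rw [sq_abs, hB] at this
    exact_mod_cast this
  · have := pow_le_pow_left₀ (abs_nonneg _) him 2
    rw [sq_abs, hB, mul_pow, hS2, mul_comm] at this
    exact_mod_cast this

end
end Lat
end FourthMoment

namespace FourthMoment
namespace Lat

theorem norm_form_dvd {D s t R a : ℤ} (h : a ∣ s + R * t) (hR : a ∣ R ^ 2 - D) :
    a ∣ s ^ 2 - D * t ^ 2 := by
  have e : s ^ 2 - D * t ^ 2 = (s + R * t) * (s - R * t) + (R ^ 2 - D) * t ^ 2 := by ring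
  rw [e]
  exact dvd_add (h.mul_right _) (hR.mul_right _)

theorem isCoprime_aux {D s t R M : ℤ} {p q : ℕ} (hp : p.Prime) (hq : q.Prime) (hpq : p ≠ q)
    (hpM : ¬ (p : ℤ) ∣ M) (hn : s ^ 2 - D * t ^ 2 = M * (p * q) ^ 3)
    (hps : (p : ℤ) ^ 3 ∣ s + R * t) (hpR : (p : ℤ) ^ 3 ∣ R ^ 2 - D) (h : (p : ℤ) ∣ s)
    (h' : (p : ℤ) ∣ t) : False := by
  obtain ⟨s, rfl⟩ := h
  obtain ⟨t, rfl⟩ := h'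
  have hpi := Nat.prime_iff_prime_int.mp hp
  have hp0 := hpi.ne_zero
  have hps' : (p : ℤ) ^ 2 ∣ s + R * t := by
    refine (mul_dvd_mul_iff_left hp0).mp ?_
    have e : (p : ℤ) * s + R * (p * t) = p * (s + R * t) := by ring
    rw [e] at hps
    rwa [← pow_succ']
  have h2 := norm_form_dvd hps' ((pow_dvd_pow _ (by norm_num)).trans hpR)
  have e : s ^ 2 - D * t ^ 2 = M * p * q ^ 3 := by
    refine mul_left_cancel₀ (pow_ne_zero 2 hp0) ?_
    linear_combination hn
  rw [e] at h2
  have h3 : (p : ℤ) ∣ M * q ^ 3 := by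
    refine (mul_dvd_mul_iff_left hp0).mp ?_
    rw [← pow_two]
    exact h2.trans (by rw [show M * p * (q : ℤ) ^ 3 = p * (M * q ^ 3) by ring])
  rcases hpi.dvd_or_dvd h3 with h3 | h3
  · exact hpM h3
  · have := hpi.dvd_of_dvd_pow h3
    exact hpq ((Nat.prime_dvd_prime_iff_eq hp hq).mp (by exact_mod_cast this))

theorem isCoprime_of_norm {D s t R R' : ℤ} {M p q : ℕ} (hp : p.Prime) (hq : q.Prime) (hpq : p ≠ q)
    (hM : Squarefree M) (hpM : ¬ p ∣ M) (hqM : ¬ q ∣ M)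
    (hn : s ^ 2 - D * t ^ 2 = M * (p * q) ^ 3)
    (hps : (p : ℤ) ^ 3 ∣ s + R * t) (hpR : (p : ℤ) ^ 3 ∣ R ^ 2 - D)
    (hqs : (q : ℤ) ^ 3 ∣ s + R' * t) (hqR : (q : ℤ) ^ 3 ∣ R' ^ 2 - D) : IsCoprime s t := by
  refine isCoprime_of_prime_dvd ?_ ?_
  · rintro ⟨rfl, rfl⟩
    have : (M : ℤ) * (p * q) ^ 3 = 0 := by rw [← hn]; ring
    simp [hM.ne_zero, hp.ne_zero, hq.ne_zero] at this
  · intro l hl hs ht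
    obtain ⟨l', hl', hll⟩ : ∃ l' : ℕ, l'.Prime ∧ (l' : ℤ) ∣ l :=
      ⟨l.natAbs, Int.prime_iff_natAbs_prime.mp hl, Int.natAbs_dvd.mpr dvd_rfl⟩
    replace hs := hll.trans hs
    replace ht := hll.trans ht
    clear hl hll
    by_cases h1 : l' = p
    · subst h1
      exact isCoprime_aux (M := M) hp hq hpq (by exact_mod_cast hpM) hn hps hpR hs ht
    by_cases h2 : l' = q
    · subst h2
      exact isCoprime_aux (M := M) hq hp hpq.symm (by exact_mod_cast hqM) (by rw [hn]; ring) hqs hqR hs ht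
    have h3 : (l' : ℤ) ^ 2 ∣ M * (p * q) ^ 3 := by
      rw [← hn]
      exact dvd_sub (pow_dvd_pow_of_dvd hs 2) ((pow_dvd_pow_of_dvd ht 2).mul_left _)
    have h4 : l' ^ 2 ∣ M * (p * q) ^ 3 := by exact_mod_cast h3
    have h5 : Nat.Coprime (l' ^ 2) ((p * q) ^ 3) := by
      refine Nat.Coprime.pow _ _ (Nat.Coprime.mul_right ?_ ?_)
      · exact (Nat.coprime_primes hl' hp).mpr h1
      · exact (Nat.coprime_primes hl' hq).mpr h2
    have h6 := h5.dvd_of_dvd_mul_right h4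
    rw [pow_two] at h6
    exact hl'.one_lt.ne' (Nat.isUnit_iff.mp (hM l' h6))

theorem isCoprime_of_norm' {D s t : ℤ} {M : ℕ} (hM : Squarefree M)
    (hn : s ^ 2 - D * t ^ 2 = M) : IsCoprime s t := by
  refine isCoprime_of_prime_dvd ?_ ?_
  · rintro ⟨rfl, rfl⟩
    have : (M : ℤ) = 0 := by rw [← hn]; ring
    exact hM.ne_zero (by exact_mod_cast this)
  · intro l hl hs ht
    obtain ⟨l', hl', hll⟩ : ∃ l' : ℕ, l'.Prime ∧ (l' : ℤ) ∣ l :=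
      ⟨l.natAbs, Int.prime_iff_natAbs_prime.mp hl, Int.natAbs_dvd.mpr dvd_rfl⟩
    have h3 : (l' : ℤ) ^ 2 ∣ M := by
      rw [← hn]
      exact dvd_sub (pow_dvd_pow_of_dvd (hll.trans hs) 2)
        ((pow_dvd_pow_of_dvd (hll.trans ht) 2).mul_left _)
    have h4 : l' ^ 2 ∣ M := by exact_mod_cast h3
    rw [pow_two] at h4
    exact hl'.one_lt.ne' (Nat.isUnit_iff.mp (hM l' h4))

/-- Opposite congruences for `(s, t)` along a root of `R² ≡ D` force `s ≡ t ≡ 0`. -/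
theorem dvd_of_opposite {D s t R a : ℤ} (ha : IsCoprime a (2 * D)) (hR : a ∣ R ^ 2 - D)
    (h1 : a ∣ s + R * t) (h2 : a ∣ s - R * t) : a ∣ s ∧ a ∣ t := by
  have hD : IsCoprime a D := ha.of_mul_right_right
  have h2a : IsCoprime a 2 := ha.of_mul_right_left
  have hRc : IsCoprime a R := by
    have : IsCoprime a (R ^ 2) := by
      obtain ⟨c, hc⟩ := hR
      have e : R ^ 2 = D + a * c := by linear_combination hc
      rw [e]; exact hD.add_mul_left_right c
    exact (IsCoprime.pow_right_iff (by norm_num)).mp this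
  constructor
  · refine h2a.dvd_of_dvd_mul_left ?_
    have := dvd_add h1 h2
    ring_nf at this ⊢; exact this
  · refine (h2a.mul_right hRc).dvd_of_dvd_mul_left ?_
    have := dvd_sub h1 h2
    ring_nf at this ⊢; exact this

/-- Hensel lifting of a square root modulo `p` to one modulo `p³`. -/
theorem exists_root_cube {D r : ℤ} {p : ℕ} (hp : p.Prime) (hpD : ¬ (p : ℤ) ∣ 2 * D)
    (hr : (p : ℤ) ∣ r ^ 2 - D) : ∃ R : ℤ, (p : ℤ) ^ 3 ∣ R ^ 2 - D := by
  have hpi := Nat.prime_iff_prime_int.mp hp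
  have step : ∀ k : ℕ, 0 < k → (∃ r : ℤ, (p : ℤ) ^ k ∣ r ^ 2 - D) →
      ∃ r : ℤ, (p : ℤ) ^ (2 * k) ∣ r ^ 2 - D := by
    rintro k hk ⟨r, hr⟩
    have h1 : ¬ (p : ℤ) ∣ 2 * r := by
      intro h
      apply hpD
      have h2 : (p : ℤ) ∣ r ^ 2 - D := (dvd_pow_self _ hk.ne').trans hr
      have := dvd_sub (h.mul_right r) (h2.mul_left 2)
      ring_nf at this ⊢; exact this
    obtain ⟨u, v, huv⟩ := ((hpi.coprime_iff_not_dvd.mpr h1).pow_left (m := k))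
    obtain ⟨c, hc⟩ := hr
    refine ⟨r - (r ^ 2 - D) * v, c * u + c ^ 2 * v ^ 2, ?_⟩
    rw [mul_comm 2 k, pow_mul]
    have : (r - (r ^ 2 - D) * v) ^ 2 - D = (r ^ 2 - D) * (1 - v * (2 * r)) +
        (r ^ 2 - D) ^ 2 * v ^ 2 := by ring
    rw [this, ← huv, hc]; ring
  obtain ⟨R, hR⟩ := step 2 (by norm_num) (step 1 (by norm_num) ⟨r, by simpa using hr⟩)
  exact ⟨R, (pow_dvd_pow _ (by norm_num)).trans hR⟩

end Lat
end FourthMoment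

namespace FourthMoment
namespace Lat

open Finset

/-- `(pq)³` is properly represented by the form `s² - D t²`, with a bounded representation. -/
def Repr (D : ℤ) (p q : ℕ) : Prop :=
  p ≠ q ∧ ∃ s t : ℤ, t ≠ 0 ∧ IsCoprime s t ∧ s ^ 2 - D * t ^ 2 = (p * q) ^ 3 ∧
    s ^ 2 ≤ 4 * (p * q) ^ 3 ∧ D * t ^ 2 ≤ 4 * (p * q) ^ 3

theorem eq_and_repr {D : ℤ} {ι : Type*} {m : ι → ℕ} {r : ι → ℤ}
    {P : Finset ℕ} {ρ : ℕ → ℤ} (hm : ∀ i, Squarefree (m i)) (hmD : ∀ i, IsCoprime (m i : ℤ) (2 * D))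
    (hmm : ∀ i j, i ≠ j → Nat.Coprime (m i) (m j)) (hr : ∀ i, (m i : ℤ) ∣ r i ^ 2 - D)
    (hP : ∀ p ∈ P, p.Prime) (hPm : ∀ p ∈ P, ∀ i, ¬ p ∣ m i)
    (hPD : ∀ p ∈ P, ¬ (p : ℤ) ∣ 2 * D) (hρ : ∀ p ∈ P, (p : ℤ) ^ 3 ∣ ρ p ^ 2 - D)
    (hsep : ∀ i j, i ≠ j → ∀ s t : ℤ, IsCoprime s t → (m i : ℤ) ∣ s + r i * t →
      (m j : ℤ) ∣ s - r j * t → (s ^ 2 - D * t ^ 2 = m i * m j ∨ ∃ p ∈ P, ∃ q ∈ P,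
        s ^ 2 - D * t ^ 2 = m i * m j * (p * q) ^ 3) → False)
    {i j : ι} {p q : ℕ} (hp : p ∈ P) (hq : q ∈ P) {s t : ℤ}
    (hi : (m i : ℤ) ∣ s + r i * t) (hj : (m j : ℤ) ∣ s - r j * t)
    (hps : (p : ℤ) ^ 3 ∣ s + ρ p * t) (hqs : (q : ℤ) ^ 3 ∣ s - ρ q * t)
    (hn : s ^ 2 - D * t ^ 2 = (m i * p ^ 3 : ℕ) * (m j * q ^ 3 : ℕ))
    (hs : s ^ 2 ≤ 4 * ((m i * p ^ 3 : ℕ) * (m j * q ^ 3 : ℕ)))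
    (ht : D * t ^ 2 ≤ 4 * ((m i * p ^ 3 : ℕ) * (m j * q ^ 3 : ℕ))) :
    i = j ∧ (p = q ∨ Repr D p q) := by
  have hcop : ∀ p ∈ P, ∀ i, IsCoprime (m i : ℤ) p := fun p hp i =>
    ((Nat.prime_iff_prime_int.mp (hP p hp)).coprime_iff_not_dvd.mpr
      (by exact_mod_cast hPm p hp i)).symm
  have hsq : i ≠ j → Squarefree (m i * m j) := fun h =>
    (Nat.squarefree_mul (hmm i j h)).mpr ⟨hm i, hm j⟩
  push_cast at hn hs ht
  by_cases hpq : p = q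
  · subst hpq
    refine ⟨?_, Or.inl rfl⟩
    by_contra hij
    have hpi := Nat.prime_iff_prime_int.mp (hP p hp)
    obtain ⟨⟨s, rfl⟩, ⟨t, rfl⟩⟩ := dvd_of_opposite
      ((hpi.coprime_iff_not_dvd.mpr (hPD p hp)).pow_left (m := 3)) (hρ p hp) hps hqs
    have hn' : s ^ 2 - D * t ^ 2 = m i * m j := by
      refine mul_left_cancel₀ (pow_ne_zero 6 hpi.ne_zero) ?_
      linear_combination hn
    refine hsep i j hij s t (isCoprime_of_norm' (hsq hij) (by push_cast; exact hn')) ?_ ?_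
      (Or.inl hn')
    · refine ((hcop p hp i).pow_right (n := 3)).dvd_of_dvd_mul_left ?_
      ring_nf at hi ⊢; exact hi
    · refine ((hcop p hp j).pow_right (n := 3)).dvd_of_dvd_mul_left ?_
      ring_nf at hj ⊢; exact hj
  by_cases hij : i = j
  · subst hij
    refine ⟨rfl, Or.inr ⟨hpq, ?_⟩⟩
    have hm0 : (m i : ℤ) ≠ 0 := by exact_mod_cast (hm i).ne_zero
    obtain ⟨⟨s, rfl⟩, ⟨t, rfl⟩⟩ := dvd_of_opposite (hmD i) (hr i) hi hj
    have hn' : s ^ 2 - D * t ^ 2 = (p * q) ^ 3 := by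
      refine mul_left_cancel₀ (pow_ne_zero 2 hm0) ?_
      linear_combination hn
    have hc : IsCoprime s t := by
      refine isCoprime_of_norm (R := ρ p) (R' := -ρ q) (M := 1) (hP p hp) (hP q hq) hpq
        squarefree_one (hP p hp).not_dvd_one (hP q hq).not_dvd_one (by simpa using hn') ?_ (hρ p hp)
        ?_ (by rw [neg_sq]; exact hρ q hq)
      · refine ((hcop p hp i).symm.pow_left (m := 3)).dvd_of_dvd_mul_left (z := s + ρ p * t) ?_
        ring_nf at hps ⊢; exact hps
      · refine ((hcop q hq i).symm.pow_left (m := 3)).dvd_of_dvd_mul_left (z := s + -ρ q * t) ?_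
        ring_nf at hqs ⊢; exact hqs
    have hm2 : (0 : ℤ) < (m i : ℤ) ^ 2 := by positivity
    refine ⟨s, t, ?_, hc, hn', ?_, ?_⟩
    · rintro rfl
      have h1 := isCoprime_zero_right.mp hc
      have h2 : (p : ℤ) ∣ s ^ 2 := ⟨p ^ 2 * q ^ 3, by linear_combination hn'⟩
      exact (Nat.prime_iff_prime_int.mp (hP p hp)).not_isUnit (isUnit_of_dvd_unit h2 (h1.pow 2))
    · refine le_of_mul_le_mul_left ?_ hm2
      linarith
    · refine le_of_mul_le_mul_left ?_ hm2
      linarith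
  · exfalso
    have hn' : s ^ 2 - D * t ^ 2 = m i * m j * (p * q) ^ 3 := by rw [hn]; ring
    refine hsep i j hij s t ?_ hi hj (Or.inr ⟨p, hp, q, hq, hn'⟩)
    refine isCoprime_of_norm (R := ρ p) (R' := -ρ q) (M := m i * m j) (hP p hp) (hP q hq) hpq
      (hsq hij) ?_ ?_ (by rw [hn']; push_cast; ring) hps (hρ p hp) (by simpa [← sub_eq_add_neg] using hqs)
      (by rw [neg_sq]; exact hρ q hq)
    · exact fun h => ((hP p hp).dvd_mul.mp h).elim (hPm p hp i) (hPm p hp j)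
    · exact fun h => ((hP q hq).dvd_mul.mp h).elim (hPm q hq i) (hPm q hq j)

open Classical in
/-- Cauchy–Schwarz for the fibres of a map on a product in which only pairs with equal first
component collide. -/
theorem card_mul_sq_le {ι δ : Type*} [Fintype ι] (P : Finset ℕ) (T : Finset δ) (F : ι → ℕ → δ)
    (R : ℕ → ℕ → Prop) (hF : ∀ i, ∀ p ∈ P, F i p ∈ T)
    (h : ∀ i j, ∀ p ∈ P, ∀ q ∈ P, F i p = F j q → i = j ∧ (p = q ∨ R p q)) (hι : 0 < Fintype.card ι) :
    Fintype.card ι * P.card ^ 2 ≤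
      T.card * (P.card + ((P ×ˢ P).filter (fun x => R x.1 x.2)).card) := by
  set A := (univ : Finset ι) ×ˢ P with hA
  set f : ι × ℕ → δ := fun x => F x.1 x.2 with hf
  set n : δ → ℕ := fun d => (A.filter (fun x => f x = d)).card with hn
  have hmaps : ∀ x ∈ A, f x ∈ T := fun x hx => hF _ _ (mem_product.mp hx).2
  have hAcard : A.card = Fintype.card ι * P.card := by rw [hA, card_product, card_univ]
  have h1 : A.card = ∑ d ∈ T, n d := card_eq_sum_card_fiberwise hmaps
  have h2 : (∑ d ∈ T, n d) ^ 2 ≤ T.card * ∑ d ∈ T, n d ^ 2 := sq_sum_le_card_mul_sum_sq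
  have h3 : ∑ d ∈ T, n d ^ 2 = ∑ x ∈ A, n (f x) := by
    rw [← sum_fiberwise_of_maps_to hmaps]
    refine sum_congr rfl fun d _ => ?_
    have : ∀ x ∈ A.filter (fun x => f x = d), n (f x) = n d := fun x hx => by
      rw [(mem_filter.mp hx).2]
    rw [sum_congr rfl this, sum_const, smul_eq_mul, pow_two]
  have h4 : ∀ x ∈ A, n (f x) ≤ 1 + (P.filter (fun q => R x.2 q)).card := by
    rintro ⟨i, p⟩ hx
    have hp := (mem_product.mp hx).2
    have : A.filter (fun y => f y = f (i, p)) ⊆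
        (insert p (P.filter (fun q => R p q))).image (fun q => (i, q)) := by
      rintro ⟨j, q⟩ hy
      rw [mem_filter] at hy
      have hq := (mem_product.mp hy.1).2
      obtain ⟨rfl, hpq⟩ := h i j p hp q hq hy.2.symm
      refine mem_image.mpr ⟨q, ?_, rfl⟩
      rcases hpq with rfl | hpq
      · exact mem_insert_self _ _
      · exact mem_insert_of_mem (mem_filter.mpr ⟨hq, hpq⟩)
    refine (card_le_card this).trans (card_image_le.trans ((card_insert_le _ _).trans ?_))
    rw [add_comm]
  have h5 : ∑ x ∈ A, n (f x) ≤
      Fintype.card ι * (P.card + ((P ×ˢ P).filter (fun x => R x.1 x.2)).card) := by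
    refine (sum_le_sum h4).trans ?_
    rw [hA, sum_product]
    simp only [sum_const, card_univ, smul_eq_mul]
    refine Nat.mul_le_mul_left _ (le_of_eq ?_)
    rw [sum_add_distrib, sum_const, smul_eq_mul, mul_one, card_filter, sum_product]
    simp only [card_filter]
  have h6 : (Fintype.card ι * P.card) ^ 2 ≤ T.card * (Fintype.card ι *
      (P.card + ((P ×ˢ P).filter (fun x => R x.1 x.2)).card)) := by
    rw [← hAcard, h1]
    refine h2.trans (Nat.mul_le_mul_left _ ?_)
    rw [h3]; exact h5
  refine Nat.le_of_mul_le_mul_left ?_ hι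
  calc _ = (Fintype.card ι * P.card) ^ 2 := by ring
    _ ≤ _ := h6
    _ = _ := by ring

open Classical in
theorem card_mul_sq_le_of_sep {D : ℤ} (hD : ∀ n : ℤ, D ≠ n * n) (hD0 : 0 < D) {S J : ℕ}
    (hS : ∀ c : ℤ, (c : ℝ) ^ 2 ≤ D → |c| ≤ S) (hJ : 4 * √(D : ℝ) ≤ 4 ^ J)
    {ι : Type*} [Fintype ι] (hι : 0 < Fintype.card ι) {m : ι → ℕ} {r : ι → ℤ}
    {P : Finset ℕ} (hm : ∀ i, Squarefree (m i)) (hmD : ∀ i, IsCoprime (m i : ℤ) (2 * D))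
    (hmm : ∀ i j, i ≠ j → Nat.Coprime (m i) (m j)) (hr : ∀ i, (m i : ℤ) ∣ r i ^ 2 - D)
    (hP : ∀ p ∈ P, p.Prime) (hPm : ∀ p ∈ P, ∀ i, ¬ p ∣ m i)
    (hPD : ∀ p ∈ P, ¬ (p : ℤ) ∣ 2 * D) (hρ : ∀ p ∈ P, ∃ x : ℤ, (p : ℤ) ∣ x ^ 2 - D)
    (hsep : ∀ i j, i ≠ j → ∀ s t : ℤ, IsCoprime s t → (m i : ℤ) ∣ s + r i * t →
      (m j : ℤ) ∣ s - r j * t → (s ^ 2 - D * t ^ 2 = m i * m j ∨ ∃ p ∈ P, ∃ q ∈ P,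
        s ^ 2 - D * t ^ 2 = m i * m j * (p * q) ^ 3) → False) :
    Fintype.card ι * P.card ^ 2 ≤
      (dataSet D S J).card * (P.card + ((P ×ˢ P).filter (fun x => Repr D x.1 x.2)).card) := by
  have hρ' : ∀ p, ∃ R : ℤ, p ∈ P → (p : ℤ) ^ 3 ∣ R ^ 2 - D := fun p => by
    by_cases hp : p ∈ P
    · obtain ⟨x, hx⟩ := hρ p hp
      obtain ⟨R, hR⟩ := exists_root_cube (hP p hp) (hPD p hp) hx
      exact ⟨R, fun _ => hR⟩
    · exact ⟨0, fun h => absurd h hp⟩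
  choose ρ hρ using hρ'
  have hcrt : ∀ i p, ∃ R : ℤ, p ∈ P → (m i : ℤ) ∣ R - r i ∧ (p : ℤ) ^ 3 ∣ R - ρ p := fun i p => by
    by_cases hp : p ∈ P
    · obtain ⟨u, v, huv⟩ : IsCoprime (m i : ℤ) ((p : ℤ) ^ 3) :=
        (((Nat.prime_iff_prime_int.mp (hP p hp)).coprime_iff_not_dvd.mpr
          (by exact_mod_cast hPm p hp i)).symm).pow_right
      exact ⟨ρ p * (u * m i) + r i * (v * p ^ 3), fun _ =>
        ⟨⟨u * (ρ p - r i), by linear_combination (r i) * huv⟩,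
          ⟨v * (r i - ρ p), by linear_combination (ρ p) * huv⟩⟩⟩
    · exact ⟨0, fun h => absurd h hp⟩
  choose R hR using hcrt
  have hdvd : ∀ {a x y : ℤ}, a ∣ x - y → a ∣ y ^ 2 - D → a ∣ x ^ 2 - D := fun {a x y} h h' => by
    have := dvd_add (h.mul_right (x + y)) h'
    ring_nf at this ⊢; exact this
  have hA : ∀ i, ∀ p ∈ P, (0 : ℤ) < ((m i * p ^ 3 : ℕ) : ℤ) := fun i p hp => by
    have h1 := Nat.pos_of_ne_zero (hm i).ne_zero
    have h2 := (hP p hp).pos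
    exact_mod_cast Nat.mul_pos h1 (pow_pos h2 3)
  have hdata : ∀ i p, ∃ δ, p ∈ P → δ ∈ dataSet D S J ∧
      HasData D ((m i * p ^ 3 : ℕ) : ℤ) (R i p) δ := fun i p => by
    by_cases hp : p ∈ P
    · obtain ⟨δ, hδ⟩ := exists_hasData hD hD0 hS hJ (hA i p hp) (r := R i p) (by
        push_cast
        refine IsCoprime.mul_dvd ?_ (hdvd (hR i p hp).1 (hr i)) (hdvd (hR i p hp).2 (hρ p hp))
        exact (((Nat.prime_iff_prime_int.mp (hP p hp)).coprime_iff_not_dvd.mpr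
          (by exact_mod_cast hPm p hp i)).symm).pow_right)
      exact ⟨δ, fun _ => hδ⟩
    · exact ⟨(0, 0, 0), fun h => absurd h hp⟩
  choose F hF using hdata
  refine card_mul_sq_le P _ F (Repr D) (fun i p hp => (hF i p hp).1) ?_ hι
  intro i j p hp q hq hpq
  have h2 := (hF j q hq).2
  rw [← hpq] at h2
  obtain ⟨s, t, e1, e2, e3, e4, e5⟩ := (hF i p hp).2.exists_quotient hD hD0 (hA i p hp) (hA j q hq) h2
  have f1 : ∀ {a b x y : ℤ}, a ∣ b → b ∣ s + x * t → a ∣ x - y → a ∣ s + y * t := fun h1 h2 h3 => by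
    have := dvd_sub (h1.trans h2) (h3.mul_right t)
    ring_nf at this ⊢; exact this
  have f2 : ∀ {a b x y : ℤ}, a ∣ b → b ∣ s - x * t → a ∣ x - y → a ∣ s - y * t := fun h1 h2 h3 => by
    have := dvd_add (h1.trans h2) (h3.mul_right t)
    ring_nf at this ⊢; exact this
  refine eq_and_repr hm hmD hmm hr hP hPm hPD hρ hsep hp hq
    (f1 ?_ e2 (hR i p hp).1) (f2 ?_ e1 (hR j q hq).1) (f1 ?_ e2 (hR i p hp).2)
    (f2 ?_ e1 (hR j q hq).2) e3 e4 e5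
  · push_cast; exact dvd_mul_right _ _
  · push_cast; exact dvd_mul_right _ _
  · push_cast; exact dvd_mul_left _ _
  · push_cast; exact dvd_mul_left _ _

end Lat
end FourthMoment

namespace FourthMoment

open Finset

open Classical in
/-- A set of pairs of primes injects, up to order, into a set recording their products. -/
theorem card_pairs_le (P : Finset ℕ) (hP : ∀ p ∈ P, p.Prime) (R : ℕ → ℕ → Prop)
    (T : Finset (ℕ × ℕ × ℤ)) (h : ∀ p ∈ P, ∀ q ∈ P, R p q → ∃ x ∈ T, x.2.1 = p * q) :
    ((P ×ˢ P).filter (fun x => R x.1 x.2)).card ≤ 2 * T.card := by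
  have hex : ∀ x : ℕ × ℕ, ∃ y, x ∈ (P ×ˢ P).filter (fun x => R x.1 x.2) →
      y ∈ T ∧ y.2.1 = x.1 * x.2 := fun x => by
    by_cases hx : x ∈ (P ×ˢ P).filter (fun x => R x.1 x.2)
    · rw [mem_filter, mem_product] at hx
      obtain ⟨y, hy⟩ := h x.1 hx.1.1 x.2 hx.1.2 hx.2
      exact ⟨y, fun _ => hy⟩
    · exact ⟨(0, 0, 0), fun h => absurd h hx⟩
  choose g hg using hex
  refine (card_le_mul_card_image_of_maps_to (f := g) (fun x hx => (hg x hx).1) 2 ?_)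
  intro y _
  rcases ((P ×ˢ P).filter (fun x => R x.1 x.2)).filter (fun x => g x = y) |>.eq_empty_or_nonempty
    with h0 | ⟨⟨p, q⟩, hx⟩
  · rw [h0]; simp
  · refine (card_le_card (t := {(p, q), (q, p)}) ?_).trans card_le_two
    rintro ⟨p', q'⟩ hx'
    rw [mem_filter] at hx hx'
    have e : p' * q' = p * q := by
      rw [← (hg _ hx.1).2, ← (hg _ hx'.1).2, hx.2, hx'.2]
    have hm := mem_product.mp (mem_filter.mp hx.1).1
    have hm' := mem_product.mp (mem_filter.mp hx'.1).1
    have hp := hP p hm.1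
    have hq := hP q hm.2
    have hp' := hP p' hm'.1
    have hq' := hP q' hm'.2
    rw [mem_insert, mem_singleton, Prod.mk.injEq, Prod.mk.injEq]
    rcases hp'.dvd_mul.mp (Dvd.intro q' e) with h1 | h1
    · have := (Nat.prime_dvd_prime_iff_eq hp' hp).mp h1
      subst this
      exact Or.inl ⟨rfl, Nat.eq_of_mul_eq_mul_left hp.pos e⟩
    · have := (Nat.prime_dvd_prime_iff_eq hp' hq).mp h1
      subst this
      refine Or.inr ⟨rfl, Nat.eq_of_mul_eq_mul_left hp'.pos (e.trans (mul_comm _ _))⟩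

namespace Lat

theorem Repr.exists_mem_solSet {κ d V Z p q : ℕ} (hV : ∀ v : ℕ, d * v ^ 2 ≤ 4 * Z ^ 6 → v ≤ V)
    (hκ : 0 < κ) (hp : p.Prime) (hq : q.Prime) (hpZ : p ≤ Z) (hqZ : q ≤ Z)
    (h : Repr (κ * d : ℕ) p q) : ∃ x ∈ solSet (-κ) 1 V (Z ^ 2) (2 * Z ^ 3) d, x.2.1 = p * q := by
  obtain ⟨-, s, t, ht0, hst, hn, hs, ht⟩ := h
  have hZ : p * q ≤ Z ^ 2 := by rw [pow_two]; exact Nat.mul_le_mul hpZ hqZ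
  have hZ6 : (p * q) ^ 3 ≤ Z ^ 6 := by
    calc _ ≤ (Z ^ 2) ^ 3 := Nat.pow_le_pow_left hZ 3
      _ = _ := by ring
  have hcop : ∀ l : ℕ, l.Prime → l ∣ p * q → ¬ l ∣ t.natAbs := by
    intro l hl h1 h2
    have hli := Nat.prime_iff_prime_int.mp hl
    have h3 : (l : ℤ) ∣ t := Int.natCast_dvd.mpr h2
    have h4 : (l : ℤ) ∣ s ^ 2 := by
      have h5 : (l : ℤ) ∣ p * q := by exact_mod_cast h1
      have e : s ^ 2 = (p * q) ^ 3 + (κ * d : ℕ) * t ^ 2 := by linear_combination hn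
      rw [e]
      exact dvd_add (dvd_pow h5 (by norm_num)) ((dvd_pow h3 (by norm_num)).mul_left _)
    exact hli.not_isUnit (hst.isUnit_of_dvd' (hli.dvd_of_dvd_pow h4) h3)
  refine ⟨(t.natAbs, p * q, s), ?_, rfl⟩
  rw [solSet, mem_filter]
  simp only [mem_product, mem_Icc]
  refine ⟨⟨⟨Int.natAbs_pos.mpr ht0, hV _ ?_⟩, ⟨Nat.mul_pos hp.pos hq.pos, hZ⟩, ?_⟩, ?_, ?_⟩
  · have h1 : (d : ℤ) * (t.natAbs : ℤ) ^ 2 ≤ 4 * Z ^ 6 := by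
      rw [Int.natAbs_sq]
      have h2 : (d : ℤ) * t ^ 2 ≤ (κ * d : ℕ) * t ^ 2 := by
        refine mul_le_mul_of_nonneg_right ?_ (sq_nonneg t)
        exact_mod_cast Nat.le_mul_of_pos_left d hκ
      have h3 : ((p : ℤ) * q) ^ 3 ≤ Z ^ 6 := by exact_mod_cast hZ6
      linarith
    exact_mod_cast h1
  · rw [← abs_le]
    refine abs_le_of_sq_le_sq ?_ (by positivity)
    have h3 : ((p : ℤ) * q) ^ 3 ≤ Z ^ 6 := by exact_mod_cast hZ6
    push_cast
    nlinarith
  · rw [Int.natAbs_sq]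
    push_cast at hn ⊢
    linear_combination hn
  · exact Nat.Coprime.symm (Nat.Coprime.symm (Nat.coprime_of_dvd fun l hl h1 h2 => hcop l hl h1 h2))

theorem card_dataSet_le {D : ℤ} {S J T F : ℕ} (hT : ∀ n : ℕ, 0 < n → n ≤ S → n.divisors.card ≤ T)
    (hF : ∀ (n : ℕ) (x : ℤ), (n : ℤ) ∣ x ^ 2 - D → ∀ f : ℕ, (f : ℤ) ∣ 2 * x → f ^ 2 ∣ n → f ≤ F) :
    (dataSet D S J).card ≤ (T * F * (2 * J + 1)) * (2 * S + 1) := by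
  have hmaps : ∀ p ∈ dataSet D S J, p.1 ∈ Icc (-(S : ℤ)) S := fun p hp =>
    (mem_product.mp (mem_filter.mp hp).1).1
  have hc : (Icc (-(S : ℤ)) S).card = 2 * S + 1 := by rw [Int.card_Icc]; omega
  rw [← hc]
  refine card_le_mul_card_image_of_maps_to hmaps _ fun c hcm => ?_
  have hcS : c.natAbs ≤ S := by rw [mem_Icc] at hcm; omega
  by_cases hc0 : c = 0
  · rw [show (dataSet D S J).filter (fun p => p.1 = c) = ∅ from ?_]
    · simp
    · refine filter_eq_empty_iff.mpr fun p hp h => ?_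
      exact (mem_filter.mp hp).2.1 (h.trans hc0)
  have hpos : 0 < c.natAbs := Int.natAbs_pos.mpr hc0
  have key := card_sqrt_mod_le c.natAbs hpos D F (fun x hx => hF _ x hx)
  set B := (Ico (0 : ℤ) c.natAbs).filter (fun x => (c.natAbs : ℤ) ∣ x ^ 2 - D) with hB
  have hJ : (Icc (-(J : ℤ)) J).card = 2 * J + 1 := by rw [Int.card_Icc]; omega
  calc ((dataSet D S J).filter (fun p => p.1 = c)).card ≤ (B ×ˢ Icc (-(J : ℤ)) J).card := by
        refine card_le_card_of_injOn (fun p => p.2) ?_ ?_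
        · intro p hp
          rw [mem_coe, mem_filter] at hp
          obtain ⟨hp, rfl⟩ := hp
          obtain ⟨hp1, -, hp2, hp3⟩ := mem_filter.mp hp
          simp only [mem_product, mem_Ico] at hp1
          simp only [mem_coe, mem_product, hB, mem_filter, mem_Ico, Int.natCast_natAbs]
          exact ⟨⟨⟨hp1.2.1.1, hp2⟩, (abs_dvd _ _).mpr hp3⟩, hp1.2.2⟩
        · intro p hp q hq h
          rw [mem_coe, mem_filter] at hp hq
          exact Prod.ext (hp.2.trans hq.2.symm) h
    _ = B.card * (2 * J + 1) := by rw [card_product, hJ]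
    _ ≤ T * F * (2 * J + 1) := by
        refine Nat.mul_le_mul_right _ (key.trans (Nat.mul_le_mul_right _ (hT _ hpos hcS)))

theorem le_of_sq_dvd_mul {B d f : ℕ} (hB : 0 < B) (hd : Squarefree d) (h : f ^ 2 ∣ B * d) : f ≤ B := by
  have hf : 0 < f := by
    rcases Nat.eq_zero_or_pos f with rfl | hf
    · simp [hB.ne', hd.ne_zero] at h
    · exact hf
  set g := Nat.gcd f B with hg
  have hg0 : 0 < g := Nat.gcd_pos_of_pos_left _ hf
  obtain ⟨f', hf'⟩ : g ∣ f := Nat.gcd_dvd_left ..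
  obtain ⟨B', hB'⟩ : g ∣ B := Nat.gcd_dvd_right ..
  have hco : Nat.Coprime f' B' := by
    have := Nat.coprime_div_gcd_div_gcd (m := f) (n := B) hg0
    rw [← hg] at this
    rwa [Nat.div_eq_of_eq_mul_right hg0 hf', Nat.div_eq_of_eq_mul_right hg0 hB'] at this
  have h1 : f' ^ 2 ∣ B' * d := by
    have h2 : g * (g * f' ^ 2) ∣ g * (B' * d) := by
      have e : g * (g * f' ^ 2) = f ^ 2 := by rw [hf']; ring
      rw [e, ← mul_assoc, ← hB']; exact h
    exact (Dvd.intro_left g rfl).trans (Nat.dvd_of_mul_dvd_mul_left hg0 h2)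
  have h2 : f' ^ 2 ∣ d := (hco.pow_left 2).dvd_of_dvd_mul_left h1
  have h3 : f' = 1 := by
    rw [pow_two] at h2
    exact Nat.isUnit_iff.mp (hd f' h2)
  rw [hf', h3, mul_one]
  exact Nat.gcd_le_right _ hB

/-- The number of reduced basis data for `D = κ d` is `O(d^{1/2+η})`. -/
theorem exists_card_dataSet_le (κ : ℕ) (hκ : 0 < κ) (η : ℝ) (hη : 0 < η) :
    ∃ C : ℝ, 0 < C ∧ ∀ d : ℕ, Squarefree d → ∃ S J : ℕ,
      (∀ c : ℤ, (c : ℝ) ^ 2 ≤ ((κ * d : ℕ) : ℤ) → |c| ≤ S) ∧ 4 * √((((κ * d : ℕ) : ℤ)) : ℝ) ≤ 4 ^ J ∧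
      ((dataSet ((κ * d : ℕ) : ℤ) S J).card : ℝ) ≤ C * (d : ℝ) ^ (1 / 2 + η) := by
  obtain ⟨C₁, hC₁, hτ⟩ := exists_card_divisors_le η hη
  set C₂ : ℝ := (η / 2)⁻¹ with hC₂
  have hC₂0 : 0 < C₂ := by positivity
  have hκ' : (0 : ℝ) < κ := by exact_mod_cast hκ
  refine ⟨C₁ * (4 * κ) * (4 * C₂ + 5) * 3 * (κ : ℝ) ^ (1 / 2 + η), by positivity, fun d hd => ?_⟩
  have hd0 : 0 < d := Nat.pos_of_ne_zero hd.ne_zero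
  set D := κ * d with hD
  have hD0 : 0 < D := Nat.mul_pos hκ hd0
  have hD1 : (1 : ℝ) ≤ D := by exact_mod_cast hD0
  have hsqrt1 : 1 ≤ √(D : ℝ) := Real.one_le_sqrt.mpr hD1
  have hSle : (Nat.sqrt D : ℝ) ≤ √(D : ℝ) := Real.nat_sqrt_le_real_sqrt
  have hDlt : D < 2 ^ (Nat.log 2 D + 1) := Nat.lt_pow_succ_log_self (by norm_num) D
  refine ⟨Nat.sqrt D, Nat.log 2 D + 2, fun c hc => ?_, ?_, ?_⟩
  · have h1 : c ^ 2 ≤ (D : ℤ) := by exact_mod_cast hc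
    have h2 : c.natAbs ≤ Nat.sqrt D := by
      rw [Nat.le_sqrt', ← Nat.cast_le (α := ℤ)]
      push_cast
      rwa [sq_abs]
    rw [Int.abs_eq_natAbs]
    exact_mod_cast h2
  · rw [Int.cast_natCast]
    have h1 : √(D : ℝ) ≤ D := by
      exact Real.sqrt_le_iff.mpr ⟨by linarith, by nlinarith⟩
    have h2 : (D : ℝ) ≤ 2 ^ (Nat.log 2 D + 1) := by exact_mod_cast hDlt.le
    have h3 : (2 : ℝ) ^ (Nat.log 2 D) ≤ 4 ^ (Nat.log 2 D) :=
      pow_le_pow_left₀ (by norm_num) (by norm_num) _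
    have h4 : (0 : ℝ) < 4 ^ (Nat.log 2 D) := by positivity
    rw [pow_succ] at h2
    rw [pow_add]
    linarith
  · set T := ⌊C₁ * (D : ℝ) ^ (η / 2)⌋₊ with hT
    have key := card_dataSet_le (D := (D : ℤ)) (S := Nat.sqrt D) (J := Nat.log 2 D + 2) (T := T)
      (F := 4 * κ) ?_ ?_
    · have hTle : (T : ℝ) ≤ C₁ * (D : ℝ) ^ (η / 2) := Nat.floor_le (by positivity)
      have hDη : 1 ≤ (D : ℝ) ^ (η / 2) := Real.one_le_rpow hD1 (by positivity)
      have hJ : ((2 * (Nat.log 2 D + 2) + 1 : ℕ) : ℝ) ≤ (4 * C₂ + 5) * (D : ℝ) ^ (η / 2) := by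
        have h1 : Real.log D ≤ C₂ * (D : ℝ) ^ (η / 2) := by
          rw [hC₂, inv_mul_eq_div]; exact Real.log_le_rpow_div (by linarith) (by positivity)
        have h2 : (Nat.log 2 D : ℝ) * Real.log 2 ≤ Real.log D := by
          rw [← Real.log_pow]
          refine Real.log_le_log (by positivity) ?_
          exact_mod_cast Nat.pow_log_le_self 2 hD0.ne'
        have h3 : (1 / 2 : ℝ) ≤ Real.log 2 := by linarith [Real.log_two_gt_d9]
        have h4 : (Nat.log 2 D : ℝ) * (1 / 2) ≤ Nat.log 2 D * Real.log 2 :=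
          mul_le_mul_of_nonneg_left h3 (by positivity)
        push_cast
        nlinarith
      have hS : ((2 * Nat.sqrt D + 1 : ℕ) : ℝ) ≤ 3 * (D : ℝ) ^ (1 / 2 : ℝ) := by
        rw [← Real.sqrt_eq_rpow]
        push_cast
        linarith
      calc ((dataSet (D : ℤ) (Nat.sqrt D) (Nat.log 2 D + 2)).card : ℝ)
          ≤ ((T * (4 * κ) * (2 * (Nat.log 2 D + 2) + 1)) * (2 * Nat.sqrt D + 1) : ℕ) := by
            exact_mod_cast key
        _ = (T * (4 * κ) * ((2 * (Nat.log 2 D + 2) + 1 : ℕ) : ℝ)) *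
            ((2 * Nat.sqrt D + 1 : ℕ) : ℝ) := by push_cast; ring
        _ ≤ ((C₁ * (D : ℝ) ^ (η / 2)) * (4 * κ) * ((4 * C₂ + 5) * (D : ℝ) ^ (η / 2))) *
            (3 * (D : ℝ) ^ (1 / 2 : ℝ)) := by gcongr
        _ = C₁ * (4 * κ) * (4 * C₂ + 5) * 3 *
            ((D : ℝ) ^ (1 / 2 : ℝ) * ((D : ℝ) ^ (η / 2) * (D : ℝ) ^ (η / 2))) := by ring
        _ = C₁ * (4 * κ) * (4 * C₂ + 5) * 3 * (D : ℝ) ^ (1 / 2 + η) := by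
            rw [← Real.rpow_add (by linarith), add_halves, ← Real.rpow_add (by linarith)]
        _ = _ := by
            rw [hD, Nat.cast_mul, Real.mul_rpow (by positivity) (by positivity), ← mul_assoc]
    · intro n hn hnS
      refine Nat.le_floor ((hτ n hn).trans (mul_le_mul_of_nonneg_left ?_ (by linarith)))
      calc (n : ℝ) ^ η ≤ (√(D : ℝ)) ^ η := by
            refine Real.rpow_le_rpow (by positivity) (le_trans ?_ hSle) hη.le
            exact_mod_cast hnS
        _ = (D : ℝ) ^ (η / 2) := by
            rw [Real.sqrt_eq_rpow, ← Real.rpow_mul (by positivity)]; congr 1; ring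
    · intro n x hx f hfx hfn
      refine le_of_sq_dvd_mul (by omega) hd ?_
      have h1 : (f : ℤ) ^ 2 ∣ x ^ 2 - D := (by exact_mod_cast hfn : (f : ℤ) ^ 2 ∣ n).trans hx
      have h2 : (f : ℤ) ^ 2 ∣ (2 * x) ^ 2 := pow_dvd_pow_of_dvd hfx 2
      have h3 : (f : ℤ) ^ 2 ∣ ((4 * κ * d : ℕ) : ℤ) := by
        have e : ((4 * κ * d : ℕ) : ℤ) = (2 * x) ^ 2 - 4 * (x ^ 2 - D) := by
          rw [hD]; push_cast; ring
        rw [e]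
        exact dvd_sub h2 (h1.mul_left _)
      exact_mod_cast h3

end Lat
end FourthMoment

namespace FourthMoment
namespace PrimeSum

open Filter Topology

theorem norm_natCast_cpow_neg (p : Nat.Primes) (s : ℝ) :
    ‖((p : ℕ) : ℂ) ^ (-(s : ℂ))‖ = ((p : ℕ) : ℝ) ^ (-s) := by
  rw [Complex.norm_natCast_cpow_of_pos p.2.pos]; simp

theorem rpow_neg_le_half (p : Nat.Primes) {s : ℝ} (hs : 1 < s) :
    ((p : ℕ) : ℝ) ^ (-s) ≤ 1 / 2 := by
  have h2 : (2 : ℝ) ≤ (p : ℕ) := by exact_mod_cast p.2.two_le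
  calc ((p : ℕ) : ℝ) ^ (-s) ≤ ((p : ℕ) : ℝ) ^ (-1 : ℝ) :=
        Real.rpow_le_rpow_of_exponent_le (by linarith) (by linarith)
    _ = ((p : ℕ) : ℝ)⁻¹ := Real.rpow_neg_one _
    _ ≤ 1 / 2 := by rw [one_div]; exact inv_anti₀ (by norm_num) h2

theorem rpow_neg_sq_le (p : Nat.Primes) {s : ℝ} (hs : 1 < s) :
    (((p : ℕ) : ℝ) ^ (-s)) ^ 2 ≤ ((p : ℕ) : ℝ) ^ (-2 : ℝ) := by
  have h2 : (1 : ℝ) ≤ (p : ℕ) := by exact_mod_cast p.2.one_lt.le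
  rw [← Real.rpow_natCast, ← Real.rpow_mul (by linarith)]
  exact Real.rpow_le_rpow_of_exponent_le h2 (by push_cast; linarith)

theorem summable_primes {s : ℝ} (hs : 1 < s) :
    Summable fun p : Nat.Primes => ((p : ℕ) : ℝ) ^ (-s) :=
  Nat.Primes.summable_rpow.mpr (by linarith)

theorem summable_mul_of_bounded {s : ℝ} (hs : 1 < s) {f : Nat.Primes → ℝ} {B : ℝ}
    (hf : ∀ p, |f p| ≤ B) : Summable fun p : Nat.Primes => f p * ((p : ℕ) : ℝ) ^ (-s) := by
  refine Summable.of_norm_bounded ((summable_primes hs).mul_left B) fun p => ?_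
  rw [norm_mul, Real.norm_eq_abs, Real.norm_of_nonneg (by positivity)]
  exact mul_le_mul_of_nonneg_right (hf p) (by positivity)

theorem log_norm_LSeries_le {N : ℕ} (χ : DirichletCharacter ℂ N) {s : ℝ} (hs : 1 < s) :
    LSeries (fun n => χ n) s ≠ 0 ∧ Real.log ‖LSeries (fun n => χ n) s‖ ≤
      ∑' p : Nat.Primes, (χ (p : ℕ)).re * ((p : ℕ) : ℝ) ^ (-s) +
        ∑' p : Nat.Primes, ((p : ℕ) : ℝ) ^ (-2 : ℝ) := by
  have hs' : 1 < (s : ℂ).re := by simpa using hs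
  rw [← DirichletCharacter.LSeries_eulerProduct_exp_log χ hs']
  refine ⟨Complex.exp_ne_zero _, ?_⟩
  rw [Complex.norm_exp, Real.log_exp]
  set z : Nat.Primes → ℂ := fun p => χ (p : ℕ) * ((p : ℕ) : ℂ) ^ (-(s : ℂ)) with hz
  have hzn : ∀ p, ‖z p‖ ≤ ((p : ℕ) : ℝ) ^ (-s) := fun p => by
    rw [hz]
    simp only [norm_mul, norm_natCast_cpow_neg]
    exact mul_le_of_le_one_left (by positivity) (χ.norm_le_one _)
  have hzre : ∀ p, (z p).re = (χ (p : ℕ)).re * ((p : ℕ) : ℝ) ^ (-s) := fun p => by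
    have e : ((p : ℕ) : ℂ) ^ (-(s : ℂ)) = ((((p : ℕ) : ℝ) ^ (-s) : ℝ) : ℂ) := by
      rw [Complex.ofReal_cpow (by positivity)]; simp
    rw [hz]
    simp only [e, Complex.re_mul_ofReal]
  have hlog : ∀ p, ‖-Complex.log (1 - z p) - z p‖ ≤ ((p : ℕ) : ℝ) ^ (-2 : ℝ) := fun p => by
    have h1 : ‖z p‖ ≤ 1 / 2 := (hzn p).trans (rpow_neg_le_half p hs)
    have h2 := Complex.norm_log_one_sub_inv_sub_self_le (z := z p) (by linarith)
    rw [Complex.log_inv _ (fun h => ?_)] at h2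
    · refine h2.trans (le_trans ?_ (rpow_neg_sq_le p hs))
      have h3 : (1 - ‖z p‖)⁻¹ ≤ 2 := by
        rw [inv_le_comm₀ (by linarith) (by norm_num)]; linarith
      calc ‖z p‖ ^ 2 * (1 - ‖z p‖)⁻¹ / 2 ≤ ‖z p‖ ^ 2 * 2 / 2 := by gcongr
        _ = ‖z p‖ ^ 2 := by ring
        _ ≤ _ := pow_le_pow_left₀ (norm_nonneg _) (hzn p) 2
    · have h3 := Complex.abs_re_le_norm (z p)
      rw [Complex.arg_eq_pi_iff] at h
      have := (abs_le.mp h3).2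
      have h4 := h.1
      rw [Complex.sub_re, Complex.one_re] at h4
      linarith
  have hsz : Summable z := Summable.of_norm_bounded (summable_primes hs) hzn
  have hs2 : Summable fun p : Nat.Primes => ((p : ℕ) : ℝ) ^ (-2 : ℝ) := summable_primes (by norm_num)
  have hsd : Summable fun p => -Complex.log (1 - z p) - z p := Summable.of_norm_bounded hs2 hlog
  have hsl : Summable fun p => -Complex.log (1 - z p) := by
    simpa using hsd.add hsz
  have e1 : ∑' p, -Complex.log (1 - z p) = ∑' p, z p + ∑' p, (-Complex.log (1 - z p) - z p) := by
    rw [← hsz.tsum_add hsd]; simp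
  rw [e1, Complex.add_re, Complex.re_tsum hsz]
  simp only [hzre]
  gcongr
  calc (∑' p, (-Complex.log (1 - z p) - z p)).re ≤ ‖∑' p, (-Complex.log (1 - z p) - z p)‖ :=
        Complex.re_le_norm _
    _ ≤ ∑' p : Nat.Primes, ((p : ℕ) : ℝ) ^ (-2 : ℝ) := tsum_of_norm_bounded hs2.hasSum hlog

theorem exists_log_le_tsum :
    ∃ C : ℝ, ∀ᶠ s in 𝓝[>] (1 : ℝ),
      Real.log (1 / (s - 1)) - C ≤ ∑' p : Nat.Primes, ((p : ℕ) : ℝ) ^ (-s) := by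
  set C₂ := ∑' p : Nat.Primes, ((p : ℕ) : ℝ) ^ (-2 : ℝ)
  refine ⟨Real.log 2 + C₂, ?_⟩
  have h1 : Tendsto (fun s : ℝ => ‖((s : ℂ) - 1) * riemannZeta s‖) (𝓝[>] 1) (𝓝 1) := by
    have h2 : Tendsto (fun s : ℝ => (s : ℂ)) (𝓝[>] 1) (𝓝[≠] 1) := by
      refine tendsto_nhdsWithin_iff.mpr ⟨?_, ?_⟩
      · have := (Complex.continuous_ofReal.tendsto (1 : ℝ)).mono_left
          (nhdsWithin_le_nhds (s := Set.Ioi 1))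
        simpa using this
      · filter_upwards [self_mem_nhdsWithin] with s hs
        have : s ≠ 1 := ne_of_gt hs
        simpa using this
    simpa using (riemannZeta_residue_one.comp h2).norm
  filter_upwards [h1.eventually (lt_mem_nhds (show (1 / 2 : ℝ) < 1 by norm_num)),
    self_mem_nhdsWithin] with s h2 hs
  have hs : 1 < s := hs
  obtain ⟨-, h3⟩ := log_norm_LSeries_le (1 : DirichletCharacter ℂ 1) hs
  have e : LSeries (fun n => (1 : DirichletCharacter ℂ 1) n) s = riemannZeta s := by
    rw [← DirichletCharacter.LFunction_eq_LSeries _ (by simpa using hs)]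
    simp
  rw [e] at h3
  have h4 : ∀ p : Nat.Primes, (1 : DirichletCharacter ℂ 1) ((p : ℕ) : ZMod 1) = 1 := fun p =>
    MulChar.one_apply (isUnit_of_subsingleton _)
  simp only [h4, Complex.one_re, one_mul] at h3
  rw [norm_mul] at h2
  have e2 : ‖(s : ℂ) - 1‖ = s - 1 := by
    rw [← Complex.ofReal_one, ← Complex.ofReal_sub, Complex.norm_real, Real.norm_of_nonneg]
    linarith
  rw [e2] at h2
  have hz : 1 / (s - 1) * (1 / 2) ≤ ‖riemannZeta s‖ := by
    rw [div_mul_eq_mul_div, div_le_iff₀ (by linarith)]; linarith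
  have := Real.log_le_log (by have : 0 < s - 1 := by linarith
                              positivity) hz
  rw [Real.log_mul (by have : s - 1 ≠ 0 := by linarith
                       positivity) (by norm_num), one_div 2, Real.log_inv] at this
  linarith

theorem exists_le_tsum_char {N : ℕ} [NeZero N] (χ : DirichletCharacter ℂ N) :
    ∃ C : ℝ, ∀ᶠ s in 𝓝[>] (1 : ℝ),
      -C ≤ ∑' p : Nat.Primes, (χ (p : ℕ)).re * ((p : ℕ) : ℝ) ^ (-s) := by
  by_cases hχ : χ = 1
  · refine ⟨0, Eventually.of_forall fun s => ?_⟩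
    rw [neg_zero]
    refine tsum_nonneg fun p => mul_nonneg ?_ (by positivity)
    rw [hχ]
    by_cases hp : IsUnit ((p : ℕ) : ZMod N)
    · rw [MulChar.one_apply hp]; simp
    · rw [MulChar.map_nonunit _ hp]; simp
  set C₂ := ∑' p : Nat.Primes, ((p : ℕ) : ℝ) ^ (-2 : ℝ)
  set c := ‖χ.LFunction 1‖
  have hc : 0 < c := norm_pos_iff.mpr (DirichletCharacter.LFunction_apply_one_ne_zero hχ)
  have h1 : Tendsto (fun s : ℝ => ‖χ.LFunction s‖) (𝓝[>] 1) (𝓝 c) := by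
    have := ((DirichletCharacter.differentiable_LFunction hχ).continuous.comp
      Complex.continuous_ofReal).norm.tendsto (1 : ℝ)
    simp only [Function.comp, Complex.ofReal_one] at this
    exact this.mono_left nhdsWithin_le_nhds
  refine ⟨C₂ - Real.log (c / 2), ?_⟩
  filter_upwards [h1.eventually (lt_mem_nhds (half_lt_self hc)), self_mem_nhdsWithin] with s h2 hs
  obtain ⟨-, h3⟩ := log_norm_LSeries_le χ (s := s) hs
  rw [← DirichletCharacter.LFunction_eq_LSeries _ (by simpa using hs)] at h3
  have := Real.log_le_log (by positivity) h2.le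
  linarith

end PrimeSum
end FourthMoment

namespace FourthMoment
namespace PrimeSum

open Filter Topology NumberField

section Zeta

variable (K : Type*) [Field K] [NumberField K]

/-- A finite partial sum of the Dedekind zeta function is bounded by its value. -/
theorem sum_absNorm_rpow_le {s : ℝ} (hs : dedekindZeta K s ≠ 0) (F : Finset (Ideal (𝓞 K)))
    (hF : ∀ I ∈ F, I ≠ ⊥) :
    ∑ I ∈ F, (Ideal.absNorm I : ℝ) ^ (-s) ≤ ‖dedekindZeta K s‖ := by
  classical
  set a : ℕ → ℕ := fun n => Nat.card {I : Ideal (𝓞 K) // Ideal.absNorm I = n} with ha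
  have hsum : LSeriesSummable (fun n => (a n : ℂ)) s := by
    by_contra h
    exact hs (tsum_eq_zero_of_not_summable h)
  have hterm : ∀ n, LSeries.term (fun n => (a n : ℂ)) s n =
      ((if n = 0 then 0 else (a n : ℝ) * (n : ℝ) ^ (-s) : ℝ) : ℂ) := fun n => by
    rw [LSeries.term_def]
    split_ifs with h
    · simp
    · rw [Complex.ofReal_mul, Complex.ofReal_cpow (by positivity), Complex.ofReal_neg,
        Complex.cpow_neg, div_eq_mul_inv]
      simp
  set g : ℕ → ℝ := fun n => if n = 0 then 0 else (a n : ℝ) * (n : ℝ) ^ (-s) with hg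
  have hg0 : ∀ n, 0 ≤ g n := fun n => by
    simp only [hg]; split_ifs <;> positivity
  have hgs : Summable g := by
    have h1 : Summable fun n => ((g n : ℝ) : ℂ) := by
      refine Summable.congr (f := LSeries.term (fun n => (a n : ℂ)) s) hsum hterm
    exact Complex.summable_ofReal.mp h1
  have hz : dedekindZeta K s = ((∑' n, g n : ℝ) : ℂ) := by
    rw [Complex.ofReal_tsum]
    exact tsum_congr hterm
  rw [hz, Complex.norm_real, Real.norm_of_nonneg (tsum_nonneg hg0)]
  have hmaps : ∀ I ∈ F, Ideal.absNorm I ∈ F.image Ideal.absNorm := fun I hI =>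
    Finset.mem_image_of_mem _ hI
  rw [← Finset.sum_fiberwise_of_maps_to hmaps]
  refine le_trans (Finset.sum_le_sum fun n hn => ?_) (hgs.sum_le_tsum _ (fun n _ => hg0 n))
  obtain ⟨I, hI, rfl⟩ := Finset.mem_image.mp hn
  have hI0 : Ideal.absNorm I ≠ 0 := by
    rw [Ne, Ideal.absNorm_eq_zero_iff]; exact hF I hI
  simp only [hg, if_neg hI0]
  rw [Finset.sum_congr rfl (g := fun _ => (Ideal.absNorm I : ℝ) ^ (-s))
    (fun J hJ => by rw [(Finset.mem_filter.mp hJ).2]), Finset.sum_const, nsmul_eq_mul]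
  refine mul_le_mul_of_nonneg_right ?_ (by positivity)
  have hfin := Ideal.finite_setOfPred_absNorm_eq (S := 𝓞 K) (Ideal.absNorm I)
  have := Set.ncard_le_ncard (s := (F.filter fun J => Ideal.absNorm J = Ideal.absNorm I :
    Set (Ideal (𝓞 K)))) (t := {J | Ideal.absNorm J = Ideal.absNorm I})
    (fun J hJ => by simpa using (Finset.mem_filter.mp (Finset.mem_coe.mp hJ)).2) hfin
  rw [Set.ncard_coe_finset] at this
  exact_mod_cast this

theorem prod_one_add_absNorm_le {s : ℝ} (hs : dedekindZeta K s ≠ 0) (S : Finset (Ideal (𝓞 K)))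
    (hS : ∀ I ∈ S, Prime I) :
    ∏ I ∈ S, (1 + (Ideal.absNorm I : ℝ) ^ (-s)) ≤ ‖dedekindZeta K s‖ := by
  classical
  have hinj : Set.InjOn (fun t : Finset (Ideal (𝓞 K)) => ∏ I ∈ t, I) (S.powerset : Set _) := by
    intro t ht u hu h
    have h1 : ∀ t ∈ S.powerset,
        UniqueFactorizationMonoid.normalizedFactors (∏ I ∈ t, I) = t.val := fun t ht => by
      have := UniqueFactorizationMonoid.normalizedFactors_prod_of_prime (m := t.val)
        (fun p hp => hS p (Finset.mem_powerset.mp ht hp))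
      rw [← this, Finset.prod_val]; rfl
    exact Finset.val_injective (by rw [← h1 t ht, ← h1 u hu]; exact congrArg _ h)
  rw [Finset.prod_one_add]
  refine le_trans (le_of_eq ?_) (sum_absNorm_rpow_le K hs
    (S.powerset.image fun t => ∏ I ∈ t, I) ?_)
  · rw [Finset.sum_image hinj]
    refine Finset.sum_congr rfl fun t _ => ?_
    rw [map_prod, Nat.cast_prod, Real.finsetProd_rpow _ _ (fun _ _ => by positivity)]
  · intro I hI
    obtain ⟨t, ht, rfl⟩ := Finset.mem_image.mp hI
    exact Finset.prod_ne_zero_iff.mpr fun J hJ => (hS J (Finset.mem_powerset.mp ht hJ)).ne_zero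

theorem exists_sum_log_le : ∃ C : ℝ, ∀ᶠ s in 𝓝[>] (1 : ℝ), ∀ S : Finset (Ideal (𝓞 K)),
    (∀ I ∈ S, Prime I) →
      ∑ I ∈ S, Real.log (1 + (Ideal.absNorm I : ℝ) ^ (-s)) ≤ Real.log (1 / (s - 1)) + C := by
  set R := dedekindZeta_residue K
  have hR : 0 < R := dedekindZeta_residue_pos K
  refine ⟨Real.log (2 * R), ?_⟩
  have h1 := (tendsto_sub_one_mul_dedekindZeta_nhdsGT K).norm
  rw [Complex.norm_real, Real.norm_of_nonneg hR.le] at h1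
  filter_upwards [h1.eventually (lt_mem_nhds hR),
    h1.eventually (gt_mem_nhds (show R < 2 * R by linarith)), self_mem_nhdsWithin]
    with s h2 h3 hs S hS
  have hs : 1 < s := hs
  have hz : dedekindZeta K s ≠ 0 := fun h => by simp [h] at h2
  have h4 := prod_one_add_absNorm_le K hz S hS
  have e2 : ‖(s : ℂ) - 1‖ = s - 1 := by
    rw [← Complex.ofReal_one, ← Complex.ofReal_sub, Complex.norm_real, Real.norm_of_nonneg]
    linarith
  rw [norm_mul, e2] at h3
  have hs0 : 0 < s - 1 := by linarith
  rw [← Real.log_prod (fun I _ => by positivity), ← Real.log_mul (by positivity) (by positivity)]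
  refine Real.log_le_log (Finset.prod_pos fun I _ => by positivity) (h4.trans ?_)
  rw [div_mul_eq_mul_div, le_div_iff₀ hs0]
  linarith

end Zeta

end PrimeSum
end FourthMoment

namespace FourthMoment
namespace PrimeSum

open Filter Topology NumberField Polynomial

/-- The number of roots of an integer polynomial modulo `p`. -/
noncomputable def rootCount (f : ℤ[X]) (p : ℕ) : ℕ :=
  Nat.card {a : ZMod p // f.eval₂ (Int.castRingHom (ZMod p)) a = 0}

theorem rootCount_le {f : ℤ[X]} (hf : f.Monic) {p : ℕ} (hp : p.Prime) :
    rootCount f p ≤ f.natDegree := by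
  have := Fact.mk hp
  have h0 : f.map (Int.castRingHom (ZMod p)) ≠ 0 := (hf.map _).ne_zero
  have e : {a : ZMod p | f.eval₂ (Int.castRingHom (ZMod p)) a = 0} =
      (f.map (Int.castRingHom (ZMod p))).roots.toFinset := by
    ext a
    simp [h0, eval_map]
  have h1 : rootCount f p = Set.ncard {a : ZMod p | f.eval₂ (Int.castRingHom (ZMod p)) a = 0} := rfl
  rw [h1, e, Set.ncard_coe_finset]
  calc _ ≤ Multiset.card (f.map (Int.castRingHom (ZMod p))).roots := Multiset.toFinset_card_le _
    _ ≤ (f.map (Int.castRingHom (ZMod p))).natDegree := card_roots' _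
    _ = _ := hf.natDegree_map _

theorem exists_ringHom {O : Type*} [CommRing O] [IsDomain O] [CharZero O] {θ : O} {f : ℤ[X]}
    (hf : ∀ g : ℤ[X], aeval θ g = 0 → f ∣ g) {c : ℤ} (hc : ∀ x : O, ∃ g : ℤ[X], (c : O) * x = aeval θ g)
    {p : ℕ} (hp : p.Prime) (hpc : ¬ (p : ℤ) ∣ c) {a : ZMod p}
    (ha : f.eval₂ (Int.castRingHom (ZMod p)) a = 0) : ∃ φ : O →+* ZMod p, φ θ = a := by
  have := Fact.mk hp
  choose g hg using hc
  have hc0 : (c : ZMod p) ≠ 0 := fun h => hpc ((ZMod.intCast_zmod_eq_zero_iff_dvd c p).mp h)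
  set ev : ℤ[X] →+* ZMod p := eval₂RingHom (Int.castRingHom (ZMod p)) a with hev
  have hker : ∀ g₁ g₂ : ℤ[X], aeval θ g₁ = aeval θ g₂ → ev g₁ = ev g₂ := fun g₁ g₂ h => by
    obtain ⟨k, hk⟩ := hf (g₁ - g₂) (by rw [map_sub, h, sub_self])
    have : ev (g₁ - g₂) = 0 := by
      rw [hk, map_mul]
      have : ev f = 0 := ha
      rw [this, zero_mul]
    rwa [map_sub, sub_eq_zero] at this
  have hC : ∀ n : ℤ, aeval θ (C n) = (n : O) := fun n => by simp
  have hevC : ∀ n : ℤ, ev (C n) = (n : ZMod p) := fun n => by simp [hev]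
  have key : ∀ (x : O) (h : ℤ[X]) (n : ℤ), (n : O) * x = aeval θ h →
      (c : ZMod p) * ev h = n * ev (g x) := fun x h n hx => by
    have := hker (C c * h) (C n * g x) (by
      rw [map_mul, map_mul, hC, hC, ← hg, ← hx]; ring)
    rwa [map_mul, map_mul, hevC, hevC] at this
  refine ⟨{ toFun := fun x => (c : ZMod p)⁻¹ * ev (g x)
            map_one' := ?_, map_mul' := ?_, map_zero' := ?_, map_add' := ?_ }, ?_⟩
  · have := key 1 1 1 (by simp)
    rw [map_one, mul_one, Int.cast_one, one_mul] at this
    rw [← this, inv_mul_cancel₀ hc0]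
  · intro x y
    have := key (x * y) (g x * g y) (c * c) (by rw [map_mul, ← hg, ← hg]; push_cast; ring)
    rw [map_mul] at this
    push_cast at this
    field_simp
    linear_combination -(c : ZMod p)⁻¹ * (this) + (ev (g x) * ev (g y) - c * ev (g (x*y))) *
      (inv_mul_cancel₀ hc0)
  · have := key 0 0 1 (by simp)
    rw [map_zero, mul_zero, Int.cast_one, one_mul] at this
    rw [← this, mul_zero]
  · intro x y
    have := key (x + y) (g x + g y) c (by rw [map_add, ← hg, ← hg]; ring)
    have := mul_left_cancel₀ hc0 this
    rw [← this, map_add]; ring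
  · have := key θ X 1 (by simp)
    simp only [RingHom.coe_mk, MonoidHom.coe_mk, OneHom.coe_mk]
    rw [Int.cast_one, one_mul] at this
    rw [← this, ← mul_assoc, inv_mul_cancel₀ hc0]
    simp [hev]

/-- A surjection onto `ZMod p` is determined by its kernel. -/
theorem ringHom_eq_of_ker_eq {O : Type*} [CommRing O] {p : ℕ} [Fact p.Prime] {φ ψ : O →+* ZMod p}
    (h : RingHom.ker φ = RingHom.ker ψ) : φ = ψ := by
  ext x
  obtain ⟨n, hn⟩ := ZMod.intCast_surjective (φ x)
  have h1 : x - (n : O) ∈ RingHom.ker φ := by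
    rw [RingHom.mem_ker, map_sub, map_intCast, hn, sub_self]
  rw [h, RingHom.mem_ker, map_sub, map_intCast, hn, sub_eq_zero] at h1
  exact h1.symm

theorem absNorm_ker {K : Type*} [Field K] [NumberField K] {p : ℕ} [hp : Fact p.Prime]
    (φ : 𝓞 K →+* ZMod p) : Ideal.absNorm (RingHom.ker φ) = p ∧ Prime (RingHom.ker φ) := by
  have hsurj : Function.Surjective φ := fun y => by
    obtain ⟨n, hn⟩ := ZMod.intCast_surjective y
    exact ⟨n, by rw [map_intCast, hn]⟩
  have e : Ideal.absNorm (RingHom.ker φ) = p := by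
    rw [Ideal.absNorm_apply, Submodule.cardQuot_apply]
    rw [Nat.card_congr (RingHom.quotientKerEquivOfSurjective hsurj).toEquiv, Nat.card_zmod]
  refine ⟨e, Ideal.prime_of_isPrime (fun h => ?_) (RingHom.ker_isPrime φ)⟩
  rw [h, Ideal.absNorm_bot] at e
  exact hp.out.ne_zero e.symm

theorem le_log_one_add {x : ℝ} (hx : 0 ≤ x) : x - x ^ 2 ≤ Real.log (1 + x) := by
  refine le_trans ?_ (Real.le_log_one_add_of_nonneg hx)
  rw [le_div_iff₀ (by linarith)]
  nlinarith [pow_nonneg hx 3, sq_nonneg x]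

end PrimeSum
end FourthMoment

namespace FourthMoment
namespace PrimeSum

open Filter Topology NumberField Polynomial

theorem exists_mul_mem_adjoin {K : Type*} [Field K] [CharZero K] [Algebra ℚ K] (θ : 𝓞 K)
    (B : PowerBasis ℚ K) (hB : B.gen = algebraMap (𝓞 K) K θ) :
    ∃ c : ℤ, c ≠ 0 ∧ ∀ x : 𝓞 K, ∃ g : ℤ[X], (c : 𝓞 K) * x = aeval θ g := by
  have hint : IsIntegral ℤ B.gen := hB ▸ RingOfIntegers.isIntegral_coe θ
  have := B.finite
  have hd0 := Algebra.discr_not_zero_of_basis ℚ B.basis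
  have hdint : IsIntegral ℤ (Algebra.discr ℚ B.basis) := by
    refine Algebra.discr_isIntegral ℚ fun i => ?_
    rw [B.basis_eq_pow]
    exact hint.pow _
  obtain ⟨c, hc⟩ := IsIntegrallyClosed.isIntegral_iff.mp hdint
  refine ⟨c, ?_, fun x => ?_⟩
  · rintro rfl
    exact hd0 (by rw [← hc]; simp)
  · have h1 := Algebra.discr_mul_isIntegral_mem_adjoin (R := ℤ) ℚ (B := B) hint
      (RingOfIntegers.isIntegral_coe x)
    rw [Algebra.adjoin_singleton_eq_range_aeval] at h1
    obtain ⟨g, hg⟩ := h1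
    refine ⟨g, RingOfIntegers.coe_injective ?_⟩
    rw [← aeval_algebraMap_apply, ← hB]
    refine Eq.trans ?_ hg.symm
    rw [← hc, map_mul, Algebra.smul_def]
    simp

/-- The data of a number field generated by a root of a monic irreducible integer polynomial. -/
theorem exists_numberField (f : ℤ[X]) (hf : f.Monic)
    (hirr : Irreducible (f.map (Int.castRingHom ℚ))) :
    ∃ (K : Type) (_ : Field K) (_ : NumberField K) (θ : 𝓞 K) (c : ℤ), c ≠ 0 ∧
      (∀ g : ℤ[X], aeval θ g = 0 → f ∣ g) ∧ ∀ x : 𝓞 K, ∃ g : ℤ[X], (c : 𝓞 K) * x = aeval θ g := by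
  have := Fact.mk hirr
  set F := f.map (Int.castRingHom ℚ) with hF
  have hfd : FiniteDimensional ℚ (AdjoinRoot F) := (AdjoinRoot.powerBasis hirr.ne_zero).finite
  have hchar : CharZero (AdjoinRoot F) := algebraRat.charZero _
  have hnf : NumberField (AdjoinRoot F) := { }
  have hev : ∀ g : ℤ[X], aeval (AdjoinRoot.root F) g = AdjoinRoot.mk F (g.map (Int.castRingHom ℚ)) :=
    fun g => by
      rw [← AdjoinRoot.aeval_eq, ← algebraMap_int_eq, aeval_map_algebraMap]
  have hint : IsIntegral ℤ (AdjoinRoot.root F) := by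
    refine ⟨f, hf, ?_⟩
    have := hev f
    rw [← hF, AdjoinRoot.mk_self] at this
    exact this
  obtain ⟨θ, hθ⟩ : ∃ θ : 𝓞 (AdjoinRoot F), algebraMap (𝓞 (AdjoinRoot F)) (AdjoinRoot F) θ =
    AdjoinRoot.root F := ⟨⟨_, hint⟩, rfl⟩
  obtain ⟨c, hc0, hc⟩ := exists_mul_mem_adjoin θ (AdjoinRoot.powerBasis hirr.ne_zero)
    ((AdjoinRoot.powerBasis_gen _).trans hθ.symm)
  refine ⟨AdjoinRoot F, inferInstance, hnf, θ, c, hc0, fun g hg => ?_, hc⟩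
  have h1 : aeval (AdjoinRoot.root F) g = 0 := by
    have := congrArg (algebraMap (𝓞 (AdjoinRoot F)) (AdjoinRoot F)) hg
    rw [← aeval_algebraMap_apply, map_zero, hθ] at this
    exact this
  rw [hev, AdjoinRoot.mk_eq_zero] at h1
  exact (Polynomial.map_dvd_map (Int.castRingHom ℚ) Int.cast_injective hf).mp h1

/-- The kernels of the homomorphisms to `ZMod p` extending the roots modulo `p`. -/
theorem exists_primes_of_roots {K : Type*} [Field K] [NumberField K] {θ : 𝓞 K} {f : ℤ[X]}
    (hf : ∀ g : ℤ[X], aeval θ g = 0 → f ∣ g) {c : ℤ}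
    (hc : ∀ x : 𝓞 K, ∃ g : ℤ[X], (c : 𝓞 K) * x = aeval θ g) {p : ℕ} (hp : p.Prime)
    (hpc : ¬ (p : ℤ) ∣ c) : ∃ S : Finset (Ideal (𝓞 K)), S.card = rootCount f p ∧
      ∀ I ∈ S, Prime I ∧ Ideal.absNorm I = p := by
  classical
  have := Fact.mk hp
  choose φ hφ using fun a : {a : ZMod p // f.eval₂ (Int.castRingHom (ZMod p)) a = 0} =>
    exists_ringHom hf hc hp hpc a.2
  refine ⟨Finset.univ.image fun a => RingHom.ker (φ a), ?_, fun I hI => ?_⟩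
  · rw [Finset.card_image_of_injective, Finset.card_univ, rootCount, Nat.card_eq_fintype_card]
    intro a b h
    exact Subtype.ext (by rw [← hφ a, ← hφ b, ringHom_eq_of_ker_eq h])
  · obtain ⟨a, -, rfl⟩ := Finset.mem_image.mp hI
    exact (absNorm_ker (φ a)).symm

theorem exists_sum_rootCount_le (f : ℤ[X]) (hf : f.Monic)
    (hirr : Irreducible (f.map (Int.castRingHom ℚ))) :
    ∃ C : ℝ, ∀ᶠ s in 𝓝[>] (1 : ℝ), ∀ P : Finset Nat.Primes,
      ∑ p ∈ P, (rootCount f p : ℝ) * ((p : ℕ) : ℝ) ^ (-s) ≤ Real.log (1 / (s - 1)) + C := by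
  classical
  obtain ⟨K, _, _, θ, c, hc0, hdvd, hc⟩ := exists_numberField f hf hirr
  obtain ⟨C, hC⟩ := exists_sum_log_le K
  set n : ℝ := (f.natDegree : ℝ) with hn
  set C₂ := ∑' p : Nat.Primes, ((p : ℕ) : ℝ) ^ (-2 : ℝ) with hC₂
  have hs2 : Summable fun p : Nat.Primes => ((p : ℕ) : ℝ) ^ (-2 : ℝ) := summable_primes (by norm_num)
  refine ⟨C + n * C₂ + c.natAbs.primeFactors.card * n, ?_⟩
  filter_upwards [hC, self_mem_nhdsWithin] with s hs hs1 P
  have hs1 : 1 < s := hs1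
  have hcount : ∀ p : Nat.Primes, (rootCount f p : ℝ) ≤ n := fun p => by
    rw [hn]
    exact_mod_cast rootCount_le hf p.2
  rw [← Finset.sum_filter_add_sum_filter_not P (fun p : Nat.Primes => ((p : ℕ) : ℤ) ∣ c), add_comm]
  refine add_le_add (b := Real.log (1 / (s - 1)) + (C + n * C₂))
    (d := c.natAbs.primeFactors.card * n) ?_ ?_ |>.trans (by linarith)
  · set Q := P.filter (fun p : Nat.Primes => ¬ ((p : ℕ) : ℤ) ∣ c) with hQ
    have hex : ∀ p : Nat.Primes, ∃ S : Finset (Ideal (𝓞 K)), p ∈ Q →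
        S.card = rootCount f p ∧ ∀ I ∈ S, Prime I ∧ Ideal.absNorm I = p := fun p => by
      by_cases h : p ∈ Q
      · obtain ⟨S, hS⟩ := exists_primes_of_roots hdvd hc p.2 (Finset.mem_filter.mp h).2
        exact ⟨S, fun _ => hS⟩
      · exact ⟨∅, fun h' => absurd h' h⟩
    choose S hS using hex
    have hdisj : Set.PairwiseDisjoint (Q : Set Nat.Primes) S := by
      intro p hp q hq hpq
      rw [Function.onFun, Finset.disjoint_left]
      intro I hI hI'
      exact hpq (Subtype.ext (((hS p hp).2 I hI).2.symm.trans ((hS q hq).2 I hI').2))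
    have h1 := hs (Q.biUnion S) (fun I hI => by
      obtain ⟨p, hp, hI⟩ := Finset.mem_biUnion.mp hI
      exact ((hS p hp).2 I hI).1)
    rw [Finset.sum_biUnion hdisj] at h1
    have h2 : ∀ p ∈ Q, ∑ I ∈ S p, Real.log (1 + (Ideal.absNorm I : ℝ) ^ (-s)) =
        rootCount f p * Real.log (1 + ((p : ℕ) : ℝ) ^ (-s)) := fun p hp => by
      rw [Finset.sum_congr rfl (g := fun _ => Real.log (1 + ((p : ℕ) : ℝ) ^ (-s)))
        (fun I hI => by rw [((hS p hp).2 I hI).2]), Finset.sum_const, (hS p hp).1, nsmul_eq_mul]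
    rw [Finset.sum_congr rfl h2] at h1
    have h3 : ∑ p ∈ Q, (rootCount f p : ℝ) * ((p : ℕ) : ℝ) ^ (-s) ≤
        ∑ p ∈ Q, (rootCount f p * Real.log (1 + ((p : ℕ) : ℝ) ^ (-s)) +
          n * ((p : ℕ) : ℝ) ^ (-2 : ℝ)) := Finset.sum_le_sum fun p _ => by
      have h4 := le_log_one_add (x := ((p : ℕ) : ℝ) ^ (-s)) (by positivity)
      have h5 := rpow_neg_sq_le p hs1
      have h6 := hcount p
      have h7 : (0 : ℝ) ≤ rootCount f p := by positivity
      calc (rootCount f p : ℝ) * ((p : ℕ) : ℝ) ^ (-s)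
          ≤ rootCount f p * (Real.log (1 + ((p : ℕ) : ℝ) ^ (-s)) + ((p : ℕ) : ℝ) ^ (-2 : ℝ)) :=
            mul_le_mul_of_nonneg_left (by linarith) h7
        _ ≤ _ := by
            rw [mul_add]
            gcongr
    have h4 : ∑ p ∈ Q, ((p : ℕ) : ℝ) ^ (-2 : ℝ) ≤ C₂ := hs2.sum_le_tsum _ (fun p _ => by positivity)
    rw [Finset.sum_add_distrib, ← Finset.mul_sum] at h3
    have h5 := mul_le_mul_of_nonneg_left h4 (show 0 ≤ n by positivity)
    linarith
  · calc _ ≤ ∑ p ∈ P.filter (fun p : Nat.Primes => ((p : ℕ) : ℤ) ∣ c), n := by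
          refine Finset.sum_le_sum fun p _ => ?_
          refine (mul_le_of_le_one_right (by positivity) ?_).trans (hcount p)
          exact (rpow_neg_le_half p hs1).trans (by norm_num)
      _ = (P.filter (fun p : Nat.Primes => ((p : ℕ) : ℤ) ∣ c)).card * n := by
          rw [Finset.sum_const, nsmul_eq_mul]
      _ ≤ _ := by
          refine mul_le_mul_of_nonneg_right ?_ (by positivity)
          rw [Nat.cast_le]
          refine Finset.card_le_card_of_injOn (fun p => (p : ℕ)) ?_ ?_
          · intro p hp
            simp only [Finset.coe_filter, Set.mem_ofPred_eq] at hp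
            simp only [Finset.mem_coe, Nat.mem_primeFactors]
            exact ⟨p.2, Int.natCast_dvd.mp hp.2, by simpa using hc0⟩
          · intro p _ q _ h
            exact Subtype.ext h

end PrimeSum
end FourthMoment

namespace FourthMoment
namespace PrimeSum

open Filter Topology NumberField Polynomial

theorem tsum_le_tsum_of_finset {s : ℝ} (hs : 1 < s) {f g : Nat.Primes → ℝ} {A B : ℝ}
    (hf : ∀ p, |f p| ≤ A) (hg : ∀ p, |g p| ≤ B) (T : Finset Nat.Primes) (h : ∀ p ∉ T, f p ≤ g p) :
    ∑' p : Nat.Primes, f p * ((p : ℕ) : ℝ) ^ (-s) ≤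
      ∑' p : Nat.Primes, g p * ((p : ℕ) : ℝ) ^ (-s) + T.card * (A + B) := by
  classical
  set e : Nat.Primes → ℝ := fun p => if p ∈ T then A + B else 0 with he
  have he0 : ∀ p ∉ T, e p = 0 := fun p hp => if_neg hp
  have h1 : ∑' p, e p = T.card * (A + B) := by
    rw [tsum_eq_sum he0, Finset.sum_congr rfl (g := fun _ => A + B) (fun p hp => if_pos hp),
      Finset.sum_const, nsmul_eq_mul]
  have hse : Summable e := summable_of_ne_finset_zero he0
  rw [← h1, ← (summable_mul_of_bounded hs hg).tsum_add hse]
  refine (summable_mul_of_bounded hs hf).tsum_le_tsum (fun p => ?_)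
    ((summable_mul_of_bounded hs hg).add hse)
  have h2 := abs_le.mp (hf p)
  have h3 := abs_le.mp (hg p)
  have h4 : (0 : ℝ) ≤ ((p : ℕ) : ℝ) ^ (-s) := by positivity
  have h5 : ((p : ℕ) : ℝ) ^ (-s) ≤ 1 := (rpow_neg_le_half p hs).trans (by norm_num)
  by_cases hp : p ∈ T
  · have : e p = A + B := if_pos hp
    rw [this]
    nlinarith
  · rw [he0 p hp, add_zero]
    exact mul_le_mul_of_nonneg_right (h p hp) h4

theorem abs_jacobiSym_le (a : ℤ) (b : ℕ) : |(jacobiSym a b : ℝ)| ≤ 1 := by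
  rcases jacobiSym.trichotomy a b with h | h | h <;> rw [h] <;> norm_num

theorem rootCount_sq_add {k p : ℕ} (hp : p.Prime) (hp2 : p ≠ 2) :
    (rootCount (X ^ 2 + C (k : ℤ)) p : ℤ) = jacobiSym (-k) p + 1 := by
  have := Fact.mk hp
  rw [← jacobiSym.legendreSym.to_jacobiSym, ← legendreSym.card_sqrts p hp2, ← Set.ncard_eq_toFinset_card',
    rootCount]
  congr 1
  change Set.ncard {a : ZMod p | _} = _
  congr 1
  ext a
  simp [eval₂_add, eq_neg_iff_add_eq_zero]

theorem exists_tsum_jacobiSym_neg_le (k : ℕ) (hk : 0 < k) : ∃ C : ℝ, ∀ᶠ s in 𝓝[>] (1 : ℝ),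
    ∑' p : Nat.Primes, (jacobiSym (-k) p : ℝ) * ((p : ℕ) : ℝ) ^ (-s) ≤ C := by
  have hm : (X ^ 2 + C (k : ℤ)).Monic := monic_X_pow_add_C _ two_ne_zero
  have hirr : Irreducible ((X ^ 2 + C (k : ℤ)).map (Int.castRingHom ℚ)) := by
    have e : (X ^ 2 + C (k : ℤ)).map (Int.castRingHom ℚ) = X ^ 2 + C (k : ℚ) := by simp
    rw [e]
    refine irreducible_of_degree_le_three_of_not_isRoot ?_ fun x => ?_
    · rw [natDegree_X_pow_add_C]; decide
    · simp only [IsRoot.def, eval_add, eval_pow, eval_X, eval_C]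
      have : (0 : ℚ) < k := by exact_mod_cast hk
      positivity
  obtain ⟨C₁, h1⟩ := exists_sum_rootCount_le _ hm hirr
  obtain ⟨C₂, h2⟩ := exists_log_le_tsum
  refine ⟨C₁ + C₂ + 4, ?_⟩
  filter_upwards [h1, h2, self_mem_nhdsWithin] with s h1 h2 hs
  have hs : 1 < s := hs
  let two : Nat.Primes := ⟨2, Nat.prime_two⟩
  have hbd : ∀ p : Nat.Primes, |(rootCount (X ^ 2 + C (k : ℤ)) p : ℝ)| ≤ 2 := fun p => by
    rw [Nat.abs_cast]
    have := rootCount_le hm p.2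
    rw [natDegree_X_pow_add_C] at this
    exact_mod_cast this
  have hJ := fun p : Nat.Primes => abs_jacobiSym_le (-k) p
  have hJ1 : ∀ p : Nat.Primes, |(jacobiSym (-k) p : ℝ) + 1| ≤ 2 := fun p =>
    (abs_add_le _ _).trans (by have := hJ p; rw [abs_one]; linarith)
  have h3 := tsum_le_tsum_of_finset hs hJ1 hbd ({two} : Finset Nat.Primes) (fun p hp => by
    have hp2 : (p : ℕ) ≠ 2 := fun h => hp (Finset.mem_singleton.mpr (Subtype.ext h))
    have := rootCount_sq_add (k := k) p.2 hp2
    have : (rootCount (X ^ 2 + C (k : ℤ)) p : ℝ) = jacobiSym (-k) p + 1 := by exact_mod_cast this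
    exact this.ge)
  have h4 := (summable_mul_of_bounded hs hbd).tsum_le_of_sum_le h1
  have h5 : ∑' p : Nat.Primes, ((jacobiSym (-k) p : ℝ) + 1) * ((p : ℕ) : ℝ) ^ (-s) =
      ∑' p : Nat.Primes, (jacobiSym (-k) p : ℝ) * ((p : ℕ) : ℝ) ^ (-s) +
        ∑' p : Nat.Primes, ((p : ℕ) : ℝ) ^ (-s) := by
    rw [← (summable_mul_of_bounded hs hJ).tsum_add (summable_primes hs)]
    refine tsum_congr fun p => by ring
  rw [h5, Finset.card_singleton] at h3
  push_cast at h3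
  linarith

/-- The Dirichlet character `n ↦ (k / n)` modulo `4 * k`. -/
theorem exists_dirichletCharacter (k : ℕ) (hk : 0 < k) : ∃ χ : DirichletCharacter ℂ (4 * k),
    ∀ p : ℕ, p.Prime → p ≠ 2 → χ p = (jacobiSym k p : ℂ) := by
  classical
  have hne : NeZero (4 * k) := ⟨by omega⟩
  have h1 : Fact (1 < 4 * k) := ⟨by omega⟩
  have hodd : ∀ x : ZMod (4 * k), IsUnit x → Nat.Coprime x.val (4 * k) := fun x hx =>
    (ZMod.isUnit_iff_coprime _ _).mp (by rwa [ZMod.natCast_zmod_val])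
  have hodd' : ∀ n : ℕ, Nat.Coprime n (4 * k) → Odd n := fun n h => by
    rw [← Nat.not_even_iff_odd, even_iff_two_dvd]
    intro h2
    have := Nat.dvd_gcd h2 (show 2 ∣ 4 * k from ⟨2 * k, by ring⟩)
    rw [h] at this
    omega
  let χ : MulChar (ZMod (4 * k)) ℂ :=
    { toFun := fun x => if IsUnit x then (jacobiSym k x.val : ℂ) else 0
      map_one' := by
        rw [if_pos isUnit_one, ZMod.val_one, jacobiSym.one_right, Int.cast_one]
      map_mul' := fun x y => by
        by_cases hx : IsUnit x
        · by_cases hy : IsUnit y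
          · rw [if_pos hx, if_pos hy, if_pos (hx.mul hy), ZMod.val_mul]
            have hx' := hodd' _ (hodd x hx)
            have hy' := hodd' _ (hodd y hy)
            have := jacobiSym.mod_right' k (hx'.mul hy')
            rw [← this, jacobiSym.mul_right' _ hx'.pos.ne' hy'.pos.ne']
            push_cast
            rfl
          · rw [if_neg hy, if_neg (fun h => hy (isUnit_of_mul_isUnit_right h)), mul_zero]
        · rw [if_neg hx, if_neg (fun h => hx (isUnit_of_mul_isUnit_left h)), zero_mul]
      map_nonunit' := fun x hx => if_neg hx }
  refine ⟨χ, fun p hp hp2 => ?_⟩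
  change (if IsUnit ((p : ℕ) : ZMod (4 * k)) then _ else _) = _
  have hpo : Odd p := hp.odd_of_ne_two hp2
  split_ifs with h
  · rw [ZMod.val_natCast, ← jacobiSym.mod_right' k hpo]
  · rw [ZMod.isUnit_iff_coprime] at h
    have : p ∣ 4 * k := by
      by_contra h'
      exact h ((Nat.Prime.coprime_iff_not_dvd hp).mpr h')
    have hpk : p ∣ k := (hp.dvd_mul.mp this).resolve_left fun h4 => by
      have : p ∣ 2 ^ 2 := h4
      exact hp2 ((Nat.prime_dvd_prime_iff_eq hp Nat.prime_two).mp (hp.dvd_of_dvd_pow this))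
    have : jacobiSym k p = 0 := by
      rw [jacobiSym.eq_zero_iff]
      refine ⟨hp.ne_zero, fun h1 => ?_⟩
      rw [Int.gcd_natCast_natCast] at h1
      exact hp.one_lt.ne' (Nat.dvd_one.mp (h1 ▸ Nat.dvd_gcd hpk dvd_rfl))
    rw [this, Int.cast_zero]

theorem exists_le_tsum_jacobiSym (k : ℕ) (hk : 0 < k) : ∃ C : ℝ, ∀ᶠ s in 𝓝[>] (1 : ℝ),
    -C ≤ ∑' p : Nat.Primes, (jacobiSym k p : ℝ) * ((p : ℕ) : ℝ) ^ (-s) := by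
  have hne : NeZero (4 * k) := ⟨by omega⟩
  obtain ⟨χ, hχ⟩ := exists_dirichletCharacter k hk
  obtain ⟨C, hC⟩ := exists_le_tsum_char χ
  refine ⟨C + 2, ?_⟩
  filter_upwards [hC, self_mem_nhdsWithin] with s h1 hs
  have hs : 1 < s := hs
  let two : Nat.Primes := ⟨2, Nat.prime_two⟩
  have h3 := tsum_le_tsum_of_finset hs (f := fun p => (χ (p : ℕ)).re) (A := 1)
    (fun p => (Complex.abs_re_le_norm _).trans (χ.norm_le_one _))
    (fun p : Nat.Primes => abs_jacobiSym_le k p) ({two} : Finset Nat.Primes) (fun p hp => by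
      have hp2 : (p : ℕ) ≠ 2 := fun h => hp (Finset.mem_singleton.mpr (Subtype.ext h))
      change (χ ((p : ℕ) : ZMod (4 * k))).re ≤ _
      rw [hχ p p.2 hp2, Complex.intCast_re])
  rw [Finset.card_singleton] at h3
  push_cast at h3
  linarith

end PrimeSum
end FourthMoment

namespace FourthMoment
namespace PrimeSum

open Filter Topology NumberField Polynomial

section Local

variable {p : ℕ} [Fact p.Prime] {k : Type*} [Field k] [CharP k p]

theorem exists_castHom_eq {x : k} (hx : x ^ p = x) : ∃ a : ZMod p, ZMod.castHom dvd_rfl k a = x := by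
  classical
  have hp : p.Prime := Fact.out
  have h0 : (X ^ p - X : k[X]) ≠ 0 := FiniteField.X_pow_card_sub_X_ne_zero k hp.one_lt
  have hinj : Function.Injective (ZMod.castHom (dvd_refl p) k) := (ZMod.castHom dvd_rfl k).injective
  by_contra! h
  have h1 : insert x (Finset.univ.image (ZMod.castHom (dvd_refl p) k)) ⊆
      (X ^ p - X : k[X]).roots.toFinset := by
    intro y hy
    rw [Multiset.mem_toFinset, mem_roots h0, IsRoot.def, eval_sub, eval_pow, eval_X, sub_eq_zero]
    rcases Finset.mem_insert.mp hy with rfl | hy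
    · exact hx
    · obtain ⟨a, -, rfl⟩ := Finset.mem_image.mp hy
      rw [← map_pow, ZMod.pow_card]
  have h2 := Finset.card_le_card h1
  rw [Finset.card_insert_of_notMem (by simpa using h), Finset.card_image_of_injective _ hinj,
    Finset.card_univ, ZMod.card] at h2
  have h3 := (Multiset.toFinset_card_le _).trans (card_roots' (X ^ p - X : k[X]))
  rw [FiniteField.X_pow_card_sub_X_natDegree_eq k hp.one_lt] at h3
  omega

/-- The cubic with roots `y + z`, where `y ^ 3`, `z ^ 3` are `U ± V * √(-d)` and `y * z = n`. -/
noncomputable def cubic (n U : ℤ) : ℤ[X] := X ^ 3 - C (3 * n) * X - C (2 * U)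

theorem eval₂_cubic {R : Type*} [CommRing R] (n U : ℤ) (f : ℤ →+* R) (x : R) :
    (cubic n U).eval₂ f x = x ^ 3 - 3 * n * x - 2 * U := by
  simp only [cubic, eval₂_sub, eval₂_mul, eval₂_pow, eval₂_X, eval₂_C, map_mul]
  simp

theorem cubic_eval_eq {R : Type*} [CommRing R] {n U y z : R} (h : y ^ 3 + z ^ 3 = 2 * U)
    (hyz : y * z = n) : (y + z) ^ 3 - 3 * n * (y + z) - 2 * U = 0 := by
  linear_combination h + 3 * (y + z) * hyz

theorem card_le_rootCount {n U : ℤ} (S : Finset k)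
    (hS : ∀ x ∈ S, x ^ p = x ∧ x ^ 3 - 3 * n * x - 2 * U = 0) : S.card ≤ rootCount (cubic n U) p := by
  classical
  choose g hg using fun x : S => exists_castHom_eq (p := p) (hS x.1 x.2).1
  have hroot : ∀ x : S, (cubic n U).eval₂ (Int.castRingHom (ZMod p)) (g x) = 0 := fun x => by
    refine (ZMod.castHom dvd_rfl k).injective ?_
    rw [eval₂_cubic, map_zero, ← (hS x.1 x.2).2, ← hg x]
    simp only [map_sub, map_mul, map_pow, map_ofNat, map_intCast]
  have hinj : Function.Injective fun x : S =>
      (⟨g x, hroot x⟩ : {a : ZMod p // (cubic n U).eval₂ (Int.castRingHom (ZMod p)) a = 0}) := by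
    intro x y hxy
    refine Subtype.ext ?_
    have h := congrArg Subtype.val hxy
    dsimp only at h
    rw [← hg x, ← hg y, h]
  have := Nat.card_le_card_of_injective _ hinj
  rwa [Nat.card_eq_fintype_card, Fintype.card_coe] at this

omit [Fact p.Prime] [CharP k p] in
theorem eq_of_pow_three_eq (hp3 : p % 3 = 2) {a b : k} (ha : a ^ p = a) (hb : b ^ p = b)
    (h : a ^ 3 = b ^ 3) : a = b := by
  have key : ∀ x : k, x ^ p = x → x = (x ^ 3) ^ ((2 * p - 1) / 3) := fun x hx => by
    have e : 3 * ((2 * p - 1) / 3) = p + (p - 1) := by omega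
    rw [← pow_mul, e, pow_add, hx, ← pow_succ', Nat.sub_add_cancel (by omega), hx]
  rw [key a ha, key b hb, h]

theorem intCast_pow_char (n : ℤ) : (n : k) ^ p = n := by
  have := map_intCast (frobenius k p) n
  rwa [frobenius_def] at this

theorem three_le_rootCount {d : ℕ} {U V n r : ℤ} (hnorm : U ^ 2 + d * V ^ 2 = n ^ 3)
    (hp2 : p ≠ 2) (hp3 : p % 3 = 2) (hn : ¬ (p : ℤ) ∣ n) (hV : ¬ (p : ℤ) ∣ V) (hd : ¬ (p : ℤ) ∣ d)
    (hr : (p : ℤ) ∣ r ^ 2 - 3 * d) [IsAlgClosed k] (φ : Eis →+* k)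
    (hφ : φ ((-(V * r) : ℤ) + (U : ℤ) * Eis.theta) ^ ((p ^ 2 - 1) / 3) = 1) :
    3 ≤ rootCount (cubic n U) p := by
  classical
  have hp : p.Prime := Fact.out
  have hcast : ∀ m : ℤ, ¬ (p : ℤ) ∣ m → (m : k) ≠ 0 := fun m hm h =>
    hm ((CharP.intCast_eq_zero_iff k p m).mp h)
  have hn0 := hcast n hn
  have hV0 := hcast V hV
  have h2 : (2 : k) ≠ 0 := by
    have := hcast 2 (fun h => hp2 ((Nat.prime_dvd_prime_iff_eq hp Nat.prime_two).mp
      (by exact_mod_cast h)))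
    simpa using this
  have h3 : (3 : k) ≠ 0 := by
    have := hcast 3 (fun h => by
      have := (Nat.prime_dvd_prime_iff_eq hp Nat.prime_three).mp (by exact_mod_cast h)
      omega)
    simpa using this
  set θ := φ Eis.theta with hθ
  have hθ2 : θ ^ 2 = -3 := by rw [hθ, ← map_pow, Eis.theta_sq, map_neg, map_ofNat]
  have hθ0 : θ ≠ 0 := by
    intro h
    rw [h] at hθ2
    apply h3
    linear_combination hθ2
  have hθp : θ ^ p = -θ := by
    rw [hθ, Eis.map_pow_char φ hp hp3, Eis.star_theta, map_neg]
  have hr2 : (r : k) ^ 2 = 3 * d := by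
    have := (CharP.intCast_eq_zero_iff k p _).mpr hr
    push_cast at this
    linear_combination this
  set δ := -(r : k) / θ with hδ
  have hδθ : δ * θ = -r := by rw [hδ]; field_simp
  have hδ2 : δ ^ 2 = -d := by
    have : θ ^ 2 * (δ ^ 2 + d) = 0 := by
      linear_combination (δ * θ - r) * hδθ + hr2 + d * hθ2
    have := (mul_eq_zero.mp this).resolve_left (pow_ne_zero 2 hθ0)
    linear_combination this
  have hδp : δ ^ p = -δ := by
    rw [hδ, div_pow, hθp]
    have := intCast_pow_char (p := p) (k := k) (-r)
    push_cast at this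
    rw [this]
    field_simp
  have hδ0 : δ ≠ 0 := by
    intro h
    rw [h] at hδ2
    refine hcast d hd ?_
    push_cast
    linear_combination hδ2
  set α := (U : k) + V * δ with hα
  set β := (U : k) - V * δ with hβ
  have hαβ : α * β = (n : k) ^ 3 := by
    have : ((U ^ 2 + d * V ^ 2 : ℤ) : k) = ((n ^ 3 : ℤ) : k) := by rw [hnorm]
    push_cast at this
    rw [hα, hβ]
    linear_combination this - (V : k) ^ 2 * hδ2
  have hαβne : α ≠ β := by
    intro h
    have : 2 * ((V : k) * δ) = 0 := by
      rw [hα, hβ] at h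
      linear_combination h
    exact mul_ne_zero h2 (mul_ne_zero hV0 hδ0) this
  have hαp : α ^ p = β := by
    rw [hα, hβ, add_pow_char, mul_pow, intCast_pow_char, intCast_pow_char, hδp]
    ring
  have h6 : 3 ∣ p ^ 2 - 1 := Eis.three_dvd_sq_sub_one hp (by rintro rfl; omega)
  have hα1 : α ^ ((p ^ 2 - 1) / 3) = 1 := by
    have e1 : φ ((-(V * r) : ℤ) + (U : ℤ) * Eis.theta) = α * θ := by
      rw [map_add, map_mul, map_intCast, map_intCast, ← hθ, hα]
      push_cast
      linear_combination -(V : k) * hδθ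
    have e2 : θ ^ ((p ^ 2 - 1) / 3) = 1 := by
      have hodd : p % 2 = 1 := (hp.eq_two_or_odd).resolve_left hp2
      obtain ⟨j, rfl⟩ : ∃ j, p = 6 * j + 5 := ⟨p / 6, by omega⟩
      have : ((6 * j + 5) ^ 2 - 1) / 3 = 2 * ((6 * j + 4) * (2 * (j + 1))) / 2 := by
        have : (6 * j + 5) ^ 2 - 1 = 3 * ((6 * j + 4) * (2 * (j + 1))) := by
          rw [Nat.sub_eq_iff_eq_add (Nat.one_le_pow _ _ (by omega))]; ring
        omega
      have e3 : ((6 * j + 5) ^ 2 - 1) / 3 = 2 * ((6 * j + 4) * (j + 1)) := by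
        rw [this]
        have : 2 * ((6 * j + 4) * (2 * (j + 1))) = 2 * (2 * ((6 * j + 4) * (j + 1))) := by ring
        omega
      have h31 : ((-3 : ℤ) : k) ^ (6 * j + 4) = 1 := by
        have h := intCast_pow_char (p := 6 * j + 5) (k := k) (-3)
        refine mul_right_cancel₀ (b := ((-3 : ℤ) : k)) (by simpa using h3) ?_
        rw [← pow_succ, h, one_mul]
      rw [e3, pow_mul, hθ2, pow_mul]
      push_cast at h31
      rw [h31, one_pow]
    rw [e1, mul_pow, e2, mul_one] at hφ
    exact hφ
  have key : ∀ y : k, y ^ 3 = α → (y + y ^ p) ^ p = y + y ^ p ∧ y * y ^ p = n := fun y hy => by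
    have h1 : (y ^ p) ^ p = y := by
      rw [← pow_mul, ← pow_two, ← Nat.sub_add_cancel (Nat.one_le_pow 2 p hp.pos), pow_succ,
        ← Nat.mul_div_cancel' h6, pow_mul, hy, hα1, one_mul]
    refine ⟨by rw [add_pow_char, h1, add_comm], eq_of_pow_three_eq hp3 ?_ (intCast_pow_char n) ?_⟩
    · rw [mul_pow, h1, mul_comm]
    · rw [mul_pow, ← pow_mul, mul_comm p 3, pow_mul, hy, hαp, hαβ]
  obtain ⟨y, hy⟩ := IsAlgClosed.exists_pow_nat_eq α (n := 3) (by norm_num)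
  have hy0 : y ≠ 0 := by
    rintro rfl
    have : (n : k) ^ 3 = 0 := by rw [← hαβ, ← hy]; ring
    exact hn0 (pow_eq_zero_iff three_ne_zero |>.mp this)
  have hinj : ∀ y₁ y₂ : k, y₁ ^ 3 = α → y₂ ^ 3 = α → y₁ + y₁ ^ p = y₂ + y₂ ^ p → y₁ = y₂ := by
    intro y₁ y₂ h₁ h₂ h
    have h4 := (key y₁ h₁).2
    have h5 := (key y₂ h₂).2
    have : (y₁ - y₂) * (y₁ - y₂ ^ p) = 0 := by linear_combination y₁ * h - h4 + h5
    rcases mul_eq_zero.mp this with h7 | h7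
    · exact sub_eq_zero.mp h7
    · exfalso
      apply hαβne
      rw [← hαp, ← h₂, ← pow_mul, mul_comm 3 p, pow_mul, ← sub_eq_zero.mp h7, h₁, h₂]
  have hprim : IsPrimitiveRoot (φ Eis.om) 3 := by
    refine ⟨by rw [← map_pow, Eis.om_pow_three, map_one], fun l hl => ?_⟩
    rw [Nat.dvd_iff_mod_eq_zero]
    have h1 : Eis.om ^ l = Eis.om ^ (l % 3) := pow_eq_pow_mod l Eis.om_pow_three
    have h2 : Eis.om ^ l = 1 := Eis.eq_of_map_eq φ hp (by rintro rfl; omega)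
      (by rw [← pow_mul, mul_comm, pow_mul, Eis.om_pow_three, one_pow]) (one_pow 3)
      (by rw [map_pow, hl, map_one])
    exact Nat.dvd_iff_mod_eq_zero.mp (Eis.isPrimitiveRoot_om.dvd_of_pow_eq_one l h2)
  set Y : Finset k := (Finset.range 3).image (fun i => φ Eis.om ^ i * y) with hY
  have hYc : Y.card = 3 := by
    rw [hY, Finset.card_image_of_injOn, Finset.card_range]
    intro i hi j hj hij
    exact hprim.pow_inj (Finset.mem_range.mp hi) (Finset.mem_range.mp hj)
      (mul_right_cancel₀ hy0 hij)
  have hY3 : ∀ x ∈ Y, x ^ 3 = α := by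
    intro x hx
    obtain ⟨i, -, rfl⟩ := Finset.mem_image.mp hx
    rw [mul_pow, ← pow_mul, mul_comm i 3, pow_mul, hprim.pow_eq_one, one_pow, one_mul, hy]
  rw [← hYc, ← Finset.card_image_of_injOn (f := fun x => x + x ^ p)
    (fun a ha b hb h => hinj a b (hY3 a ha) (hY3 b hb) h)]
  refine card_le_rootCount _ fun x hx => ?_
  obtain ⟨x, hx', rfl⟩ := Finset.mem_image.mp hx
  replace hx := hx'
  refine ⟨(key x (hY3 x hx)).1, cubic_eval_eq ?_ (key x (hY3 x hx)).2⟩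
  rw [← pow_mul, mul_comm p 3, pow_mul, hY3 x hx, hαp, hα, hβ]
  ring

end Local

end PrimeSum
end FourthMoment

namespace FourthMoment
namespace PrimeSum

open Filter Topology NumberField Polynomial

section Local

variable {p : ℕ} [Fact p.Prime]

omit [Fact p.Prime] in
theorem intCast_ne_zero {k : Type*} [Field k] [CharP k p] {m : ℤ} (hm : ¬ (p : ℤ) ∣ m) :
    (m : k) ≠ 0 := fun h => hm ((CharP.intCast_eq_zero_iff k p m).mp h)

/-- The case where `-d` is a square and cubing is a bijection modulo `p`. -/
theorem one_le_rootCount_of_sq {d : ℕ} {U V n : ℤ} (hnorm : U ^ 2 + d * V ^ 2 = n ^ 3)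
    (hp3 : p % 3 = 2) (hn : ¬ (p : ℤ) ∣ n) (hsq : ∃ δ : ZMod p, δ ^ 2 = -d) :
    1 ≤ rootCount (cubic n U) p := by
  classical
  obtain ⟨δ, hδ⟩ := hsq
  have hn0 : (n : ZMod p) ≠ 0 := intCast_ne_zero hn
  have hαβ : ((U : ZMod p) + V * δ) * (U - V * δ) = (n : ZMod p) ^ 3 := by
    have : ((U ^ 2 + d * V ^ 2 : ℤ) : ZMod p) = ((n ^ 3 : ℤ) : ZMod p) := by rw [hnorm]
    push_cast at this
    linear_combination this - (V : ZMod p) ^ 2 * hδ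
  set α := (U : ZMod p) + V * δ with hα
  set β := (U : ZMod p) - V * δ with hβ
  have hroot : ∀ x : ZMod p, (x ^ ((2 * p - 1) / 3)) ^ 3 = x := fun x => by
    have e : (2 * p - 1) / 3 * 3 = p + (p - 1) := by omega
    rw [← pow_mul, e, pow_add, ZMod.pow_card, ← pow_succ', Nat.sub_add_cancel (by omega),
      ZMod.pow_card]
  have h := card_le_rootCount (p := p) (k := ZMod p) (n := n) (U := U)
    {α ^ ((2 * p - 1) / 3) + β ^ ((2 * p - 1) / 3)} (fun x hx => by
      rw [Finset.mem_singleton] at hx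
      rw [hx]
      refine ⟨ZMod.pow_card _, cubic_eval_eq ?_ ?_⟩
      · rw [hroot, hroot, hα, hβ]; ring
      · refine eq_of_pow_three_eq (p := p) hp3 (ZMod.pow_card _) (ZMod.pow_card _) ?_
        rw [mul_pow, hroot, hroot, hαβ])
  rwa [Finset.card_singleton] at h

/-- The case where `-d` is not a square and `p ≡ 1 (mod 3)`. -/
theorem one_le_rootCount_of_not_sq (k : Type*) [Field k] [CharP k p] [IsAlgClosed k] {d : ℕ} {U V n : ℤ} (hnorm : U ^ 2 + d * V ^ 2 = n ^ 3)
    (hp3 : p % 3 = 1) (hn : ¬ (p : ℤ) ∣ n) (hsq : ¬ ∃ δ : ZMod p, δ ^ 2 = -d) :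
    1 ≤ rootCount (cubic n U) p := by
  classical
  have hp : p.Prime := Fact.out
  have hn0 : (n : k) ≠ 0 := intCast_ne_zero hn
  obtain ⟨δ, hδ⟩ := IsAlgClosed.exists_pow_nat_eq (-(d : k)) (n := 2) (by norm_num)
  have hδp : δ ^ p = -δ := by
    have h1 : (δ ^ p) ^ 2 = δ ^ 2 := by
      rw [← pow_mul, mul_comm, pow_mul, hδ]
      have := intCast_pow_char (p := p) (k := k) (-(d : ℤ))
      push_cast at this
      exact this
    rcases sq_eq_sq_iff_eq_or_eq_neg.mp h1 with h | h
    · exfalso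
      obtain ⟨a, ha⟩ := exists_castHom_eq h
      refine hsq ⟨a, (ZMod.castHom dvd_rfl k).injective ?_⟩
      rw [map_pow, ha, hδ, map_neg, map_natCast]
    · exact h
  have hαβ : ((U : k) + V * δ) * (U - V * δ) = (n : k) ^ 3 := by
    have : ((U ^ 2 + d * V ^ 2 : ℤ) : k) = ((n ^ 3 : ℤ) : k) := by rw [hnorm]
    push_cast at this
    linear_combination this - (V : k) ^ 2 * hδ
  have hαp : ((U : k) + V * δ) ^ p = U - V * δ := by
    rw [add_pow_char, mul_pow, intCast_pow_char, intCast_pow_char, hδp]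
    ring
  set α := (U : k) + V * δ with hα
  set β := (U : k) - V * δ with hβ
  obtain ⟨y, hy⟩ := IsAlgClosed.exists_pow_nat_eq α (n := 3) (by norm_num)
  set w := y * y ^ p / n with hw
  have hyp3 : (y ^ p) ^ 3 = β := by rw [← pow_mul, mul_comm, pow_mul, hy, hαp]
  have hw3 : w ^ 3 = 1 := by
    rw [hw, div_pow, mul_pow, hyp3, hy, hαβ, div_self (pow_ne_zero 3 hn0)]
  have hwp : w ^ p = w := by
    have h := pow_eq_pow_mod p hw3
    rwa [hp3, pow_one] at h
  have hyw : y * y ^ p = n * w := by rw [hw]; field_simp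
  have hz : (y * w) * (y ^ p * w) = n := by linear_combination w ^ 2 * hyw + n * hw3
  have hzp : (y * w) ^ p = y ^ p * w := by rw [mul_pow, hwp]
  have hzp' : (y ^ p * w) ^ p = y * w := by
    have h0 : y ^ p * w ≠ 0 := right_ne_zero_of_mul (hz ▸ hn0)
    refine mul_left_cancel₀ h0 ?_
    rw [mul_comm _ (y * w), hz, ← hzp, ← mul_pow, hzp, hz, intCast_pow_char]
  have h := card_le_rootCount (p := p) (k := k) (n := n) (U := U)
    {y * w + y ^ p * w} (fun x hx => by
      rw [Finset.mem_singleton] at hx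
      rw [hx]
      refine ⟨by rw [add_pow_char, hzp, hzp', add_comm], cubic_eval_eq ?_ hz⟩
      rw [mul_pow, mul_pow, hyp3, hw3, hy, hα, hβ]
      ring)
  rwa [Finset.card_singleton] at h

theorem jacobiSym_neg_three {p : ℕ} (hp : p.Prime) (hp2 : p ≠ 2) (hp3 : p ≠ 3) :
    p % 3 = 1 ∧ jacobiSym (-3) p = 1 ∨ p % 3 = 2 ∧ jacobiSym (-3) p = -1 := by
  have hodd := hp.odd_of_ne_two hp2
  have h3 : ¬ 3 ∣ p := fun h => hp3 ((Nat.prime_dvd_prime_iff_eq Nat.prime_three hp).mp h).symm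
  have h1 : jacobiSym (-3) p = jacobiSym (-3) (p % 12) := jacobiSym.mod_right (-3) hodd
  have h2 := Nat.odd_iff.mp hodd
  have : p % 12 = 1 ∨ p % 12 = 5 ∨ p % 12 = 7 ∨ p % 12 = 11 := by omega
  rcases this with h | h | h | h <;> rw [h1, h]
  · left; exact ⟨by omega, by norm_num⟩
  · right; exact ⟨by omega, by norm_num⟩
  · left; exact ⟨by omega, by norm_num⟩
  · right; exact ⟨by omega, by norm_num⟩

theorem jacobiSym_eq_iff {a : ℤ} (ha : ¬ (p : ℤ) ∣ a) :
    (jacobiSym a p = 1 ∧ ∃ x : ZMod p, x ^ 2 = a) ∨ (jacobiSym a p = -1 ∧ ¬ ∃ x : ZMod p, x ^ 2 = a) := by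
  have ha0 : (a : ZMod p) ≠ 0 := intCast_ne_zero ha
  rw [← jacobiSym.legendreSym.to_jacobiSym]
  have e : (∃ x : ZMod p, x ^ 2 = a) ↔ IsSquare (a : ZMod p) :=
    ⟨fun ⟨x, hx⟩ => ⟨x, by rw [← hx, pow_two]⟩, fun ⟨x, hx⟩ => ⟨x, by rw [hx, pow_two]⟩⟩
  rw [e, ← legendreSym.eq_neg_one_iff, ← legendreSym.eq_one_iff p ha0]
  rcases legendreSym.eq_one_or_neg_one p ha0 with h | h <;> rw [h] <;> norm_num

end Local

theorem weight_le_rootCount {d : ℕ} {U V n : ℤ} (hnorm : U ^ 2 + d * V ^ 2 = n ^ 3) {p : ℕ}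
    [Fact p.Prime] (hp2 : p ≠ 2) (hp3 : p ≠ 3) (hn : ¬ (p : ℤ) ∣ n) (hV : ¬ (p : ℤ) ∣ V)
    (hd : ¬ (p : ℤ) ∣ d)
    (h : p % 3 = 2 → ∀ r : ℤ, (p : ℤ) ∣ r ^ 2 - 3 * d →
      ∃ φ : Eis →+* AlgebraicClosure (ZMod p),
        φ ((-(V * r) : ℤ) + (U : ℤ) * Eis.theta) ^ ((p ^ 2 - 1) / 3) = 1) :
    (5 - 3 * jacobiSym (-3) p - 3 * jacobiSym (-d) p + jacobiSym (3 * d) p : ℤ) ≤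
      4 * rootCount (cubic n U) p := by
  have hp : p.Prime := Fact.out
  have : CharP (AlgebraicClosure (ZMod p)) p :=
    charP_of_injective_algebraMap (algebraMap (ZMod p) _).injective p
  have e : jacobiSym (3 * d) p = jacobiSym (-3) p * jacobiSym (-d) p := by
    rw [← jacobiSym.mul_left]; congr 1; ring
  have hd' : ¬ (p : ℤ) ∣ -d := by rwa [dvd_neg]
  rw [e]
  rcases jacobiSym_neg_three hp hp2 hp3 with ⟨h3, h3'⟩ | ⟨h3, h3'⟩ <;>
    rcases jacobiSym_eq_iff hd' with ⟨h4, h4'⟩ | ⟨h4, h4'⟩ <;> rw [h3', h4] <;> push_cast at h4'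
  · omega
  · have := one_le_rootCount_of_not_sq (AlgebraicClosure (ZMod p)) hnorm h3 hn h4'
    omega
  · have := one_le_rootCount_of_sq hnorm h3 hn h4'
    omega
  · have h5 : jacobiSym (3 * d) p = 1 := by rw [e, h3', h4]; norm_num
    have hp3d : ¬ (p : ℤ) ∣ 3 * d := fun h => by
      rcases (Nat.prime_iff_prime_int.mp hp).dvd_mul.mp h with h | h
      · exact hp3 ((Nat.prime_dvd_prime_iff_eq hp Nat.prime_three).mp (by exact_mod_cast h))
      · exact hd h
    rcases jacobiSym_eq_iff hp3d with ⟨h6, x, hx⟩ | ⟨h6, -⟩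
    · obtain ⟨r, rfl⟩ := ZMod.intCast_surjective x
      have hr : (p : ℤ) ∣ r ^ 2 - 3 * d := by
        rw [← CharP.intCast_eq_zero_iff (ZMod p)]
        push_cast at hx ⊢
        rw [hx, sub_self]
      obtain ⟨φ, hφ⟩ := h h3 r hr
      have := three_le_rootCount hnorm hp2 h3 hn hV hd hr φ hφ
      omega
    · rw [h5] at h6; norm_num at h6

theorem irreducible_cubic {d : ℕ} (hd : 0 < d) {U V n : ℤ} (hnorm : U ^ 2 + d * V ^ 2 = n ^ 3)
    (hcube : ∀ a b : ℚ, a ^ 3 - 3 * d * a * b ^ 2 = U → 3 * a ^ 2 * b - d * b ^ 3 = V → False) :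
    (cubic n U).Monic ∧ (cubic n U).natDegree = 3 ∧
      Irreducible ((cubic n U).map (Int.castRingHom ℚ)) := by
  have hdeg : ∀ {R : Type} [CommRing R] [Nontrivial R] (a b : R),
      (X ^ 3 - C a * X - C b).Monic ∧ (X ^ 3 - C a * X - C b).natDegree = 3 := fun a b =>
    ⟨by monicity!, by compute_degree!⟩
  refine ⟨(hdeg _ _).1, (hdeg _ _).2, irreducible_of_degree_le_three_of_not_isRoot ?_ fun x hx => ?_⟩
  · rw [(show (cubic n U).Monic from (hdeg _ _).1).natDegree_map, cubic, (hdeg _ _).2]; decide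
  · rw [IsRoot.def, eval_map, eval₂_cubic] at hx
    have hd0 : (d : ℚ) ≠ 0 := by exact_mod_cast hd.ne'
    have hN : (U : ℚ) ^ 2 + d * V ^ 2 = n ^ 3 := by exact_mod_cast hnorm
    by_cases h : x ^ 2 = n
    · have hU : (U : ℚ) = (-x) ^ 3 := by linear_combination -hx / 2 + 3 / 2 * x * h
      have hV : (V : ℚ) = 0 := by
        have : (d : ℚ) * V ^ 2 = 0 := by
          rw [hU, ← h] at hN
          linear_combination hN
        exact pow_eq_zero_iff two_ne_zero |>.mp ((mul_eq_zero.mp this).resolve_left hd0)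
      exact hcube (-x) 0 (by rw [hU]; ring) (by rw [hV]; ring)
    · have hne : x ^ 2 - n ≠ 0 := sub_ne_zero.mpr h
      obtain ⟨w, hw⟩ : ∃ w : ℚ, w * (x ^ 2 - n) = 2 * V := ⟨2 * V / (x ^ 2 - n), by field_simp⟩
      have hw2 : d * w ^ 2 = 4 * n - x ^ 2 := by
        refine mul_right_cancel₀ (pow_ne_zero 2 hne) ?_
        linear_combination d * (w * (x ^ 2 - n) + 2 * V) * hw + 4 * hN +
          ((x ^ 3 - 3 * n * x) + 2 * U) * hx
      refine hcube (x / 2) (w / 2) ?_ ?_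
      · linear_combination hx / 2 - 3 / 8 * x * hw2
      · linear_combination hw / 2 - w / 8 * hw2

/-- If the cubic symbols of `U + V * √(-d)` are trivial at almost all primes, then it is a cube. -/
theorem false_of_symbol_eq_one {d : ℕ} (hd : 0 < d) {U V n : ℤ} (hnorm : U ^ 2 + d * V ^ 2 = n ^ 3)
    (hcube : ∀ a b : ℚ, a ^ 3 - 3 * d * a * b ^ 2 = U → 3 * a ^ 2 * b - d * b ^ 3 = V → False)
    (T : Finset ℕ) (h : ∀ (p : ℕ) [Fact p.Prime], p ∉ T → p % 3 = 2 → ∀ r : ℤ, (p : ℤ) ∣ r ^ 2 - 3 * d →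
      ∃ φ : Eis →+* AlgebraicClosure (ZMod p),
        φ ((-(V * r) : ℤ) + (U : ℤ) * Eis.theta) ^ ((p ^ 2 - 1) / 3) = 1) : False := by
  classical
  obtain ⟨hmon, hdeg, hirr⟩ := irreducible_cubic hd hnorm hcube
  have hV0 : V ≠ 0 := by
    rintro rfl
    by_cases hn : n = 0
    · rw [hn] at hnorm
      have : U = 0 := by nlinarith
      exact hcube 0 0 (by rw [this]; simp) (by simp)
    · have hnq : (n : ℚ) ≠ 0 := by exact_mod_cast hn
      have hN : (U : ℚ) ^ 2 = n ^ 3 := by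
        have : U ^ 2 = n ^ 3 := by linear_combination hnorm
        exact_mod_cast this
      refine hcube (U / n) 0 ?_ (by simp)
      field_simp
      linear_combination U * hN
  have hn0 : n ≠ 0 := by
    rintro rfl
    have : 0 < (d : ℤ) * V ^ 2 := by positivity
    nlinarith [sq_nonneg U]
  set M := (6 * d * V * n).natAbs with hM
  have hM0 : M ≠ 0 := by
    rw [hM, Int.natAbs_ne_zero]
    have : (d : ℤ) ≠ 0 := by exact_mod_cast hd.ne'
    positivity
  set T' : Finset Nat.Primes := (T ∪ M.primeFactors).preimage (fun p : Nat.Primes => (p : ℕ))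
    (fun x _ y _ h => Subtype.ext h) with hT'
  have hgood : ∀ p : Nat.Primes, p ∉ T' →
      (5 - 3 * jacobiSym (-3) p - 3 * jacobiSym (-d) p + jacobiSym (3 * d) p : ℤ) ≤
        4 * rootCount (cubic n U) p := by
    intro p hp
    replace hp : (p : ℕ) ∉ T ∪ M.primeFactors := fun h => hp (Finset.mem_preimage.mpr h)
    rw [Finset.mem_union, not_or, Nat.mem_primeFactors] at hp
    have hpM : ¬ ((p : ℕ) : ℤ) ∣ 6 * d * V * n := fun hdvd =>
      hp.2 ⟨p.2, Int.natCast_dvd.mp hdvd, hM0⟩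
    have := Fact.mk p.2
    refine weight_le_rootCount hnorm ?_ ?_ ?_ ?_ ?_ (h p hp.1)
    · intro h2; exact hpM (by rw [h2]; exact ⟨3 * d * V * n, by push_cast; ring⟩)
    · intro h2; exact hpM (by rw [h2]; exact ⟨2 * d * V * n, by push_cast; ring⟩)
    · intro h2; exact hpM (h2.mul_left _)
    · intro h2; exact hpM ((h2.mul_left _).mul_right _)
    · intro h2; exact hpM (((h2.mul_left _).mul_right _).mul_right _)
  obtain ⟨C₀, h0⟩ := exists_sum_rootCount_le _ hmon hirr
  obtain ⟨C₁, h1⟩ := exists_log_le_tsum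
  obtain ⟨C₂, h2⟩ := exists_tsum_jacobiSym_neg_le 3 (by norm_num)
  obtain ⟨C₃, h3⟩ := exists_tsum_jacobiSym_neg_le d hd
  obtain ⟨C₄, h4⟩ := exists_le_tsum_jacobiSym (3 * d) (by omega)
  have h5 : Tendsto (fun s : ℝ => Real.log (1 / (s - 1))) (𝓝[>] 1) atTop := by
    refine Real.tendsto_log_atTop.comp ?_
    simp_rw [one_div]
    refine tendsto_inv_nhdsGT_zero.comp ?_
    refine tendsto_nhdsWithin_iff.mpr ⟨?_, ?_⟩
    · refine (Continuous.tendsto' (by fun_prop) _ _ (by norm_num)).mono_left nhdsWithin_le_nhds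
    · filter_upwards [self_mem_nhdsWithin] with s hs
      exact sub_pos.mpr (show 1 < s from hs)
  have h6 := h5.eventually (eventually_gt_atTop
    (4 * C₀ + 5 * C₁ + 3 * C₂ + 3 * C₃ + C₄ + T'.card * (12 + 12)))
  obtain ⟨s, h0, h1, h2, h3, h4, h6, hs⟩ :=
    (h0.and (h1.and (h2.and (h3.and (h4.and (h6.and self_mem_nhdsWithin)))))).exists
  have hs : 1 < s := hs
  set L := Real.log (1 / (s - 1))
  have hJ3 := fun p : Nat.Primes => abs_jacobiSym_le (-3) p
  have hJd := fun p : Nat.Primes => abs_jacobiSym_le (-d) p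
  have hJ3d := fun p : Nat.Primes => abs_jacobiSym_le (3 * d) p
  have hr : ∀ p : Nat.Primes, |(4 * rootCount (cubic n U) p : ℝ)| ≤ 12 := fun p => by
    rw [abs_of_nonneg (by positivity)]
    have := rootCount_le hmon p.2
    rw [hdeg] at this
    have : (rootCount (cubic n U) p : ℝ) ≤ 3 := by exact_mod_cast this
    linarith
  have hw : ∀ p : Nat.Primes, |(5 - 3 * jacobiSym (-3) p - 3 * jacobiSym (-d) p +
      jacobiSym (3 * d) p : ℝ)| ≤ 12 := fun p => by
    have h1 := abs_le.mp (hJ3 p)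
    have h2 := abs_le.mp (hJd p)
    have h3 := abs_le.mp (hJ3d p)
    rw [abs_le]
    constructor <;> linarith
  have h7 := tsum_le_tsum_of_finset hs hw hr T' (fun p hp => by exact_mod_cast hgood p hp)
  have h8 : ∑' p : Nat.Primes, (4 * rootCount (cubic n U) p : ℝ) * ((p : ℕ) : ℝ) ^ (-s) ≤
      4 * (L + C₀) := by
    refine (summable_mul_of_bounded hs hr).tsum_le_of_sum_le fun P => ?_
    simp_rw [mul_assoc]
    rw [← Finset.mul_sum]
    exact mul_le_mul_of_nonneg_left (h0 P) (by norm_num)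
  have s1 := (summable_primes hs).hasSum.mul_left 5
  have s2 := (summable_mul_of_bounded hs hJ3).hasSum.mul_left 3
  have s3 := (summable_mul_of_bounded hs hJd).hasSum.mul_left 3
  have s4 := (summable_mul_of_bounded hs hJ3d).hasSum
  have s5 := ((s1.sub s2).sub s3).add s4
  have h9 := s5.tsum_eq.symm.trans (tsum_congr (g := fun p : Nat.Primes =>
    (5 - 3 * jacobiSym (-3) p - 3 * jacobiSym (-d) p + jacobiSym (3 * d) p : ℝ) *
      ((p : ℕ) : ℝ) ^ (-s)) fun p => by ring)
  rw [← h9] at h7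
  push_cast at h2 h3 h4 h7
  linarith

end PrimeSum
end FourthMoment

namespace FourthMoment
namespace Eis

/-- `z` is the cubic residue symbol of `γ` modulo the inert prime `l`. -/
def IsSym (l : ℕ) (γ z : Eis) : Prop :=
  z ^ 3 = 1 ∧ ∀ (k : Type) [Field k] [CharP k l] (φ : Eis →+* k),
    φ γ ^ ((l ^ 2 - 1) / 3) = φ z

variable {l : ℕ}

theorem IsSym.mul {γ γ' z z' : Eis} (h : IsSym l γ z) (h' : IsSym l γ' z') :
    IsSym l (γ * γ') (z * z') := by
  refine ⟨by rw [mul_pow, h.1, h'.1, one_mul], fun k _ _ φ => ?_⟩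
  rw [map_mul, mul_pow, h.2 k φ, h'.2 k φ, map_mul]

theorem IsSym.star {γ z : Eis} (h : IsSym l γ z) : IsSym l (star γ) (star z) := by
  refine ⟨by rw [← star_pow, h.1, star_one], fun k _ _ φ => ?_⟩
  have := h.2 k (φ.comp (starRingEnd Eis))
  exact this

theorem IsSym.of_dvd_sub {γ γ' z : Eis} (h : IsSym l γ z) (hd : ((l : ℤ) : Eis) ∣ γ' - γ) :
    IsSym l γ' z := by
  refine ⟨h.1, fun k _ _ φ => ?_⟩
  obtain ⟨c, hc⟩ := hd
  have : φ γ' = φ γ := by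
    have h1 := congrArg φ hc
    rw [map_sub, map_mul, map_intCast] at h1
    have h2 : ((l : ℤ) : k) = 0 := by simp
    rwa [h2, zero_mul, sub_eq_zero] at h1
  rw [this, h.2 k φ]

theorem IsSym.unique (hl : l.Prime) (hl3 : l ≠ 3) {γ z z' : Eis} (h : IsSym l γ z)
    (h' : IsSym l γ z') : z = z' := by
  have : Fact l.Prime := ⟨hl⟩
  have := charP_of_injective_algebraMap (algebraMap (ZMod l) (AlgebraicClosure (ZMod l))).injective l
  obtain ⟨φ⟩ := exists_hom l
  exact eq_of_map_eq φ hl hl3 h.1 h'.1 (by rw [← h.2 _ φ, ← h'.2 _ φ])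

theorem isSym_intCast (hl : l.Prime) (hl3 : l % 3 = 2) {m : ℤ} (hm : ¬ (l : ℤ) ∣ m) :
    IsSym l (m : Eis) 1 := by
  refine ⟨one_pow _, fun k _ _ φ => ?_⟩
  rw [map_intCast, map_one, intCast_euler hl hl3 hm]

theorem isSym_theta (hl : l.Prime) (hl2 : l ≠ 2) (hl3 : l % 3 = 2) : IsSym l theta 1 := by
  refine ⟨one_pow _, fun k _ _ φ => ?_⟩
  have : Fact l.Prime := ⟨hl⟩
  have hodd := hl.eq_two_or_odd.resolve_left hl2
  obtain ⟨j, rfl⟩ : ∃ j, l = 6 * j + 5 := ⟨l / 6, by omega⟩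
  have e : ((6 * j + 5) ^ 2 - 1) / 3 = 2 * ((6 * j + 4) * (j + 1)) := by
    have : (6 * j + 5) ^ 2 = 3 * (2 * ((6 * j + 4) * (j + 1))) + 1 := by ring
    omega
  have h3 : ((-3 : ℤ) : k) ≠ 0 := by
    rw [Ne, CharP.intCast_eq_zero_iff k (6 * j + 5)]
    intro h
    have := Int.le_of_dvd (by norm_num) ((dvd_neg).mpr h)
    push_cast at this
    omega
  have h1 : ((-3 : ℤ) : k) ^ (6 * j + 4) = 1 := by
    refine mul_right_cancel₀ h3 ?_
    rw [← pow_succ, one_mul]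
    exact PrimeSum.intCast_pow_char _
  rw [e, pow_mul, ← map_pow, theta_sq, pow_mul]
  have : φ (-3) = ((-3 : ℤ) : k) := by rw [← map_intCast φ]; norm_num
  rw [this, h1, one_pow, map_one]

theorem dvd_of_map_eq_zero (hl : l.Prime) (hl3 : l % 3 = 2) {k : Type*} [Field k] [CharP k l]
    (φ : Eis →+* k) {x : Eis} (h : φ x = 0) : ((l : ℤ) : Eis) ∣ x := by
  have h1 : (l : ℤ) ∣ x.norm := by
    by_contra hc
    exact map_ne_zero φ hc h
  rw [norm_eq] at h1
  obtain ⟨⟨a, ha⟩, ⟨b, hb⟩⟩ := prime_dvd_of_dvd_norm hl hl3 h1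
  refine ⟨⟨a, b⟩, ?_⟩
  ext <;> simp [ha, hb]

theorem exists_isSym (hl : l.Prime) (hl3 : l % 3 = 2) {γ : Eis} (h : ¬ (l : ℤ) ∣ γ.norm) :
    ∃ z, IsSym l γ z := by
  have : Fact l.Prime := ⟨hl⟩
  have := charP_of_injective_algebraMap (algebraMap (ZMod l) (AlgebraicClosure (ZMod l))).injective l
  have hne3 : l ≠ 3 := by rintro rfl; omega
  obtain ⟨φ⟩ := exists_hom l
  have hprim : IsPrimitiveRoot (φ om) 3 := by
    have f3 : Fact (Nat.Prime 3) := ⟨by norm_num⟩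
    refine IsPrimitiveRoot.iff_orderOf.mpr (orderOf_eq_prime (by rw [← map_pow, om_pow_three, map_one]) ?_)
    intro h0
    have := eq_of_map_eq φ hl hne3 om_pow_three (one_pow 3) (h0.trans (map_one φ).symm)
    exact isPrimitiveRoot_om.ne_one (by norm_num) this
  have h1 : (φ γ ^ ((l ^ 2 - 1) / 3)) ^ 3 = 1 := by
    rw [← pow_mul, Nat.div_mul_cancel (three_dvd_sq_sub_one hl hne3)]
    exact map_pow_sq_sub_one φ hl hne3 (map_ne_zero φ h)
  obtain ⟨i, -, hi⟩ := hprim.eq_pow_of_pow_eq_one h1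
  refine ⟨om ^ i, by rw [← pow_mul, mul_comm, pow_mul, om_pow_three, one_pow], fun k _ _ ψ => ?_⟩
  have h2 : φ (γ ^ ((l ^ 2 - 1) / 3) - om ^ i) = 0 := by
    rw [map_sub, map_pow, map_pow, ← hi, sub_self]
  obtain ⟨c, hc⟩ := dvd_of_map_eq_zero hl hl3 φ h2
  have h3 := congrArg ψ hc
  rw [map_sub, map_mul, map_intCast, map_pow] at h3
  have h4 : ((l : ℤ) : k) = 0 := by simp
  rwa [h4, zero_mul, sub_eq_zero] at h3

/-- The element of the Eisenstein integers attached to an element of `ℤ[√-d]` and a residue. -/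
def twist {D : ℤ} (r : ℤ) (x : ℤ√D) : Eis := ((-(x.im * r) : ℤ) : Eis) + ((x.re : ℤ) : Eis) * theta

theorem twist_mul {d : ℤ} (r : ℤ) (x y : ℤ√(-d)) :
    twist r x * twist r y - theta * twist r (x * y) =
      ((x.im * y.im * (r ^ 2 - 3 * d) : ℤ) : Eis) := by
  have h := theta_sq
  simp only [twist, Zsqrtd.re_mul, Zsqrtd.im_mul]
  push_cast
  linear_combination (d * x.im * y.im : Eis) * h

theorem norm_twist {d : ℤ} (r : ℤ) (x : ℤ√(-d)) :
    (twist r x).norm = 3 * x.norm + x.im ^ 2 * (r ^ 2 - 3 * d) := by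
  rw [twist, norm_eq]
  simp [theta, Zsqrtd.norm]
  ring

theorem star_twist {d : ℤ} (r : ℤ) (x : ℤ√d) : star (twist r x) = - twist (-r) x := by
  simp only [twist, star_add, star_mul, star_theta]
  simp
  ring

/-- A prime at which cubic symbols of twists are multiplicative. -/
structure Good (d : ℤ) (l : ℕ) (r : ℤ) : Prop where
  prime : l.Prime
  mod_three : l % 3 = 2
  ne_two : l ≠ 2
  dvd : (l : ℤ) ∣ r ^ 2 - 3 * d

theorem Good.ne_three {d r : ℤ} (h : Good d l r) : l ≠ 3 := by
  rintro rfl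
  have := h.mod_three
  omega

theorem Good.not_dvd_norm {d r : ℤ} (h : Good d l r) {x : ℤ√(-d)} (hx : ¬ (l : ℤ) ∣ x.norm) :
    ¬ (l : ℤ) ∣ (twist r x).norm := by
  rw [norm_twist]
  intro h1
  have h2 := (dvd_add_left (h.dvd.mul_left _)).mp h1
  rcases (Nat.prime_iff_prime_int.mp h.prime).dvd_or_dvd h2 with h3 | h3
  · have : l ∣ 3 := by exact_mod_cast h3
    exact h.ne_three ((Nat.prime_dvd_prime_iff_eq h.prime (by norm_num)).mp this)
  · exact hx h3

theorem Good.exists_isSym {d r : ℤ} (h : Good d l r) {x : ℤ√(-d)} (hx : ¬ (l : ℤ) ∣ x.norm) :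
    ∃ z, IsSym l (twist r x) z :=
  Eis.exists_isSym h.prime h.mod_three (h.not_dvd_norm hx)

theorem IsSym.cancel {γ γ' z : Eis} (h : IsSym l (γ * γ') z) (h' : IsSym l γ 1) :
    IsSym l γ' z := by
  refine ⟨h.1, fun k _ _ φ => ?_⟩
  have h1 := h.2 k φ
  rwa [map_mul, mul_pow, h'.2 k φ, map_one, one_mul] at h1

theorem Good.mul {d r : ℤ} (h : Good d l r) {x y : ℤ√(-d)} {z w : Eis}
    (hx : IsSym l (twist r x) z) (hy : IsSym l (twist r y) w) :
    IsSym l (twist r (x * y)) (z * w) := by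
  refine IsSym.cancel ?_ (isSym_theta h.prime h.ne_two h.mod_three)
  refine (hx.mul hy).of_dvd_sub ?_
  rw [← neg_sub, twist_mul, dvd_neg]
  obtain ⟨c, hc⟩ := h.dvd
  rw [hc]
  exact ⟨((x.im * y.im * c : ℤ) : Eis), by push_cast; ring⟩

theorem Good.pow_three {d r : ℤ} (h : Good d l r) {x : ℤ√(-d)} {z : Eis}
    (hx : IsSym l (twist r x) z) : IsSym l (twist r (x ^ 3)) 1 := by
  have := h.mul (h.mul hx hx) hx
  rw [← pow_two, ← pow_succ, ← pow_two, ← pow_succ, hx.1] at this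
  exact this

theorem Good.intCast {d r : ℤ} (h : Good d l r) {c : ℤ} (hc : ¬ (l : ℤ) ∣ c) :
    IsSym l (twist r (c : ℤ√(-d))) 1 := by
  have e : twist r (c : ℤ√(-d)) = (c : Eis) * theta := by simp [twist]
  rw [e]
  simpa using (isSym_intCast h.prime h.mod_three hc).mul (isSym_theta h.prime h.ne_two h.mod_three)

theorem Good.star {d r : ℤ} (h : Good d l r) {x : ℤ√(-d)} {z : Eis}
    (hx : IsSym l (twist r x) z) : IsSym l (twist (-r) x) (star z) := by
  have h1 := hx.star
  rw [star_twist] at h1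
  have h2 : IsSym l ((-1 : ℤ) : Eis) 1 := isSym_intCast h.prime h.mod_three (by
    intro h3
    have h4 := Int.natAbs_dvd_natAbs.mpr h3
    simp at h4
    exact h.prime.one_lt.ne' h4)
  simpa using h1.mul h2

theorem IsSym.twist_congr {d r r' : ℤ} (hr : (l : ℤ) ∣ r' - r) {x : ℤ√(-d)}
    {z : Eis} (hx : IsSym l (twist r x) z) : IsSym l (twist r' x) z := by
  refine hx.of_dvd_sub ?_
  obtain ⟨c, hc⟩ := hr
  refine ⟨((-(x.im * c) : ℤ) : Eis), ?_⟩
  have : r' = r + l * c := by linarith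
  simp only [twist, this]
  push_cast
  ring

theorem Good.congr {d r : ℤ} (h : Good d l r) {r' : ℤ} (hr : (l : ℤ) ∣ r' - r) : Good d l r' := by
  refine ⟨h.1, h.2, h.3, ?_⟩
  have : r' ^ 2 - 3 * d = (r' - r) * (r' + r) + (r ^ 2 - 3 * d) := by ring
  rw [this]
  exact dvd_add (hr.mul_right _) h.dvd

theorem Good.neg {d r : ℤ} (h : Good d l r) : Good d l (-r) :=
  ⟨h.1, h.2, h.3, by rw [neg_sq]; exact h.dvd⟩

end Eis
end FourthMoment

namespace FourthMoment
namespace Eis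

theorem hasEnoughRootsOfUnity {n : ℕ} [NeZero n] (h : n ∣ 3) : HasEnoughRootsOfUnity Eis n := by
  have h3 : HasEnoughRootsOfUnity Eis 3 := ⟨⟨om, isPrimitiveRoot_om⟩, inferInstance⟩
  exact HasEnoughRootsOfUnity.of_dvd Eis h

theorem card_hom {G : Type*} [CommGroup G] [Finite G] (hG : ∀ g : G, g ^ 3 = 1) :
    Nat.card (G →* Eisˣ) = Nat.card G := by
  have h : Monoid.exponent G ∣ 3 := Monoid.exponent_dvd_of_forall_pow_eq_one hG
  have : NeZero (Monoid.exponent G) := ⟨Monoid.exponent_ne_zero_of_finite⟩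
  have := hasEnoughRootsOfUnity h
  exact CommGroup.card_monoidHom_of_hasEnoughRootsOfUnity G Eis

theorem finite_hom {G : Type*} [CommGroup G] [Finite G] (hG : ∀ g : G, g ^ 3 = 1) :
    Finite (G →* Eisˣ) :=
  Nat.finite_of_card_ne_zero (by rw [card_hom hG]; exact Nat.card_pos.ne')

theorem closure_eq_top_of_separating {G : Type*} [CommGroup G] [Finite G]
    (hG : ∀ g : G, g ^ 3 = 1) (F : Set (G →* Eisˣ)) (h : ∀ g ≠ 1, ∃ f ∈ F, f g ≠ 1) :
    Subgroup.closure F = ⊤ := by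
  have := finite_hom hG
  have hQ : ∀ q : Subgroup.closure F, q ^ 3 = 1 := by
    rintro ⟨q, hq⟩
    ext g : 2
    change q g ^ 3 = 1
    rw [← map_pow, hG, map_one]
  have := finite_hom hQ
  refine Subgroup.eq_top_of_le_card _ ?_
  rw [card_hom hG, ← card_hom hQ]
  let ev : G →* (Subgroup.closure F →* Eisˣ) :=
    { toFun := fun g =>
        { toFun := fun q => q.1 g
          map_one' := rfl
          map_mul' := fun _ _ => rfl }
      map_one' := by ext q : 1; exact map_one q.1
      map_mul' := fun a b => by ext q : 1; exact map_mul q.1 a b }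
  refine Nat.card_le_card_of_injective ev ((injective_iff_map_eq_one ev).mpr fun g hg => ?_)
  by_contra hne
  obtain ⟨f, hf, hfg⟩ := h g hne
  exact hfg (congrArg (fun e => e ⟨f, Subgroup.subset_closure hf⟩) hg)

theorem mul_star_of_pow_three {z : Eis} (h : z ^ 3 = 1) : z * star z = 1 := by
  rw [mul_star_eq]
  have h1 : z.norm ^ 3 = 1 := by rw [← map_pow, h]; exact map_one _
  have h2 : z.norm = 1 := by
    have h3 : z.norm ∣ 1 := ⟨z.norm ^ 2, by linear_combination -h1⟩
    rcases Int.isUnit_iff.mp (isUnit_of_dvd_one h3) with h4 | h4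
    · exact h4
    · rw [h4] at h1; norm_num at h1
  rw [h2]; rfl

section Twist

variable {G : Type*} [CommGroup G] {d : ℕ} {α : G → ℤ√(-(d : ℤ))}

/-- The symbols of the twists of `α` modulo `l` are the values of the character `f`. -/
def Represents (α : G → ℤ√(-(d : ℤ))) (l : ℕ) (r : ℤ) (f : G →* Eisˣ) : Prop :=
  Good d l r ∧ ∀ g, IsSym l (twist r (α g)) (f g : Eis)

theorem Represents.inv {l : ℕ} {r : ℤ} {f : G →* Eisˣ} (h : Represents α l r f) :
    Represents α l (-r) f⁻¹ := by
  refine ⟨h.1.neg, fun g => ?_⟩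
  have h1 := h.1.star (h.2 g)
  have h2 : ((f⁻¹ g : Eisˣ) : Eis) = star (f g : Eis) := by
    have := mul_star_of_pow_three (h.2 g).1
    rw [MonoidHom.inv_apply]
    exact Units.inv_eq_of_mul_eq_one_right this
  rwa [h2]

theorem natCast_dvd_natAbs {l : ℕ} {n : ℤ} : l ∣ n.natAbs ↔ (l : ℤ) ∣ n := Int.natCast_dvd.symm

theorem exists_represents {l : ℕ} {r : ℤ} (hl : Good d l r) (hα : ∀ g, ¬ (l : ℤ) ∣ (α g).norm)
    (h : ∀ g h, ∃ (x y : ℤ√(-(d : ℤ))) (c c' : ℤ), ¬ (l : ℤ) ∣ x.norm ∧ ¬ (l : ℤ) ∣ y.norm ∧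
      ¬ (l : ℤ) ∣ c ∧ ¬ (l : ℤ) ∣ c' ∧ c * (α g * α h * x ^ 3) = c' * (α (g * h) * y ^ 3)) :
    ∃ f, Represents α l r f := by
  choose z hz using fun g => hl.exists_isSym (hα g)
  refine ⟨MonoidHom.mk' (fun g => Units.ofPowEqOne (z g) 3 (hz g).1 (by norm_num))
    fun a b => ?_, hl, fun g => by simpa using hz g⟩
  ext : 1
  simp only [Units.val_mul, Units.val_ofPowEqOne]
  obtain ⟨x, y, c, c', hx, hy, hc, hc', e⟩ := h a b
  obtain ⟨u, hu⟩ := hl.exists_isSym hx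
  obtain ⟨v, hv⟩ := hl.exists_isSym hy
  have h1 := hl.mul (hl.intCast hc) (hl.mul (hl.mul (hz a) (hz b)) (hl.pow_three hu))
  have h2 := hl.mul (hl.intCast hc') (hl.mul (hz (a * b)) (hl.pow_three hv))
  rw [e] at h1
  simpa using (h1.unique hl.prime hl.ne_three h2).symm

theorem norm_ne_zero (hd : 0 < d) {x : ℤ√(-(d : ℤ))} (hx : x ≠ 0) : x.norm ≠ 0 := by
  intro h
  apply hx
  rw [Zsqrtd.norm_def] at h
  have hd' : (0 : ℤ) < d := by exact_mod_cast hd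
  have h1 : x.re = 0 := by nlinarith [mul_self_nonneg x.re, mul_self_nonneg x.im]
  have h2 : x.im = 0 := by
    rw [h1] at h
    have : x.im * x.im = 0 := by nlinarith [mul_self_nonneg x.im]
    simpa using this
  ext <;> simp [h1, h2]

theorem exists_bad [Finite G] (hd : 0 < d) (hα : ∀ g, α g ≠ 0)
    (h : ∀ g h, ∃ (x y : ℤ√(-(d : ℤ))) (c c' : ℤ), x ≠ 0 ∧ y ≠ 0 ∧
      c ≠ 0 ∧ c' ≠ 0 ∧ c * (α g * α h * x ^ 3) = c' * (α (g * h) * y ^ 3)) :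
    ∃ T : Finset ℕ, ∀ l r, l ∉ T → Good d l r → ∃ f, Represents α l r f := by
  have := Fintype.ofFinite G
  choose x y c c' hx hy hc hc' e using h
  let B : ℕ := (∏ a : G, ∏ b : G, ((x a b).norm * (y a b).norm * c a b * c' a b * (α a).norm)).natAbs
  have hB : B ≠ 0 := by
    simp only [B, Int.natAbs_ne_zero, Finset.prod_ne_zero_iff]
    intro a _ b _
    exact mul_ne_zero (mul_ne_zero (mul_ne_zero (mul_ne_zero (norm_ne_zero hd (hx a b))
      (norm_ne_zero hd (hy a b))) (hc a b)) (hc' a b)) (norm_ne_zero hd (hα a))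
  refine ⟨B.primeFactors, fun l r hlB hl => ?_⟩
  have hlB' : ¬ (l : ℤ) ∣ ∏ a : G, ∏ b : G,
      ((x a b).norm * (y a b).norm * c a b * c' a b * (α a).norm) := fun h =>
    hlB (Nat.mem_primeFactors.mpr ⟨hl.prime, natCast_dvd_natAbs.mpr h, hB⟩)
  have key : ∀ a b, ¬ (l : ℤ) ∣ (x a b).norm * (y a b).norm * c a b * c' a b * (α a).norm :=
    fun a b h => hlB' ((h.trans (Finset.dvd_prod_of_mem (fun b =>
      (x a b).norm * (y a b).norm * c a b * c' a b * (α a).norm) (Finset.mem_univ b))).trans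
        (Finset.dvd_prod_of_mem (fun a => ∏ b : G,
          (x a b).norm * (y a b).norm * c a b * c' a b * (α a).norm) (Finset.mem_univ a)))
  refine exists_represents hl (fun g h => key g 1 (h.mul_left _)) fun a b =>
    ⟨x a b, y a b, c a b, c' a b, fun h => key a b ?_, fun h => key a b ?_, fun h => key a b ?_,
      fun h => key a b ?_, e a b⟩
  · exact (((h.mul_right _).mul_right _).mul_right _).mul_right _
  · exact (((h.mul_left _).mul_right _).mul_right _).mul_right _
  · exact ((h.mul_left _).mul_right _).mul_right _
  · exact (h.mul_left _).mul_right _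

theorem exists_separating [Finite G] (hG : ∀ g : G, g ^ 3 = 1) (hd : 0 < d) (e n : G → ℤ)
    (he : ∀ g, e g ≠ 0) (hn : ∀ g, (α g).norm = e g * n g ^ 3)
    (hcube : ∀ g ≠ 1, ∀ a b : ℚ, a ^ 3 - 3 * d * a * b ^ 2 = e g * (α g).re →
      3 * a ^ 2 * b - d * b ^ 3 = e g * (α g).im → False) {T : Finset ℕ}
    (hT : ∀ l r, l ∉ T → Good d l r → ∃ f, Represents α l r f) {g : G} (hg : g ≠ 1) :
    ∃ f ∈ {f : G →* Eisˣ | ∀ T' : Finset ℕ, ∃ l ∉ T', ∃ r, Represents α l r f}, f g ≠ 1 := by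
  classical
  by_contra! hcon
  have := finite_hom hG
  have := Fintype.ofFinite (G →* Eisˣ)
  have h1 : ∀ f : G →* Eisˣ, ∃ T' : Finset ℕ, f g ≠ 1 → ∀ l ∉ T', ∀ r, ¬ Represents α l r f := by
    intro f
    by_cases hf : f g = 1
    · exact ⟨∅, fun h => absurd hf h⟩
    · by_contra! hc
      refine hf (hcon f fun T' => ?_)
      obtain ⟨-, l, hl, r, hr⟩ := hc T'
      exact ⟨l, hl, r, hr⟩
  choose T' hT' using h1
  refine PrimeSum.false_of_symbol_eq_one (U := e g * (α g).re) (V := e g * (α g).im)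
    (n := e g * n g) hd ?_ ?_ (T ∪ Finset.univ.biUnion T' ∪ {2} ∪ (e g).natAbs.primeFactors) ?_
  · have h2 := hn g
    rw [Zsqrtd.norm_def] at h2
    linear_combination e g ^ 2 * h2
  · intro a b h2 h3
    exact hcube g hg a b (by rw [h2]; push_cast; ring) (by rw [h3]; push_cast; ring)
  · intro p hpF hp hp3 r hr
    simp only [Finset.mem_union, not_or, Finset.mem_biUnion, Finset.mem_univ, true_and,
      not_exists, Finset.mem_singleton] at hp
    obtain ⟨⟨⟨hpT, hpT'⟩, hp2⟩, hpe⟩ := hp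
    have hgood : Good d p r := ⟨hpF.out, hp3, hp2, hr⟩
    have hpe' : ¬ (p : ℤ) ∣ e g := fun h =>
      hpe (Nat.mem_primeFactors.mpr ⟨hpF.out, natCast_dvd_natAbs.mpr h, by simpa using he g⟩)
    obtain ⟨f, hf⟩ := hT p r hpT hgood
    have hfg : f g = 1 := by
      by_contra hne
      exact hT' f hne p (hpT' f) r hf
    have := charP_of_injective_algebraMap (algebraMap (ZMod p) (AlgebraicClosure (ZMod p))).injective p
    obtain ⟨φ⟩ := exists_hom p
    have h2 := hf.2 g
    rw [hfg, Units.val_one] at h2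
    have h3 := (isSym_intCast hgood.prime hp3 hpe').mul h2
    have h4 := h3.2 _ φ
    refine ⟨φ, ?_⟩
    rw [mul_one, map_one] at h4
    rw [← h4]
    congr 2
    simp only [twist]
    push_cast
    ring

/-- Every character is a product of symbols modulo primes outside a given finite set. -/
theorem exists_prod_eq [Finite G] (hG : ∀ g : G, g ^ 3 = 1) (hd : 0 < d) (hα : ∀ g, α g ≠ 0)
    (h : ∀ g h, ∃ (x y : ℤ√(-(d : ℤ))) (c c' : ℤ), x ≠ 0 ∧ y ≠ 0 ∧
      c ≠ 0 ∧ c' ≠ 0 ∧ c * (α g * α h * x ^ 3) = c' * (α (g * h) * y ^ 3))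
    (e n : G → ℤ) (he : ∀ g, e g ≠ 0) (hn : ∀ g, (α g).norm = e g * n g ^ 3)
    (hcube : ∀ g ≠ 1, ∀ a b : ℚ, a ^ 3 - 3 * d * a * b ^ 2 = e g * (α g).re →
      3 * a ^ 2 * b - d * b ^ 3 = e g * (α g).im → False) (ψ : G →* Eisˣ) (T : Finset ℕ) :
    ∃ (S : Finset ℕ) (ρ : ℕ → ℤ) (f : ℕ → (G →* Eisˣ)),
      (∀ l ∈ S, l ∉ T ∧ Represents α l (ρ l) (f l)) ∧ ∏ l ∈ S, f l = ψ := by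
  classical
  obtain ⟨T₀, hT₀⟩ := exists_bad hd hα h
  have htop := closure_eq_top_of_separating hG _ fun g hg =>
    exists_separating hG hd e n he hn hcube hT₀ hg
  have hψ := htop ▸ Subgroup.mem_top ψ
  induction hψ using Subgroup.closure_induction generalizing T with
  | mem f hf =>
    obtain ⟨l, hl, r, hr⟩ := hf T
    exact ⟨{l}, fun _ => r, fun _ => f, by simpa using ⟨hl, hr⟩, by simp⟩
  | one => exact ⟨∅, 0, 1, by simp, by simp⟩
  | inv f _ ih =>
    obtain ⟨S, ρ, g, h1, h2⟩ := ih T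
    exact ⟨S, -ρ, g⁻¹, fun l hl => ⟨(h1 l hl).1, (h1 l hl).2.inv⟩, by
      rw [← h2]; exact Finset.prod_inv_distrib g⟩
  | mul f f' _ _ ih ih' =>
    obtain ⟨S, ρ, g, h1, h2⟩ := ih T
    obtain ⟨S', ρ', g', h1', h2'⟩ := ih' (T ∪ S)
    have hdisj : Disjoint S S' := Finset.disjoint_right.mpr fun l hl hl' =>
      (h1' l hl).1 (Finset.mem_union_right _ hl')
    refine ⟨S ∪ S', fun l => if l ∈ S then ρ l else ρ' l, fun l => if l ∈ S then g l else g' l,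
      fun l hl => ?_, ?_⟩
    · by_cases hlS : l ∈ S
      · simpa [hlS] using h1 l hlS
      · have hl' : l ∈ S' := (Finset.mem_union.mp hl).resolve_left hlS
        simpa [hlS] using ⟨fun hT => (h1' l hl').1 (Finset.mem_union_left _ hT), (h1' l hl').2⟩
    · rw [Finset.prod_union hdisj, ← h2, ← h2']
      congr 1
      · exact Finset.prod_congr rfl fun l hl => by simp [hl]
      · exact Finset.prod_congr rfl fun l hl => by simp [Finset.disjoint_right.mp hdisj hl]

end Twist

end Eis
end FourthMoment

namespace FourthMoment
namespace Eis

section Twist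

variable {G : Type*} [CommGroup G] {d : ℕ} {α : G → ℤ√(-(d : ℤ))}

/-- The character `ψ` is the cubic symbol of the twists of `α` modulo `m`. -/
def CharMod (α : G → ℤ√(-(d : ℤ))) (ψ : G →* Eisˣ) (m : ℕ) (r : ℤ) : Prop :=
  Squarefree m ∧ ∃ f : ℕ → (G →* Eisˣ),
    (∀ l ∈ m.primeFactors, Represents α l r (f l)) ∧ ∏ l ∈ m.primeFactors, f l = ψ

theorem CharMod.inv {ψ : G →* Eisˣ} {m : ℕ} {r : ℤ} (h : CharMod α ψ m r) :
    CharMod α ψ⁻¹ m (-r) := by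
  obtain ⟨hm, f, hf, hψ⟩ := h
  refine ⟨hm, f⁻¹, fun l hl => (hf l hl).inv, ?_⟩
  rw [← hψ]
  exact Finset.prod_inv_distrib f

theorem CharMod.good {ψ : G →* Eisˣ} {m : ℕ} {r : ℤ} (h : CharMod α ψ m r) {l : ℕ}
    (hl : l.Prime) (hlm : l ∣ m) : Good d l r := by
  obtain ⟨hm, f, hf, hψ⟩ := h
  exact (hf l (Nat.mem_primeFactors.mpr ⟨hl, hlm, hm.ne_zero⟩)).1

theorem CharMod.dvd {ψ : G →* Eisˣ} {m : ℕ} {r : ℤ} (h : CharMod α ψ m r) :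
    (m : ℤ) ∣ r ^ 2 - 3 * d := by
  rw [← natCast_dvd_natAbs, ← Nat.prod_primeFactors_of_squarefree h.1]
  refine Finset.prod_primes_dvd _ (fun l hl => (Nat.prime_of_mem_primeFactors hl).prime)
    fun l hl => natCast_dvd_natAbs.mpr (h.good (Nat.prime_of_mem_primeFactors hl)
      (Nat.dvd_of_mem_primeFactors hl)).dvd

theorem CharMod.map_eq {ψ : G →* Eisˣ} {m : ℕ} {r : ℤ} (h : CharMod α ψ m r) (χ : ℤ →* Eis) (g : G)
    (hχ : ∀ l : ℕ, l.Prime → l ∣ m → IsSym l (twist r (α g)) (χ l)) : χ m = ψ g := by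
  obtain ⟨hm, f, hf, hψ⟩ := h
  rw [← hψ, MonoidHom.finsetProd_apply, Units.coe_prod]
  conv_lhs => rw [← Nat.prod_primeFactors_of_squarefree hm]
  rw [Nat.cast_prod, map_prod]
  refine Finset.prod_congr rfl fun l hl => ?_
  have hlp := Nat.prime_of_mem_primeFactors hl
  exact (hχ l hlp (Nat.dvd_of_mem_primeFactors hl)).unique hlp (hf l hl).1.ne_three ((hf l hl).2 g)

theorem exists_forall_dvd_sub (S : Finset ℕ) (hS : ∀ l ∈ S, l.Prime) (ρ : ℕ → ℤ) :
    ∃ r : ℤ, ∀ l ∈ S, (l : ℤ) ∣ r - ρ l := by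
  classical
  induction S using Finset.induction_on with
  | empty => exact ⟨0, by simp⟩
  | insert a S ha ih =>
    obtain ⟨r, hr⟩ := ih fun l hl => hS l (Finset.mem_insert_of_mem hl)
    have hco : IsCoprime (a : ℤ) (∏ l ∈ S, (l : ℤ)) := IsCoprime.prod_right fun l hl =>
      Nat.isCoprime_iff_coprime.mpr ((Nat.coprime_primes (hS a (Finset.mem_insert_self _ _))
        (hS l (Finset.mem_insert_of_mem hl))).mpr fun h => ha (h ▸ hl))
    obtain ⟨u, v, huv⟩ := hco
    refine ⟨r + v * (∏ l ∈ S, (l : ℤ)) * (ρ a - r), fun l hl => ?_⟩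
    rcases Finset.mem_insert.mp hl with rfl | hl
    · exact ⟨u * (r - ρ l), by linear_combination (ρ l - r) * huv⟩
    · have h1 := hr l hl
      have h2 : (l : ℤ) ∣ ∏ l ∈ S, (l : ℤ) := Finset.dvd_prod_of_mem (fun l : ℕ => (l : ℤ)) hl
      have h3 := dvd_add h1 ((h2.mul_left v).mul_right (ρ a - r))
      ring_nf at h3 ⊢
      exact h3

theorem exists_charMod {ψ : G →* Eisˣ} {T S : Finset ℕ} {ρ : ℕ → ℤ} {f : ℕ → (G →* Eisˣ)}
    (h : ∀ l ∈ S, l ∉ T ∧ Represents α l (ρ l) (f l)) (hψ : ∏ l ∈ S, f l = ψ) :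
    ∃ m r, CharMod α ψ m r ∧ ∀ l ∈ m.primeFactors, l ∉ T := by
  have hS : ∀ l ∈ S, l.Prime := fun l hl => (h l hl).2.1.prime
  obtain ⟨r, hr⟩ := exists_forall_dvd_sub S hS ρ
  have hp : (∏ l ∈ S, l).primeFactors = S := Nat.primeFactors_prod hS
  refine ⟨∏ l ∈ S, l, r, ⟨?_, f, fun l hl => ?_, by rw [hp, hψ]⟩, fun l hl => (h l (hp ▸ hl)).1⟩
  · exact Finset.squarefree_prod_of_pairwise_isCoprime (fun a ha b hb hab =>
      (Nat.coprime_iff_isRelPrime.mp ((Nat.coprime_primes (hS a ha) (hS b hb)).mpr hab)))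
      fun l hl => (hS l hl).prime.squarefree
  · rw [hp] at hl
    obtain ⟨h1, h2⟩ := (h l hl).2
    exact ⟨h1.congr (hr l hl), fun g => (h2 g).twist_congr (hr l hl)⟩

theorem exists_disjoint_family {ι : Type*} [Finite ι] (Q : ι → ℕ → ℤ → Prop) (T : Finset ℕ)
    (h : ∀ i (T : Finset ℕ), ∃ m r, Q i m r ∧ ∀ l ∈ m.primeFactors, l ∉ T) :
    ∃ (m : ι → ℕ) (r : ι → ℤ), (∀ i, Q i (m i) (r i) ∧ ∀ l ∈ (m i).primeFactors, l ∉ T) ∧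
      ∀ i j, i ≠ j → Disjoint (m i).primeFactors (m j).primeFactors := by
  classical
  have := Fintype.ofFinite ι
  have key : ∀ s : Finset ι, ∃ (m : ι → ℕ) (r : ι → ℤ),
      (∀ i ∈ s, Q i (m i) (r i) ∧ ∀ l ∈ (m i).primeFactors, l ∉ T) ∧
      ∀ i ∈ s, ∀ j ∈ s, i ≠ j → Disjoint (m i).primeFactors (m j).primeFactors := by
    intro s
    induction s using Finset.induction_on with
    | empty => exact ⟨0, 0, by simp, by simp⟩
    | insert a s ha ih =>
      obtain ⟨m, r, h1, h2⟩ := ih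
      obtain ⟨m', r', h3, h4⟩ := h a (T ∪ s.biUnion fun i => (m i).primeFactors)
      have hne : ∀ i ∈ s, i ≠ a := fun i hi h => ha (h ▸ hi)
      have hdis : ∀ i ∈ s, Disjoint (m i).primeFactors m'.primeFactors := fun i hi =>
        Finset.disjoint_left.mpr fun l hl hl' => h4 l hl' (Finset.mem_union_right _
          (Finset.mem_biUnion.mpr ⟨i, hi, hl⟩))
      refine ⟨Function.update m a m', Function.update r a r', fun i hi => ?_,
        fun i hi j hj hij => ?_⟩
      · rcases Finset.mem_insert.mp hi with rfl | hi
        · simpa using ⟨h3, fun l hl hl' hl'' hT =>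
            h4 l (Nat.mem_primeFactors.mpr ⟨hl, hl', hl''⟩) (Finset.mem_union_left _ hT)⟩
        · simpa [hne i hi] using h1 i hi
      · rcases Finset.mem_insert.mp hi with rfl | hi'
        · have hj := (Finset.mem_insert.mp hj).resolve_left (Ne.symm hij)
          simpa [hne j hj] using (hdis j hj).symm
        · rcases Finset.mem_insert.mp hj with rfl | hj
          · have hi := (Finset.mem_insert.mp hi).resolve_left hij
            simpa [hne i hi] using hdis i hi
          · simpa [hne i hi', hne j hj] using h2 i hi' j hj hij
  obtain ⟨m, r, h1, h2⟩ := key Finset.univ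
  exact ⟨m, r, fun i => h1 i (Finset.mem_univ i),
    fun i j => h2 i (Finset.mem_univ i) j (Finset.mem_univ j)⟩

theorem IsSym.of_dvd_add {l : ℕ} {r s t : ℤ} {x : ℤ√(-(d : ℤ))} {z : Eis} (hl : l.Prime)
    (hl3 : l % 3 = 2) (ht : ¬ (l : ℤ) ∣ t) (hs : (l : ℤ) ∣ s - r * t)
    (h : IsSym l ((-(x.im * s) : ℤ) + (x.re * t : ℤ) * theta) z) : IsSym l (twist r x) z := by
  have h1 : IsSym l ((t : Eis) * twist r x) z := by
    refine h.of_dvd_sub ?_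
    obtain ⟨c, hc⟩ := hs
    refine ⟨((x.im * c : ℤ) : Eis), ?_⟩
    have : s = r * t + l * c := by linarith
    simp only [twist, this]
    push_cast
    ring
  exact h1.cancel (isSym_intCast hl hl3 ht)

/-- Two characters are equal when their moduli divide a common value of the form. -/
theorem CharMod.eq {ψ ψ' : G →* Eisˣ} {m m' : ℕ} {r r' : ℤ} (h : CharMod α ψ m r)
    (h' : CharMod α ψ' m' r') {e n : G → ℤ} (he : ∀ g, e g = 1 ∨ e g = 4)
    (hn : ∀ g, (α g).norm = e g * n g ^ 3) (hco : ∀ g, IsCoprime (α g).re (α g).im)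
    (h3 : ∀ g, ¬ 3 ∣ (α g).re) (h27 : ∀ g, ¬ 27 ∣ (α g).im) {s t : ℤ} (hst : IsCoprime s t)
    (hs : (m : ℤ) ∣ s + r * t) (hs' : (m' : ℤ) ∣ s - r' * t) (ht3 : 27 ∣ t) (ht2 : 2 ∣ t) {b : ℕ}
    (hM : s ^ 2 - 3 * d * t ^ 2 = m * m' * b ^ 3)
    (hl : ∀ l : ℕ, l.Prime → (l : ℤ) ∣ s ^ 2 - 3 * d * t ^ 2 →
      l % 3 = 2 ∧ (∀ g, ¬ (l : ℤ) ∣ n g) ∧ ¬ (l : ℤ) ∣ d)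
    (hb : ∀ χ : ℤ →* Eis, (∀ l : ℕ, l.Prime → l ∣ b → χ l ^ 3 = 1) → χ b ^ 3 = 1) : ψ = ψ' := by
  ext g : 2
  obtain ⟨χ, hχ1, hχ⟩ := cubic_reciprocity (U := (α g).re) (V := (α g).im) (d := d)
    (by have := hn g; rw [Zsqrtd.norm_def] at this; linear_combination this)
    (he g) (hco g) (h3 g) (h27 g) ht3 ht2 hst
    fun l hlp hd => ⟨(hl l hlp hd).1, (hl l hlp hd).2.1 g, (hl l hlp hd).2.2⟩
  have hsym : ∀ (l : ℕ) (ρ : ℤ), l.Prime → (l : ℤ) ∣ s ^ 2 - 3 * d * t ^ 2 → (l : ℤ) ∣ s - ρ * t →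
      IsSym l (twist ρ (α g)) (χ l) := fun l ρ hlp hd hs => by
    refine IsSym.of_dvd_add hlp (hl l hlp hd).1 (fun hlt => ?_) hs (hχ l hlp hd)
    have h1 := (dvd_add hs (hlt.mul_left ρ))
    rw [sub_add_cancel] at h1
    exact (Nat.prime_iff_prime_int.mp hlp).not_isUnit (hst.isUnit_of_dvd' h1 hlt)
  have e1 := h.inv.map_eq χ g fun l hlp hlm => by
    have hlm' : (l : ℤ) ∣ m := by exact_mod_cast hlm
    refine hsym l (-r) hlp (hM ▸ (hlm'.mul_right _).mul_right _) ?_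
    have := hlm'.trans hs
    ring_nf at this ⊢
    exact this
  have e2 := h'.map_eq χ g fun l hlp hlm => by
    have hlm' : (l : ℤ) ∣ m' := by exact_mod_cast hlm
    exact hsym l r' hlp (hM ▸ (hlm'.mul_left _).mul_right _) (hlm'.trans hs')
  have e3 : χ b ^ 3 = 1 := hb χ fun l hlp hlb => by
    have hlb' : (l : ℤ) ∣ b := by exact_mod_cast hlb
    exact (hχ l hlp (hM ▸ (hlb'.pow (by norm_num)).mul_left _)).1
  rw [hM, map_mul, map_mul, map_pow, e1, e2, e3, mul_one, ← Units.val_mul, Units.val_eq_one,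
    MonoidHom.inv_apply, inv_mul_eq_one] at hχ1
  rw [hχ1]

open Classical in
theorem card_mul_sq_le [Finite G] (hG : ∀ g : G, g ^ 3 = 1) (hd : 0 < d)
    (hsq : ∀ k : ℤ, ((8748 * d : ℕ) : ℤ) ≠ k * k)
    (h : ∀ g h, ∃ (x y : ℤ√(-(d : ℤ))) (c c' : ℤ), x ≠ 0 ∧ y ≠ 0 ∧
      c ≠ 0 ∧ c' ≠ 0 ∧ c * (α g * α h * x ^ 3) = c' * (α (g * h) * y ^ 3))
    {e n : G → ℤ} (he : ∀ g, e g = 1 ∨ e g = 4) (hn : ∀ g, (α g).norm = e g * n g ^ 3)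
    (hco : ∀ g, IsCoprime (α g).re (α g).im) (h3 : ∀ g, ¬ 3 ∣ (α g).re)
    (h27 : ∀ g, ¬ 27 ∣ (α g).im)
    (hcube : ∀ g ≠ 1, ∀ a b : ℚ, a ^ 3 - 3 * d * a * b ^ 2 = e g * (α g).re →
      3 * a ^ 2 * b - d * b ^ 3 = e g * (α g).im → False) {S J : ℕ}
    (hS : ∀ c : ℤ, (c : ℝ) ^ 2 ≤ ((8748 * d : ℕ) : ℤ) → |c| ≤ S)
    (hJ : 4 * √((((8748 * d : ℕ) : ℤ)) : ℝ) ≤ 4 ^ J) {P : Finset ℕ}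
    (hP : ∀ p ∈ P, p.Prime ∧ p % 3 = 2 ∧ p ≠ 2 ∧ ¬ p ∣ d ∧ (∀ g, ¬ (p : ℤ) ∣ n g) ∧
      ∃ x : ℤ, (p : ℤ) ∣ x ^ 2 - 3 * d) :
    Nat.card G * P.card ^ 2 ≤ (Lat.dataSet ((8748 * d : ℕ) : ℤ) S J).card *
      (P.card + ((P ×ˢ P).filter (fun x => Lat.Repr ((8748 * d : ℕ) : ℤ) x.1 x.2)).card) := by
  have := finite_hom hG
  have := Fintype.ofFinite (G →* Eisˣ)
  have := Fintype.ofFinite G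
  have hα : ∀ g, α g ≠ 0 := fun g h0 => h3 g (by rw [h0]; exact dvd_zero _)
  have he' : ∀ g, e g ≠ 0 := fun g => by rcases he g with h | h <;> rw [h] <;> norm_num
  have hn0 : ∀ g, n g ≠ 0 := fun g h0 => norm_ne_zero hd (hα g) (by rw [hn, h0]; ring)
  let T : Finset ℕ := (6 * d).primeFactors ∪ Finset.univ.biUnion (fun g => (n g).natAbs.primeFactors) ∪ P
  obtain ⟨m, r, hm, hdis⟩ := exists_disjoint_family (fun ψ => CharMod α ψ) T fun ψ T' => by
    obtain ⟨S', ρ, f, h1, h2⟩ := exists_prod_eq hG hd hα h e n he' hn hcube ψ T'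
    exact exists_charMod h1 h2
  have hm0 : ∀ i, m i ≠ 0 := fun i => (hm i).1.1.ne_zero
  have hmT : ∀ i (l : ℕ), l.Prime → l ∣ m i → l % 3 = 2 ∧ ¬ l ∣ 6 * d ∧
      (∀ g, ¬ (l : ℤ) ∣ n g) ∧ l ∉ P := by
    intro i l hl hlm
    have h1 := (hm i).2 l (Nat.mem_primeFactors.mpr ⟨hl, hlm, hm0 i⟩)
    simp only [T, Finset.mem_union, not_or, Finset.mem_biUnion, Finset.mem_univ, true_and,
      not_exists] at h1
    obtain ⟨⟨h2, h3⟩, h4⟩ := h1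
    exact ⟨((hm i).1.good hl hlm).mod_three, fun h => h2 (Nat.mem_primeFactors.mpr
      ⟨hl, h, by positivity⟩), fun g h => h3 g (Nat.mem_primeFactors.mpr
        ⟨hl, natCast_dvd_natAbs.mpr h, by simpa using hn0 g⟩), h4⟩
  have hPT : ∀ p ∈ P, ¬ p ∣ 6 * d := fun p hp hdv => by
    obtain ⟨h1, h2, h4, h5, -⟩ := hP p hp
    rcases h1.dvd_mul.mp hdv with h6 | h6
    · have h7 : p ∣ 2 * 3 := h6
      rcases h1.dvd_mul.mp h7 with h7 | h7
      · exact h4 ((Nat.prime_dvd_prime_iff_eq h1 (by norm_num)).mp h7)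
      · have := (Nat.prime_dvd_prime_iff_eq h1 (by norm_num)).mp h7
        omega
    · exact h5 h6
  have hD : ∀ l : ℕ, l.Prime → ¬ l ∣ 6 * d → ¬ (l : ℤ) ∣ 2 * ((8748 * d : ℕ) : ℤ) := by
    intro l hl h1 h2
    have h3 : l ∣ (6 * d) ^ 7 := by
      have h4 : l ∣ 2 * (8748 * d) := by exact_mod_cast h2
      exact h4.trans ⟨16 * d ^ 6, by ring⟩
    exact h1 (hl.dvd_of_dvd_pow h3)
  have hcop : ∀ i, IsCoprime (m i : ℤ) (2 * ((8748 * d : ℕ) : ℤ)) := fun i => by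
    have : Nat.Coprime (m i) (2 * (8748 * d)) := Nat.Coprime.symm <| Nat.coprime_of_dvd
      fun l hl h1 h2 => hD l hl (hmT i l hl h2).2.1 (by exact_mod_cast h1)
    exact_mod_cast Nat.isCoprime_iff_coprime.mpr this
  rw [← card_hom hG, Nat.card_eq_fintype_card]
  refine Lat.card_mul_sq_le_of_sep hsq (by positivity) hS hJ Fintype.card_pos (m := m)
    (r := fun i => 54 * r i) (fun i => (hm i).1.1) hcop (fun i j hij => ?_) (fun i => ?_)
    (fun p hp => (hP p hp).1) (fun p hp i hpm => (hmT i p (hP p hp).1 hpm).2.2.2 hp)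
    (fun p hp => hD p (hP p hp).1 (hPT p hp)) (fun p hp => ?_) ?_
  · exact Nat.disjoint_primeFactors (hm0 i) (hm0 j) |>.mp (hdis i j hij)
  · obtain ⟨c, hc⟩ := (hm i).1.dvd
    exact ⟨2916 * c, by push_cast; linear_combination 2916 * hc⟩
  · obtain ⟨x, c, hc⟩ := (hP p hp).2.2.2.2.2
    exact ⟨54 * x, 2916 * c, by push_cast; linear_combination 2916 * hc⟩
  · intro i j hij s t hst hs hs' hM
    obtain ⟨b, hb, hbM⟩ : ∃ b : ℕ, (b = 1 ∨ ∃ p ∈ P, ∃ q ∈ P, b = p * q) ∧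
        s ^ 2 - ((8748 * d : ℕ) : ℤ) * t ^ 2 = m i * m j * b ^ 3 := by
      rcases hM with h1 | ⟨p, hp, q, hq, h1⟩
      · exact ⟨1, Or.inl rfl, by rw [h1]; simp⟩
      · exact ⟨p * q, Or.inr ⟨p, hp, q, hq, rfl⟩, by rw [h1]; push_cast; ring⟩
    have hbl : ∀ l : ℕ, l.Prime → l ∣ b → l ∈ P := fun l hl hlb => by
      rcases hb with rfl | ⟨p, hp, q, hq, rfl⟩
      · exact absurd (Nat.dvd_one.mp hlb) hl.ne_one
      · rcases hl.dvd_mul.mp hlb with h1 | h1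
        · rwa [(Nat.prime_dvd_prime_iff_eq hl (hP p hp).1).mp h1]
        · rwa [(Nat.prime_dvd_prime_iff_eq hl (hP q hq).1).mp h1]
    have hM' : s ^ 2 - 3 * d * (54 * t) ^ 2 = m i * m j * b ^ 3 := by
      rw [← hbM]; push_cast; ring
    have hl : ∀ l : ℕ, l.Prime → (l : ℤ) ∣ s ^ 2 - 3 * d * (54 * t) ^ 2 →
        l % 3 = 2 ∧ (∀ g, ¬ (l : ℤ) ∣ n g) ∧ ¬ l ∣ 6 * d := by
      intro l hl hlM
      rw [hM'] at hlM
      have h1 : l ∣ m i * m j * b ^ 3 := by exact_mod_cast hlM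
      rcases hl.dvd_mul.mp h1 with h1 | h1
      · rcases hl.dvd_mul.mp h1 with h1 | h1
        · exact ⟨(hmT i l hl h1).1, (hmT i l hl h1).2.2.1, (hmT i l hl h1).2.1⟩
        · exact ⟨(hmT j l hl h1).1, (hmT j l hl h1).2.2.1, (hmT j l hl h1).2.1⟩
      · have h2 := hbl l hl (hl.dvd_of_dvd_pow h1)
        exact ⟨(hP l h2).2.1, (hP l h2).2.2.2.2.1, hPT l h2⟩
    have hst' : IsCoprime s (54 * t) := by
      refine IsCoprime.mul_right ?_ hst
      rw [Int.isCoprime_iff_gcd_eq_one]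
      by_contra hne
      obtain ⟨l, hlp, hlg⟩ := Nat.exists_prime_and_dvd hne
      have h1 : (l : ℤ) ∣ s := (Int.natCast_dvd_natCast.mpr hlg).trans (Int.gcd_dvd_left _ _)
      have h2 : (l : ℤ) ∣ 54 := (Int.natCast_dvd_natCast.mpr hlg).trans (Int.gcd_dvd_right _ _)
      have h4 : (l : ℤ) ∣ s ^ 2 - 3 * d * (54 * t) ^ 2 :=
        dvd_sub (h1.pow (by norm_num)) (((h2.mul_right _).pow (by norm_num)).mul_left _)
      have h5 : l ∣ 54 := by exact_mod_cast h2
      have h6 : l ∣ 6 ^ 3 := h5.trans ⟨4, by norm_num⟩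
      exact (hl l hlp h4).2.2 ((hlp.dvd_of_dvd_pow h6).mul_right _)
    refine hij ((hm i).1.eq (hm j).1 he hn hco h3 h27 hst' ?_ ?_ ⟨2 * t, by ring⟩ ⟨27 * t, by ring⟩
      hM' (fun l hlp hlM => ⟨(hl l hlp hlM).1, (hl l hlp hlM).2.1, fun hdv =>
        (hl l hlp hlM).2.2 (Dvd.dvd.mul_left (by exact_mod_cast hdv) _)⟩) fun χ hχ => ?_)
    · ring_nf at hs ⊢; exact hs
    · ring_nf at hs' ⊢; exact hs'
    · rcases hb with rfl | ⟨p, hp, q, hq, rfl⟩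
      · simp
      · rw [Nat.cast_mul, map_mul, mul_pow, hχ p (hP p hp).1 (dvd_mul_right _ _),
          hχ q (hP q hq).1 (dvd_mul_left _ _), one_mul]

end Twist

end Eis
end FourthMoment

namespace FourthMoment
namespace Eis

theorem mul_ne_mul_self {d : ℕ} (hd : Squarefree d) (hd3 : d ≠ 3) (k : ℤ) :
    ((8748 * d : ℕ) : ℤ) ≠ k * k := by
  intro h
  have h1 : 8748 * d = k.natAbs * k.natAbs := by
    rw [← Int.natAbs_mul, ← h, Int.natAbs_natCast]
  have h54 : 54 ∣ k.natAbs := by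
    have h2 : 54 ^ 2 ∣ k.natAbs ^ 2 := ⟨3 * d, by rw [pow_two, ← h1]; ring⟩
    exact (Nat.pow_dvd_pow_iff (by norm_num)).mp h2
  obtain ⟨j, hj⟩ := h54
  rw [hj] at h1
  have h2 : 3 * d = j * j := by nlinarith
  have h3 : 3 ∣ j := by
    have : 3 ∣ j * j := ⟨d, h2.symm⟩
    rcases Nat.prime_three.dvd_mul.mp this with h | h <;> exact h
  obtain ⟨i, rfl⟩ := h3
  have h4 : d = 3 * (i * i) := by nlinarith
  have h5 : i * i ∣ d := ⟨3, by rw [h4]; ring⟩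
  have h6 := Nat.isUnit_iff.mp (hd i h5)
  rw [h6] at h4
  omega

theorem exists_card_torsion_le (η : ℝ) (hη : 0 < η) : ∃ C : ℝ, 0 < C ∧
    ∀ (d : ℕ), Squarefree d → d ≠ 3 → ∀ (G : Type) [CommGroup G] [Finite G] (α : G → ℤ√(-(d : ℤ)))
    (e n : G → ℤ), (∀ g : G, g ^ 3 = 1) →
    (∀ g h, ∃ (x y : ℤ√(-(d : ℤ))) (c c' : ℤ), x ≠ 0 ∧ y ≠ 0 ∧
      c ≠ 0 ∧ c' ≠ 0 ∧ c * (α g * α h * x ^ 3) = c' * (α (g * h) * y ^ 3)) →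
    (∀ g, e g = 1 ∨ e g = 4) → (∀ g, (α g).norm = e g * n g ^ 3) →
    (∀ g, IsCoprime (α g).re (α g).im) → (∀ g, ¬ 3 ∣ (α g).re) → (∀ g, ¬ 27 ∣ (α g).im) →
    (∀ g ≠ 1, ∀ a b : ℚ, a ^ 3 - 3 * d * a * b ^ 2 = e g * (α g).re →
      3 * a ^ 2 * b - d * b ^ 3 = e g * (α g).im → False) →
    ∀ (P : Finset ℕ) (Z V : ℕ), (∀ v : ℕ, d * v ^ 2 ≤ 4 * Z ^ 6 → v ≤ V) →
    (∀ p ∈ P, p.Prime ∧ p ≤ Z ∧ p % 3 = 2 ∧ p ≠ 2 ∧ ¬ p ∣ d ∧ (∀ g, ¬ (p : ℤ) ∣ n g) ∧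
      ∃ x : ℤ, (p : ℤ) ∣ x ^ 2 - 3 * d) →
    (Nat.card G : ℝ) * (P.card : ℝ) ^ 2 ≤ C * (d : ℝ) ^ (1 / 2 + η) *
      (P.card + 2 * (solSet (-(8748 : ℕ)) 1 V (Z ^ 2) (2 * Z ^ 3) d).card) := by
  obtain ⟨C, hC, h⟩ := Lat.exists_card_dataSet_le 8748 (by norm_num) η hη
  refine ⟨C, hC, ?_⟩
  intro d hd hd3 G _ _ α e n hG hrel he hn hco h3 h27 hcube P Z V hV hP
  obtain ⟨S, J, hS, hJ, hSJ⟩ := h d hd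
  have h1 := card_mul_sq_le hG (Nat.pos_of_ne_zero hd.ne_zero) (mul_ne_mul_self hd hd3) hrel he hn
    hco h3 h27 hcube hS hJ (P := P) fun p hp => ⟨(hP p hp).1, (hP p hp).2.2⟩
  classical
  have h2 := card_pairs_le P (fun p hp => (hP p hp).1)
    (Lat.Repr ((8748 * d : ℕ) : ℤ)) (solSet (-(8748 : ℕ)) 1 V (Z ^ 2) (2 * Z ^ 3) d)
    fun p hp q hq hpq => Lat.Repr.exists_mem_solSet hV (by norm_num) (hP p hp).1 (hP q hq).1
      (hP p hp).2.1 (hP q hq).2.1 hpq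
  calc (Nat.card G : ℝ) * (P.card : ℝ) ^ 2 ≤ ((Lat.dataSet ((8748 * d : ℕ) : ℤ) S J).card : ℝ) *
      (P.card + 2 * (solSet (-(8748 : ℕ)) 1 V (Z ^ 2) (2 * Z ^ 3) d).card) := by
        have h3 := h1.trans (Nat.mul_le_mul_left _ (Nat.add_le_add_left (by convert h2) _))
        exact_mod_cast h3
    _ ≤ _ := by gcongr

end Eis
end FourthMoment

namespace FourthMoment

open NumberField

/-- `δ` is a square root of `-d` in the ring of integers of the quadratic field `ℚ(√-d)`. -/
structure IsQuad {K : Type} [Field K] [NumberField K] (d : ℕ) (δ : 𝓞 K) : Prop where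
  sq : δ ^ 2 = -(d : 𝓞 K)
  finrank : Module.finrank ℚ K = 2
  squarefree : Squarefree d

namespace IsQuad

variable {K : Type} [Field K] [NumberField K] {d : ℕ} {δ : 𝓞 K} (h : IsQuad d δ)
include h

theorem pos : 0 < d := Nat.pos_of_ne_zero h.squarefree.ne_zero

theorem sq_coe : (δ : K) ^ 2 = -(d : K) := by
  have := congrArg (algebraMap (𝓞 K) K) h.sq
  simpa using this

theorem eq_zero_of_rat {a b : ℚ} (hab : (a : K) + b * (δ : K) = 0) : a = 0 ∧ b = 0 := by
  have hd : (0 : ℚ) < d := by exact_mod_cast h.pos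
  have h1 : ((a ^ 2 + d * b ^ 2 : ℚ) : K) = 0 := by
    push_cast
    linear_combination ((a : K) - b * (δ : K)) * hab + (b : K) ^ 2 * h.sq_coe
  have h2 : a ^ 2 + d * b ^ 2 = 0 := by exact_mod_cast h1
  have ha : a = 0 := by
    have : a ^ 2 = 0 := by nlinarith [sq_nonneg a, mul_nonneg hd.le (sq_nonneg b)]
    simpa using this
  refine ⟨ha, ?_⟩
  rw [ha] at h2
  have : b ^ 2 = 0 := by nlinarith [mul_nonneg hd.le (sq_nonneg b), sq_nonneg b]
  simpa using this

theorem exists_basis : ∃ B : Module.Basis (Fin 2) ℚ K, B 0 = 1 ∧ B 1 = (δ : K) := by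
  have hli : LinearIndependent ℚ ![(1 : K), (δ : K)] := by
    rw [LinearIndependent.pair_iff]
    intro s t hst
    refine h.eq_zero_of_rat ?_
    rw [← hst, Rat.smul_def, Rat.smul_def, mul_one]
  exact ⟨basisOfLinearIndependentOfCardEqFinrank hli (by simp [h.finrank]), by simp, by simp⟩

theorem exists_rat (x : K) : ∃ a b : ℚ, x = a + b * (δ : K) := by
  obtain ⟨B, h0, h1⟩ := h.exists_basis
  refine ⟨B.repr x 0, B.repr x 1, ?_⟩
  conv_lhs => rw [← B.sum_repr x]
  rw [Fin.sum_univ_two, h0, h1, Rat.smul_def, Rat.smul_def, mul_one]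

theorem trace_norm (a b : ℚ) : Algebra.trace ℚ K (a + b * (δ : K)) = 2 * a ∧
    Algebra.norm ℚ ((a : K) + b * (δ : K)) = a ^ 2 + d * b ^ 2 := by
  obtain ⟨B, h0, h1⟩ := h.exists_basis
  have hrepr : ∀ s t : ℚ, B.repr ((s : K) + t * (δ : K)) 0 = s ∧ B.repr ((s : K) + t * (δ : K)) 1 = t := by
    intro s t
    have e : (s : K) + t * (δ : K) = s • B 0 + t • B 1 := by
      rw [h0, h1, Rat.smul_def, Rat.smul_def, mul_one]
    rw [e]
    simp
  have e0 : ((a : K) + b * (δ : K)) * B 0 = (a : K) + b * (δ : K) := by rw [h0, mul_one]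
  have e1 : ((a : K) + b * (δ : K)) * B 1 = ((-(d * b) : ℚ) : K) + a * (δ : K) := by
    rw [h1]; push_cast; linear_combination (b : K) * h.sq_coe
  rw [Algebra.trace_eq_matrix_trace B, Algebra.norm_eq_matrix_det B, Matrix.trace_fin_two,
    Matrix.det_fin_two]
  simp only [Algebra.leftMulMatrix_eq_repr_mul, e0, e1, (hrepr _ _).1, (hrepr _ _).2]
  constructor <;> ring

theorem exists_int (x : 𝓞 K) : ∃ u v : ℤ, 2 * x = u + v * δ := by
  obtain ⟨a, b, hx⟩ := h.exists_rat (x : K)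
  obtain ⟨ht, hn⟩ := h.trace_norm a b
  rw [← hx] at ht hn
  have hint := RingOfIntegers.isIntegral_coe x
  obtain ⟨u, hu⟩ := IsIntegrallyClosed.isIntegral_iff.mp (Algebra.isIntegral_trace (L := ℚ) hint)
  obtain ⟨n, hn'⟩ := IsIntegrallyClosed.isIntegral_iff.mp (Algebra.isIntegral_norm ℚ hint)
  have hu' : (u : ℚ) = 2 * a := by rw [← ht, ← hu]; simp
  have hn'' : (n : ℚ) = a ^ 2 + d * b ^ 2 := by rw [← hn, ← hn']; simp
  have hd : (d : ℚ) ≠ 0 := by exact_mod_cast h.pos.ne'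
  have hsq : IsIntegral ℤ (2 * b) := by
    have h1 : ((4 * n - u ^ 2 : ℤ) : ℚ) = d * (2 * b) ^ 2 := by
      push_cast; rw [hu', hn'']; ring
    have h2 : IsIntegral ℤ ((d : ℚ) * (2 * b)) := by
      refine IsIntegral.of_pow (n := 2) (by norm_num) ?_
      have : ((d : ℚ) * (2 * b)) ^ 2 = ((d * (4 * n - u ^ 2) : ℤ) : ℚ) := by
        push_cast at h1 ⊢; rw [h1]; ring
      rw [this]
      exact isIntegral_algebraMap (R := ℤ) (A := ℚ)
    obtain ⟨w, hw⟩ := IsIntegrallyClosed.isIntegral_iff.mp h2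
    have hw' : (w : ℚ) = d * (2 * b) := by rw [← hw]; simp
    have h4 : (w : ℤ) ^ 2 = d * (4 * n - u ^ 2) := by
      have : ((w ^ 2 : ℤ) : ℚ) = ((d * (4 * n - u ^ 2) : ℤ) : ℚ) := by
        push_cast at h1 ⊢; rw [h1, hw']; ring
      exact_mod_cast this
    have h5 : (d : ℤ) ∣ w := by
      have hsf : Squarefree (d : ℤ) := Int.squarefree_natCast.mpr h.squarefree
      exact (hsf.isRadical) 2 w ⟨_, h4⟩
    obtain ⟨c, hc⟩ := h5
    have : 2 * b = (c : ℚ) := by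
      rw [hc] at hw'
      push_cast at hw'
      exact (mul_left_cancel₀ hd hw').symm
    rw [this]
    exact isIntegral_algebraMap (R := ℤ) (A := ℚ)
  obtain ⟨v, hv⟩ := IsIntegrallyClosed.isIntegral_iff.mp hsq
  have hv' : (v : ℚ) = 2 * b := by rw [← hv]; simp
  refine ⟨u, v, ?_⟩
  apply RingOfIntegers.coe_injective
  simp only [map_mul, map_add, map_ofNat, map_intCast]
  rw [show algebraMap (𝓞 K) K x = _ from hx]
  have h1 : (u : K) = ((u : ℚ) : K) := by simp
  have h2 : (v : K) = ((v : ℚ) : K) := by simp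
  rw [h1, h2, hu', hv']
  push_cast
  ring

theorem eq_zero {u v : ℤ} (huv : (u : 𝓞 K) + v * δ = 0) : u = 0 ∧ v = 0 := by
  have h1 := congrArg (algebraMap (𝓞 K) K) huv
  simp only [map_add, map_mul, map_intCast, map_zero] at h1
  have := h.eq_zero_of_rat (a := u) (b := v) (by push_cast; exact h1)
  exact_mod_cast this

theorem ext {u v u' v' : ℤ} (huv : (u : 𝓞 K) + v * δ = u' + v' * δ) : u = u' ∧ v = v' := by
  have := h.eq_zero (u := u - u') (v := v - v') (by push_cast; linear_combination huv)
  omega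

theorem absNorm_span {x : 𝓞 K} {u v : ℤ} (hx : 2 * x = u + v * δ) :
    4 * ((Ideal.absNorm (Ideal.span {x}) : ℕ) : ℤ) = u ^ 2 + d * v ^ 2 := by
  rw [Ideal.absNorm_span_singleton]
  have h1 : (x : K) = ((u / 2 : ℚ) : K) + ((v / 2 : ℚ) : K) * (δ : K) := by
    have := congrArg (algebraMap (𝓞 K) K) hx
    simp only [map_add, map_mul, map_intCast, map_ofNat] at this
    push_cast
    linear_combination (1 / 2 : K) * this
  have h2 : 4 * ((Algebra.norm ℤ x : ℤ) : ℚ) = u ^ 2 + d * v ^ 2 := by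
    rw [Algebra.coe_norm_int, h1, (h.trace_norm _ _).2]
    ring
  have h3 : 4 * Algebra.norm ℤ x = u ^ 2 + d * v ^ 2 := by exact_mod_cast h2
  have h4 : 0 ≤ Algebra.norm ℤ x := by nlinarith [sq_nonneg u, sq_nonneg v, mul_nonneg (Nat.cast_nonneg (α := ℤ) d) (sq_nonneg v)]
  rw [← h3, Int.natCast_natAbs, abs_of_nonneg h4]

end IsQuad

end FourthMoment

namespace FourthMoment

open NumberField nonZeroDivisors

section InClass

variable {R : Type*} [CommRing R] [IsDedekindDomain R]

/-- The nonzero ideal `I` has class `c`. -/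
def InClass (I : Ideal R) (c : ClassGroup R) : Prop :=
  ∃ h : I ∈ (Ideal R)⁰, ClassGroup.mk0 ⟨I, h⟩ = c

theorem InClass.ne_bot {I : Ideal R} {c : ClassGroup R} (h : InClass I c) : I ≠ ⊥ :=
  mem_nonZeroDivisors_iff_ne_zero.mp h.1

theorem exists_inClass (c : ClassGroup R) : ∃ I : Ideal R, InClass I c := by
  obtain ⟨⟨I, hI⟩, h⟩ := ClassGroup.mk0_surjective c
  exact ⟨I, hI, h⟩

theorem exists_class {I : Ideal R} (h : I ≠ ⊥) : ∃ c, InClass I c :=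
  ⟨_, mem_nonZeroDivisors_iff_ne_zero.mpr h, rfl⟩

theorem InClass.mul {I J : Ideal R} {a b : ClassGroup R} (hI : InClass I a) (hJ : InClass J b) :
    InClass (I * J) (a * b) := by
  obtain ⟨hI, rfl⟩ := hI
  obtain ⟨hJ, rfl⟩ := hJ
  exact ⟨mul_mem hI hJ, by rw [← map_mul]; rfl⟩

theorem InClass.pow {I : Ideal R} {a : ClassGroup R} (hI : InClass I a) (n : ℕ) :
    InClass (I ^ n) (a ^ n) := by
  obtain ⟨hI, rfl⟩ := hI
  exact ⟨pow_mem hI n, by rw [← map_pow]; rfl⟩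

theorem InClass.unique {I : Ideal R} {a b : ClassGroup R} (hI : InClass I a) (hJ : InClass I b) :
    a = b := by
  obtain ⟨hI, rfl⟩ := hI
  obtain ⟨hJ, rfl⟩ := hJ
  rfl

theorem inClass_one_iff {I : Ideal R} : InClass I 1 ↔ ∃ x ≠ 0, I = Ideal.span {x} := by
  constructor
  · rintro ⟨hI, h⟩
    obtain ⟨x, hx⟩ := ((ClassGroup.mk0_eq_one_iff hI).mp h).principal
    refine ⟨x, ?_, hx⟩
    rintro rfl
    refine mem_nonZeroDivisors_iff_ne_zero.mp hI ?_
    rw [hx]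
    simp
  · rintro ⟨x, hx, rfl⟩
    have : Ideal.span {x} ∈ (Ideal R)⁰ := mem_nonZeroDivisors_iff_ne_zero.mpr (by simpa using hx)
    exact ⟨this, (ClassGroup.mk0_eq_one_iff this).mpr ⟨⟨x, rfl⟩⟩⟩

theorem inClass_span {x : R} (hx : x ≠ 0) : InClass (Ideal.span {x}) 1 :=
  inClass_one_iff.mpr ⟨x, hx, rfl⟩

theorem InClass.of_mul_left {I J : Ideal R} {a b : ClassGroup R} (hI : InClass I a)
    (h : InClass (I * J) (a * b)) : InClass J b := by
  have hJ : J ≠ ⊥ := by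
    rintro rfl
    exact h.ne_bot (Ideal.mul_bot I)
  obtain ⟨c, hc⟩ := exists_class hJ
  have := (hI.mul hc).unique h
  rwa [mul_left_cancel this] at hc

theorem InClass.span_mul_iff {J : Ideal R} {b : ClassGroup R} {x : R} (hx : x ≠ 0) :
    InClass (Ideal.span {x} * J) b ↔ InClass J b :=
  ⟨fun h => (inClass_span hx).of_mul_left (by rwa [one_mul]), fun h => by
    simpa using (inClass_span hx).mul h⟩

end InClass

namespace IsQuad

variable {K : Type} [Field K] [NumberField K] {d : ℕ} {δ : 𝓞 K} (h : IsQuad d δ)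
include h

theorem exists_omega : ∃ (ω : 𝓞 K) (t s : ℤ), 0 ≤ t ∧ t ≤ 1 ∧ 0 < s ∧ s ≤ d ∧ t ≤ s ∧
    ω ^ 2 = t * ω - s ∧ ∀ x : 𝓞 K, ∃ m n : ℤ, x = m + n * ω := by
  have key : ∀ x : 𝓞 K, ∃ u v : ℤ, 2 * x = u + v * δ ∧ (4 : ℤ) ∣ u ^ 2 + d * v ^ 2 := fun x => by
    obtain ⟨u, v, hx⟩ := h.exists_int x
    exact ⟨u, v, hx, _, (h.absNorm_span hx).symm⟩
  have hd4 : d % 4 ≠ 0 := fun h4 => by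
    have h5 : 2 * 2 ∣ d := by omega
    have := Nat.isUnit_iff.mp (h.squarefree 2 h5)
    omega
  have hpos := h.pos
  have sq4 : ∀ u : ℤ, (u % 2 = 0 ∧ u ^ 2 % 4 = 0) ∨ (u % 2 = 1 ∧ u ^ 2 % 4 = 1) := fun u => by
    rcases Int.even_or_odd' u with ⟨k, rfl | rfl⟩
    · left; constructor
      · omega
      · ring_nf; omega
    · right; constructor
      · omega
      · ring_nf; omega
  by_cases h3 : d % 4 = 3
  · have hint : IsIntegral ℤ ((1 + (δ : K)) / 2) := by
      refine ⟨Polynomial.X ^ 2 - Polynomial.X + Polynomial.C (((d + 1) / 4 : ℕ) : ℤ), ?_, ?_⟩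
      · monicity!
      · simp only [Polynomial.eval₂_add, Polynomial.eval₂_sub, Polynomial.eval₂_pow,
          Polynomial.eval₂_X, Polynomial.eval₂_C]
        have h1 : ((algebraMap ℤ K) (((d + 1) / 4 : ℕ) : ℤ)) * 4 = d + 1 := by
          have : (d + 1) / 4 * 4 = d + 1 := by omega
          simp only [algebraMap_int_eq, eq_intCast, Int.cast_natCast]
          exact_mod_cast congrArg (Nat.cast (R := K)) this
        linear_combination (1 / 4 : K) * h1 + (1 / 4 : K) * h.sq_coe
    obtain ⟨ω, hω⟩ : ∃ ω : 𝓞 K, 2 * ω = 1 + δ := by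
      refine ⟨⟨_, hint⟩, ?_⟩
      apply RingOfIntegers.coe_injective
      simp only [map_add, map_one]
      change 2 * ((1 + (δ : K)) / 2) = 1 + (δ : K)
      field_simp
    have two : (2 : 𝓞 K) ≠ 0 := two_ne_zero
    refine ⟨ω, 1, ((d + 1) / 4 : ℕ), by norm_num, le_rfl, by omega, by omega, by omega, ?_, fun x => ?_⟩
    · have h1 : ((((d + 1) / 4 : ℕ) : ℤ) : 𝓞 K) * 4 = d + 1 := by
        have : (d + 1) / 4 * 4 = d + 1 := by omega
        exact_mod_cast congrArg (Nat.cast (R := 𝓞 K)) this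
      apply mul_left_cancel₀ two
      apply mul_left_cancel₀ two
      push_cast at h1 ⊢
      linear_combination (2 * ω + δ - 1) * hω + h.sq + h1
    · obtain ⟨u, v, hx, h4⟩ := key x
      have h5 : u % 2 = v % 2 := by
        obtain ⟨c, hc⟩ : ∃ c : ℤ, (d : ℤ) = 4 * c + 3 := ⟨d / 4, by omega⟩
        rw [hc, add_mul, mul_assoc] at h4
        rcases sq4 u with ⟨hu, hu'⟩ | ⟨hu, hu'⟩ <;> rcases sq4 v with ⟨hv, hv'⟩ | ⟨hv, hv'⟩ <;> omega
      refine ⟨(u - v) / 2, v, ?_⟩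
      have h6 : (((u - v) / 2 : ℤ) : 𝓞 K) * 2 = u - v := by
        have : (u - v) / 2 * 2 = u - v := by omega
        exact_mod_cast congrArg (Int.cast (R := 𝓞 K)) this
      apply mul_left_cancel₀ two
      linear_combination hx - h6 - v * hω
  · refine ⟨δ, 0, d, le_rfl, by norm_num, by exact_mod_cast hpos, le_rfl, by omega, ?_, fun x => ?_⟩
    · rw [h.sq]; push_cast; ring
    · obtain ⟨u, v, hx, h4⟩ := key x
      have h5 : u % 2 = 0 ∧ v % 2 = 0 := by
        obtain ⟨c, hc⟩ : ∃ c : ℤ, (d : ℤ) = 4 * c + 1 ∨ (d : ℤ) = 4 * c + 2 := ⟨d / 4, by omega⟩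
        rcases hc with hc | hc <;> rw [hc, add_mul, mul_assoc] at h4 <;>
        rcases sq4 u with ⟨hu, hu'⟩ | ⟨hu, hu'⟩ <;> rcases sq4 v with ⟨hv, hv'⟩ | ⟨hv, hv'⟩ <;> omega
      refine ⟨u / 2, v / 2, ?_⟩
      have h6 : ((u / 2 : ℤ) : 𝓞 K) * 2 = u := by
        have : u / 2 * 2 = u := by omega
        exact_mod_cast congrArg (Int.cast (R := 𝓞 K)) this
      have h7 : ((v / 2 : ℤ) : 𝓞 K) * 2 = v := by
        have : v / 2 * 2 = v := by omega
        exact_mod_cast congrArg (Int.cast (R := 𝓞 K)) this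
      apply mul_left_cancel₀ (two_ne_zero : (2 : 𝓞 K) ≠ 0)
      linear_combination hx - h6 - δ * h7

theorem exists_small_mem {I : Ideal (𝓞 K)} (hI : I ≠ ⊥) : ∃ x ∈ I, x ≠ 0 ∧
    (Ideal.absNorm (Ideal.span {x}) : ℝ) ≤ 2 * √d * Ideal.absNorm I := by
  set N := Ideal.absNorm I with hN
  have hN0 : 0 < N := Nat.pos_of_ne_zero (by rw [hN, Ne, Ideal.absNorm_eq_zero_iff]; exact hI)
  have hd : (0 : ℝ) < √d := Real.sqrt_pos.mpr (by exact_mod_cast h.pos)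
  have hdd : √(d : ℝ) * √d = d := Real.mul_self_sqrt (Nat.cast_nonneg d)
  have hNr : (0 : ℝ) < N := by exact_mod_cast hN0
  set A := ⌊√(N * √d)⌋₊ with hA
  set B := ⌊√(N / √d)⌋₊ with hB
  have hA1 : √(N * √d) < A + 1 := Nat.lt_floor_add_one _
  have hB1 : √(N / √d) < B + 1 := Nat.lt_floor_add_one _
  have hA2 : (A : ℝ) ^ 2 ≤ N * √d := by
    have : (A : ℝ) ≤ √(N * √d) := Nat.floor_le (Real.sqrt_nonneg _)
    calc (A : ℝ) ^ 2 ≤ √(N * √d) ^ 2 := by gcongr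
      _ = _ := Real.sq_sqrt (by positivity)
  have hB2 : (B : ℝ) ^ 2 ≤ N / √d := by
    have : (B : ℝ) ≤ √(N / √d) := Nat.floor_le (Real.sqrt_nonneg _)
    calc (B : ℝ) ^ 2 ≤ √(N / √d) ^ 2 := by gcongr
      _ = _ := Real.sq_sqrt (by positivity)
  have hlt : N < (A + 1) * (B + 1) := by
    have h1 : √(N * √d) * √(N / √d) = N := by
      rw [← Real.sqrt_mul (by positivity)]
      have : (N : ℝ) * √d * (N / √d) = (N : ℝ) ^ 2 := by field_simp
      rw [this, Real.sqrt_sq hNr.le]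
    have h2 : (N : ℝ) < (A + 1) * (B + 1) := by
      rw [← h1]
      exact mul_lt_mul'' hA1 hB1 (Real.sqrt_nonneg _) (Real.sqrt_nonneg _)
    exact_mod_cast h2
  have hcard : Nat.card (𝓞 K ⧸ I) = N := by
    rw [hN, Ideal.absNorm_apply, Submodule.cardQuot_apply]
  have hfin : Finite (𝓞 K ⧸ I) := Nat.finite_of_card_ne_zero (by omega)
  have := Fintype.ofFinite (𝓞 K ⧸ I)
  obtain ⟨⟨a, b⟩, ⟨a', b'⟩, hne, hab⟩ := Fintype.exists_ne_map_eq_of_card_lt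
    (fun p : Fin (A + 1) × Fin (B + 1) =>
      Ideal.Quotient.mk I (((p.1 : ℕ) : ℤ) + ((p.2 : ℕ) : ℤ) * δ)) (by
      rw [← Nat.card_eq_fintype_card, hcard]; simpa using hlt)
  rw [Ideal.Quotient.eq] at hab
  set x : ℤ := (a : ℕ) - (a' : ℕ) with hx
  set y : ℤ := (b : ℕ) - (b' : ℕ) with hy
  have e : (((a : ℕ) : ℤ) : 𝓞 K) + ((b : ℕ) : ℤ) * δ - (((a' : ℕ) : ℤ) + ((b' : ℕ) : ℤ) * δ)
      = x + y * δ := by rw [hx, hy]; push_cast; ring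
  have hxA : |x| ≤ A := by rw [abs_le]; omega
  have hyB : |y| ≤ B := by rw [abs_le]; omega
  refine ⟨x + y * δ, by rw [← e]; exact hab, fun h0 => ?_, ?_⟩
  · obtain ⟨h1, h2⟩ := h.eq_zero h0
    have ha : (a : ℕ) = a' := by omega
    have hb : (b : ℕ) = b' := by omega
    exact hne (Prod.ext (Fin.ext ha) (Fin.ext hb))
  · have h1 := h.absNorm_span (x := x + y * δ) (u := 2 * x) (v := 2 * y) (by push_cast; ring)
    have h2 : ((Ideal.absNorm (Ideal.span {(x : 𝓞 K) + y * δ}) : ℕ) : ℝ) = x ^ 2 + d * y ^ 2 := by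
      have : ((Ideal.absNorm (Ideal.span {(x : 𝓞 K) + y * δ}) : ℕ) : ℤ) = x ^ 2 + d * y ^ 2 := by
        linarith
      exact_mod_cast this
    have h3 : (x : ℝ) ^ 2 ≤ (A : ℝ) ^ 2 := by
      rw [← sq_abs (x : ℝ)]
      have : |(x : ℝ)| ≤ A := by exact_mod_cast hxA
      gcongr
    have h4 : (y : ℝ) ^ 2 ≤ (B : ℝ) ^ 2 := by
      rw [← sq_abs (y : ℝ)]
      have : |(y : ℝ)| ≤ B := by exact_mod_cast hyB
      gcongr
    rw [h2]
    have h5 : (d : ℝ) * (N / √d) = N * √d := by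
      field_simp; linarith [hdd]
    have h6 : (d : ℝ) * y ^ 2 ≤ d * (N / √d) := by
      have := h4.trans hB2
      gcongr
    rw [h5] at h6
    linarith [h3.trans hA2]

theorem exists_inClass_le (c : ClassGroup (𝓞 K)) : ∃ I, InClass I c ∧
    (Ideal.absNorm I : ℝ) ≤ 2 * √d := by
  obtain ⟨J, hJ⟩ := exists_inClass c⁻¹
  obtain ⟨x, hxJ, hx0, hx⟩ := h.exists_small_mem hJ.ne_bot
  obtain ⟨I, hI⟩ := Ideal.dvd_span_singleton.mpr hxJ
  refine ⟨I, hJ.of_mul_left (by rw [← hI, inv_mul_cancel]; exact inClass_span hx0), ?_⟩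
  rw [hI, map_mul] at hx
  have hN0 : 0 < Ideal.absNorm J :=
    Nat.pos_of_ne_zero (by rw [Ne, Ideal.absNorm_eq_zero_iff]; exact hJ.ne_bot)
  have : (0 : ℝ) < Ideal.absNorm J := by exact_mod_cast hN0
  push_cast at hx
  nlinarith

end IsQuad

end FourthMoment

namespace FourthMoment

open NumberField nonZeroDivisors

theorem exists_inClass_min {K : Type} [Field K] [NumberField K] (P : Ideal (𝓞 K) → Prop)
    (hP : ∃ I, P I) : ∃ I, P I ∧ ∀ J, P J → Ideal.absNorm I ≤ Ideal.absNorm J := by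
  classical
  have hex : ∃ n, ∃ I, P I ∧ Ideal.absNorm I = n := hP.imp' _ fun I hI => ⟨I, hI, rfl⟩
  obtain ⟨I, hI, hn⟩ := Nat.find_spec hex
  exact ⟨I, hI, fun J hJ => hn ▸ Nat.find_min' hex ⟨J, hJ, rfl⟩⟩

namespace IsQuad

variable {K : Type} [Field K] [NumberField K] {d : ℕ} {δ : 𝓞 K} (h : IsQuad d δ)
include h

theorem absNorm_span_int (g : ℤ) :
    ((Ideal.absNorm (Ideal.span {(g : 𝓞 K)}) : ℕ) : ℤ) = g ^ 2 := by
  have := h.absNorm_span (x := (g : 𝓞 K)) (u := 2 * g) (v := 0) (by push_cast; ring)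
  linarith

theorem exists_sub_mem {ω : 𝓞 K} {t s : ℤ} (hω : ω ^ 2 = t * ω - s)
    (hgen : ∀ x : 𝓞 K, ∃ m n : ℤ, x = m + n * ω) {c : ClassGroup (𝓞 K)} {I : Ideal (𝓞 K)}
    (hI : InClass I c) (hmin : ∀ J, InClass J c → Ideal.absNorm I ≤ Ideal.absNorm J) :
    ∃ b : ℤ, ω - b ∈ I := by
  let J : Ideal ℤ :=
    { carrier := {y | ∃ x : ℤ, (x : 𝓞 K) + y * ω ∈ I}
      add_mem' := by
        rintro y z ⟨x, hx⟩ ⟨w, hw⟩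
        refine ⟨x + w, ?_⟩
        have := I.add_mem hx hw
        push_cast
        ring_nf at this ⊢
        exact this
      zero_mem' := ⟨0, by simp⟩
      smul_mem' := by
        rintro k y ⟨x, hx⟩
        refine ⟨k * x, ?_⟩
        have := I.mul_mem_left (k : 𝓞 K) hx
        rw [smul_eq_mul]
        push_cast
        ring_nf at this ⊢
        exact this }
  obtain ⟨g, hg⟩ := (IsPrincipalIdealRing.principal J).principal
  have hmem : ∀ y, y ∈ J ↔ g ∣ y := fun y => by rw [hg]; exact Ideal.mem_span_singleton
  have hdvd : ∀ x y : ℤ, (x : 𝓞 K) + y * ω ∈ I → g ∣ x ∧ g ∣ y := fun x y hxy => by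
    have h1 : g ∣ y := (hmem y).mp ⟨x, hxy⟩
    have h2 : g ∣ x + y * t := (hmem _).mp ⟨-(y * s), by
      have := I.mul_mem_left ω hxy
      have e : ω * ((x : 𝓞 K) + y * ω) = ((-(y * s) : ℤ) : 𝓞 K) + ((x + y * t : ℤ) : 𝓞 K) * ω := by
        push_cast; linear_combination (y : 𝓞 K) * hω
      rwa [e] at this⟩
    exact ⟨(Int.dvd_iff_dvd_of_dvd_add h2).mpr (h1.mul_right t), h1⟩
  have hle : Ideal.span {(g : 𝓞 K)} ∣ I := by
    rw [Ideal.dvd_iff_le]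
    intro z hz
    obtain ⟨x, y, rfl⟩ := hgen z
    obtain ⟨⟨k, hk⟩, l, hl⟩ := hdvd x y hz
    refine Ideal.mem_span_singleton.mpr ⟨k + l * ω, ?_⟩
    rw [hk, hl]; push_cast; ring
  obtain ⟨I', hI'⟩ := hle
  have hg0 : g ≠ 0 := by
    rintro rfl
    refine hI.ne_bot ?_
    rw [hI']
    simp
  have hgK : (g : 𝓞 K) ≠ 0 := by exact_mod_cast hg0
  have hcl : InClass I' c := (InClass.span_mul_iff hgK).mp (hI' ▸ hI)
  have h1 := hmin I' hcl
  have hpos : 0 < Ideal.absNorm I' :=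
    Nat.pos_of_ne_zero (by rw [Ne, Ideal.absNorm_eq_zero_iff]; exact hcl.ne_bot)
  have h2 : ((Ideal.absNorm I : ℕ) : ℤ) = g ^ 2 * (Ideal.absNorm I' : ℕ) := by
    rw [hI', map_mul, Nat.cast_mul, h.absNorm_span_int]
  have h3 : g ^ 2 ≤ 1 := by
    have : ((Ideal.absNorm I : ℕ) : ℤ) ≤ (Ideal.absNorm I' : ℕ) := by exact_mod_cast h1
    have h5 : (0 : ℤ) < (Ideal.absNorm I' : ℕ) := by exact_mod_cast hpos
    nlinarith
  have hgu : g ∣ 1 := by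
    have h6 : g ≤ 1 := by nlinarith
    have h7 : -1 ≤ g := by nlinarith
    have : g = 1 ∨ g = -1 := by omega
    rcases this with rfl | rfl <;> norm_num
  obtain ⟨x, hx⟩ := (hmem 1).mpr hgu
  refine ⟨-x, ?_⟩
  have e : ω - ((-x : ℤ) : 𝓞 K) = (x : 𝓞 K) + ((1 : ℤ) : 𝓞 K) * ω := by push_cast; ring
  rwa [e]

theorem exists_reduced {ω : 𝓞 K} {t s : ℤ} (hω : ω ^ 2 = t * ω - s)
    (hgen : ∀ x : 𝓞 K, ∃ m n : ℤ, x = m + n * ω) (c : ClassGroup (𝓞 K)) :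
    ∃ (I : Ideal (𝓞 K)) (a b : ℕ), InClass I c ∧ (a : ℝ) ≤ 2 * √d ∧ b < a ∧
      (a : ℤ) ∣ b ^ 2 - t * b + s ∧ ∀ x y : ℤ, (x : 𝓞 K) + y * ω ∈ I ↔ (a : ℤ) ∣ x + y * b := by
  obtain ⟨I, hI, hmin⟩ := exists_inClass_min (fun I => InClass I c) (exists_inClass c)
  obtain ⟨b₀, hb₀⟩ := h.exists_sub_mem hω hgen hI hmin
  set a := Ideal.absNorm I with ha
  have hpos : 0 < a := Nat.pos_of_ne_zero (by rw [ha, Ne, Ideal.absNorm_eq_zero_iff]; exact hI.ne_bot)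
  have haI : (a : 𝓞 K) ∈ I := Ideal.absNorm_mem I
  have hmodI : ∀ n : ℤ, (a : ℤ) ∣ n → (n : 𝓞 K) ∈ I := by
    rintro n ⟨k, rfl⟩
    push_cast
    exact I.mul_mem_right _ haI
  have hapos : (0 : ℤ) < a := by exact_mod_cast hpos
  obtain ⟨b, hb⟩ := Int.eq_ofNat_of_zero_le (Int.emod_nonneg b₀ hapos.ne')
  have hba : b < a := by
    have := Int.emod_lt_of_pos b₀ hapos
    omega
  have hbI : ω - (b : ℤ) ∈ I := by
    have h1 : ((b₀ - b : ℤ) : 𝓞 K) ∈ I := hmodI _ (hb ▸ Int.dvd_self_sub_emod)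
    have e : ω - ((b : ℤ) : 𝓞 K) = (ω - b₀) + ((b₀ - b : ℤ) : 𝓞 K) := by push_cast; ring
    rw [e]
    exact I.add_mem hb₀ h1
  have hred : ∀ x y : ℤ, (x : 𝓞 K) + y * ω ∈ I ↔ ((x + y * b : ℤ) : 𝓞 K) ∈ I := fun x y => by
    have e : (x : 𝓞 K) + y * ω = ((x + y * b : ℤ) : 𝓞 K) + y * (ω - (b : ℤ)) := by
      push_cast; ring
    rw [e]
    exact I.add_mem_iff_left (I.mul_mem_left _ hbI)
  have hcard : Nat.card (𝓞 K ⧸ I) = a := by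
    rw [ha, Ideal.absNorm_apply, Submodule.cardQuot_apply]
  have hfin : Finite (𝓞 K ⧸ I) := Nat.finite_of_card_ne_zero (by omega)
  have hsurj : Function.Surjective (fun i : Fin a => Ideal.Quotient.mk I (((i : ℕ) : ℤ) : 𝓞 K)) := by
    intro q
    obtain ⟨z, rfl⟩ := Ideal.Quotient.mk_surjective q
    obtain ⟨x, y, rfl⟩ := hgen z
    obtain ⟨r, hr⟩ := Int.eq_ofNat_of_zero_le (Int.emod_nonneg (x + y * b) hapos.ne')
    have hra : r < a := by
      have := Int.emod_lt_of_pos (x + y * b) hapos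
      omega
    refine ⟨⟨r, hra⟩, ?_⟩
    rw [Ideal.Quotient.eq]
    have e : ((r : ℤ) : 𝓞 K) - ((x : 𝓞 K) + y * ω) = ((r - x : ℤ) : 𝓞 K) + ((-y : ℤ) : 𝓞 K) * ω := by
      push_cast; ring
    rw [e, hred]
    refine hmodI _ ?_
    have : (a : ℤ) ∣ (x + y * b) - (x + y * b) % a := Int.dvd_self_sub_emod
    rw [hr] at this
    obtain ⟨k, hk⟩ := this
    exact ⟨-k, by linear_combination -hk⟩
  have hinj := ((Nat.bijective_iff_surjective_and_card _).mpr
    ⟨hsurj, by rw [hcard, Nat.card_fin]⟩).injective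
  have hint : ∀ n : ℤ, (n : 𝓞 K) ∈ I ↔ (a : ℤ) ∣ n := fun n => by
    refine ⟨fun hn => ?_, hmodI n⟩
    obtain ⟨r, hr⟩ := Int.eq_ofNat_of_zero_le (Int.emod_nonneg n hapos.ne')
    have hra : r < a := by
      have := Int.emod_lt_of_pos n hapos
      omega
    have h1 : ((r : ℤ) : 𝓞 K) ∈ I := by
      have h2 : ((n - r : ℤ) : 𝓞 K) ∈ I := hmodI _ (by
        have : (a : ℤ) ∣ n - n % a := Int.dvd_self_sub_emod
        rwa [hr] at this)
      have := I.sub_mem hn h2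
      push_cast at this ⊢
      simpa using this
    have h3 : (⟨r, hra⟩ : Fin a) = ⟨0, hpos⟩ := by
      apply hinj
      simp only
      rw [Ideal.Quotient.eq]
      simpa using h1
    have h4 : r = 0 := by simpa using h3
    rw [h4] at hr
    exact Int.dvd_of_emod_eq_zero hr
  refine ⟨I, a, b, hI, ?_, hba, ?_, fun x y => (hred x y).trans (hint _)⟩
  · obtain ⟨J, hJ, hJle⟩ := h.exists_inClass_le c
    exact le_trans (by exact_mod_cast hmin J hJ) hJle
  · rw [← hint]
    have h1 := I.mul_mem_left (((t - b : ℤ) : 𝓞 K) - ω) hbI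
    have e : (((t - b : ℤ) : 𝓞 K) - ω) * (ω - (b : ℤ)) = ((b ^ 2 - t * b + s : ℤ) : 𝓞 K) := by
      push_cast; linear_combination -hω
    rwa [e] at h1

end IsQuad

theorem exists_card_classGroup_le (η : ℝ) (hη : 0 < η) : ∃ C > 0, ∀ (K : Type) [Field K]
    [NumberField K] (d : ℕ) (δ : 𝓞 K), IsQuad d δ →
    (Nat.card (ClassGroup (𝓞 K)) : ℝ) ≤ C * (d : ℝ) ^ (1 / 2 + η) := by
  obtain ⟨C, hC1, hC⟩ := exists_card_divisors_le η hη
  refine ⟨3 * (C * 5 ^ η), by positivity, fun K _ _ d δ h => ?_⟩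
  obtain ⟨ω, t, s, ht0, ht1, hs0, hsd, hts, hω, hgen⟩ := h.exists_omega
  choose I a b hI ha hba hdvd hmem using h.exists_reduced hω hgen
  have hd1 : (1 : ℝ) ≤ d := by exact_mod_cast h.pos
  have hdd : √(d : ℝ) * √d = d := Real.mul_self_sqrt (by linarith)
  have hsq1 : 1 ≤ √(d : ℝ) := Real.one_le_sqrt.mpr hd1
  set B := ⌊2 * √(d : ℝ)⌋₊ with hB
  have hBle : (B : ℝ) ≤ 2 * √d := Nat.floor_le (by positivity)
  have hBsq : B ^ 2 ≤ 4 * d := by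
    have : (B : ℝ) ^ 2 ≤ (2 * √d) ^ 2 := by gcongr
    rw [mul_pow, sq √(d : ℝ), hdd] at this
    norm_num at this
    exact_mod_cast this
  have hmpos : ∀ n : ℕ, 0 < (n : ℤ) ^ 2 - t * n + s := fun n => by
    rcases Nat.eq_zero_or_pos n with rfl | hn
    · simpa using hs0
    · have : (1 : ℤ) ≤ n := by exact_mod_cast hn
      nlinarith
  set m : ℕ → ℕ := fun n => ((n : ℤ) ^ 2 - t * n + s).toNat with hm
  have hmz : ∀ n, ((m n : ℕ) : ℤ) = (n : ℤ) ^ 2 - t * n + s := fun n => Int.toNat_of_nonneg (hmpos n).le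
  have hinj : Function.Injective (fun c => (⟨b c, a c⟩ : Σ _ : ℕ, ℕ)) := by
    intro c c' hcc
    simp only [Sigma.mk.injEq, heq_eq_eq] at hcc
    have : I c = I c' := by
      ext z
      obtain ⟨x, y, rfl⟩ := hgen z
      rw [hmem, hmem, hcc.1, hcc.2]
    have h1 := hI c
    rw [this] at h1
    exact h1.unique (hI c')
  have hcard : Nat.card (ClassGroup (𝓞 K)) ≤
      ((Finset.range (B + 1)).sigma (fun n => (m n).divisors)).card := by
    rw [Nat.card_eq_fintype_card, ← Finset.card_univ]
    refine Finset.card_le_card_of_injOn _ (fun c _ => ?_) hinj.injOn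
    have haB : a c ≤ B := Nat.le_floor (ha c)
    have := hba c
    simp only [Finset.coe_sigma, Set.mem_sigma_iff, Finset.mem_coe, Finset.mem_range,
      Nat.mem_divisors]
    refine ⟨by omega, ?_, ?_⟩
    · have := hdvd c
      rw [← hmz] at this
      exact_mod_cast this
    · have := hmpos (b c)
      rw [← hmz] at this
      exact_mod_cast this.ne'
  have hτ : ∀ n ∈ Finset.range (B + 1), ((m n).divisors.card : ℝ) ≤ C * (5 ^ η * (d : ℝ) ^ η) := by
    intro n hn
    have hnB : n ≤ B := by rw [Finset.mem_range] at hn; omega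
    have h1 : m n ≤ 5 * d := by
      have h2 : (m n : ℤ) ≤ 5 * d := by
        rw [hmz]
        have h3 : n ^ 2 ≤ 4 * d := le_trans (Nat.pow_le_pow_left hnB 2) hBsq
        have h4 : (n : ℤ) ^ 2 ≤ 4 * d := by exact_mod_cast h3
        nlinarith [mul_nonneg ht0 (Nat.cast_nonneg (α := ℤ) n)]
      exact_mod_cast h2
    have h0 : 0 < m n := by
      have := hmpos n
      rw [← hmz] at this
      exact_mod_cast this
    refine (hC _ h0).trans ?_
    rw [← Real.mul_rpow (by norm_num) (by linarith)]
    have : (m n : ℝ) ≤ 5 * d := by exact_mod_cast h1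
    gcongr
  calc (Nat.card (ClassGroup (𝓞 K)) : ℝ)
      ≤ (((Finset.range (B + 1)).sigma (fun n => (m n).divisors)).card : ℝ) := by exact_mod_cast hcard
    _ = ∑ n ∈ Finset.range (B + 1), ((m n).divisors.card : ℝ) := by
        rw [Finset.card_sigma]; push_cast; rfl
    _ ≤ ∑ n ∈ Finset.range (B + 1), C * (5 ^ η * (d : ℝ) ^ η) := Finset.sum_le_sum hτ
    _ = (B + 1) * (C * (5 ^ η * (d : ℝ) ^ η)) := by simp
    _ ≤ (3 * √d) * (C * (5 ^ η * (d : ℝ) ^ η)) := by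
        gcongr
        linarith
    _ = 3 * (C * 5 ^ η) * (d : ℝ) ^ (1 / 2 + η) := by
        rw [Real.rpow_add (by linarith), Real.sqrt_eq_rpow]; ring

end FourthMoment

namespace FourthMoment

open NumberField nonZeroDivisors Finset

theorem card_sq_le_card_mul_card_collisions {α β : Type*} [DecidableEq β] (f : α → β)
    (P : Finset α) (T : Finset β) (hf : ∀ p ∈ P, f p ∈ T) :
    P.card ^ 2 ≤ T.card * ((P ×ˢ P).filter (fun x => f x.1 = f x.2)).card := by
  have h1 : P.card = ∑ t ∈ T, (P.filter (fun p => f p = t)).card :=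
    card_eq_sum_card_fiberwise hf
  have h2 : ((P ×ˢ P).filter (fun x => f x.1 = f x.2)).card =
      ∑ t ∈ T, (P.filter (fun p => f p = t)).card ^ 2 := by
    rw [card_eq_sum_card_fiberwise (f := fun x => f x.1) (t := T)
      (fun x hx => hf _ (mem_product.mp (mem_filter.mp hx).1).1)]
    refine sum_congr rfl fun t _ => ?_
    rw [pow_two, ← card_product]
    congr 1
    ext ⟨p, q⟩
    simp only [mem_filter, mem_product]
    constructor
    · rintro ⟨⟨⟨h1, h2⟩, h3⟩, h4⟩
      exact ⟨⟨h1, h4⟩, h2, h3 ▸ h4⟩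
    · rintro ⟨⟨h1, h4⟩, h2, h3⟩
      exact ⟨⟨⟨h1, h2⟩, h4.trans h3.symm⟩, h4⟩
  rw [h2, h1]
  exact sq_sum_le_card_mul_sum_sq

namespace IsQuad

variable {K : Type} [Field K] [NumberField K] {d : ℕ} {δ : 𝓞 K} (h : IsQuad d δ)
include h

theorem span_pair_ne_top {p : ℕ} (hp : p.Prime) (hp2 : p ≠ 2) {r : ℤ} (hr : (p : ℤ) ∣ r ^ 2 + d) :
    Ideal.span {(p : 𝓞 K), δ - r} ≠ ⊤ := by
  intro htop
  have h1 : (1 : 𝓞 K) ∈ Ideal.span {(p : 𝓞 K), δ - r} := htop ▸ Submodule.mem_top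
  obtain ⟨x, y, hxy⟩ := Ideal.mem_span_pair.mp h1
  obtain ⟨k, hk⟩ := hr
  have hk' : (r : 𝓞 K) ^ 2 + d = p * k := by exact_mod_cast congrArg (Int.cast (R := 𝓞 K)) hk
  obtain ⟨u, v, huv⟩ := h.exists_int (x * (δ + r) - y * k)
  have e : ((p * u - 2 * r : ℤ) : 𝓞 K) + ((p * v - 2 : ℤ) : 𝓞 K) * δ = 0 := by
    push_cast
    linear_combination (-(p : 𝓞 K)) * huv + 2 * (δ + r) * hxy - 2 * y * h.sq + 2 * y * hk'
  have h2 := (h.eq_zero e).2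
  have h3 : (p : ℤ) ∣ 2 := ⟨v, by linarith⟩
  exact hp2 ((Nat.prime_dvd_prime_iff_eq hp Nat.prime_two).mp (by exact_mod_cast h3))

theorem exists_split {p : ℕ} (hp : p.Prime) (hp2 : p ≠ 2) (hpd : ¬ p ∣ d) {r : ℤ}
    (hr : (p : ℤ) ∣ r ^ 2 + d) : ∃ A B : Ideal (𝓞 K), A * B = Ideal.span {(p : 𝓞 K)} ∧
      IsCoprime A B ∧ Ideal.absNorm A = p ∧ Ideal.absNorm B = p := by
  have hA := h.span_pair_ne_top hp hp2 hr
  have hB := h.span_pair_ne_top hp hp2 (r := -r) (by rwa [neg_sq])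
  have hpi := Nat.prime_iff_prime_int.mp hp
  have hcop : IsCoprime (p : ℤ) (2 * r) := by
    rw [hpi.coprime_iff_not_dvd]
    intro hdv
    rcases hpi.dvd_mul.mp hdv with h2 | h2
    · exact hp2 ((Nat.prime_dvd_prime_iff_eq hp Nat.prime_two).mp (by exact_mod_cast h2))
    · refine hpd ?_
      have : (p : ℤ) ∣ d := (Int.dvd_iff_dvd_of_dvd_add hr).mp (dvd_pow h2 two_ne_zero)
      exact_mod_cast this
  obtain ⟨m, n, hmn⟩ := hcop
  have hmn' : (m : 𝓞 K) * p + n * (2 * r) = 1 := by exact_mod_cast congrArg (Int.cast (R := 𝓞 K)) hmn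
  obtain ⟨k, hk⟩ := hr
  have hk' : (r : 𝓞 K) ^ 2 + d = p * k := by exact_mod_cast congrArg (Int.cast (R := 𝓞 K)) hk
  set A := Ideal.span {(p : 𝓞 K), δ - r} with hAdef
  set B := Ideal.span {(p : 𝓞 K), δ - ((-r : ℤ) : 𝓞 K)} with hBdef
  have hAB : A * B = Ideal.span {(p : 𝓞 K)} := by
    rw [hAdef, hBdef, Ideal.span_pair_mul_span_pair]
    apply le_antisymm
    · rw [Ideal.span_le]
      rintro x (rfl | rfl | rfl | rfl) <;> refine Ideal.mem_span_singleton.mpr ?_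
      · exact dvd_mul_right _ _
      · exact dvd_mul_right _ _
      · exact dvd_mul_left _ _
      · refine ⟨-k, ?_⟩
        push_cast
        linear_combination h.sq - hk'
    · rw [Ideal.span_singleton_le_iff_mem]
      set I := Ideal.span {(p : 𝓞 K) * p, (p : 𝓞 K) * (δ - ((-r : ℤ) : 𝓞 K)), (δ - r) * p,
        (δ - r) * (δ - ((-r : ℤ) : 𝓞 K))} with hI
      have e : (p : 𝓞 K) = m * (p * p) + n * (p * (δ - ((-r : ℤ) : 𝓞 K))) - n * ((δ - r) * p) := by
        push_cast
        linear_combination -(p : 𝓞 K) * hmn'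
      rw [e]
      refine I.sub_mem (I.add_mem (I.mul_mem_left _ (Ideal.subset_span ?_))
        (I.mul_mem_left _ (Ideal.subset_span ?_))) (I.mul_mem_left _ (Ideal.subset_span ?_)) <;> simp
  have hnorm : Ideal.absNorm A * Ideal.absNorm B = p ^ 2 := by
    rw [← map_mul, hAB]
    exact_mod_cast h.absNorm_span_int p
  have hA1 : Ideal.absNorm A ≠ 1 := by rwa [Ne, Ideal.absNorm_eq_one_iff]
  have hB1 : Ideal.absNorm B ≠ 1 := by rwa [Ne, Ideal.absNorm_eq_one_iff]
  refine ⟨A, B, hAB, ?_, (hp.mul_eq_prime_sq_iff hA1 hB1).mp hnorm⟩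
  rw [Ideal.isCoprime_iff_exists]
  refine ⟨m * p - n * (δ - r), A.sub_mem (A.mul_mem_left _ (Ideal.subset_span (by simp)))
    (A.mul_mem_left _ (Ideal.subset_span (by simp))), n * (δ - ((-r : ℤ) : 𝓞 K)),
    B.mul_mem_left _ (Ideal.subset_span (by simp)), ?_⟩
  push_cast
  linear_combination hmn'

omit h in
theorem dvd_of_dvd_im {l : ℕ} (hl : l.Prime) (hl2 : l ≠ 2) {β : 𝓞 K} {u v : ℤ}
    (hβ : 2 * β = u + v * δ) (hu : (l : ℤ) ∣ u) (hv : (l : ℤ) ∣ v) : (l : 𝓞 K) ∣ β := by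
  obtain ⟨a, rfl⟩ := hu
  obtain ⟨b, rfl⟩ := hv
  obtain ⟨c, hc⟩ := hl.odd_of_ne_two hl2
  have hc' : (l : 𝓞 K) = 2 * c + 1 := by exact_mod_cast congrArg (Nat.cast (R := 𝓞 K)) hc
  refine ⟨β - c * (a + b * δ), ?_⟩
  push_cast at hβ
  linear_combination -c * hβ - β * hc'

theorem exists_mem_solSet {p q Z V : ℕ} (hV : ∀ v : ℕ, d * v ^ 2 ≤ 4 * Z ^ 6 → v ≤ V)
    (hp : p.Prime) (hq : q.Prime) (hpq : p ≠ q) (hp2 : p ≠ 2) (hq2 : q ≠ 2) (hpZ : p ≤ Z)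
    (hqZ : q ≤ Z) {A B A' B' : Ideal (𝓞 K)} (hAB : A * B = Ideal.span {(p : 𝓞 K)})
    (hcAB : IsCoprime A B) (hA : Ideal.absNorm A = p) (hB : Ideal.absNorm B = p)
    (hAB' : A' * B' = Ideal.span {(q : 𝓞 K)})
    (hcAB' : IsCoprime A' B') (hA' : Ideal.absNorm A' = q) (hB' : Ideal.absNorm B' = q)
    {β : 𝓞 K} (hβ : A ^ 3 * B' ^ 3 = Ideal.span {β}) :
    ∃ x ∈ solSet 1 4 V (Z ^ 2) (2 * Z ^ 3) d, x.2.1 = p * q := by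
  have hunit : ∀ I : Ideal (𝓞 K), ∀ l : ℕ, l.Prime → Ideal.absNorm I = l → ¬ IsUnit I := by
    intro I l hl hI hu
    rw [Ideal.isUnit_iff, ← Ideal.absNorm_eq_one_iff, hI] at hu
    exact hl.one_lt.ne' hu
  have hcpq : IsCoprime (Ideal.span {(p : 𝓞 K)}) (Ideal.span {(q : 𝓞 K)}) := by
    rw [Ideal.isCoprime_span_singleton_iff]
    exact_mod_cast ((Nat.isCoprime_iff_coprime.mpr ((Nat.coprime_primes hp hq).mpr hpq)).intCast
      : IsCoprime (((p : ℕ) : ℤ) : 𝓞 K) (((q : ℕ) : ℤ) : 𝓞 K))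
  rw [← hAB, ← hAB'] at hcpq
  obtain ⟨u, v, huv⟩ := h.exists_int β
  have hnorm := h.absNorm_span huv
  rw [← hβ, map_mul, map_pow, map_pow, hA, hB'] at hnorm
  push_cast at hnorm
  have hpβ : ¬ (p : 𝓞 K) ∣ β := fun hdv => by
    have h1 : B ∣ A ^ 3 * B' ^ 3 := by
      rw [hβ]
      exact (Dvd.intro_left A hAB).trans (Ideal.dvd_iff_le.mpr (Ideal.span_singleton_le_span_singleton.mpr hdv))
    have h2 : IsCoprime B (A ^ 3 * B' ^ 3) :=
      (hcAB.symm.pow_right).mul_right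
        ((hcpq.of_mul_left_right).of_mul_right_right.pow_right)
    exact hunit B p hp hB (h2.isUnit_of_dvd' dvd_rfl h1)
  have hqβ : ¬ (q : 𝓞 K) ∣ β := fun hdv => by
    have h1 : A' ∣ A ^ 3 * B' ^ 3 := by
      rw [hβ]
      exact (Dvd.intro B' hAB').trans (Ideal.dvd_iff_le.mpr (Ideal.span_singleton_le_span_singleton.mpr hdv))
    have h2 : IsCoprime A' (A ^ 3 * B' ^ 3) :=
      ((hcpq.of_mul_left_left).of_mul_right_left.symm.pow_right).mul_right (hcAB'.pow_right)
    exact hunit A' q hq hA' (h2.isUnit_of_dvd' dvd_rfl h1)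
  have hndvd : ∀ l : ℕ, l.Prime → l ≠ 2 → l ∣ p * q → ¬ (l : 𝓞 K) ∣ β → ¬ (l : ℤ) ∣ v := by
    intro l hl hl2 hlpq hlβ hlv
    refine hlβ (dvd_of_dvd_im hl hl2 huv ?_ hlv)
    have h1 : (l : ℤ) ∣ p * q := by exact_mod_cast hlpq
    have h2 : (l : ℤ) ∣ u ^ 2 := by
      have : u ^ 2 = 4 * (p * q) ^ 2 * (p * q) - d * v * v := by linear_combination -hnorm
      rw [this]
      exact dvd_sub (h1.mul_left _) (hlv.mul_left _)
    exact (Nat.prime_iff_prime_int.mp hl).dvd_of_dvd_pow h2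
  have hpv := hndvd p hp hp2 (dvd_mul_right _ _) hpβ
  have hqv := hndvd q hq hq2 (dvd_mul_left _ _) hqβ
  have hv0 : v ≠ 0 := by
    rintro rfl
    exact hpv (dvd_zero _)
  have hZ : p * q ≤ Z ^ 2 := by rw [pow_two]; exact Nat.mul_le_mul hpZ hqZ
  have hZ6 : (p * q) ^ 3 ≤ Z ^ 6 := by
    calc _ ≤ (Z ^ 2) ^ 3 := Nat.pow_le_pow_left hZ 3
      _ = _ := by ring
  have hZ6' : ((p : ℤ) * q) ^ 3 ≤ Z ^ 6 := by exact_mod_cast hZ6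
  have hd0 : (0 : ℤ) ≤ d := Nat.cast_nonneg d
  refine ⟨(v.natAbs, p * q, u), ?_, rfl⟩
  simp only [solSet, mem_filter, mem_product, mem_Icc]
  refine ⟨⟨⟨Int.natAbs_pos.mpr hv0, hV _ ?_⟩, ⟨Nat.mul_pos hp.pos hq.pos, hZ⟩, ?_⟩, ?_, ?_⟩
  · have : (d : ℤ) * (v.natAbs : ℤ) ^ 2 ≤ 4 * Z ^ 6 := by
      rw [Int.natAbs_sq]; nlinarith [sq_nonneg u]
    exact_mod_cast this
  · have h1 : u ^ 2 ≤ (2 * Z ^ 3) ^ 2 := by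
      nlinarith [mul_nonneg hd0 (sq_nonneg v)]
    have := abs_le_of_sq_le_sq' h1 (by positivity)
    push_cast
    exact this
  · rw [Int.natAbs_sq]
    push_cast
    linear_combination -hnorm
  · refine Nat.Coprime.mul_left ?_ ?_
    · rw [hp.coprime_iff_not_dvd]; intro h1; exact hpv (Int.natCast_dvd.mpr h1)
    · rw [hq.coprime_iff_not_dvd]; intro h1; exact hqv (Int.natCast_dvd.mpr h1)

theorem card_torsion_mul_sq_le {Z V : ℕ} (hV : ∀ v : ℕ, d * v ^ 2 ≤ 4 * Z ^ 6 → v ≤ V)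
    (P : Finset ℕ) (hP : ∀ p ∈ P, p.Prime ∧ p ≤ Z ∧ p ≠ 2 ∧ ¬ p ∣ d ∧ ∃ r : ℤ, (p : ℤ) ∣ r ^ 2 + d) :
    Nat.card {c : ClassGroup (𝓞 K) // c ^ 3 = 1} * P.card ^ 2 ≤ Nat.card (ClassGroup (𝓞 K)) *
      (P.card + 2 * (solSet 1 4 V (Z ^ 2) (2 * Z ^ 3) d).card) := by
  classical
  have hex : ∀ p : ℕ, ∃ A B : Ideal (𝓞 K), p ∈ P → A * B = Ideal.span {(p : 𝓞 K)} ∧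
      IsCoprime A B ∧ Ideal.absNorm A = p ∧ Ideal.absNorm B = p := fun p => by
    by_cases hp : p ∈ P
    · obtain ⟨h1, -, h2, h3, r, hr⟩ := hP p hp
      obtain ⟨A, B, hAB⟩ := h.exists_split h1 h2 h3 hr
      exact ⟨A, B, fun _ => hAB⟩
    · exact ⟨⊤, ⊤, fun h => absurd h hp⟩
  choose A B hAB using hex
  have hcl : ∀ p : ℕ, ∃ a b : ClassGroup (𝓞 K), p ∈ P → InClass (A p) a ∧ InClass (B p) b ∧
      a * b = 1 := fun p => by
    by_cases hp : p ∈ P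
    · have hp0 : (p : 𝓞 K) ≠ 0 := by exact_mod_cast (hP p hp).1.ne_zero
      have h1 := (hAB p hp).1
      have hA0 : A p ≠ ⊥ := by
        intro h0; rw [h0, Ideal.bot_mul, eq_comm, Ideal.span_singleton_eq_bot] at h1; exact hp0 h1
      have hB0 : B p ≠ ⊥ := by
        intro h0; rw [h0, Ideal.mul_bot, eq_comm, Ideal.span_singleton_eq_bot] at h1; exact hp0 h1
      obtain ⟨a, ha⟩ := exists_class hA0
      obtain ⟨b, hb⟩ := exists_class hB0
      exact ⟨a, b, fun _ => ⟨ha, hb, (ha.mul hb).unique (h1 ▸ inClass_span hp0)⟩⟩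
    · exact ⟨1, 1, fun h => absurd h hp⟩
  choose a b hcl using hcl
  let φ : ClassGroup (𝓞 K) →* ClassGroup (𝓞 K) := powMonoidHom 3
  have hcard : Nat.card {c : ClassGroup (𝓞 K) // c ^ 3 = 1} * Nat.card φ.range =
      Nat.card (ClassGroup (𝓞 K)) := by
    rw [← Subgroup.card_mul_index φ.ker, Subgroup.index_ker]
    rfl
  set T : Finset (ClassGroup (𝓞 K)) := univ.filter (fun c => c ∈ φ.range) with hT
  have hTcard : T.card = Nat.card φ.range := by
    rw [hT, ← Fintype.card_subtype, Nat.card_eq_fintype_card]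
  have h1 := card_sq_le_card_mul_card_collisions (fun p => a p ^ 3) P T
    (fun p _ => mem_filter.mpr ⟨mem_univ _, a p, rfl⟩)
  have h2 := card_pairs_le P (fun p hp => (hP p hp).1) (fun p q => p ≠ q ∧ a p ^ 3 = a q ^ 3)
    (solSet 1 4 V (Z ^ 2) (2 * Z ^ 3) d) (by
      rintro p hp q hq ⟨hne, hpq⟩
      obtain ⟨hpp, hpZ, hp2, -⟩ := hP p hp
      obtain ⟨hqp, hqZ, hq2, -⟩ := hP q hq
      obtain ⟨e1, e2, e3, e4⟩ := hAB p hp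
      obtain ⟨f1, f2, f3, f4⟩ := hAB q hq
      obtain ⟨i1, -, -⟩ := hcl p hp
      obtain ⟨-, j2, j3⟩ := hcl q hq
      have hone : InClass (A p ^ 3 * B q ^ 3) 1 := by
        have := (i1.pow 3).mul (j2.pow 3)
        rwa [hpq, ← mul_pow (a q), j3, one_pow] at this
      obtain ⟨β, -, hβ⟩ := inClass_one_iff.mp hone
      exact h.exists_mem_solSet hV hpp hqp hne hp2 hq2 hpZ hqZ e1 e2 e3 e4 f1 f2 f3 f4 hβ)
  have h3 : ((P ×ˢ P).filter (fun x => a x.1 ^ 3 = a x.2 ^ 3)).card ≤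
      P.card + ((P ×ˢ P).filter (fun x => x.1 ≠ x.2 ∧ a x.1 ^ 3 = a x.2 ^ 3)).card := by
    have hsub : (P ×ˢ P).filter (fun x => a x.1 ^ 3 = a x.2 ^ 3) ⊆ P.diag ∪
        (P ×ˢ P).filter (fun x => x.1 ≠ x.2 ∧ a x.1 ^ 3 = a x.2 ^ 3) := by
      rintro ⟨p, q⟩ hx
      rw [mem_filter, mem_product] at hx
      rw [mem_union, mem_diag, mem_filter, mem_product]
      by_cases hpq : p = q
      · exact Or.inl ⟨hx.1.1, hpq⟩
      · exact Or.inr ⟨hx.1, hpq, hx.2⟩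
    refine (card_le_card hsub).trans ((card_union_le _ _).trans ?_)
    rw [diag_card]
  calc _ ≤ Nat.card {c : ClassGroup (𝓞 K) // c ^ 3 = 1} * (T.card *
        ((P ×ˢ P).filter (fun x => a x.1 ^ 3 = a x.2 ^ 3)).card) := Nat.mul_le_mul_left _ h1
    _ = Nat.card (ClassGroup (𝓞 K)) * ((P ×ˢ P).filter (fun x => a x.1 ^ 3 = a x.2 ^ 3)).card := by
        rw [← hcard, hTcard, mul_assoc]
    _ ≤ _ := by
        refine Nat.mul_le_mul_left _ (h3.trans (Nat.add_le_add_left ?_ _))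
        convert h2

end IsQuad

end FourthMoment

namespace FourthMoment

open NumberField nonZeroDivisors

namespace IsQuad

variable {K : Type} [Field K] [NumberField K] {d : ℕ} {δ : 𝓞 K} (h : IsQuad d δ)
include h

theorem exists_inClass_coprime {N : ℕ} (hN : N ≠ 0) (c : ClassGroup (𝓞 K)) :
    ∃ I, InClass I c ∧ (Ideal.absNorm I).Coprime N := by
  obtain ⟨J, hJ⟩ := exists_inClass c⁻¹
  have hN2 : ((2 * N : ℤ) : 𝓞 K) ≠ 0 := by exact_mod_cast (by omega : (2 * N : ℤ) ≠ 0)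
  set M := Ideal.span {((2 * N : ℤ) : 𝓞 K)} with hM
  have hM0 : M ≠ 0 := by rw [hM, Ne, Ideal.zero_eq_bot, Ideal.span_singleton_eq_bot]; exact hN2
  obtain ⟨a, ha⟩ := IsDedekindDomain.exists_sup_span_eq (I := J * M) (J := J) Ideal.mul_le_left
    (mul_ne_zero hJ.ne_bot hM0)
  have haJ : a ∈ J := by
    rw [← ha]
    exact Ideal.mem_sup_right (Ideal.mem_span_singleton_self a)
  obtain ⟨B, hB⟩ := Ideal.dvd_span_singleton.mpr haJ
  have hsup : M ⊔ B = ⊤ := by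
    rw [hB, ← Ideal.mul_sup] at ha
    have : J * (M ⊔ B) = J * 1 := by rw [ha, mul_one]
    rw [mul_left_cancel₀ hJ.ne_bot this, Ideal.one_eq_top]
  have ha0 : a ≠ 0 := by
    rintro rfl
    rw [Ideal.span_singleton_eq_bot.mpr rfl, eq_comm, ← Ideal.zero_eq_bot, mul_eq_zero] at hB
    rw [hB.resolve_left hJ.ne_bot, Ideal.zero_eq_bot, sup_bot_eq, ← Ideal.absNorm_eq_one_iff] at hsup
    have h1 := h.absNorm_span_int (2 * N)
    rw [← hM, hsup] at h1
    have h2 : (1 : ℤ) ≤ N := by exact_mod_cast Nat.pos_of_ne_zero hN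
    push_cast at h1
    nlinarith
  refine ⟨B, hJ.of_mul_left (by rw [← hB, inv_mul_cancel]; exact inClass_span ha0), ?_⟩
  obtain ⟨m, hm, b, hb, hmb⟩ := Submodule.mem_sup.mp (hsup ▸ Submodule.mem_top : (1 : 𝓞 K) ∈ M ⊔ B)
  obtain ⟨x, rfl⟩ := Ideal.mem_span_singleton.mp hm
  obtain ⟨u, v, hx⟩ := h.exists_int x
  have h1 := h.absNorm_span (x := b) (u := 2 - 2 * N * u) (v := -(2 * N * v)) (by
    push_cast at hmb ⊢; linear_combination 2 * hmb - 2 * N * hx)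
  have h2 : Ideal.absNorm B ∣ Ideal.absNorm (Ideal.span {b}) :=
    Ideal.absNorm_dvd_absNorm_of_le ((Ideal.span_singleton_le_iff_mem _).mpr hb)
  refine Nat.Coprime.coprime_dvd_left h2 (Nat.isCoprime_iff_coprime.mp ?_)
  refine ⟨1, 2 * u - N * u ^ 2 - d * N * v ^ 2, ?_⟩
  linarith

theorem dvd_of_dvd_sq {l : ℕ} (hl : l.Prime) (hl2 : l ≠ 2) (hld : ¬ l ∣ d) {x : 𝓞 K}
    (hx : (l : 𝓞 K) ∣ x ^ 2) : (l : 𝓞 K) ∣ x := by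
  obtain ⟨u, v, huv⟩ := h.exists_int x
  obtain ⟨y, hy⟩ := hx
  obtain ⟨s, t, hst⟩ := h.exists_int y
  have e : ((u ^ 2 - d * v ^ 2 : ℤ) : 𝓞 K) + ((2 * u * v : ℤ) : 𝓞 K) * δ =
      ((2 * l * s : ℤ) : 𝓞 K) + ((2 * l * t : ℤ) : 𝓞 K) * δ := by
    push_cast
    linear_combination (-(2 * x + u + v * δ)) * huv + 4 * hy + 2 * l * hst - (v : 𝓞 K) ^ 2 * h.sq
  obtain ⟨h1, h2⟩ := h.ext e
  have hli := Nat.prime_iff_prime_int.mp hl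
  have hl2' : ¬ (l : ℤ) ∣ 2 := fun h =>
    hl2 ((Nat.prime_dvd_prime_iff_eq hl Nat.prime_two).mp (by exact_mod_cast h))
  have h3 : (l : ℤ) ∣ u * v := by
    refine (hli.dvd_mul.mp (?_ : (l : ℤ) ∣ 2 * (u * v))).resolve_left hl2'
    exact ⟨2 * t, by linarith⟩
  have h4 : (l : ℤ) ∣ u ^ 2 - d * v ^ 2 := ⟨2 * s, by linarith⟩
  rcases hli.dvd_mul.mp h3 with h5 | h5
  · refine dvd_of_dvd_im hl hl2 huv h5 ?_
    have h6 : (l : ℤ) ∣ d * v ^ 2 := by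
      have := dvd_sub (dvd_pow h5 two_ne_zero) h4
      rwa [sub_sub_cancel] at this
    rcases hli.dvd_mul.mp h6 with h7 | h7
    · exact absurd (by exact_mod_cast h7) hld
    · exact hli.dvd_of_dvd_pow h7
  · refine dvd_of_dvd_im hl hl2 huv ?_ h5
    have h6 : (l : ℤ) ∣ u ^ 2 := by
      have := dvd_add h4 ((dvd_pow h5 two_ne_zero).mul_left (d : ℤ))
      rwa [sub_add_cancel] at this
    exact hli.dvd_of_dvd_pow h6

end IsQuad

/-- `α = (U + Vδ)/2` generates the cube of the ideal `I` of class `g`, of norm prime to `N`. -/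
structure CubeRep {K : Type} [Field K] [NumberField K] (δ : 𝓞 K) (N : ℕ) (g : ClassGroup (𝓞 K))
    (I : Ideal (𝓞 K)) (α : 𝓞 K) (U V : ℤ) : Prop where
  inClass : InClass I g
  cube : I ^ 3 = Ideal.span {α}
  coprime : (Ideal.absNorm I).Coprime N
  two_mul : 2 * α = U + V * δ

namespace IsQuad

variable {K : Type} [Field K] [NumberField K] {d : ℕ} {δ : 𝓞 K} (h : IsQuad d δ)
  {N : ℕ} {g : ClassGroup (𝓞 K)} {I : Ideal (𝓞 K)} {α : 𝓞 K} {U V : ℤ}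
include h

theorem norm_eq (H : CubeRep δ N g I α U V) :
    U ^ 2 + d * V ^ 2 = 4 * (Ideal.absNorm I : ℤ) ^ 3 := by
  rw [← h.absNorm_span H.two_mul, ← H.cube, map_pow]
  push_cast
  ring

theorem exists_cubeRep (hN : N ≠ 0) (hg : g ^ 3 = 1) : ∃ I α U V, CubeRep δ N g I α U V := by
  obtain ⟨I, hI, hc⟩ := h.exists_inClass_coprime hN g
  obtain ⟨α, -, hα⟩ := inClass_one_iff.mp (hg ▸ hI.pow 3)
  obtain ⟨U, V, hUV⟩ := h.exists_int α
  exact ⟨I, α, U, V, hI, hα, hc, hUV⟩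

theorem cubeRep_mul (H : CubeRep δ N g I α U V) (hN : N ≠ 1) {a b : ℤ}
    (hab : IsCoprime (a ^ 2 + d * b ^ 2) (N : ℤ)) :
    ∃ J β, CubeRep δ N g J β
      ((a ^ 3 - 3 * d * a * b ^ 2) * U - d * (3 * a ^ 2 * b - d * b ^ 3) * V)
      ((3 * a ^ 2 * b - d * b ^ 3) * U + (a ^ 3 - 3 * d * a * b ^ 2) * V) := by
  have hne : (a : 𝓞 K) + b * δ ≠ 0 := fun h0 => by
    obtain ⟨rfl, rfl⟩ := h.eq_zero h0
    have h1 : IsUnit (N : ℤ) := isCoprime_zero_left.mp (by simpa using hab)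
    rw [Int.isUnit_iff_natAbs_eq, Int.natAbs_natCast] at h1
    exact hN h1
  have hnorm := h.absNorm_span (x := (a : 𝓞 K) + b * δ) (u := 2 * a) (v := 2 * b)
    (by push_cast; ring)
  refine ⟨Ideal.span {(a : 𝓞 K) + b * δ} * I, (a + b * δ) ^ 3 * α,
    (InClass.span_mul_iff hne).mpr H.inClass, ?_, ?_, ?_⟩
  · rw [mul_pow, H.cube, Ideal.span_singleton_pow, Ideal.span_singleton_mul_span_singleton]
  · rw [map_mul]
    refine Nat.Coprime.mul_left (Nat.isCoprime_iff_coprime.mp ?_) H.coprime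
    rwa [show ((Ideal.absNorm (Ideal.span {(a : 𝓞 K) + b * δ}) : ℕ) : ℤ) = a ^ 2 + d * b ^ 2 by
      linarith]
  · push_cast
    linear_combination (a + b * δ) ^ 3 * H.two_mul + (3 * a * b ^ 2 * U + 3 * a ^ 2 * b * V +
      b ^ 3 * δ * U + 3 * a * b ^ 2 * δ * V + b ^ 3 * V * (δ ^ 2 - d)) * h.sq

omit [NumberField K] h in
theorem isCoprime_of_prime {N : ℕ} {m : ℤ}
    (hm : ∀ p : ℕ, p.Prime → p ∣ N → ¬ (p : ℤ) ∣ m) : IsCoprime m (N : ℤ) := by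
  rw [Int.isCoprime_iff_gcd_eq_one]
  refine Nat.coprime_of_dvd fun p hp h1 h2 => ?_
  exact hm p hp (by simpa using h2) (Int.natCast_dvd.mpr h1)

theorem exists_cubeRep_normalized (hN : N ≠ 0) (h3N : 3 ∣ N) (hg : g ^ 3 = 1) :
    ∃ I α U V, CubeRep δ N g I α U V ∧ ¬ 3 ∣ U ∧ ¬ 27 ∣ V := by
  obtain ⟨i, N', hN', hNN⟩ := Nat.exists_eq_pow_mul_and_not_dvd hN 3 (by norm_num)
  have hN1 : N ≠ 1 := by rintro rfl; omega
  have hp3 : ∀ p : ℕ, p.Prime → p ∣ N → p = 3 ∨ p ∣ N' := fun p hp hpN => by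
    rw [hNN] at hpN
    rcases hp.dvd_mul.mp hpN with h1 | h1
    · exact Or.inl ((Nat.prime_dvd_prime_iff_eq hp Nat.prime_three).mp (hp.dvd_of_dvd_pow h1))
    · exact Or.inr h1
  obtain ⟨k, hk⟩ : ∃ k : ℤ, (N' : ℤ) ^ 2 = 3 * k + 1 := by
    have : (N' : ℤ) % 3 = 1 ∨ (N' : ℤ) % 3 = 2 := by omega
    obtain ⟨q, hq⟩ : ∃ q : ℤ, (N' : ℤ) = 3 * q + 1 ∨ (N' : ℤ) = 3 * q + 2 := ⟨N' / 3, by omega⟩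
    rcases hq with hq | hq
    · exact ⟨3 * q ^ 2 + 2 * q, by rw [hq]; ring⟩
    · exact ⟨3 * q ^ 2 + 4 * q + 1, by rw [hq]; ring⟩
  have h3p : Prime (3 : ℤ) := Int.prime_three
  have hcop3 : ∀ {I α U V}, CubeRep δ N g I α U V → ¬ (3 : ℤ) ∣ U ^ 2 + d * V ^ 2 := by
    intro I α U V H h3
    rw [h.norm_eq H] at h3
    rcases h3p.dvd_mul.mp h3 with h4 | h4
    · norm_num at h4
    · have h5 := h3p.dvd_of_dvd_pow h4
      have h6 : 3 ∣ Ideal.absNorm I := by exact_mod_cast h5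
      have := Nat.dvd_gcd h6 h3N
      rw [H.coprime.gcd_eq_one] at this
      norm_num at this
  obtain ⟨I, α, U, V, H⟩ := h.exists_cubeRep hN hg
  obtain ⟨I, α, U, V, H, hU⟩ : ∃ I α U V, CubeRep δ N g I α U V ∧ ¬ 3 ∣ U := by
    by_cases hU : 3 ∣ U
    · have hdV : ¬ (3 : ℤ) ∣ d * V ^ 2 := fun h1 => hcop3 H (dvd_add (dvd_pow hU two_ne_zero) h1)
      have hd : ¬ (3 : ℤ) ∣ d := fun h1 => hdV (h1.mul_right _)
      have hV : ¬ (3 : ℤ) ∣ V := fun h1 => hdV ((dvd_pow h1 two_ne_zero).mul_left _)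
      set b : ℤ := 2 * (N' : ℤ) ^ 2 with hb
      have hb3 : ¬ (3 : ℤ) ∣ b := by omega
      obtain ⟨a', ha'⟩ : ∃ a', 1 + b = 3 * a' := ⟨1 + 2 * k, by omega⟩
      obtain ⟨J, β, HJ⟩ := h.cubeRep_mul H hN1 (a := 1 + b) (b := b) (by
        refine isCoprime_of_prime fun p hp hpN hpd => ?_
        rcases hp3 p hp hpN with rfl | h1
        · have h2 : ((3 : ℕ) : ℤ) ∣ d * b ^ 2 := by
            refine (Int.dvd_iff_dvd_of_dvd_add hpd).mp ?_
            exact dvd_pow ⟨a', by exact_mod_cast ha'⟩ two_ne_zero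
          rcases h3p.dvd_mul.mp h2 with h4 | h4
          · exact hd h4
          · exact hb3 (h3p.dvd_of_dvd_pow h4)
        · have h2 : (p : ℤ) ∣ N' := by exact_mod_cast h1
          obtain ⟨c, hc⟩ := h2.trans (Dvd.intro_left (2 * (N' : ℤ)) (by rw [hb]; ring) : (N' : ℤ) ∣ b)
          have h5 : (p : ℤ) ∣ 1 := by
            have h6 : (1 : ℤ) = ((1 + b) ^ 2 + d * b ^ 2) - p * (c * (2 + b + d * b)) := by
              linear_combination -(2 + b + d * b) * hc
            rw [h6]
            exact dvd_sub hpd (dvd_mul_right _ _)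
          exact (Nat.prime_iff_prime_int.mp hp).not_isUnit (isUnit_of_dvd_one h5))
      refine ⟨J, β, _, _, HJ, fun h1 => ?_⟩
      obtain ⟨U', rfl⟩ := hU
      have h2 : (3 : ℤ) ∣ (d ^ 2 * b ^ 3) * V := by
        obtain ⟨w, hw⟩ := h1
        refine ⟨w - ((1 + b) ^ 3 - 3 * d * (1 + b) * b ^ 2) * U' + d * (1 + b) ^ 2 * b * V, ?_⟩
        linear_combination hw
      rcases h3p.dvd_mul.mp h2 with h4 | h4
      · rcases h3p.dvd_mul.mp h4 with h4 | h4
        · exact hd (h3p.dvd_of_dvd_pow h4)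
        · exact hb3 (h3p.dvd_of_dvd_pow h4)
      · exact hV h4
    · exact ⟨I, α, U, V, H, hU⟩
  by_cases hV : 27 ∣ V
  · have hN3 : ¬ (3 : ℤ) ∣ N' := by exact_mod_cast hN'
    obtain ⟨J, β, HJ⟩ := h.cubeRep_mul H hN1 (a := 1) (b := 6 * N') (by
      refine isCoprime_of_prime fun p hp hpN hpd => ?_
      have h1 : (p : ℤ) ∣ d * (6 * N') ^ 2 := by
        rcases hp3 p hp hpN with rfl | h1
        · exact ⟨d * (12 * N' ^ 2), by push_cast; ring⟩
        · have h2 : (p : ℤ) ∣ N' := by exact_mod_cast h1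
          exact (dvd_pow (h2.mul_left 6) two_ne_zero).mul_left _
      have h5 : (p : ℤ) ∣ 1 := by
        have := dvd_sub hpd h1
        rwa [add_sub_cancel_right, one_pow] at this
      exact (Nat.prime_iff_prime_int.mp hp).not_isUnit (isUnit_of_dvd_one h5))
    refine ⟨J, β, _, _, HJ, fun h1 => hU ?_, fun h1 => ?_⟩
    · obtain ⟨w, hw⟩ := h1
      exact ⟨w + d * (6 * N') ^ 2 * U + d * (6 * N' - d * 72 * N' ^ 3) * V, by linear_combination hw⟩
    · obtain ⟨w, hw⟩ := h1
      obtain ⟨V', rfl⟩ := hV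
      have h2 : (3 : ℤ) ∣ 2 * (N' * U) := by
        refine ⟨w + 8 * d * N' ^ 3 * U - (1 - 3 * d * (6 * N') ^ 2) * V', ?_⟩
        linarith
      rcases h3p.dvd_mul.mp h2 with h4 | h4
      · norm_num at h4
      · rcases h3p.dvd_mul.mp h4 with h4 | h4
        · exact hN3 h4
        · exact hU h4
  · exact ⟨I, α, U, V, H, hU, hV⟩

theorem exists_cubeRep_primitive (hN : N ≠ 0) (hdN : 6 * d ∣ N) (hg : g ^ 3 = 1) :
    ∃ I α U V, CubeRep δ N g I α U V ∧ ¬ 3 ∣ U ∧ ¬ 27 ∣ V ∧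
      ∀ l : ℕ, l.Prime → ¬ (l : 𝓞 K) ∣ α := by
  have h3N : 3 ∣ N := (Dvd.intro (2 * d) (by ring)).trans hdN
  obtain ⟨I, ⟨α, U, V, H, hU, hV⟩, hmin⟩ := exists_inClass_min
    (fun I => ∃ α U V, CubeRep δ N g I α U V ∧ ¬ 3 ∣ U ∧ ¬ 27 ∣ V)
    (h.exists_cubeRep_normalized hN h3N hg)
  refine ⟨I, α, U, V, H, hU, hV, fun l hl hlα => ?_⟩
  have hl0 : (l : 𝓞 K) ≠ 0 := by exact_mod_cast hl.ne_zero
  have hlnorm : Ideal.absNorm (Ideal.span {(l : 𝓞 K)}) = l ^ 2 := by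
    exact_mod_cast h.absNorm_span_int l
  by_cases hlN : l ∣ N
  · have h1 : Ideal.absNorm (Ideal.span {(l : 𝓞 K)}) ∣ Ideal.absNorm (I ^ 3) := by
      rw [H.cube]
      exact Ideal.absNorm_dvd_absNorm_of_le (Ideal.span_singleton_le_span_singleton.mpr hlα)
    rw [hlnorm, map_pow] at h1
    have h2 : l ∣ Ideal.absNorm I := hl.dvd_of_dvd_pow ((dvd_pow_self l two_ne_zero).trans h1)
    have := Nat.dvd_gcd h2 hlN
    rw [H.coprime.gcd_eq_one] at this
    exact hl.one_lt.ne' (Nat.dvd_one.mp this)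
  · have hl2 : l ≠ 2 := by
      rintro rfl
      exact hlN ((Dvd.intro (3 * d) (by ring)).trans hdN)
    have hld : ¬ l ∣ d := fun h1 => hlN ((h1.mul_left 6).trans hdN)
    have hIl : I ≤ Ideal.span {(l : 𝓞 K)} := fun x hx => by
      rw [Ideal.mem_span_singleton]
      have h1 : x ^ 3 ∈ I ^ 3 := Ideal.pow_mem_pow hx 3
      rw [H.cube, Ideal.mem_span_singleton] at h1
      refine h.dvd_of_dvd_sq hl hl2 hld (h.dvd_of_dvd_sq hl hl2 hld ?_)
      have := (hlα.trans h1).mul_right x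
      ring_nf at this ⊢
      exact this
    obtain ⟨J, hJ⟩ := Ideal.dvd_iff_le.mpr hIl
    have hcube := H.cube
    rw [hJ, mul_pow, Ideal.span_singleton_pow] at hcube
    have h3 : (l : 𝓞 K) ^ 3 ∣ α := by
      rw [← Ideal.mem_span_singleton]
      exact Ideal.mul_le_left (hcube ▸ Ideal.mem_span_singleton_self α)
    obtain ⟨β, rfl⟩ := h3
    rw [← Ideal.span_singleton_mul_span_singleton] at hcube
    have hl3 : Ideal.span {(l : 𝓞 K) ^ 3} ≠ 0 := by
      rw [Ne, Ideal.zero_eq_bot, Ideal.span_singleton_eq_bot]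
      exact pow_ne_zero 3 hl0
    have hJ3 : J ^ 3 = Ideal.span {β} := mul_left_cancel₀ hl3 hcube
    obtain ⟨U', V', hUV⟩ := h.exists_int β
    obtain ⟨e1, e2⟩ := h.ext (u := U) (v := V) (u' := l ^ 3 * U') (v' := l ^ 3 * V') (by
      push_cast; linear_combination -H.two_mul + l ^ 3 * hUV)
    have hJc : InClass J g := (InClass.span_mul_iff hl0).mp (hJ ▸ H.inClass)
    have h4 : Ideal.absNorm I = l ^ 2 * Ideal.absNorm J := by rw [hJ, map_mul, hlnorm]
    have h5 := hmin J ⟨β, U', V', ⟨hJc, hJ3, Nat.Coprime.coprime_dvd_left ⟨l ^ 2, by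
      rw [h4, mul_comm]⟩ H.coprime, hUV⟩, fun h1 => hU (e1 ▸ h1.mul_left _),
      fun h1 => hV (e2 ▸ h1.mul_left _)⟩
    have hpos : 0 < Ideal.absNorm J :=
      Nat.pos_of_ne_zero (by rw [Ne, Ideal.absNorm_eq_zero_iff]; exact hJc.ne_bot)
    have h6 : 2 ^ 2 ≤ l ^ 2 := Nat.pow_le_pow_left hl.two_le 2
    rw [h4] at h5
    have h7 := Nat.mul_le_mul_right (Ideal.absNorm J) h6
    omega

end IsQuad

end FourthMoment

namespace FourthMoment

open NumberField nonZeroDivisors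

namespace IsQuad

variable {K : Type} [Field K] [NumberField K] {d : ℕ} {δ : 𝓞 K} (h : IsQuad d δ)
  {N : ℕ} {g : ClassGroup (𝓞 K)} {I : Ideal (𝓞 K)} {α : 𝓞 K} {U V : ℤ}
include h

theorem exists_emb : ∃ ι : ℤ√(-(d : ℤ)) →+* 𝓞 K, Function.Injective ι ∧
    ∀ A, ι A = A.re + A.im * δ := by
  have hδ : δ * δ = ((-(d : ℤ) : ℤ) : 𝓞 K) := by
    push_cast; rw [← pow_two]; exact h.sq
  refine ⟨Zsqrtd.lift ⟨δ, hδ⟩, ?_, fun A => by simp⟩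
  rw [injective_iff_map_eq_zero]
  intro A hA
  have := h.eq_zero (u := A.re) (v := A.im) (by simpa using hA)
  exact Zsqrtd.ext this.1 this.2

theorem exists_coprime_rep (H : CubeRep δ N g I α U V) (hU : ¬ 3 ∣ U) (hV : ¬ 27 ∣ V)
    (hprim : ∀ l : ℕ, l.Prime → ¬ (l : 𝓞 K) ∣ α) : ∃ (A : ℤ√(-(d : ℤ))) (m : ℤ),
      (m = 1 ∨ m = 2) ∧ (A.re : 𝓞 K) + A.im * δ = m * α ∧
      A.norm = m ^ 2 * (Ideal.absNorm I : ℤ) ^ 3 ∧ IsCoprime A.re A.im ∧ ¬ 3 ∣ A.re ∧ ¬ 27 ∣ A.im := by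
  have hn := h.norm_eq H
  have h2 := H.two_mul
  by_cases hev : 2 ∣ U ∧ 2 ∣ V
  · obtain ⟨⟨a, rfl⟩, b, rfl⟩ := hev
    have hα : α = a + b * δ := by
      apply mul_left_cancel₀ (two_ne_zero : (2 : 𝓞 K) ≠ 0)
      push_cast at h2
      linear_combination h2
    refine ⟨⟨a, b⟩, 1, Or.inl rfl, by simp [hα], ?_, ?_, fun h3 => hU (h3.mul_left 2),
      fun h3 => hV (h3.mul_left 2)⟩
    · rw [Zsqrtd.norm_def]
      push_cast
      linarith
    · rw [Int.isCoprime_iff_gcd_eq_one]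
      refine Nat.coprime_of_dvd fun l hl h3 h4 => hprim l hl ?_
      obtain ⟨s, hs⟩ := Int.natCast_dvd.mpr h3
      obtain ⟨t, ht⟩ := Int.natCast_dvd.mpr h4
      have hs : a = l * s := hs
      have ht : b = l * t := ht
      exact ⟨s + t * δ, by rw [hα, hs, ht]; push_cast; ring⟩
  · refine ⟨⟨U, V⟩, 2, Or.inr rfl, by simp [h2], ?_, ?_, hU, hV⟩
    · rw [Zsqrtd.norm_def]
      push_cast
      linarith
    · rw [Int.isCoprime_iff_gcd_eq_one]
      refine Nat.coprime_of_dvd fun l hl h3 h4 => ?_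
      have h3 := Int.natCast_dvd.mpr h3
      have h4 := Int.natCast_dvd.mpr h4
      by_cases hl2 : l = 2
      · subst hl2
        exact hev ⟨h3, h4⟩
      · exact hprim l hl (dvd_of_dvd_im hl hl2 h2 h3 h4)

theorem eq_one_or_of_isUnit (hd : 4 < d) {u : 𝓞 K} (hu : IsUnit u) : u = 1 ∨ u = -1 := by
  obtain ⟨a, b, hab⟩ := h.exists_int u
  have h1 := h.absNorm_span hab
  rw [Ideal.span_singleton_eq_top.mpr hu, Ideal.absNorm_top] at h1
  have hd' : (4 : ℤ) < d := by exact_mod_cast hd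
  have hb : b = 0 := by
    by_contra hb
    have : 1 ≤ b ^ 2 := by have := sq_pos_of_ne_zero hb; omega
    push_cast at h1
    nlinarith [sq_nonneg a]
  subst hb
  have ha : (a - 2) * (a + 2) = 0 := by push_cast at h1; linarith
  rcases mul_eq_zero.mp ha with ha | ha
  · left
    apply mul_left_cancel₀ (two_ne_zero : (2 : 𝓞 K) ≠ 0)
    rw [hab, show a = 2 by omega]; simp
  · right
    apply mul_left_cancel₀ (two_ne_zero : (2 : 𝓞 K) ≠ 0)
    rw [hab, show a = -2 by omega]; simp

theorem exists_relation (hd : 4 < d) {g₁ g₂ : ClassGroup (𝓞 K)} {I₁ I₂ I₃ : Ideal (𝓞 K)}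
    {α₁ α₂ α₃ : 𝓞 K} (h₁ : InClass I₁ g₁) (h₂ : InClass I₂ g₂) (h₃ : InClass I₃ (g₁ * g₂))
    (e₁ : I₁ ^ 3 = Ideal.span {α₁}) (e₂ : I₂ ^ 3 = Ideal.span {α₂}) (e₃ : I₃ ^ 3 = Ideal.span {α₃}) :
    ∃ (x y : 𝓞 K) (s : ℤ), x ≠ 0 ∧ y ≠ 0 ∧ s ≠ 0 ∧ α₁ * α₂ * x ^ 3 = s * (α₃ * y ^ 3) := by
  obtain ⟨m₁₂, c₁₂⟩ := h₁.mul h₂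
  obtain ⟨m₃, c₃⟩ := h₃
  obtain ⟨x, y, hx, hy, hxy⟩ := ClassGroup.mk0_eq_mk0_iff.mp (c₁₂.trans c₃.symm)
  simp only at hxy
  have h4 := congrArg (· ^ 3) hxy
  simp only [mul_pow, e₁, e₂, e₃, Ideal.span_singleton_pow, Ideal.span_singleton_mul_span_singleton,
    Ideal.span_singleton_eq_span_singleton] at h4
  obtain ⟨u, hu⟩ := h4
  rcases h.eq_one_or_of_isUnit hd u.isUnit with hu1 | hu1 <;> rw [hu1] at hu
  · exact ⟨x, y, 1, hx, hy, one_ne_zero, by push_cast; linear_combination hu⟩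
  · exact ⟨x, y, -1, hx, hy, by norm_num, by push_cast; linear_combination -hu⟩

omit h in
theorem _root_.FourthMoment.eq_span_of_cube_eq {y : 𝓞 K} (hy : y ≠ 0)
    (hI : I ^ 3 = Ideal.span {y ^ 3}) : I = Ideal.span {y} := by
  have hle : I ≤ Ideal.span {y} := fun x hx => by
    have h1 : x ^ 3 ∈ I ^ 3 := Ideal.pow_mem_pow hx 3
    rw [hI, Ideal.mem_span_singleton, IsIntegrallyClosed.pow_dvd_pow_iff (by norm_num)] at h1
    exact Ideal.mem_span_singleton.mpr h1
  obtain ⟨J, hJ⟩ := Ideal.dvd_iff_le.mpr hle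
  rw [hJ, mul_pow, Ideal.span_singleton_pow] at hI
  have h0 : Ideal.span {y ^ 3} ≠ 0 := by
    rw [Ne, Ideal.zero_eq_bot, Ideal.span_singleton_eq_bot]
    exact pow_ne_zero 3 hy
  have hJ3 : J ^ 3 = 1 := mul_left_cancel₀ h0 (by rw [hI, mul_one])
  have hJ1 : IsUnit J := (isUnit_pow_iff (by norm_num : 3 ≠ 0)).mp (hJ3 ▸ isUnit_one)
  rw [hJ, Ideal.isUnit_iff.mp hJ1, Ideal.mul_top]

theorem eq_one_of_cube {A : ℤ√(-(d : ℤ))} {m : ℤ} (hm : m ≠ 0)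
    (hA : (A.re : 𝓞 K) + A.im * δ = m * α) (hI : InClass I g) (hIα : I ^ 3 = Ideal.span {α})
    {a b : ℚ} (h1 : a ^ 3 - 3 * d * a * b ^ 2 = (m ^ 2 : ℤ) * A.re)
    (h2 : 3 * a ^ 2 * b - d * b ^ 3 = (m ^ 2 : ℤ) * A.im) : g = 1 := by
  have hmK : (m : K) ≠ 0 := by exact_mod_cast hm
  have hA' : (A.re : K) + A.im * (δ : K) = m * (α : K) := by
    have := congrArg (algebraMap (𝓞 K) K) hA
    simpa using this
  have h1' : (a : K) ^ 3 - 3 * d * a * (b : K) ^ 2 = (m : K) ^ 2 * A.re := by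
    have := congrArg (Rat.cast (K := K)) h1
    push_cast at this
    exact this
  have h2' : 3 * (a : K) ^ 2 * b - d * (b : K) ^ 3 = (m : K) ^ 2 * A.im := by
    have := congrArg (Rat.cast (K := K)) h2
    push_cast at this
    exact this
  have hy3 : (((a : K) + b * (δ : K)) / m) ^ 3 = (α : K) := by
    rw [div_pow, div_eq_iff (pow_ne_zero 3 hmK)]
    linear_combination h1' + (δ : K) * h2' + (m : K) ^ 2 * hA' +
      (3 * a * (b : K) ^ 2 + (b : K) ^ 3 * (δ : K)) * h.sq_coe
  have hint : IsIntegral ℤ (((a : K) + b * (δ : K)) / m) :=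
    IsIntegral.of_pow (n := 3) (by norm_num) (hy3 ▸ RingOfIntegers.isIntegral_coe α)
  obtain ⟨y, hy⟩ : ∃ y : 𝓞 K, y ^ 3 = α := by
    refine ⟨⟨_, hint⟩, ?_⟩
    apply RingOfIntegers.coe_injective
    exact (map_pow (algebraMap (𝓞 K) K) _ 3).trans hy3
  have hy0 : y ≠ 0 := by
    rintro rfl
    rw [zero_pow (by norm_num)] at hy
    rw [← hy, Ideal.span_singleton_eq_bot.mpr rfl] at hIα
    exact hI.ne_bot (pow_eq_zero_iff three_ne_zero |>.mp hIα)
  rw [← hy] at hIα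
  exact hI.unique (eq_span_of_cube_eq hy0 hIα ▸ inClass_span hy0)

end IsQuad

theorem exists_card_torsion_mul_sq_le (η : ℝ) (hη : 0 < η) : ∃ C > 0, ∀ (K : Type) [Field K]
    [NumberField K] (d : ℕ) (δ : 𝓞 K), IsQuad d δ → 4 < d → ∀ (P : Finset ℕ) (Z V : ℕ),
    (∀ v : ℕ, d * v ^ 2 ≤ 4 * Z ^ 6 → v ≤ V) →
    (∀ p ∈ P, p.Prime ∧ p ≤ Z ∧ p % 3 = 2 ∧ p ≠ 2 ∧ ¬ p ∣ d ∧ ∃ x : ℤ, (p : ℤ) ∣ x ^ 2 - 3 * d) →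
    (Nat.card {c : ClassGroup (𝓞 K) // c ^ 3 = 1} : ℝ) * (P.card : ℝ) ^ 2 ≤
      C * (d : ℝ) ^ (1 / 2 + η) *
        (P.card + 2 * (solSet (-(8748 : ℕ)) 1 V (Z ^ 2) (2 * Z ^ 3) d).card) := by
  obtain ⟨C, hC, hmain⟩ := Eis.exists_card_torsion_le η hη
  refine ⟨C, hC, fun K _ _ d δ h hd P Z V hV hP => ?_⟩
  obtain ⟨ι, hι, hιA⟩ := h.exists_emb
  let φ : ClassGroup (𝓞 K) →* ClassGroup (𝓞 K) := powMonoidHom 3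
  let G := φ.ker
  have hG : ∀ g : G, (g : ClassGroup (𝓞 K)) ^ 3 = 1 := fun g => g.2
  set N := 6 * d * Z.factorial with hN
  have hN0 : N ≠ 0 := by have := Z.factorial_pos; positivity
  have hrep : ∀ g : G, ∃ (I : Ideal (𝓞 K)) (α : 𝓞 K) (A : ℤ√(-(d : ℤ))) (m : ℤ),
      (InClass I g ∧ I ^ 3 = Ideal.span {α} ∧ (Ideal.absNorm I).Coprime N) ∧ (m = 1 ∨ m = 2) ∧
      (A.re : 𝓞 K) + A.im * δ = m * α ∧ A.norm = m ^ 2 * (Ideal.absNorm I : ℤ) ^ 3 ∧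
      IsCoprime A.re A.im ∧ ¬ 3 ∣ A.re ∧ ¬ 27 ∣ A.im := fun g => by
    obtain ⟨I, α, U, V, H, hU, hV, hprim⟩ := h.exists_cubeRep_primitive hN0 (Dvd.intro _ rfl) (hG g)
    obtain ⟨A, m, hA⟩ := h.exists_coprime_rep H hU hV hprim
    exact ⟨I, α, A, m, ⟨H.inClass, H.cube, H.coprime⟩, hA⟩
  choose I α A m hI hm hA hnorm hco h3 h27 using hrep
  have hm0 : ∀ g, m g ≠ 0 := fun g => by rcases hm g with e | e <;> rw [e] <;> norm_num
  have hιA' : ∀ g, ι (A g) = m g * α g := fun g => (hιA _).trans (hA g)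
  have := hmain d h.squarefree (by omega) G A (fun g => m g ^ 2) (fun g => Ideal.absNorm (I g))
    (fun g => Subtype.ext (hG g)) ?_ (fun g => by rcases hm g with e | e <;> rw [e] <;> norm_num)
    hnorm hco h3 h27 ?_ P Z V hV ?_
  · exact this
  · intro g g'
    obtain ⟨x, y, s, hx, hy, hs, hxy⟩ := h.exists_relation hd (hI g).1 (hI g').1 (hI (g * g')).1
      (hI g).2.1 (hI g').2.1 (hI (g * g')).2.1
    have hdouble : ∀ x : 𝓞 K, x ≠ 0 → ∃ X : ℤ√(-(d : ℤ)), X ≠ 0 ∧ ι X = 2 * x := fun x hx => by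
      obtain ⟨u, v, huv⟩ := h.exists_int x
      have hX : ι ⟨u, v⟩ = 2 * x := by rw [hιA, huv]
      refine ⟨⟨u, v⟩, fun h0 => hx ?_, hX⟩
      rw [h0, map_zero] at hX
      simpa using hX.symm
    obtain ⟨X, hX0, hX⟩ := hdouble x hx
    obtain ⟨Y, hY0, hY⟩ := hdouble y hy
    refine ⟨X, Y, m (g * g'), s * (m g * m g'), hX0, hY0, hm0 _,
      mul_ne_zero hs (mul_ne_zero (hm0 _) (hm0 _)), hι ?_⟩
    simp only [map_mul, map_pow, map_intCast, hιA', hX, hY]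
    push_cast
    linear_combination 8 * (m (g * g') : 𝓞 K) * m g * m g' * hxy
  · intro g hg a b h1 h2
    exact hg (Subtype.ext (h.eq_one_of_cube (hm0 g) (hA g) (hI g).1 (hI g).2.1 h1 h2))
  · intro p hp
    obtain ⟨hp1, hp2, hp3, hp4, hp5, hp6⟩ := hP p hp
    refine ⟨hp1, hp2, hp3, hp4, hp5, fun g hpg => ?_, hp6⟩
    have h1 : p ∣ Ideal.absNorm (I g) := by exact_mod_cast hpg
    have h2 : p ∣ N := (Nat.dvd_factorial hp1.pos hp2).mul_left _
    have := Nat.dvd_gcd h1 h2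
    rw [(hI g).2.2.gcd_eq_one] at this
    exact hp1.one_lt.ne' (Nat.dvd_one.mp this)

end FourthMoment

namespace FourthMoment

open Finset

/-- The product `2 · 5 · 8 ⋯ (3n - 1)`. -/
def prodTwoMod (n : ℕ) : ℕ := ∏ k ∈ range n, (3 * k + 2)

theorem prodTwoMod_ne_zero (n : ℕ) : prodTwoMod n ≠ 0 :=
  prod_ne_zero_iff.mpr fun _ _ => by omega

theorem card_filter_dvd {q k₀ : ℕ} (hq : q.Coprime 3) (hk₀ : k₀ < q) (h : q ∣ 3 * k₀ + 2) (n : ℕ) :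
    #{k ∈ range n | q ∣ 3 * k + 2} = n / q + if k₀ < n % q then 1 else 0 := by
  rw [← Nat.mod_eq_of_lt hk₀, ← Nat.count_modEq_card n (by omega) k₀, Nat.count_eq_card_filter_range]
  congr 1
  refine filter_congr fun k _ => ?_
  rw [← Nat.modEq_zero_iff_dvd]
  have h0 := (Nat.modEq_zero_iff_dvd.mpr h)
  refine ⟨fun hk => ?_, fun hk => ((hk.mul_left 3).add_right 2).trans h0⟩
  exact Nat.ModEq.cancel_left_of_coprime hq (Nat.ModEq.add_right_cancel' 2 (hk.trans h0.symm))

theorem card_filter_dvd_of_mod_three_eq_one {q : ℕ} (hq : q % 3 = 1) (hq1 : 1 < q) (n : ℕ) :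
    #{k ∈ range n | q ∣ 3 * k + 2} + n / q ≤ 2 * n / q := by
  have hco : q.Coprime 3 := by
    rw [Nat.coprime_comm, Nat.Prime.coprime_iff_not_dvd Nat.prime_three]; omega
  rw [card_filter_dvd hco (k₀ := (2 * q - 2) / 3) (by omega) ⟨2, by omega⟩,
    Nat.le_div_iff_mul_le (by omega)]
  have := Nat.div_add_mod n q
  have := Nat.mod_lt n (by omega : q > 0)
  split_ifs with h
  · have : 2 * q < 3 * (n % q) := by omega
    nlinarith
  · nlinarith [Nat.div_mul_le_self n q]

theorem card_filter_dvd_le {q : ℕ} (hq : q.Coprime 3) (n : ℕ) :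
    #{k ∈ range n | q ∣ 3 * k + 2} + n / q ≤ 2 * n / q + if q < 3 * n then 1 else 0 := by
  rcases Nat.eq_zero_or_pos q with rfl | hq0
  · simp
  split_ifs with hqn
  · obtain ⟨k₀, hk₀, hk⟩ : ∃ k₀ < q, q ∣ 3 * k₀ + 2 := by
      obtain ⟨k, -, hk⟩ := Nat.exists_mul_mod_eq_of_coprime (2 * (q - 1)) hq.symm hq0.ne'
      refine ⟨k % q, Nat.mod_lt _ hq0, ?_⟩
      rw [← Nat.modEq_zero_iff_dvd]
      have h1 : 3 * (k % q) ≡ 2 * (q - 1) [MOD q] := ((Nat.mod_modEq k q).mul_left 3).trans hk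
      refine (h1.add_right 2).trans ?_
      rw [Nat.modEq_zero_iff_dvd]
      exact ⟨2, by omega⟩
    rw [card_filter_dvd hq hk₀ hk]
    have : 2 * (n / q) ≤ 2 * n / q := by
      rw [Nat.le_div_iff_mul_le hq0]; nlinarith [Nat.div_mul_le_self n q]
    split_ifs <;> omega
  · rw [card_eq_zero.mpr (filter_eq_empty_iff.mpr fun k hk h => ?_)]
    · rw [Nat.zero_add, Nat.add_zero]; gcongr; omega
    · have := Nat.le_of_dvd (by omega) h
      rw [mem_range] at hk
      omega

theorem factorization_prodTwoMod {p n b : ℕ} (hp : p.Prime) (hb : Nat.log p (3 * n) < b) :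
    (prodTwoMod n).factorization p = ∑ i ∈ Ico 1 b, #{k ∈ range n | p ^ i ∣ 3 * k + 2} := by
  rw [prodTwoMod, Nat.factorization_prod_apply fun _ _ => by omega]
  simp only [card_filter]
  rw [sum_comm]
  refine sum_congr rfl fun k hk => ?_
  rw [mem_range] at hk
  rw [← card_filter, Nat.factorization_eq_card_pow_dvd_of_lt hp (by omega)]
  exact (Nat.lt_pow_succ_log_self hp.one_lt _).trans_le (Nat.pow_le_pow_right hp.pos
    ((Nat.succ_le_succ (Nat.log_mono_right (by omega))).trans hb))

/-- Primes up to `Z` that are congruent to `2` modulo `3`. -/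
def primesTwoMod (Z : ℕ) : Finset ℕ := {p ∈ Icc 1 Z | p.Prime ∧ p % 3 = 2}

theorem prodTwoMod_dvd (m : ℕ) : prodTwoMod (3 * m) * 3 ^ m * (3 * m).factorial ∣
    (2 * (3 * m)).factorial * ∏ p ∈ primesTwoMod (9 * m), p ^ Nat.log p (9 * m) := by
  set n := 3 * m with hn
  have hR : ∏ p ∈ primesTwoMod (9 * m), p ^ Nat.log p (9 * m) ≠ 0 :=
    prod_ne_zero_iff.mpr fun p hp => pow_ne_zero _ (by
      rw [primesTwoMod, mem_filter] at hp; exact hp.2.1.ne_zero)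
  have h0 := prodTwoMod_ne_zero n
  rw [← Nat.factorization_prime_le_iff_dvd (by positivity) (by positivity)]
  intro p hp
  rw [Nat.factorization_mul (by positivity) (by positivity), Nat.factorization_mul h0 (by positivity),
    Nat.factorization_mul (by positivity) hR, Nat.factorization_pow,
    Nat.factorization_prod fun p hp => pow_ne_zero _ (by
      rw [primesTwoMod, mem_filter] at hp; exact hp.2.1.ne_zero)]
  set b := Nat.log p (3 * n) + 1 with hb
  have hfac : ∀ k ≤ 3 * n, k.factorial.factorization p = ∑ i ∈ Ico 1 b, k / p ^ i := fun k hk =>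
    Nat.factorization_factorial hp ((Nat.log_mono_right hk).trans_lt (Nat.lt_succ_self _))
  simp only [Finsupp.coe_add, Pi.add_apply, Finsupp.smul_apply, smul_eq_mul]
  rw [factorization_prodTwoMod hp (b := b) (Nat.lt_succ_self _)]
  by_cases hp3 : p = 3
  · subst hp3
    have h1 : ∑ i ∈ Ico 1 b, #{k ∈ range n | 3 ^ i ∣ 3 * k + 2} = 0 :=
      sum_eq_zero fun i hi => card_eq_zero.mpr (filter_eq_empty_iff.mpr fun k _ hk => by
        have := (dvd_pow_self 3 (by rw [mem_Ico] at hi; omega)).trans hk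
        omega)
    have h2 := Nat.factorization_factorial_mul hp (n := m)
    have h3 : 2 * n.factorial.factorization 3 ≤ (2 * n).factorial.factorization 3 := by
      rw [hfac _ (by omega), hfac _ (by omega), mul_sum]
      refine sum_le_sum fun i _ => ?_
      rw [Nat.le_div_iff_mul_le (by positivity)]; nlinarith [Nat.div_mul_le_self n (3 ^ i)]
    rw [hp.factorization_self]
    rw [← hn] at h2
    omega
  have hco : p.Coprime 3 := (Nat.coprime_primes hp Nat.prime_three).mpr hp3
  rw [Nat.factorization_eq_zero_of_not_dvd fun h => hp3 ((Nat.prime_dvd_prime_iff_eq hp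
    Nat.prime_three).mp h), hfac _ (by omega), hfac _ (by omega), mul_zero, add_zero,
    ← sum_add_distrib]
  rw [Nat.coprime_comm, Nat.Prime.coprime_iff_not_dvd Nat.prime_three] at hco
  obtain hmod | hmod : p % 3 = 1 ∨ p % 3 = 2 := by omega
  · refine le_add_right (sum_le_sum fun i hi => ?_)
    rw [mem_Ico] at hi
    refine card_filter_dvd_of_mod_three_eq_one (by simp [Nat.pow_mod, hmod]) ?_ n
    exact Nat.one_lt_pow (by omega) hp.one_lt
  · refine (sum_le_sum fun i _ => card_filter_dvd_le (q := p ^ i) (Nat.Coprime.pow_left i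
      ((Nat.coprime_primes hp Nat.prime_three).mpr hp3)) n).trans ?_
    rw [sum_add_distrib]
    refine Nat.add_le_add_left ?_ _
    rw [← card_filter]
    have hlog : #{i ∈ Ico 1 b | p ^ i < 3 * n} ≤ Nat.log p (9 * m) := by
      refine (card_filter_le _ _).trans ?_
      rw [Nat.card_Ico, hb, hn, show 3 * (3 * m) = 9 * m by ring]; omega
    by_cases hpn : p ≤ 9 * m
    · refine hlog.trans ?_
      rw [sum_apply']
      refine le_trans ?_ (single_le_sum (a := p)
        (f := fun x => (x ^ Nat.log x (9 * m)).factorization p) (fun _ _ => Nat.zero_le _) (by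
        rw [primesTwoMod, mem_filter, mem_Icc]; exact ⟨⟨hp.pos, hpn⟩, hp, hmod⟩))
      rw [Nat.factorization_pow]
      simp [hp.factorization_self]
    · rw [Nat.log_of_lt (by omega)] at hlog
      exact hlog.trans (Nat.zero_le _)

theorem prodTwoMod_ge (n : ℕ) : 2 * (3 ^ n * n.factorial) ≤ prodTwoMod (n + 1) := by
  induction n with
  | zero => simp [prodTwoMod]
  | succ n ih =>
    rw [prodTwoMod, prod_range_succ, ← prodTwoMod, Nat.factorial_succ, pow_succ]
    nlinarith [Nat.zero_le (prodTwoMod (n + 1))]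

theorem pow_le_card_primesTwoMod {m : ℕ} (hm : 0 < m) :
    81 ^ m ≤ 64 ^ m * (9 * m) ^ (#(primesTwoMod (9 * m)) + 1) := by
  have hdvd := Nat.le_of_dvd (Nat.mul_pos (by positivity) (prod_pos fun p hp => pow_pos (by
    rw [primesTwoMod, mem_filter] at hp; exact hp.2.1.pos) _)) (prodTwoMod_dvd m)
  have hprod : ∏ p ∈ primesTwoMod (9 * m), p ^ Nat.log p (9 * m) ≤
      (9 * m) ^ #(primesTwoMod (9 * m)) :=
    prod_le_pow_card _ _ _ fun p _ => Nat.pow_log_le_self p (by omega)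
  set R := (9 * m) ^ #(primesTwoMod (9 * m)) with hR
  obtain ⟨n, hn⟩ : ∃ n, 3 * m = n + 1 := ⟨3 * m - 1, by omega⟩
  have hfac : (2 * (n + 1)).factorial ≤ 4 ^ (n + 1) * ((n + 1).factorial * (n + 1).factorial) := by
    have h1 := Nat.choose_mul_factorial_mul_factorial (show n + 1 ≤ 2 * (n + 1) by omega)
    rw [show 2 * (n + 1) - (n + 1) = n + 1 by omega, mul_assoc] at h1
    rw [← h1, show 4 = 2 ^ 2 by norm_num, ← pow_mul]
    exact Nat.mul_le_mul_right _ (Nat.choose_le_two_pow _ _)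
  have hge := prodTwoMod_ge n
  rw [hn] at hdvd
  have hF := n.factorial_pos
  have hF1 : (n + 1).factorial = (n + 1) * n.factorial := Nat.factorial_succ n
  have key : 2 * 3 ^ n * 3 ^ m ≤ 4 ^ (n + 1) * (n + 1) * R := by
    refine Nat.le_of_mul_le_mul_right ?_ (Nat.mul_pos hF (n + 1).factorial_pos)
    calc 2 * 3 ^ n * 3 ^ m * (n.factorial * (n + 1).factorial)
        = 2 * (3 ^ n * n.factorial) * 3 ^ m * (n + 1).factorial := by ring
      _ ≤ _ := Nat.mul_le_mul_right _ (Nat.mul_le_mul_right _ hge)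
      _ ≤ _ := hdvd
      _ ≤ _ := Nat.mul_le_mul hfac hprod
      _ = _ := by rw [hF1]; ring
  have e1 : 81 ^ m = 3 ^ n * 3 * 3 ^ m := by
    rw [← pow_succ, ← hn, ← pow_add, show 3 * m + m = 4 * m by ring, pow_mul]; norm_num
  have e2 : 64 ^ m = 4 ^ (n + 1) := by rw [← hn, pow_mul]; norm_num
  rw [e1, e2, pow_succ (9 * m), ← hR, show 9 * m = 3 * (n + 1) by omega]
  calc 3 ^ n * 3 * 3 ^ m ≤ 3 * (2 * 3 ^ n * 3 ^ m) := by
        rw [show 3 * (2 * 3 ^ n * 3 ^ m) = 2 * (3 ^ n * 3 * 3 ^ m) by ring]; omega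
    _ ≤ 3 * (4 ^ (n + 1) * (n + 1) * R) := Nat.mul_le_mul_left _ key
    _ = _ := by ring

theorem le_card_primesTwoMod_mul_log {Z : ℕ} (hZ : 2 ≤ Z) :
    (Z : ℝ) / 90 ≤ (#(primesTwoMod Z) + 1) * Real.log Z := by
  have hlog2 : Real.log 2 ≤ Real.log Z := Real.log_le_log (by norm_num) (by exact_mod_cast hZ)
  have hl2 := Real.log_two_gt_d9
  rcases lt_or_ge Z 9 with h9 | h9
  · have : (Z : ℝ) ≤ 9 := by exact_mod_cast h9.le
    nlinarith [Nat.cast_nonneg (α := ℝ) #(primesTwoMod Z)]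
  obtain ⟨m, hm⟩ : ∃ m, m = Z / 9 := ⟨_, rfl⟩
  have hm0 : 0 < m := by omega
  have hmono : #(primesTwoMod (9 * m)) ≤ #(primesTwoMod Z) := card_le_card fun p hp => by
    rw [primesTwoMod, mem_filter, mem_Icc] at hp ⊢
    exact ⟨⟨hp.1.1, by omega⟩, hp.2⟩
  have h1 : (81 : ℝ) ^ m ≤ 64 ^ m * (9 * m) ^ (#(primesTwoMod (9 * m)) + 1) := by
    exact_mod_cast pow_le_card_primesTwoMod hm0
  have hm0' : (0 : ℝ) < m := by exact_mod_cast hm0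
  have h2 := Real.log_le_log (by positivity) h1
  rw [Real.log_mul (by positivity) (by positivity), Real.log_pow, Real.log_pow, Real.log_pow] at h2
  have h3 : (17 : ℝ) / 81 ≤ Real.log 81 - Real.log 64 := by
    rw [← Real.log_div (by norm_num) (by norm_num)]
    have := Real.one_sub_inv_le_log_of_pos (show (0 : ℝ) < 81 / 64 by norm_num)
    norm_num at this ⊢
    exact this
  have h4 : Real.log (9 * m) ≤ Real.log Z := Real.log_le_log (by positivity) (by
    exact_mod_cast (by omega : 9 * m ≤ Z))
  have h5 : (Z : ℝ) ≤ 18 * m := by exact_mod_cast (by omega : Z ≤ 18 * m)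
  have h6 : ((#(primesTwoMod (9 * m)) + 1 : ℕ) : ℝ) * Real.log (9 * m) ≤
      (#(primesTwoMod Z) + 1) * Real.log Z := by
    refine mul_le_mul (by exact_mod_cast Nat.succ_le_succ hmono) h4 (Real.log_nonneg ?_) (by positivity)
    exact_mod_cast (by omega : 1 ≤ 9 * m)
  nlinarith

theorem exists_le_card_primesTwoMod (η : ℝ) (hη : 0 < η) : ∃ c > 0, ∀ Z : ℕ, 2 ≤ Z →
    c * (Z : ℝ) ^ (1 - η) ≤ #(primesTwoMod Z) := by
  refine ⟨η / 180, by positivity, fun Z hZ => ?_⟩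
  have hZ0 : (0 : ℝ) < Z := by exact_mod_cast (by omega : 0 < Z)
  have h1 := le_card_primesTwoMod_mul_log hZ
  have h2 : (1 : ℝ) ≤ #(primesTwoMod Z) := by
    exact_mod_cast card_pos.mpr ⟨2, by simp [primesTwoMod, hZ, Nat.prime_two]⟩
  have h3 := Real.log_le_rpow_div hZ0.le hη
  rw [le_div_iff₀ hη] at h3
  have h4 : 0 ≤ Real.log Z := Real.log_natCast_nonneg Z
  rw [Real.rpow_sub hZ0, Real.rpow_one, ← mul_div_assoc, div_le_iff₀ (by positivity)]
  have h5 : (Z : ℝ) / 90 ≤ 2 * #(primesTwoMod Z) * Real.log Z := h1.trans (by nlinarith)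
  nlinarith [mul_le_mul_of_nonneg_right h5 hη.le, mul_le_mul_of_nonneg_left h3 (by linarith : (0 : ℝ) ≤ 2 * #(primesTwoMod Z))]

end FourthMoment

namespace FourthMoment

open Finset NumberField

/-- The solutions counted by the two types of auxiliary primes. -/
noncomputable def solCount (Z V d : ℕ) : ℕ :=
  #(solSet 1 4 V (Z ^ 2) (2 * Z ^ 3) d) + #(solSet (-(8748 : ℕ)) 1 V (Z ^ 2) (2 * Z ^ 3) d)

theorem exists_dvd_sq_add_or {p d : ℕ} (hp : p.Prime) (hp2 : p ≠ 2) (hmod : p % 3 = 2)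
    (hpd : ¬ p ∣ d) : (∃ r : ℤ, (p : ℤ) ∣ r ^ 2 + d) ∨ ∃ x : ℤ, (p : ℤ) ∣ x ^ 2 - 3 * d := by
  have : Fact p.Prime := ⟨hp⟩
  have hp3 : p ≠ 3 := fun h => by omega
  have hpd' : ¬ (p : ℤ) ∣ d := by exact_mod_cast hpd
  have hpp : Prime (p : ℤ) := Nat.prime_iff_prime_int.mp hp
  have hp3' : ¬ (p : ℤ) ∣ 3 := fun h =>
    hp3 ((Nat.prime_dvd_prime_iff_eq hp Nat.prime_three).mp (by exact_mod_cast h))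
  have key : jacobiSym (-d) p * jacobiSym (3 * d) p = -1 := by
    rw [← jacobiSym.mul_left, show -(d : ℤ) * (3 * d) = -3 * d ^ 2 by ring, jacobiSym.mul_left,
      jacobiSym.sq_one' (by rw [Int.gcd_natCast_natCast]; exact ((Nat.Prime.coprime_iff_not_dvd hp).mpr hpd).symm), mul_one]
    rcases PrimeSum.jacobiSym_neg_three hp hp2 hp3 with h | h
    · omega
    · exact h.2
  have hlift : ∀ a : ℤ, (∃ x : ZMod p, x ^ 2 = a) → ∃ r : ℤ, (p : ℤ) ∣ r ^ 2 - a := by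
    rintro a ⟨x, hx⟩
    obtain ⟨r, rfl⟩ := ZMod.intCast_surjective x
    refine ⟨r, (ZMod.intCast_zmod_eq_zero_iff_dvd _ p).mp ?_⟩
    push_cast
    rw [hx, sub_self]
  rcases PrimeSum.jacobiSym_eq_iff (p := p) (a := -d) (by rwa [dvd_neg]) with h | h
  · obtain ⟨r, hr⟩ := hlift _ h.2
    exact Or.inl ⟨r, by simpa using hr⟩
  rcases PrimeSum.jacobiSym_eq_iff (p := p) (a := 3 * d)
    (fun h => (hpp.dvd_or_dvd h).elim hp3' hpd') with h' | h'
  · exact Or.inr (hlift _ h'.2)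
  · rw [h.1, h'.1] at key
    norm_num at key

theorem exists_card_torsion_le (η : ℝ) (hη : 0 < η) : ∃ C > 0, ∀ (K : Type) [Field K]
    [NumberField K] (d : ℕ) (δ : 𝓞 K), IsQuad d δ → 4 < d → ∀ Z V : ℕ, 2 ≤ Z → Z ≤ d →
    (∀ v : ℕ, d * v ^ 2 ≤ 4 * Z ^ 6 → v ≤ V) →
    (Nat.card {c : ClassGroup (𝓞 K) // c ^ 3 = 1} : ℝ) * (Z : ℝ) ^ 2 ≤
      C * (d : ℝ) ^ (1 / 2 + η) * (Z + solCount Z V d) := by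
  obtain ⟨C₁, hC₁, h₁⟩ := exists_card_classGroup_le (η / 8) (by positivity)
  obtain ⟨C₂, hC₂, h₂⟩ := exists_card_torsion_mul_sq_le (η / 8) (by positivity)
  obtain ⟨C₃, hC₃, h₃⟩ := exists_card_divisors_le (η / 8) (by positivity)
  obtain ⟨c, hc, h₄⟩ := exists_le_card_primesTwoMod (η / 8) (by positivity)
  refine ⟨8 * (C₁ + C₂) * (1 + 2 * C₃ / c) ^ 2, by positivity, fun K _ _ d δ h hd Z V hZ hZd hV => ?_⟩
  have hd0 : (0 : ℝ) < d := by exact_mod_cast (by omega : 0 < d)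
  have hd1 : (1 : ℝ) ≤ d := by exact_mod_cast (by omega : 1 ≤ d)
  have hZ0 : (0 : ℝ) < Z := by exact_mod_cast (by omega : 0 < Z)
  classical
  let P₁ : Finset ℕ := {p ∈ Icc 1 Z | p.Prime ∧ p ≠ 2 ∧ ¬ p ∣ d ∧ ∃ r : ℤ, (p : ℤ) ∣ r ^ 2 + d}
  let P₂ : Finset ℕ :=
    {p ∈ Icc 1 Z | p.Prime ∧ p % 3 = 2 ∧ p ≠ 2 ∧ ¬ p ∣ d ∧ ∃ x : ℤ, (p : ℤ) ∣ x ^ 2 - 3 * d}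
  have hle₁ : #P₁ ≤ Z := (card_filter_le _ _).trans (by simp)
  have hle₂ : #P₂ ≤ Z := (card_filter_le _ _).trans (by simp)
  have hsub : primesTwoMod Z ⊆ insert 2 d.divisors ∪ (P₁ ∪ P₂) := fun p hp => by
    simp only [primesTwoMod, mem_filter] at hp
    simp only [P₁, P₂, mem_union, mem_insert, Nat.mem_divisors, mem_filter]
    by_cases hp2 : p = 2
    · exact Or.inl (Or.inl hp2)
    by_cases hpd : p ∣ d
    · exact Or.inl (Or.inr ⟨hpd, by omega⟩)
    rcases exists_dvd_sq_add_or hp.2.1 hp2 hp.2.2 hpd with hr | hr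
    · exact Or.inr (Or.inl ⟨hp.1, hp.2.1, hp2, hpd, hr⟩)
    · exact Or.inr (Or.inr ⟨hp.1, hp.2.1, hp.2.2, hp2, hpd, hr⟩)
  have hcard : #(primesTwoMod Z) ≤ 1 + #d.divisors + (#P₁ + #P₂) := by
    refine (card_le_card hsub).trans ((card_union_le _ _).trans (add_le_add ?_ (card_union_le _ _)))
    rw [add_comm]
    exact card_insert_le _ _
  set S := solCount Z V d with hS
  set D := (d : ℝ) ^ (η / 8) with hD
  have hD1 : 1 ≤ D := Real.one_le_rpow hd1 (by positivity)
  have hpow : (d : ℝ) ^ (1 / 2 + η / 8) = (d : ℝ) ^ (1 / 2 : ℝ) * D := Real.rpow_add hd0 _ _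
  have hpow8 : (d : ℝ) ^ (1 / 2 + η) = (d : ℝ) ^ (1 / 2 : ℝ) * D ^ 8 := by
    rw [Real.rpow_add hd0, hD, ← Real.rpow_natCast, ← Real.rpow_mul hd0.le]
    norm_num
  set s := (d : ℝ) ^ (1 / 2 : ℝ)
  have hs : 0 < s := Real.rpow_pos_of_pos hd0 _
  have h₁ := h₁ K d δ h
  set t := Nat.card {c : ClassGroup (𝓞 K) // c ^ 3 = 1} with ht
  have htriv : (t : ℝ) ≤ C₁ * (s * D) := by
    rw [← hpow]
    refine le_trans ?_ h₁
    exact_mod_cast Nat.card_le_card_of_injective _ Subtype.val_injective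
  obtain ⟨n, hn1, hn2, hn3⟩ : ∃ n : ℕ, n ≤ Z ∧ #(primesTwoMod Z) ≤ 1 + #d.divisors + 2 * n ∧
      (t : ℝ) * (n : ℝ) ^ 2 ≤ (C₁ + C₂) * (s * D) * (n + 2 * S) := by
    have hS₁ : (#(solSet 1 4 V (Z ^ 2) (2 * Z ^ 3) d) : ℝ) ≤ S :=
      Nat.cast_le.mpr (Nat.le_add_right _ _)
    have hS₂ : (#(solSet (-(8748 : ℕ)) 1 V (Z ^ 2) (2 * Z ^ 3) d) : ℝ) ≤ S :=
      Nat.cast_le.mpr (Nat.le_add_left _ _)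
    rcases le_total #P₁ #P₂ with hP | hP
    · refine ⟨#P₂, hle₂, by omega, (h₂ K d δ h hd P₂ Z V hV fun p hp => ?_).trans ?_⟩
      · simp only [P₂, mem_filter, mem_Icc] at hp
        exact ⟨hp.2.1, hp.1.2, hp.2.2⟩
      · rw [hpow]
        have : 0 ≤ s * D := by positivity
        gcongr
        linarith
    · refine ⟨#P₁, hle₁, by omega, ?_⟩
      have := h.card_torsion_mul_sq_le hV P₁ fun p hp => by
        simp only [P₁, mem_filter, mem_Icc] at hp
        exact ⟨hp.2.1, hp.1.2, hp.2.2⟩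
      have h5 : (t : ℝ) * (#P₁ : ℝ) ^ 2 ≤ Nat.card (ClassGroup (𝓞 K)) *
          (#P₁ + 2 * #(solSet 1 4 V (Z ^ 2) (2 * Z ^ 3) d)) := by exact_mod_cast this
      rw [hpow] at h₁
      have h6 : C₁ * (s * D) ≤ (C₁ + C₂) * (s * D) := by gcongr; linarith
      exact h5.trans (mul_le_mul (h₁.trans h6) (by linarith) (by positivity) (by positivity))
  have hZn : (Z : ℝ) ≤ 2 * C₃ / c * D ^ 2 * (1 + n) := by
    have h5 : c * (Z : ℝ) ^ (1 - η / 8) ≤ 2 * C₃ * D * (1 + n) := by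
      have h6 : (#(primesTwoMod Z) : ℝ) ≤ 1 + #d.divisors + 2 * n := by exact_mod_cast hn2
      have h7 := h₃ d (by omega)
      have h8 : 1 ≤ C₃ * D := one_le_mul_of_one_le_of_one_le hC₃ hD1
      nlinarith [h₄ Z hZ, Nat.cast_nonneg (α := ℝ) n]
    have h6 : (Z : ℝ) ^ (η / 8) ≤ D :=
      Real.rpow_le_rpow hZ0.le (by exact_mod_cast hZd) (by positivity)
    have h7 : (Z : ℝ) ^ (1 - η / 8) * (Z : ℝ) ^ (η / 8) = Z := by
      rw [← Real.rpow_add hZ0]; simp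
    rw [div_mul_eq_mul_div, div_mul_eq_mul_div, le_div_iff₀ hc]
    calc (Z : ℝ) * c = c * (Z : ℝ) ^ (1 - η / 8) * (Z : ℝ) ^ (η / 8) := by
          rw [mul_assoc, h7, mul_comm]
      _ ≤ 2 * C₃ * D * (1 + n) * D := mul_le_mul h5 h6 (by positivity) (by positivity)
      _ = _ := by ring
  rw [hpow8]
  set A := 2 * C₃ / c with hA
  have hA0 : 0 < A := by positivity
  have hS0 : (0 : ℝ) ≤ S := Nat.cast_nonneg S
  rcases Nat.eq_zero_or_pos n with rfl | hn0
  · rw [Nat.cast_zero, add_zero, mul_one] at hZn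
    calc (t : ℝ) * (Z : ℝ) ^ 2 = t * Z * Z := by ring
      _ ≤ C₁ * (s * D) * (A * D ^ 2) * (Z + S) := by gcongr; linarith
      _ = 1 * C₁ * A * (s * D ^ 3) * (Z + S) := by ring
      _ ≤ 8 * (C₁ + C₂) * (1 + A) ^ 2 * (s * D ^ 8) * (Z + S) := by
        gcongr
        · norm_num
        · linarith
        · nlinarith
        · norm_num
      _ = _ := by ring
  · have hn1' : (1 : ℝ) ≤ n := by exact_mod_cast hn0
    have hn1'' : (n : ℝ) ≤ Z := by exact_mod_cast hn1
    have h5 : (Z : ℝ) ≤ A * D ^ 2 * (2 * n) := hZn.trans (by gcongr; linarith)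
    calc (t : ℝ) * (Z : ℝ) ^ 2 ≤ t * (A * D ^ 2 * (2 * n)) ^ 2 := by gcongr
      _ = 4 * A ^ 2 * D ^ 4 * (t * (n : ℝ) ^ 2) := by ring
      _ ≤ 4 * A ^ 2 * D ^ 4 * ((C₁ + C₂) * (s * D) * (n + 2 * S)) := by gcongr
      _ ≤ 4 * A ^ 2 * D ^ 4 * ((C₁ + C₂) * (s * D) * (2 * (Z + S))) := by gcongr; linarith
      _ = 8 * (C₁ + C₂) * A ^ 2 * (s * D ^ 5) * (Z + S) := by ring
      _ ≤ 8 * (C₁ + C₂) * (1 + A) ^ 2 * (s * D ^ 8) * (Z + S) := by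
        gcongr
        · linarith
        · norm_num
      _ = _ := by ring

end FourthMoment

namespace FourthMoment

open Finset

theorem card_level_le {h : ℕ → ℝ} {X : ℕ} (hX : 4 ≤ X) {D : Finset ℕ} (hD : D ⊆ sqfreeDyadic X)
    {H b g t : ℝ} (hH : 0 < H) (hb : 0 < b) (hg : 1 ≤ g) (ht : 0 < t) (htX : t ^ 6 = X)
    (hHle : ∀ d ∈ D, H ≤ h d) (hle : ∀ d ∈ D, h d ≤ b * t ^ 3)
    (hmain : ∀ d ∈ D, ∀ Z V : ℕ, 2 ≤ Z → Z ≤ X → (∀ v : ℕ, X * v ^ 2 ≤ 4 * Z ^ 6 → v ≤ V) →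
      h d * (Z : ℝ) ^ 2 ≤ b * t ^ 3 * (Z + solCount Z V d))
    (hsum : ∀ Z V : ℕ, Z ≤ X → V ≤ X ^ 3 → ∑ d ∈ sqfreeDyadic X, (solCount Z V d : ℝ) ^ 2 ≤
      g * (V * ((Z : ℝ) ^ 4 + (Z : ℝ) ^ 2 * (V + t ^ 3)))) :
    H ^ 4 * #D ≤ 3584 * g * b ^ 4 * t ^ 11 := by
  rcases D.eq_empty_or_nonempty with rfl | ⟨d₀, hd₀⟩
  · simp only [card_empty, Nat.cast_zero, mul_zero]; positivity
  have ht1 : 1 ≤ t := by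
    by_contra! hlt
    have h1 : t ^ 6 < 1 := pow_lt_one₀ ht.le hlt (by norm_num)
    rw [htX] at h1
    have : (4 : ℝ) ≤ X := by exact_mod_cast hX
    linarith
  have hHB : H ≤ b * t ^ 3 := (hHle d₀ hd₀).trans (hle d₀ hd₀)
  have hcard : (#D : ℝ) ≤ t ^ 6 := by
    rw [htX]
    have := (card_le_card hD).trans (card_filter_le _ _)
    rw [Nat.card_Ico] at this
    exact_mod_cast this.trans (by omega)
  obtain ⟨Z, hZ⟩ : ∃ Z, Z = ⌈2 * (b * t ^ 3) / H⌉₊ := ⟨_, rfl⟩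
  have hZ1 : 2 * (b * t ^ 3) ≤ H * Z := by
    rw [hZ, mul_comm H, ← div_le_iff₀ hH]; exact Nat.le_ceil _
  have hZ2 : H * Z ≤ 4 * (b * t ^ 3) := by
    have h1 := (Nat.ceil_lt_add_one (a := 2 * (b * t ^ 3) / H) (by positivity)).le
    rw [← hZ, ← sub_le_iff_le_add, le_div_iff₀ hH] at h1
    nlinarith
  have hZ3 : 2 ≤ Z := by
    rw [hZ]
    have h1 : (2 : ℝ) ≤ 2 * (b * t ^ 3) / H := by rw [le_div_iff₀ hH]; linarith
    exact_mod_cast h1.trans (Nat.le_ceil _)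
  have hZ0 : (2 : ℝ) ≤ Z := by exact_mod_cast hZ3
  have hHZ : H ^ 4 * (Z : ℝ) ^ 4 ≤ 256 * b ^ 4 * t ^ 12 := by
    have := pow_le_pow_left₀ (by positivity) hZ2 4
    calc _ = (H * Z) ^ 4 := by ring
      _ ≤ _ := this
      _ = _ := by ring
  rcases lt_or_ge (t ^ 2) (Z : ℝ) with hZt | hZt
  · have h1 : t ^ 8 ≤ (Z : ℝ) ^ 4 := by
      calc t ^ 8 = (t ^ 2) ^ 4 := by ring
        _ ≤ _ := by gcongr
    have h2 : H ^ 4 ≤ 256 * b ^ 4 * t ^ 4 := by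
      refine le_of_mul_le_mul_right (a := t ^ 8) ?_ (by positivity)
      calc H ^ 4 * t ^ 8 ≤ H ^ 4 * (Z : ℝ) ^ 4 := by gcongr
        _ ≤ _ := hHZ
        _ = _ := by ring
    calc H ^ 4 * #D ≤ 256 * b ^ 4 * t ^ 4 * t ^ 6 := by gcongr
      _ = 256 * 1 * b ^ 4 * t ^ 10 := by ring
      _ ≤ 3584 * g * b ^ 4 * t ^ 11 := by gcongr <;> norm_num
  have hZX : Z ≤ X := by
    have h1 : t ^ 2 ≤ t ^ 6 := pow_le_pow_right₀ ht1 (by norm_num)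
    rw [htX] at h1
    exact_mod_cast hZt.trans h1
  obtain ⟨V, hV⟩ : ∃ V, V = Nat.sqrt (4 * Z ^ 6 / X) := ⟨_, rfl⟩
  have hVall : ∀ v : ℕ, X * v ^ 2 ≤ 4 * Z ^ 6 → v ≤ V := fun v hv => by
    rw [hV, Nat.le_sqrt', Nat.le_div_iff_mul_le (by omega)]
    linarith
  have hV2 : V ^ 2 * X ≤ 4 * Z ^ 6 := by
    rw [← Nat.le_div_iff_mul_le (by omega), hV]
    exact Nat.sqrt_le' _
  have hS : ∀ d ∈ D, (Z : ℝ) ≤ solCount Z V d := fun d hd => by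
    have h1 := hmain d hd Z V hZ3 hZX hVall
    have h2 := mul_le_mul_of_nonneg_right (hHle d hd) (sq_nonneg (Z : ℝ))
    have h3 : b * t ^ 3 * (2 * Z) ≤ b * t ^ 3 * (Z + solCount Z V d) := by
      refine le_trans ?_ (h2.trans h1)
      nlinarith
    have := le_of_mul_le_mul_left h3 (by positivity)
    linarith
  have hV1 : 1 ≤ V := by
    by_contra! hlt
    have h1 := hS d₀ hd₀
    have h2 : solCount Z V d₀ = 0 := by
      rw [show V = 0 by omega]
      simp [solCount, solSet]
    rw [h2] at h1
    norm_num at h1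
    linarith
  have hV3 : V * t ^ 3 ≤ 2 * (Z : ℝ) ^ 3 := by
    refine le_of_pow_le_pow_left₀ (n := 2) (by norm_num) (by positivity) ?_
    have h1 : (V : ℝ) ^ 2 * X ≤ 4 * (Z : ℝ) ^ 6 := by exact_mod_cast hV2
    rw [← htX] at h1
    linarith
  have hVX : V ≤ X ^ 3 := by
    refine le_of_pow_le_pow_left₀ (n := 2) (by norm_num) (by positivity) ?_
    have h1 : Z ^ 6 ≤ X ^ 6 := Nat.pow_le_pow_left hZX 6
    have h2 : V ^ 2 * 4 ≤ V ^ 2 * X := Nat.mul_le_mul_left _ hX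
    rw [show (X ^ 3) ^ 2 = X ^ 6 by ring]
    omega
  have hVt : (V : ℝ) ≤ 2 * t ^ 3 := by
    refine le_of_mul_le_mul_right (a := t ^ 3) ?_ (by positivity)
    calc V * t ^ 3 ≤ 2 * (Z : ℝ) ^ 3 := hV3
      _ ≤ 2 * (t ^ 2) ^ 3 := by gcongr
      _ = _ := by ring
  have htZ : t ≤ 2 * Z := by
    have h1 : (1 : ℝ) ≤ V := by exact_mod_cast hV1
    refine le_of_pow_le_pow_left₀ (n := 3) (by norm_num) (by positivity) ?_
    nlinarith [pow_pos ht 3, pow_pos (by linarith : (0 : ℝ) < Z) 3]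
  have hDZ : #D * (Z : ℝ) ^ 2 ≤ g * (V * ((Z : ℝ) ^ 4 + (Z : ℝ) ^ 2 * (V + t ^ 3))) := by
    refine le_trans ?_ (hsum Z V hZX hVX)
    refine le_trans ?_ (sum_le_sum_of_subset_of_nonneg hD fun _ _ _ => sq_nonneg _)
    rw [← nsmul_eq_mul]
    exact card_nsmul_le_sum _ _ _ fun d hd => pow_le_pow_left₀ (by positivity) (hS d hd) 2
  have hDt : #D * t ^ 3 ≤ 14 * g * (Z : ℝ) ^ 4 * t ^ 2 := by
    have h1 : (#D : ℝ) ≤ g * (V * ((Z : ℝ) ^ 2 + 3 * t ^ 3)) := by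
      refine le_of_mul_le_mul_right (a := (Z : ℝ) ^ 2) ?_ (by positivity)
      calc _ ≤ _ := hDZ
        _ ≤ g * (V * ((Z : ℝ) ^ 4 + (Z : ℝ) ^ 2 * (2 * t ^ 3 + t ^ 3))) := by gcongr
        _ = _ := by ring
    have h2 : (Z : ℝ) ^ 2 + 3 * t ^ 3 ≤ 7 * t ^ 2 * Z := by nlinarith [sq_nonneg t]
    calc #D * t ^ 3 ≤ g * (V * (7 * t ^ 2 * Z)) * t ^ 3 := by
          gcongr
          exact h1.trans (by gcongr)
      _ = g * (V * t ^ 3) * (7 * t ^ 2 * Z) := by ring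
      _ ≤ g * (2 * (Z : ℝ) ^ 3) * (7 * t ^ 2 * Z) := by gcongr
      _ = _ := by ring
  refine le_of_mul_le_mul_right (a := t ^ 3) ?_ (by positivity)
  calc H ^ 4 * #D * t ^ 3 = H ^ 4 * (#D * t ^ 3) := by ring
    _ ≤ H ^ 4 * (14 * g * (Z : ℝ) ^ 4 * t ^ 2) := by gcongr
    _ = 14 * g * t ^ 2 * (H ^ 4 * (Z : ℝ) ^ 4) := by ring
    _ ≤ 14 * g * t ^ 2 * (256 * b ^ 4 * t ^ 12) := by gcongr
    _ = _ := by ring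

end FourthMoment

namespace FourthMoment

open Finset

theorem sum_le_of_fiberwise_le {s : Finset ℕ} {f : ℕ → ℝ} {κ : ℕ → ℕ} {L : ℕ} {M : ℝ}
    (hκ : ∀ d ∈ s, κ d < L) (hM : ∀ k < L, ∑ d ∈ s with κ d = k, f d ≤ M) :
    ∑ d ∈ s, f d ≤ L * M := by
  rw [← sum_fiberwise_of_maps_to (t := range L) fun d hd => mem_range.mpr (hκ d hd)]
  refine (sum_le_card_nsmul _ _ M fun k hk => hM k (mem_range.mp hk)).trans_eq ?_
  rw [card_range, nsmul_eq_mul]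

theorem exists_natLog_le (η : ℝ) (hη : 0 < η) :
    ∃ C > 0, ∀ n : ℕ, 0 < n → ((Nat.log 2 n + 1 : ℕ) : ℝ) ≤ C * (n : ℝ) ^ η := by
  refine ⟨2 / η + 1, by positivity, fun n hn => ?_⟩
  have hn0 : (0 : ℝ) < n := by exact_mod_cast hn
  have h1 : (2 : ℝ) ^ Nat.log 2 n ≤ n := by exact_mod_cast Nat.pow_log_le_self 2 hn.ne'
  have h2 := Real.log_le_log (by positivity) h1
  rw [Real.log_pow] at h2
  have h3 := Real.log_le_rpow_div hn0.le hη
  have h4 := Real.log_two_gt_d9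
  have h5 : (1 : ℝ) ≤ (n : ℝ) ^ η := Real.one_le_rpow (by exact_mod_cast hn) hη.le
  have h6 : (Nat.log 2 n : ℝ) * (1 / 2) ≤ (n : ℝ) ^ η / η :=
    (mul_le_mul_of_nonneg_left (by linarith) (Nat.cast_nonneg _)).trans (h2.trans h3)
  push_cast
  rw [add_mul, div_mul_eq_mul_div, mul_div_assoc]
  linarith

theorem exists_sum_solCount_sq_le (η : ℝ) (hη : 0 < η) : ∃ C : ℝ, 1 ≤ C ∧ ∀ X Z V : ℕ, 0 < X →
    Z ≤ X → V ≤ X ^ 3 → ∑ d ∈ sqfreeDyadic X, (solCount Z V d : ℝ) ^ 2 ≤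
      C * (X : ℝ) ^ η * (V * ((Z : ℝ) ^ 4 + (Z : ℝ) ^ 2 * (V + Real.sqrt X))) := by
  obtain ⟨C₁, hC₁, h₁⟩ := exists_second_moment_le 1 4 (by norm_num) (by norm_num) η hη
  obtain ⟨C₂, hC₂, h₂⟩ := exists_second_moment_le (-(8748 : ℕ)) 1 (by norm_num) (by norm_num) η hη
  refine ⟨1 + 2 * (C₁ + C₂), by linarith, fun X Z V hX hZ hV => ?_⟩
  have hY : Z ^ 2 ≤ X ^ 2 := Nat.pow_le_pow_left hZ 2
  have h₁ := h₁ X V (Z ^ 2) (2 * Z ^ 3) hX hV hY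
  have h₂ := h₂ X V (Z ^ 2) (2 * Z ^ 3) hX hV hY
  have hsplit : ∑ d ∈ sqfreeDyadic X, (solCount Z V d : ℝ) ^ 2 ≤
      2 * (∑ d ∈ sqfreeDyadic X, (#(solSet 1 4 V (Z ^ 2) (2 * Z ^ 3) d) : ℝ) ^ 2) +
      2 * ∑ d ∈ sqfreeDyadic X, (#(solSet (-(8748 : ℕ)) 1 V (Z ^ 2) (2 * Z ^ 3) d) : ℝ) ^ 2 := by
    rw [mul_sum, mul_sum, ← sum_add_distrib]
    refine sum_le_sum fun d _ => ?_
    rw [solCount, Nat.cast_add]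
    nlinarith [sq_nonneg ((#(solSet 1 4 V (Z ^ 2) (2 * Z ^ 3) d) : ℝ) -
      #(solSet (-(8748 : ℕ)) 1 V (Z ^ 2) (2 * Z ^ 3) d))]
  rw [Nat.cast_pow, ← pow_mul] at h₁ h₂
  rw [mul_assoc] at h₁ h₂ ⊢
  have hT : 0 ≤ (X : ℝ) ^ η * (V * ((Z : ℝ) ^ (2 * 2) + (Z : ℝ) ^ 2 * (V + Real.sqrt X))) := by
    positivity
  refine (hsplit.trans (add_le_add (mul_le_mul_of_nonneg_left h₁ two_pos.le)
    (mul_le_mul_of_nonneg_left h₂ two_pos.le))).trans ?_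
  change _ ≤ _ * ((X : ℝ) ^ η * (V * ((Z : ℝ) ^ (2 * 2) + (Z : ℝ) ^ 2 * (V + Real.sqrt X))))
  linarith

/-- The properties of `h = h₃` entering the moment estimate. -/
structure TorsionBound (h : ℕ → ℕ) : Prop where
  pos : ∀ d, Squarefree d → 4 < d → 0 < h d
  le : ∀ η : ℝ, 0 < η → ∃ C : ℝ, 0 < C ∧ ∀ d, Squarefree d → 4 < d →
    (h d : ℝ) ≤ C * (d : ℝ) ^ (1 / 2 + η) ∧ ∀ Z V : ℕ, 2 ≤ Z → Z ≤ d →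
      (∀ v : ℕ, d * v ^ 2 ≤ 4 * Z ^ 6 → v ≤ V) →
      h d * (Z : ℝ) ^ 2 ≤ C * (d : ℝ) ^ (1 / 2 + η) * (Z + solCount Z V d)

theorem TorsionBound.exists_sum_dyadic_le {h : ℕ → ℕ} (hh : TorsionBound h) (ε : ℝ) (hε : 0 < ε) :
    ∃ C > 0, ∀ X : ℕ, 5 ≤ X →
      ∑ d ∈ sqfreeDyadic X, (h d : ℝ) ^ 4 ≤ C * (X : ℝ) ^ ((11 : ℝ) / 6 + ε) := by
  obtain ⟨η, hη0, hη⟩ : ∃ η, 0 < η ∧ ε = 6 * η := ⟨ε / 6, by positivity, by ring⟩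
  obtain ⟨C₀, hC₀, h₀⟩ := hh.le η hη0
  obtain ⟨C₁, hC₁, h₁⟩ := exists_sum_solCount_sq_le η hη0
  obtain ⟨C₂, hC₂, h₂⟩ := exists_natLog_le (η / (1 + η)) (by positivity)
  set c := C₀ * 2 ^ (1 / 2 + η) with hc
  have hc0 : 0 < c := by positivity
  refine ⟨C₂ * (c + 1) ^ (η / (1 + η)) * (57344 * C₁ * c ^ 4), by positivity, fun X hX => ?_⟩
  have hX0 : (0 : ℝ) < X := by exact_mod_cast (by omega : 0 < X)
  have hX1 : (1 : ℝ) ≤ X := by exact_mod_cast (by omega : 1 ≤ X)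
  set t := (X : ℝ) ^ ((1 : ℝ) / 6) with ht
  set E := (X : ℝ) ^ η with hE
  have hE1 : 1 ≤ E := Real.one_le_rpow hX1 hη0.le
  have ht0 : 0 < t := Real.rpow_pos_of_pos hX0 _
  have htpow : ∀ n : ℕ, t ^ n = (X : ℝ) ^ ((n : ℝ) / 6) := fun n => by
    rw [ht, ← Real.rpow_natCast, ← Real.rpow_mul hX0.le]
    congr 1
    ring
  have ht3 : t ^ 3 = Real.sqrt X := by rw [htpow, Real.sqrt_eq_rpow]; norm_num
  have ht6 : t ^ 6 = X := by rw [htpow]; norm_num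
  have hB : ∀ d ∈ sqfreeDyadic X, Squarefree d ∧ 4 < d ∧ X ≤ d ∧
      C₀ * (d : ℝ) ^ (1 / 2 + η) ≤ c * E * t ^ 3 := fun d hd => by
    rw [sqfreeDyadic, mem_filter, mem_Ico] at hd
    refine ⟨hd.2, by omega, hd.1.1, ?_⟩
    have h3 : (d : ℝ) ≤ 2 * X := by exact_mod_cast hd.1.2.le
    calc C₀ * (d : ℝ) ^ (1 / 2 + η) ≤ C₀ * (2 * X) ^ (1 / 2 + η) := by gcongr
      _ = _ := by
        rw [Real.mul_rpow (by norm_num) hX0.le, Real.rpow_add hX0, ← Real.sqrt_eq_rpow, ← ht3, hc]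
        ring
  set N := ⌊c * E * t ^ 3⌋₊ + 1 with hN
  have hhN : ∀ d ∈ sqfreeDyadic X, h d ≤ N := fun d hd => by
    obtain ⟨hd1, hd2, -, hd4⟩ := hB d hd
    exact (Nat.le_floor ((h₀ d hd1 hd2).1.trans hd4)).trans (Nat.le_succ _)
  have hNE : ((Nat.log 2 N + 1 : ℕ) : ℝ) ≤ C₂ * (c + 1) ^ (η / (1 + η)) * E := by
    have h3 : (N : ℝ) ≤ (c + 1) * (X : ℝ) ^ (1 + η) := by
      have h4 : t ^ 3 ≤ X := by rw [← ht6]; exact pow_le_pow_right₀ (Real.one_le_rpow hX1 (by norm_num)) (by norm_num)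
      have h5 := Nat.floor_le (show 0 ≤ c * E * t ^ 3 by positivity)
      rw [hN, Real.rpow_add hX0, Real.rpow_one, ← hE]
      push_cast
      have h6 : c * E * t ^ 3 ≤ c * E * X := by gcongr
      nlinarith
    calc _ ≤ C₂ * (N : ℝ) ^ (η / (1 + η)) := h₂ N (Nat.succ_pos _)
      _ ≤ C₂ * ((c + 1) * (X : ℝ) ^ (1 + η)) ^ (η / (1 + η)) := by gcongr
      _ = _ := by
        rw [Real.mul_rpow (by positivity) (by positivity), ← Real.rpow_mul hX0.le,
          mul_div_cancel₀ _ (by positivity), mul_assoc]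
  have hlevel : ∑ d ∈ sqfreeDyadic X, (h d : ℝ) ^ 4 ≤
      ((Nat.log 2 N + 1 : ℕ) : ℝ) * (16 * (3584 * (C₁ * E) * (c * E) ^ 4 * t ^ 11)) := by
    refine sum_le_of_fiberwise_le (κ := fun d => Nat.log 2 (h d))
      (fun d hd => Nat.lt_succ_of_le (Nat.log_mono_right (hhN d hd))) fun k _ => ?_
    set D := {d ∈ sqfreeDyadic X | Nat.log 2 (h d) = k} with hD
    have hDB : ∀ d ∈ D, d ∈ sqfreeDyadic X ∧ 2 ^ k ≤ h d ∧ h d < 2 ^ (k + 1) := fun d hd => by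
      rw [hD, mem_filter] at hd
      obtain ⟨hd1, hd2, -⟩ := hB d hd.1
      exact ⟨hd.1, hd.2 ▸ Nat.pow_log_le_self 2 (hh.pos d hd1 hd2).ne',
        hd.2 ▸ Nat.lt_pow_succ_log_self (by norm_num) _⟩
    have hcard := card_level_le (h := fun d => h d) (X := X) (by omega) (D := D) (filter_subset _ _)
      (H := 2 ^ k) (b := c * E) (g := C₁ * E) (t := t) (by positivity) (by positivity)
      (one_le_mul_of_one_le_of_one_le hC₁ hE1) ht0 ht6 (fun d hd => by exact_mod_cast (hDB d hd).2.1)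
      (fun d hd => ?_) (fun d hd Z V hZ hZX hV => ?_) (fun Z V hZ hV => ?_)
    · calc ∑ d ∈ D, (h d : ℝ) ^ 4 ≤ ∑ d ∈ D, 16 * ((2 : ℝ) ^ k) ^ 4 := by
            refine sum_le_sum fun d hd => ?_
            have h3 : (h d : ℝ) ≤ 2 * 2 ^ k := by
              rw [← pow_succ']; exact_mod_cast (hDB d hd).2.2.le
            calc (h d : ℝ) ^ 4 ≤ (2 * 2 ^ k) ^ 4 := by gcongr
              _ = _ := by ring
        _ = 16 * (((2 : ℝ) ^ k) ^ 4 * #D) := by rw [sum_const, nsmul_eq_mul]; ring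
        _ ≤ _ := by gcongr
    · obtain ⟨hd1, hd2, -, hd4⟩ := hB d (hDB d hd).1
      exact (h₀ d hd1 hd2).1.trans hd4
    · obtain ⟨hd1, hd2, hd3, hd4⟩ := hB d (hDB d hd).1
      refine ((h₀ d hd1 hd2).2 Z V hZ (hZX.trans hd3) fun v hv => hV v ?_).trans (by gcongr)
      exact (Nat.mul_le_mul_right _ hd3).trans hv
    · rw [ht3]
      exact h₁ X Z V (by omega) hZ hV
  have hexp : (X : ℝ) ^ ((11 : ℝ) / 6 + ε) = t ^ 11 * E ^ 6 := by
    rw [Real.rpow_add hX0, htpow, hE, ← Real.rpow_natCast, ← Real.rpow_mul hX0.le, hη]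
    norm_num [mul_comm]
  calc _ ≤ _ := hlevel
    _ ≤ C₂ * (c + 1) ^ (η / (1 + η)) * E * (16 * (3584 * (C₁ * E) * (c * E) ^ 4 * t ^ 11)) := by
      gcongr
    _ = _ := by rw [hexp]; ring

theorem TorsionBound.exists_sum_le {h : ℕ → ℕ} (hh : TorsionBound h) (ε : ℝ) (hε : 0 < ε) :
    ∃ C > 0, ∀ X : ℝ, 2 ≤ X → ∑ d ∈ (range (⌈X⌉₊ + 1)).filter
      (fun d : ℕ => Squarefree d ∧ 0 < d ∧ (d : ℝ) < X), (h d : ℝ) ^ 4 ≤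
        C * X ^ ((11 : ℝ) / 6 + ε) := by
  obtain ⟨C₁, hC₁, h₁⟩ := hh.exists_sum_dyadic_le (ε / 2) (by positivity)
  obtain ⟨C₂, hC₂, h₂⟩ := exists_natLog_le (ε / 2) (by positivity)
  set M := ∑ d ∈ range 8, (h d : ℝ) ^ 4 with hM
  have hM0 : 0 ≤ M := sum_nonneg fun _ _ => by positivity
  refine ⟨C₂ * (C₁ + M), by positivity, fun X hX => ?_⟩
  have hX0 : 0 < X := by linarith
  have hfloor := Nat.floor_le hX0.le
  have hfloor1 : 0 < ⌊X⌋₊ := Nat.floor_pos.mpr (by linarith)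
  have hkey : ∑ d ∈ (range (⌈X⌉₊ + 1)).filter
      (fun d : ℕ => Squarefree d ∧ 0 < d ∧ (d : ℝ) < X), (h d : ℝ) ^ 4 ≤
      ((Nat.log 2 ⌊X⌋₊ + 1 : ℕ) : ℝ) * ((C₁ + M) * X ^ ((11 : ℝ) / 6 + ε / 2)) := by
    refine sum_le_of_fiberwise_le (κ := Nat.log 2) (fun d hd => ?_) fun k hk => ?_
    · rw [mem_filter] at hd
      exact Nat.lt_succ_of_le (Nat.log_mono_right (Nat.le_floor hd.2.2.2.le))
    · have hkX : ((2 ^ k : ℕ) : ℝ) ≤ X := by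
        refine le_trans ?_ hfloor
        exact_mod_cast (Nat.pow_le_pow_right (by norm_num) (Nat.lt_succ_iff.mp hk)).trans
          (Nat.pow_log_le_self 2 hfloor1.ne')
      have hbound : ∀ d, Nat.log 2 d = k → 0 < d → 2 ^ k ≤ d ∧ d < 2 * 2 ^ k := fun d hd hd0 => by
        rw [← pow_succ', ← hd]
        exact ⟨Nat.pow_log_le_self 2 hd0.ne', Nat.lt_pow_succ_log_self (by norm_num) d⟩
      have hXpow : 1 ≤ X ^ ((11 : ℝ) / 6 + ε / 2) := Real.one_le_rpow (by linarith) (by positivity)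
      rcases lt_or_ge k 3 with hk3 | hk3
      · have h8 : 2 * 2 ^ k ≤ 8 := by
          have := Nat.pow_le_pow_right (n := 2) (by norm_num) (Nat.lt_succ_iff.mp hk3)
          omega
        refine (sum_le_sum_of_subset_of_nonneg (t := range 8) (fun d hd => ?_)
          fun _ _ _ => by positivity).trans ?_
        · rw [mem_filter, mem_filter] at hd
          exact mem_range.mpr ((hbound d hd.2 hd.1.2.2.1).2.trans_le h8)
        · rw [← hM]; nlinarith
      · have h8 := Nat.pow_le_pow_right (n := 2) (by norm_num) hk3
        refine (sum_le_sum_of_subset_of_nonneg (t := sqfreeDyadic (2 ^ k)) (fun d hd => ?_)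
          fun _ _ _ => by positivity).trans ((h₁ (2 ^ k) (by omega)).trans ?_)
        · rw [mem_filter, mem_filter] at hd
          rw [sqfreeDyadic, mem_filter, mem_Ico]
          exact ⟨hbound d hd.2 hd.1.2.2.1, hd.1.2.1⟩
        · gcongr
          linarith
  refine hkey.trans ?_
  calc _ ≤ C₂ * X ^ (ε / 2) * ((C₁ + M) * X ^ ((11 : ℝ) / 6 + ε / 2)) := by
        gcongr
        exact (h₂ _ hfloor1).trans (by gcongr)
    _ = C₂ * (C₁ + M) * (X ^ ((11 : ℝ) / 6 + ε / 2) * X ^ (ε / 2)) := by ring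
    _ = _ := by
      rw [← Real.rpow_add hX0]
      ring_nf

end FourthMoment

namespace FourthMoment

theorem sqrt_mul_I_sq (d : ℕ) : ((Real.sqrt d : ℂ) * Complex.I) ^ 2 = -(d : ℂ) := by
  rw [mul_pow, Complex.I_sq, ← Complex.ofReal_pow, Real.sq_sqrt (Nat.cast_nonneg d)]
  simp

theorem isIntegral_sqrt_mul_I (d : ℕ) {R : Type*} [CommRing R] [Algebra R ℂ] :
    IsIntegral R ((Real.sqrt d : ℂ) * Complex.I) := by
  refine IsIntegral.of_pow two_pos ?_
  rw [sqrt_mul_I_sq, show -(d : ℂ) = algebraMap R ℂ (-(d : R)) by simp]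
  exact isIntegral_algebraMap

instance numberField_Kneg (d : ℕ) : NumberField (Kneg d) where
  to_charZero := inferInstance
  to_finiteDimensional := IntermediateField.adjoin.finiteDimensional (isIntegral_sqrt_mul_I d)

theorem minpoly_sqrt_mul_I {d : ℕ} (hd : 0 < d) :
    minpoly ℚ ((Real.sqrt d : ℂ) * Complex.I) = Polynomial.X ^ 2 + Polynomial.C (d : ℚ) := by
  have hdeg : (Polynomial.X ^ 2 + Polynomial.C (d : ℚ)).natDegree = 2 :=
    Polynomial.natDegree_X_pow_add_C
  refine (minpoly.eq_of_irreducible_of_monic ?_ ?_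
    (Polynomial.monic_X_pow_add_C _ two_ne_zero)).symm
  · refine (Polynomial.irreducible_iff_roots_eq_zero_of_degree_le_three hdeg.ge
      (hdeg.trans_le (by norm_num))).mpr (Multiset.eq_zero_of_forall_notMem fun x hx => ?_)
    have h := Polynomial.isRoot_of_mem_roots hx
    simp only [Polynomial.IsRoot, Polynomial.eval_add, Polynomial.eval_pow, Polynomial.eval_X,
      Polynomial.eval_C] at h
    have hd' : (0 : ℚ) < d := by exact_mod_cast hd
    nlinarith [sq_nonneg x]
  · simp [sqrt_mul_I_sq]

theorem exists_isQuad_Kneg {d : ℕ} (hd : Squarefree d) :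
    ∃ δ : NumberField.RingOfIntegers (Kneg d), IsQuad d δ := by
  let x : Kneg d := ⟨_, IntermediateField.mem_adjoin_simple_self ℚ _⟩
  have hx : x ^ 2 = -(d : Kneg d) := Subtype.ext (by push_cast; exact sqrt_mul_I_sq d)
  have hint : IsIntegral ℤ x := by
    refine IsIntegral.of_pow two_pos ?_
    rw [hx]
    exact_mod_cast (isIntegral_algebraMap (R := ℤ) (A := Kneg d) (x := (d : ℤ))).neg
  refine ⟨⟨x, hint⟩, NumberField.RingOfIntegers.ext ?_, ?_, hd⟩
  · push_cast
    exact hx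
  · have h := IntermediateField.adjoin.finrank (K := ℚ) (isIntegral_sqrt_mul_I d)
    rwa [minpoly_sqrt_mul_I (Nat.pos_of_ne_zero hd.ne_zero), Polynomial.natDegree_X_pow_add_C] at h

theorem torsionBound_hneg : TorsionBound (hneg 3) where
  pos d _ _ :=
    haveI : Nonempty {c : ClassGroup (NumberField.RingOfIntegers (Kneg d)) // c ^ 3 = 1} :=
      ⟨⟨1, one_pow 3⟩⟩
    Nat.card_pos
  le η hη := by
    obtain ⟨C₁, hC₁, h₁⟩ := exists_card_classGroup_le η hη
    obtain ⟨C₂, hC₂, h₂⟩ := exists_card_torsion_le η hη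
    refine ⟨C₁ + C₂, by positivity, fun d hd hd4 => ?_⟩
    obtain ⟨δ, hδ⟩ := exists_isQuad_Kneg hd
    refine ⟨?_, fun Z V hZ hZd hV => (h₂ _ d δ hδ hd4 Z V hZ hZd hV).trans ?_⟩
    · calc (hneg 3 d : ℝ)
          ≤ (Nat.card (ClassGroup (NumberField.RingOfIntegers (Kneg d))) : ℝ) :=
            Nat.cast_le.mpr (Nat.card_le_card_of_injective _ Subtype.val_injective)
        _ ≤ C₁ * (d : ℝ) ^ (1 / 2 + η) := h₁ _ d δ hδ
        _ ≤ _ := by gcongr; linarith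
    · gcongr
      linarith

end FourthMoment

/-- For every `ε > 0` there is `C = C(ε)` such that for all `X ≥ 2`,
`∑_{0 < d < X, d squarefree} h_3(-d)^4 ≤ C · X^(11/6 + ε)`. -/
theorem fourth_moment_h3_bound (ε : ℝ) (hε : 0 < ε) :
    ∃ C : ℝ, 0 < C ∧ ∀ X : ℝ, 2 ≤ X →
      ∑ d ∈ (Finset.range (⌈X⌉₊ + 1)).filter
          (fun d : ℕ => Squarefree d ∧ 0 < d ∧ (d : ℝ) < X),
        (hneg 3 d : ℝ) ^ 4
      ≤ C * X ^ ((11 : ℝ) / 6 + ε) :=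
  FourthMoment.torsionBound_hneg.exists_sum_le ε hε
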